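/- Let H : ℝ² → ℝ be real-analytic in a neighborhood of the origin, with H(0,0) = 0 a critical point that is not a local extremum and is isolated among critical points, and let X = (∂H/∂y, −∂H/∂x) be the associated Hamiltonian vector field. Fix a sufficiently small ρ > 0 and a separatrix sector S_ρ ⊂ B_ρ. Then there exist h₀ > 0, a positive integer q, an integer k₀, and real sequences (a_k)_{k≥k₀}, (b_k)_{k≥k₀} such that for every h ∈ (0, h₀): (1) the set {p ∈ S_ρ : |H(p)| = h} is the image of an injective solution γ : [0, τ] → ℝ² of the ODE γ′(t) = X(γ(t)) with γ(0), γ(τ) ∈ ∂B_ρ and γ(t) in the interior of B_ρ for 0 < t < τ; and (2) the passage time τ equals the convergent log-Puiseux series ∑_{k=k₀}^∞ (a_k + b_k ln h) h^{k/q}. -/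

import Mathlib

/-- The closed Euclidean ball of radius `ρ` centered at the origin of `ℝ²`. -/
def euclBall (ρ : ℝ) : Set (ℝ × ℝ) := {p | p.1 ^ 2 + p.2 ^ 2 ≤ ρ ^ 2}

/-- The separatrix sector of `H` in `B_ρ` containing `x₀`: the connected component of
`B_ρ ∩ {H ≠ 0}` containing `x₀`. -/
def sector (H : ℝ × ℝ → ℝ) (ρ : ℝ) (x₀ : ℝ × ℝ) : Set (ℝ × ℝ) :=
  connectedComponentIn {p ∈ euclBall ρ | H p ≠ 0} x₀

/-- The Hamiltonian vector field `X = (∂H/∂y, -∂H/∂x)` of `H`. -/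
noncomputable def hamVF (H : ℝ × ℝ → ℝ) (p : ℝ × ℝ) : ℝ × ℝ :=
  (fderiv ℝ H p (0, 1), -(fderiv ℝ H p (1, 0)))

section

open Filter Topology

/-- `F` is the sum of the double power series with coefficients `c`, absolutely convergent on the
square of half-side `R`. -/
structure HasDoubleSeries (F : ℝ × ℝ → ℝ) (c : ℕ × ℕ → ℝ) (R : ℝ) : Prop where
  pos : 0 < R
  summable : Summable fun n : ℕ × ℕ => |c n| * R ^ (n.1 + n.2)
  hasSum : ∀ s y : ℝ, |s| ≤ R → |y| ≤ R →
    HasSum (fun n : ℕ × ℕ => c n * s ^ n.1 * y ^ n.2) (F (s, y))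

theorem summable_prod_of_antidiagonal {f : ℕ × ℕ → ℝ} (hf : ∀ n, 0 ≤ f n) {g : ℕ → ℝ}
    (hg : Summable g) (h : ∀ n, ∑ m ∈ Finset.HasAntidiagonal.antidiagonal n, f m ≤
        g n) : Summable f := by
  rw [← Finset.HasAntidiagonal.sigmaAntidiagonalEquivProd.summable_iff]
  refine (summable_sigma_of_nonneg (fun x => hf _)).2 ?_
  refine ⟨fun n => Summable.of_finite, ?_⟩
  refine Summable.of_nonneg_of_le (fun n => tsum_nonneg fun _ => hf _) (fun n => ?_) hg
  refine le_trans (le_of_eq ?_) (h n)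
  rw [tsum_fintype]
  exact Finset.sum_coe_sort (Finset.HasAntidiagonal.antidiagonal n) f

theorem hasSum_antidiagonal {f : ℕ × ℕ → ℝ} {a : ℝ} (h : HasSum f a) :
    HasSum (fun n => ∑ m ∈ Finset.HasAntidiagonal.antidiagonal n, f m) a := by
  rw [← Finset.HasAntidiagonal.sigmaAntidiagonalEquivProd.hasSum_iff] at h
  have := h.sigma (g := fun n => ∑ m ∈ Finset.HasAntidiagonal.antidiagonal n, f m) (fun n => by
    have h2 := hasSum_fintype (fun c : Finset.HasAntidiagonal.antidiagonal n =>
      (f ∘ Finset.HasAntidiagonal.sigmaAntidiagonalEquivProd) ⟨n, c⟩)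
    convert h2 using 1
    exact (Finset.sum_coe_sort (Finset.HasAntidiagonal.antidiagonal n) f).symm)
  exact this

open Classical in
theorem AnalyticAt.exists_hasDoubleSeries {F : ℝ × ℝ → ℝ} (hF : AnalyticAt ℝ F 0) :
    ∃ c R, HasDoubleSeries F c R := by
  obtain ⟨p, r, hp⟩ := hF
  obtain ⟨R₀, hR₀, hRr⟩ := ENNReal.lt_iff_exists_nnreal_btwn.1 hp.r_pos
  have hR₀' : 0 < R₀ := by exact_mod_cast hR₀
  set R : ℝ := (R₀ : ℝ) / 2 with hR
  have hRpos : 0 < R := by positivity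
  let e : (n : ℕ) → Finset (Fin n) → ℝ := fun n S =>
    p n (S.piecewise (fun _ => ((1 : ℝ), (0 : ℝ))) (fun _ => ((0 : ℝ), (1 : ℝ))))
  have he : ∀ n S, |e n S| ≤ ‖p n‖ := fun n S => by
    refine ((p n).le_opNorm _).trans ?_
    refine mul_le_of_le_one_right (norm_nonneg _) (Finset.prod_le_one (fun _ _ => norm_nonneg _) ?_)
    intro i _
    by_cases hi : i ∈ S <;> simp [Finset.piecewise, hi, Prod.norm_def]
  let c' : ℕ → ℕ → ℝ := fun n i => ∑ S ∈ Finset.powersetCard i (Finset.univ : Finset (Fin n)), e n S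
  let c : ℕ × ℕ → ℝ := fun m => c' (m.1 + m.2) m.1
  have hsum : ∀ (n : ℕ) (s y : ℝ), ∑ m ∈ Finset.HasAntidiagonal.antidiagonal n,
      c m * s ^ m.1 * y ^ m.2
      = p n (fun _ => (s, y)) := fun n s y => by
    have h1 : (fun _ : Fin n => (s, y)) = (fun _ => (s, (0:ℝ))) + (fun _ => ((0:ℝ), y)) := by
      ext <;> simp
    rw [h1, (p n).map_add_univ]
    have h2 : ∀ S : Finset (Fin n), p n (S.piecewise (fun _ => (s, (0:ℝ))) (fun _ => ((0:ℝ), y)))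
        = s ^ S.card * y ^ (n - S.card) * e n S := fun S => by
      have h3 : (S.piecewise (fun _ => (s, (0:ℝ))) (fun _ => ((0:ℝ), y)))
        = fun i => (S.piecewise (fun _ => s) (fun _ => y) i) •
          (S.piecewise (fun _ => ((1 : ℝ), (0 : ℝ))) (fun _ => ((0 : ℝ), (1 : ℝ))) i) := by
        funext i
        by_cases hi : i ∈ S <;> simp [Finset.piecewise, hi]
      rw [h3, (p n).map_smul_univ]
      rw [Finset.prod_piecewise]
      simp [e, Finset.card_univ_sdiff]
    simp_rw [h2]
    rw [← Finset.powerset_univ, Finset.sum_powerset, Finset.card_univ, Fintype.card_fin,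
      Finset.Nat.sum_antidiagonal_eq_sum_range_succ_mk]
    refine Finset.sum_congr rfl fun i hi => ?_
    have hi' : i ≤ n := Nat.lt_succ_iff.1 (Finset.mem_range.1 hi)
    simp only [c, c']
    rw [Nat.add_sub_cancel' hi', Finset.sum_mul, Finset.sum_mul]
    refine Finset.sum_congr rfl fun S hS => ?_
    rw [(Finset.mem_powersetCard.1 hS).2]
    ring
  have hle : ∀ n, ∑ m ∈ Finset.HasAntidiagonal.antidiagonal n, |c m| * R ^ (m.1 + m.2) ≤
      ‖p n‖ * (R₀ : ℝ) ^ n := by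
    intro n
    have h1 : ∀ m ∈ Finset.HasAntidiagonal.antidiagonal n, |c m| * R ^ (m.1 + m.2) ≤
        (n.choose m.1 : ℝ) * (‖p n‖ * R ^ n) := by
      intro m hm
      rw [Finset.HasAntidiagonal.mem_antidiagonal.1 hm, ← mul_assoc]
      refine mul_le_mul_of_nonneg_right ?_ (by positivity)
      simp only [c, c']
      rw [Finset.HasAntidiagonal.mem_antidiagonal.1 hm]
      refine (Finset.abs_sum_le_sum_abs _ _).trans ((Finset.sum_le_sum fun S _ => he n S).trans ?_)
      simp
    refine (Finset.sum_le_sum h1).trans (le_of_eq ?_)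
    rw [← Finset.sum_mul, Finset.Nat.sum_antidiagonal_eq_sum_range_succ_mk, ← Nat.cast_sum,
      Nat.sum_range_choose, hR, div_pow]
    push_cast
    field_simp
  have hsm : Summable fun n : ℕ × ℕ => |c n| * R ^ (n.1 + n.2) :=
    summable_prod_of_antidiagonal (fun n => by positivity)
      (p.summable_norm_mul_pow (hRr.trans_le hp.r_le)) hle
  refine ⟨c, R, hRpos, hsm, fun s y hs hy => ?_⟩
  have hsm2 : Summable fun n : ℕ × ℕ => c n * s ^ n.1 * y ^ n.2 := by
    refine Summable.of_norm_bounded hsm fun n => ?_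
    rw [Real.norm_eq_abs, abs_mul, abs_mul, abs_pow, abs_pow, mul_assoc, pow_add]
    gcongr
  have h1 := hasSum_antidiagonal hsm2.hasSum
  simp_rw [hsum] at h1
  have h2 := hp.hasSum (y := (s, y)) (by
    have : ‖((s, y) : ℝ × ℝ)‖ < R₀ := by
      rw [Prod.norm_def, Real.norm_eq_abs, Real.norm_eq_abs]
      have : R < R₀ := by rw [hR]; linarith [show (0:ℝ) < R₀ from hR₀']
      exact (max_le hs hy).trans_lt this
    rw [Metric.mem_eball, edist_zero_right]
    refine lt_trans ?_ hRr
    rw [← ofReal_norm, ENNReal.ofReal_lt_coe_iff]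
    · exact this
    · exact norm_nonneg _)
  rw [zero_add] at h2
  rw [← h1.unique h2]
  exact hsm2.hasSum

theorem HasDoubleSeries.analyticOnNhd {F : ℝ × ℝ → ℝ} {c R} (h : HasDoubleSeries F c R) :
    AnalyticOnNhd ℝ F (Metric.ball 0 R) := by
  obtain ⟨hR, hs, hF⟩ := h
  lift R to NNReal using hR.le
  let q : (n : ℕ) → ℕ × ℕ → ContinuousMultilinearMap ℝ (fun _ : Fin n => ℝ × ℝ) ℝ := fun n m =>
    (ContinuousMultilinearMap.mkPiAlgebraFin ℝ n ℝ).compContinuousLinearMap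
      (fun k => if (k : ℕ) < m.1 then ContinuousLinearMap.fst ℝ ℝ ℝ
        else ContinuousLinearMap.snd ℝ ℝ ℝ)
  have hq : ∀ n m, ‖q n m‖ ≤ 1 := fun n m => by
    refine (ContinuousMultilinearMap.norm_compContinuousLinearMap_le _ _).trans ?_
    rw [ContinuousMultilinearMap.norm_mkPiAlgebraFin, one_mul]
    refine Finset.prod_le_one (fun _ _ => norm_nonneg _) fun i _ => ?_
    split_ifs
    · exact ContinuousLinearMap.norm_fst_le _ _ _
    · exact ContinuousLinearMap.norm_snd_le _ _ _
  have hqa : ∀ n, ∀ m ∈ Finset.HasAntidiagonal.antidiagonal n, ∀ s y : ℝ, q n m (fun _ => (s, y)) =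
      s ^ m.1 * y ^ m.2 := by
    intro n m hm s y
    have hm' := Finset.HasAntidiagonal.mem_antidiagonal.1 hm
    subst hm'
    simp only [q, ContinuousMultilinearMap.compContinuousLinearMap_apply,
      ContinuousMultilinearMap.mkPiAlgebraFin_apply, List.prod_ofFn]
    rw [Fin.prod_univ_add]
    simp
  let p : FormalMultilinearSeries ℝ (ℝ × ℝ) ℝ := fun n =>
    ∑ m ∈ Finset.HasAntidiagonal.antidiagonal n, c m • q n m
  have hp : HasFPowerSeriesOnBall F p 0 R := by
   refine ⟨?_, by exact_mod_cast hR, ?_⟩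
   · refine p.le_radius_of_summable_norm ?_
     refine Summable.of_nonneg_of_le (fun n => by positivity) (fun n => ?_)
       (hasSum_antidiagonal hs.hasSum).summable
     have : ‖p n‖ ≤ ∑ m ∈ Finset.HasAntidiagonal.antidiagonal n, |c m| := by
       refine (norm_sum_le _ _).trans (Finset.sum_le_sum fun m _ => ?_)
       rw [norm_smul, Real.norm_eq_abs]
       exact mul_le_of_le_one_right (abs_nonneg _) (hq n m)
     refine (mul_le_mul_of_nonneg_right this (by positivity)).trans (le_of_eq ?_)
     rw [Finset.sum_mul]
     exact Finset.sum_congr rfl fun m hm => by rw [Finset.HasAntidiagonal.mem_antidiagonal.1 hm]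
   · rintro ⟨s, y⟩ hy
     rw [Metric.mem_eball, edist_zero_right, ← ofReal_norm,
       ENNReal.ofReal_lt_coe_iff (norm_nonneg _), Prod.norm_def, max_lt_iff] at hy
     have := hasSum_antidiagonal (hF s y hy.1.le hy.2.le)
     have key : ∀ n, p n (fun _ => (s, y)) =
         ∑ m ∈ Finset.HasAntidiagonal.antidiagonal n, c m * s ^ m.1 * y ^ m.2 := fun n => by
       have h1 : p n (fun _ => (s, y)) =
           ∑ m ∈ Finset.HasAntidiagonal.antidiagonal n, (c m • q n m) (fun _ => (s, y)) :=
         sum_apply _ _ _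
       rw [h1]
       refine Finset.sum_congr rfl fun m hm => ?_
       rw [smul_apply, hqa n m hm, smul_eq_mul, mul_assoc]
     rw [zero_add]
     simp_rw [key]
     exact this
  rw [← Metric.eball_coe]
  exact hp.analyticOnNhd

theorem HasDoubleSeries.analyticAt {F : ℝ × ℝ → ℝ} {c R} (h : HasDoubleSeries F c R) :
    AnalyticAt ℝ F 0 :=
  h.analyticOnNhd 0 (Metric.mem_ball_self h.pos)

end

section

open Filter Topology

/-- The sum of the double power series with coefficients `c`. -/
noncomputable def doubleSum (c : ℕ × ℕ → ℝ) (p : ℝ × ℝ) : ℝ := ∑' n, c n * p.1 ^ n.1 * p.2 ^ n.2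

theorem HasSum.congr_fun' {α : Type*} {f g : α → ℝ} {a : ℝ} (h : HasSum f a)
    (hfg : ∀ n, g n = f n) :
    HasSum g a := by
  rwa [show g = f from funext hfg]

theorem hasDoubleSeries_doubleSum {c : ℕ × ℕ → ℝ} {R : ℝ} (hR : 0 < R)
    (hc : Summable fun n : ℕ × ℕ => |c n| * R ^ (n.1 + n.2)) :
    HasDoubleSeries (doubleSum c) c R := by
  refine ⟨hR, hc, fun s y hs hy => ?_⟩
  refine (Summable.of_norm_bounded hc fun n => ?_).hasSum
  rw [Real.norm_eq_abs, abs_mul, abs_mul, abs_pow, abs_pow, mul_assoc, pow_add]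
  gcongr

theorem HasDoubleSeries.summable_shift {F : ℝ × ℝ → ℝ} {c R} (h : HasDoubleSeries F c R) (M N : ℕ) :
    Summable fun n : ℕ × ℕ => |c (n.1 + M, n.2 + N)| * R ^ (n.1 + n.2) := by
  have h1 : Function.Injective fun n : ℕ × ℕ => (n.1 + M, n.2 + N) := by
    rintro ⟨a, b⟩ ⟨c, d⟩ h
    simpa using h
  have h2 := (h.summable.comp_injective h1).mul_right (R ^ (M + N))⁻¹
  refine h2.congr fun n => ?_
  have := h.pos
  simp only [Function.comp]
  field_simp
  ring

theorem HasDoubleSeries.eq_of_shift {F : ℝ × ℝ → ℝ} {c R} (h : HasDoubleSeries F c R) (M N : ℕ)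
    (hc : ∀ i j, (i < M ∨ j < N) → c (i, j) = 0) {s y : ℝ} (hs : |s| ≤ R) (hy : |y| ≤ R) :
    F (s, y) = s ^ M * y ^ N * doubleSum (fun n => c (n.1 + M, n.2 + N)) (s, y) := by
  have h1 : Function.Injective fun n : ℕ × ℕ => (n.1 + M, n.2 + N) := by
    rintro ⟨a, b⟩ ⟨c, d⟩ h
    simpa using h
  have h2 := h.hasSum s y hs hy
  have h3 := (h1.hasSum_iff (fun x hx => ?_)).2 h2
  · have h4 := ((hasDoubleSeries_doubleSum h.pos (h.summable_shift M N)).hasSum s y hs hy).mul_left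
      (s ^ M * y ^ N)
    refine h3.unique ?_
    refine h4.congr_fun' fun n => ?_
    simp only [Function.comp]
    ring
  · rw [hc x.1 x.2, zero_mul, zero_mul]
    by_contra hcon
    push Not at hcon
    exact hx ⟨(x.1 - M, x.2 - N), by ext <;> simp <;> omega⟩

theorem HasDoubleSeries.apply_zero {F : ℝ × ℝ → ℝ} {c R} (h : HasDoubleSeries F c R) :
    F 0 = c 0 := by
  have h2 := h.hasSum 0 0 (by simpa using h.pos.le) (by simpa using h.pos.le)
  refine h2.unique ?_
  convert hasSum_single (0 : ℕ × ℕ) ?_ using 1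
  · simp
  · rintro ⟨i, j⟩ hij
    rcases Nat.eq_zero_or_pos i with rfl | hi
    · rcases Nat.eq_zero_or_pos j with rfl | hj
      · exact (hij rfl).elim
      · simp [hj.ne']
    · simp [hi.ne']

theorem eventually_abs_le_abs_le {R : ℝ} (hR : 0 < R) :
    ∀ᶠ p : ℝ × ℝ in 𝓝 0, |p.1| ≤ R ∧ |p.2| ≤ R := by
  filter_upwards [Metric.ball_mem_nhds (0 : ℝ × ℝ) hR] with p hp
  rw [mem_ball_zero_iff, Prod.norm_def, max_lt_iff] at hp
  exact ⟨hp.1.le, hp.2.le⟩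

/-- Division by the second coordinate. -/
theorem AnalyticAt.exists_eq_add_snd_mul {F : ℝ × ℝ → ℝ} (hF : AnalyticAt ℝ F 0) :
    ∃ F₁ : ℝ × ℝ → ℝ, AnalyticAt ℝ F₁ 0 ∧ ∀ᶠ p in 𝓝 (0 : ℝ × ℝ), F p = F (p.1, 0) + p.2 * F₁ p := by
  have hG : AnalyticAt ℝ (fun p : ℝ × ℝ => F p - F (p.1, 0)) 0 := by
    refine hF.sub (AnalyticAt.fun_comp (g := F) (f := fun p : ℝ × ℝ => (p.1, (0 : ℝ))) hF ?_)
    exact analyticAt_fst.prod analyticAt_const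
  obtain ⟨c, R, h⟩ := hF.exists_hasDoubleSeries
  have hc0 : Summable fun n : ℕ × ℕ => |if n.2 = 0 then 0 else c n| * R ^ (n.1 + n.2) := by
    refine Summable.of_nonneg_of_le (fun n => ?_) (fun n => ?_) h.summable
    · have := h.pos; positivity
    · have := h.pos
      refine mul_le_mul_of_nonneg_right ?_ (by positivity)
      split_ifs <;> simp
  have h' : HasDoubleSeries (fun p : ℝ × ℝ => F p - F (p.1, 0))
      (fun n => if n.2 = 0 then 0 else c n) R := by
    refine ⟨h.pos, hc0, fun s y hs hy => ?_⟩
    refine HasSum.congr_fun'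
      ((h.hasSum s y hs hy).sub (h.hasSum s 0 hs (by simpa using h.pos.le))) fun n => ?_
    split_ifs with hn <;> simp [hn]
  refine ⟨_, (hasDoubleSeries_doubleSum h'.pos (h'.summable_shift 0 1)).analyticAt, ?_⟩
  filter_upwards [eventually_abs_le_abs_le h.pos] with p hp
  have := h'.eq_of_shift 0 1 (fun i j hij => by
    have : j = 0 := by omega
    simp [this]) hp.1 hp.2
  simp only [pow_zero, pow_one, one_mul] at this
  rw [← this]; ring

/-- Factoring out the maximal power of the first coordinate. -/
theorem AnalyticAt.exists_eq_fst_pow_mul {F : ℝ × ℝ → ℝ} (hF : AnalyticAt ℝ F 0)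
    (hF0 : ¬ ∀ᶠ p in 𝓝 (0 : ℝ × ℝ), F p = 0) :
    ∃ (M : ℕ) (F₁ : ℝ × ℝ → ℝ), AnalyticAt ℝ F₁ 0 ∧ (∀ᶠ p in 𝓝 (0 : ℝ × ℝ), F p = p.1 ^ M * F₁ p) ∧
      ¬ ∀ᶠ y in 𝓝 (0 : ℝ), F₁ (0, y) = 0 := by
  classical
  obtain ⟨c, R, h⟩ := hF.exists_hasDoubleSeries
  have hex : ∃ i, ∃ j, c (i, j) ≠ 0 := by
    by_contra hcon
    push Not at hcon
    refine hF0 ?_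
    filter_upwards [eventually_abs_le_abs_le h.pos] with p hp
    refine (h.hasSum p.1 p.2 hp.1 hp.2).unique ?_
    convert hasSum_zero using 2 with n
    simp [hcon n.1 n.2]
  set M := Nat.find hex with hM
  have hMj : ∃ j, c (M, j) ≠ 0 := Nat.find_spec hex
  have hMlt : ∀ i < M, ∀ j, c (i, j) = 0 := fun i hi j => by
    have := Nat.find_min hex hi
    push Not at this
    exact this j
  have h1 := hasDoubleSeries_doubleSum h.pos (h.summable_shift M 0)
  refine ⟨M, _, h1.analyticAt, ?_, fun hcon => ?_⟩
  · filter_upwards [eventually_abs_le_abs_le h.pos] with p hp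
    have := h.eq_of_shift M 0 (fun i j hij => hMlt i (by omega) j) hp.1 hp.2
    simpa using this
  · set N := Nat.find hMj with hN
    have hNj : c (M, N) ≠ 0 := Nat.find_spec hMj
    have hNlt : ∀ j < N, c (M, j) = 0 := fun j hj => not_not.1 (Nat.find_min hMj hj)
    set F₁ := doubleSum (fun n => c (n.1 + M, n.2 + 0)) with hF₁
    have h2 : HasDoubleSeries (fun p : ℝ × ℝ => F₁ (0, p.2))
        (fun n => if n.1 = 0 then c (M, n.2) else 0) R := by
      refine ⟨h.pos, ?_, fun s y hs hy => ?_⟩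
      · refine Summable.of_nonneg_of_le (fun n => ?_) (fun n => ?_) h1.summable
        · have := h.pos; positivity
        · have := h.pos
          refine mul_le_mul_of_nonneg_right ?_ (by positivity)
          split_ifs with h <;> simp [h]
      · have := h1.hasSum 0 y (by simpa using h.pos.le) hy
        convert this using 2 with n
        split_ifs with h <;> simp [h]
    have h3 := hasDoubleSeries_doubleSum h2.pos (h2.summable_shift 0 N)
    have h4 : doubleSum (fun n : ℕ × ℕ => if n.1 + 0 = 0 then c (M, n.2 + N) else 0) 0 ≠ 0 := by
      rw [h3.apply_zero]
      simpa using hNj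
    have h5 := (h3.analyticAt.continuousAt.eventually_ne h4)
    have h6 : Tendsto (fun y : ℝ => ((0 : ℝ), y)) (𝓝[≠] 0) (𝓝 (0 : ℝ × ℝ)) := by
      have : ContinuousAt (fun y : ℝ => ((0 : ℝ), y)) 0 := by fun_prop
      exact this.tendsto.mono_left nhdsWithin_le_nhds
    have h7 : ∀ᶠ y : ℝ in 𝓝[≠] 0, False := by
      filter_upwards [h6.eventually h5, h6.eventually (eventually_abs_le_abs_le h.pos),
        hcon.filter_mono nhdsWithin_le_nhds, self_mem_nhdsWithin] with y hy1 hy2 hy3 hy4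
      have := h2.eq_of_shift 0 N (fun i j hij => by
        rcases hij with h | h
        · omega
        · simp [hNlt j h]) (s := 0) (y := y) hy2.1 hy2.2
      simp only at this
      rw [hy3] at this
      rcases mul_eq_zero.1 this.symm with h | h
      · simp at h
        exact hy4 h.1
      · exact hy1 h
    exact h7.exists.elim fun _ h => h

end

section

open Filter Topology

theorem ContinuousLinearMap.det_prod_eq (L : ℝ × ℝ →L[ℝ] ℝ × ℝ) :
    L.det = (L (1, 0)).1 * (L (0, 1)).2 - (L (0, 1)).1 * (L (1, 0)).2 := by
  have : L.det = LinearMap.det (L : ℝ × ℝ →ₗ[ℝ] ℝ × ℝ) := rfl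
  rw [this, ← LinearMap.det_toMatrix (Module.Basis.finTwoProd ℝ), Matrix.det_fin_two]
  simp [LinearMap.toMatrix_apply]

theorem exists_analytic_inverse {f : ℝ × ℝ → ℝ × ℝ} {p : ℝ × ℝ} (hf : AnalyticAt ℝ f p)
    (hdet : (fderiv ℝ f p).det ≠ 0) :
    ∃ g : ℝ × ℝ → ℝ × ℝ, AnalyticAt ℝ g (f p) ∧ g (f p) = p ∧ (∀ᶠ x in 𝓝 p, g (f x) = x) ∧
      ∀ᶠ y in 𝓝 (f p), f (g y) = y := by
  let i := (fderiv ℝ f p).toContinuousLinearEquivOfDetNeZero hdet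
  have hi : (i : ℝ × ℝ →L[ℝ] ℝ × ℝ) = fderiv ℝ f p := by ext <;> rfl
  have hfd : HasStrictFDerivAt f (i : ℝ × ℝ →L[ℝ] ℝ × ℝ) p := by
    rw [hi]; exact hf.hasStrictFDerivAt
  let R := hfd.toOpenPartialHomeomorph _
  have hx : p ∈ R.source := HasStrictFDerivAt.mem_toOpenPartialHomeomorph_source _
  exact ⟨R.symm, R.analyticAt_symm' hx hf hi.symm, R.left_inv hx, R.eventually_left_inverse hx,
    (R.eventually_right_inverse' hx)⟩

/-- Inverse function theorem in the second variable, with the first one as a parameter. -/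
theorem exists_analytic_inverse_snd {D : ℝ × ℝ → ℝ} {a : ℝ × ℝ} (hD : AnalyticAt ℝ D a)
    (hy : fderiv ℝ D a (0, 1) ≠ 0) :
    ∃ Y : ℝ × ℝ → ℝ, AnalyticAt ℝ Y (a.1, D a) ∧ Y (a.1, D a) = a.2 ∧
      (∀ᶠ p in 𝓝 (a.1, D a), D (p.1, Y p) = p.2) ∧ ∀ᶠ p in 𝓝 a, Y (p.1, D p) = p.2 := by
  have hf : AnalyticAt ℝ (fun p : ℝ × ℝ => (p.1, D p)) a := analyticAt_fst.prod hD
  have hd : fderiv ℝ (fun p : ℝ × ℝ => (p.1, D p)) a =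
      (ContinuousLinearMap.fst ℝ ℝ ℝ).prod (fderiv ℝ D a) :=
    (hasFDerivAt_fst.prodMk hD.differentiableAt.hasFDerivAt).fderiv
  obtain ⟨g, hg, hgp, hgl, hgr⟩ := exists_analytic_inverse hf (by
    rw [ContinuousLinearMap.det_prod_eq, hd]
    simpa using hy)
  refine ⟨fun p => (g p).2, analyticAt_snd.comp hg, congrArg Prod.snd hgp, ?_, ?_⟩
  · filter_upwards [hgr] with p hp
    have h1 := congrArg Prod.fst hp
    have h2 := congrArg Prod.snd hp
    simp only at h1 h2
    rw [← h2]
    congr 1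
    exact Prod.ext h1.symm rfl
  · filter_upwards [hgl] with p hp
    rw [hp]

theorem exists_analytic_implicit {D : ℝ × ℝ → ℝ} {a : ℝ × ℝ} (hD : AnalyticAt ℝ D a)
    (h0 : D a = 0) (hy : fderiv ℝ D a (0, 1) ≠ 0) :
    ∃ φ : ℝ → ℝ, AnalyticAt ℝ φ a.1 ∧ φ a.1 = a.2 ∧ (∀ᶠ s in 𝓝 a.1, D (s, φ s) = 0) ∧
      ∀ᶠ p in 𝓝 a, D p = 0 → p.2 = φ p.1 := by
  obtain ⟨Y, hY, hYa, hr, hl⟩ := exists_analytic_inverse_snd hD hy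
  rw [h0] at hY hYa hr
  have hA : AnalyticAt ℝ (fun s : ℝ => (s, (0 : ℝ))) a.1 := analyticAt_id.prod analyticAt_const
  refine ⟨fun s => Y (s, 0), AnalyticAt.fun_comp (g := Y) hY hA, hYa, ?_, ?_⟩
  · exact hA.continuousAt.tendsto.eventually hr
  · filter_upwards [hl] with p hp h
    rw [← hp, h]

/-- Inverse function theorem in one variable. -/
theorem exists_analytic_inverse_one {f : ℝ → ℝ} {a : ℝ} (hf : AnalyticAt ℝ f a)
    (h : deriv f a ≠ 0) :
    ∃ g : ℝ → ℝ, AnalyticAt ℝ g (f a) ∧ g (f a) = a ∧ (∀ᶠ x in 𝓝 a, g (f x) = x) ∧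
      ∀ᶠ y in 𝓝 (f a), f (g y) = y :=
  ⟨_, hf.analyticAt_localInverse h, HasStrictFDerivAt.localInverse_apply_image ..,
    HasStrictDerivAt.eventually_left_inverse .., HasStrictDerivAt.eventually_right_inverse ..⟩

end

section

open Filter Topology

/-- Partial derivative with respect to the second coordinate. -/
noncomputable def dY (F : ℝ × ℝ → ℝ) (p : ℝ × ℝ) : ℝ := fderiv ℝ F p (0, 1)

theorem AnalyticAt.dY {F : ℝ × ℝ → ℝ} {p : ℝ × ℝ} (hF : AnalyticAt ℝ F p) : AnalyticAt ℝ (dY F) p :=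
  ((ContinuousLinearMap.apply ℝ ℝ ((0 : ℝ), (1 : ℝ))).analyticAt _).comp hF.fderiv

theorem AnalyticAt.dY_iterate {F : ℝ × ℝ → ℝ} {p : ℝ × ℝ} (hF : AnalyticAt ℝ F p) (k : ℕ) :
    AnalyticAt ℝ (_root_.dY^[k] F) p := by
  induction k with
  | zero => exact hF
  | succ k ih => rw [Function.iterate_succ_apply']; exact ih.dY

theorem Filter.EventuallyEq.dY {F G : ℝ × ℝ → ℝ} {p : ℝ × ℝ} (h : F =ᶠ[𝓝 p] G) :
    _root_.dY F =ᶠ[𝓝 p] _root_.dY G :=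
  (h.fderiv (𝕜 := ℝ)).mono fun q hq => by simp only [_root_.dY, hq]

theorem Filter.EventuallyEq.dY_iterate {F G : ℝ × ℝ → ℝ} {p : ℝ × ℝ} (h : F =ᶠ[𝓝 p] G) (k : ℕ) :
    _root_.dY^[k] F =ᶠ[𝓝 p] _root_.dY^[k] G := by
  induction k with
  | zero => exact h
  | succ k ih => simp only [Function.iterate_succ_apply']; exact ih.dY

theorem dY_add_snd_mul {A G : ℝ × ℝ → ℝ} {p : ℝ × ℝ} (hA : DifferentiableAt ℝ A p)
    (hG : DifferentiableAt ℝ G p) :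
    dY (fun p => A p + p.2 * G p) p = dY A p + (G p + p.2 * dY G p) := by
  have h := hA.hasFDerivAt.add (hasFDerivAt_snd.mul hG.hasFDerivAt)
  have h2 : (fun p => A p + p.2 * G p) = (A + Prod.snd * G) := rfl
  simp only [dY]
  rw [h2, h.fderiv]
  simp
  ring

theorem dY_iterate_fst_add_snd_mul {a : ℝ → ℝ} {G : ℝ × ℝ → ℝ} (ha : AnalyticAt ℝ a 0)
    (hG : AnalyticAt ℝ G 0) (k : ℕ) :
    dY^[k + 1] (fun p => a p.1 + p.2 * G p) =ᶠ[𝓝 0]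
      fun p => p.2 * dY^[k + 1] G p + (k + 1) * dY^[k] G p := by
  induction k with
  | zero =>
    have ha' : AnalyticAt ℝ (fun p : ℝ × ℝ => a p.1) 0 :=
      AnalyticAt.fun_comp (g := a) (f := Prod.fst) (x := (0 : ℝ × ℝ)) (by exact ha) analyticAt_fst
    have ha2 : ∀ᶠ p : ℝ × ℝ in 𝓝 0, AnalyticAt ℝ a p.1 :=
      (continuous_fst.tendsto (0 : ℝ × ℝ)).eventually ha.eventually_analyticAt
    filter_upwards [ha2, hG.eventually_analyticAt] with p hp hp2
    have h1 : HasFDerivAt (fun p : ℝ × ℝ => a p.1) _ p :=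
      hp.differentiableAt.hasDerivAt.comp_hasFDerivAt (f := Prod.fst) p
        (hasFDerivAt_fst (𝕜 := ℝ) (E := ℝ) (F := ℝ) (p := p))
    rw [Function.iterate_one, dY_add_snd_mul h1.differentiableAt hp2.differentiableAt]
    have : dY (fun p : ℝ × ℝ => a p.1) p = 0 := by simp [dY, h1.fderiv]
    rw [this]
    simp
    ring
  | succ k ih =>
    rw [Function.iterate_succ_apply']
    refine ih.dY.trans ?_
    have h1 : (fun p : ℝ × ℝ => p.2 * dY^[k + 1] G p + (k + 1) * dY^[k] G p) =
      fun p => ((k + 1 : ℝ) * dY^[k] G p) + p.2 * dY^[k + 1] G p := by funext p; ring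
    rw [h1]
    filter_upwards [(hG.dY_iterate k).eventually_analyticAt,
      (hG.dY_iterate (k + 1)).eventually_analyticAt] with p hp hp2
    rw [dY_add_snd_mul (hp.differentiableAt.const_mul _) hp2.differentiableAt]
    have : dY (fun p : ℝ × ℝ => (k + 1 : ℝ) * dY^[k] G p) p = (k + 1) * dY^[k + 1] G p := by
      rw [Function.iterate_succ_apply']
      simp only [dY]
      rw [fderiv_const_mul hp.differentiableAt]
      simp
    rw [this]
    rw [Function.iterate_succ_apply' _ (k + 1)]
    push_cast
    ring

/-- Finite Taylor expansion in the second coordinate. -/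
structure TaylorSnd (F : ℝ × ℝ → ℝ) (d : ℕ) (a : ℕ → ℝ → ℝ) (U : ℝ × ℝ → ℝ) : Prop where
  coeff : ∀ j, AnalyticAt ℝ (a j) 0
  rem : AnalyticAt ℝ U 0
  eq : ∀ᶠ p in 𝓝 (0 : ℝ × ℝ), F p = ∑ j ∈ Finset.range d, a j p.1 * p.2 ^ j + p.2 ^ d * U p

theorem AnalyticAt.exists_taylorSnd {F : ℝ × ℝ → ℝ} (hF : AnalyticAt ℝ F 0) (d : ℕ) :
    ∃ a U, TaylorSnd F d a U := by
  induction d with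
  | zero => exact ⟨fun _ _ => 0, F, fun _ => analyticAt_const, hF, by simp⟩
  | succ d ih =>
    obtain ⟨a, U, h⟩ := ih
    obtain ⟨U₁, hU₁, hU⟩ := h.rem.exists_eq_add_snd_mul
    refine ⟨fun j => if j < d then a j else fun s => U (s, 0), U₁, fun j => ?_, hU₁, ?_⟩
    · by_cases hjd : j < d
      all_goals simp only [hjd, if_true, if_false]
      · exact h.coeff j
      · have hA : AnalyticAt ℝ (fun s : ℝ => (s, (0 : ℝ))) 0 := analyticAt_id.prod analyticAt_const
        exact AnalyticAt.fun_comp (g := U) h.rem hA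
    · filter_upwards [h.eq, hU] with p hp hp2
      rw [hp, Finset.sum_range_succ, hp2]
      simp only [lt_irrefl, if_false]
      have : ∑ j ∈ Finset.range d, (if j < d then a j else fun s => U (s, 0)) p.1 * p.2 ^ j =
        ∑ j ∈ Finset.range d, a j p.1 * p.2 ^ j :=
        Finset.sum_congr rfl fun j hj => by rw [if_pos (Finset.mem_range.1 hj)]
      rw [this]
      ring

theorem eventually_fst_zero {p : ℝ × ℝ → Prop} (h : ∀ᶠ q in 𝓝 (0 : ℝ × ℝ), p q) :
    ∀ᶠ s in 𝓝 (0 : ℝ), p (s, 0) := by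
  have : ContinuousAt (fun s : ℝ => (s, (0 : ℝ))) 0 := by fun_prop
  exact this.tendsto.eventually h

theorem eventually_zero_snd {p : ℝ × ℝ → Prop} (h : ∀ᶠ q in 𝓝 (0 : ℝ × ℝ), p q) :
    ∀ᶠ y in 𝓝 (0 : ℝ), p (0, y) := by
  have : ContinuousAt (fun s : ℝ => ((0 : ℝ), s)) 0 := by fun_prop
  exact this.tendsto.eventually h

theorem TaylorSnd.analyticAt {F : ℝ × ℝ → ℝ} {d a U} (h : TaylorSnd F d a U) : AnalyticAt ℝ F 0 := by
  refine AnalyticAt.congr ?_ (EventuallyEq.symm h.eq)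
  refine AnalyticAt.fun_add (Finset.analyticAt_fun_sum _ fun j _ => ?_)
    ((analyticAt_snd.pow _).mul h.rem)
  exact (AnalyticAt.fun_comp (g := a j) (f := Prod.fst) (x := (0 : ℝ × ℝ))
      (by exact h.coeff j) analyticAt_fst).mul (analyticAt_snd.pow _)

theorem TaylorSnd.dY_iterate {F : ℝ × ℝ → ℝ} {d a U} (h : TaylorSnd F d a U) :
    (∀ k < d, ∀ᶠ s in 𝓝 (0 : ℝ), dY^[k] F (s, 0) = k.factorial * a k s) ∧
      ∀ᶠ s in 𝓝 (0 : ℝ), dY^[d] F (s, 0) = d.factorial * U (s, 0) := by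
  induction d generalizing F a with
  | zero =>
    refine ⟨fun k hk => by omega, ?_⟩
    filter_upwards [eventually_fst_zero h.eq] with s hs
    simpa using hs
  | succ d ih =>
    set F₁ : ℝ × ℝ → ℝ := fun p => ∑ j ∈ Finset.range d, a (j + 1) p.1 * p.2 ^ j + p.2 ^ d * U p
      with hF₁
    have h1 : TaylorSnd F₁ d (fun j => a (j + 1)) U :=
      ⟨fun j => h.coeff _, h.rem, by simp [hF₁]⟩
    have h2 : F =ᶠ[𝓝 0] fun p => a 0 p.1 + p.2 * F₁ p := by
      filter_upwards [h.eq] with p hp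
      rw [hp, Finset.sum_range_succ', hF₁, mul_add, Finset.mul_sum]
      simp only [pow_succ, pow_zero, mul_one]
      rw [add_comm _ (a 0 p.1), add_assoc]
      congr 2
      · exact Finset.sum_congr rfl fun j _ => by ring
      · ring
    have key : ∀ k, ∀ᶠ s in 𝓝 (0 : ℝ), dY^[k + 1] F (s, 0) = (k + 1) * dY^[k] F₁ (s, 0) := fun k => by
      filter_upwards [eventually_fst_zero (h2.dY_iterate (k + 1)), eventually_fst_zero
        (dY_iterate_fst_add_snd_mul (h.coeff 0) h1.analyticAt k)] with s hs hs2
      rw [hs, hs2]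
      simp
    obtain ⟨ih1, ih2⟩ := ih h1
    constructor
    · intro k hk
      cases k with
      | zero =>
        filter_upwards [eventually_fst_zero h2] with s hs
        simpa using hs
      | succ k =>
        filter_upwards [key k, ih1 k (by omega)] with s hs hs2
        rw [hs, hs2, Nat.factorial_succ]
        push_cast
        ring
    · filter_upwards [key d, ih2] with s hs hs2
      rw [hs, hs2, Nat.factorial_succ]
      push_cast
      ring

theorem dY_iterate_shear {F : ℝ × ℝ → ℝ} {φ : ℝ → ℝ} (hF : AnalyticAt ℝ F 0) (hφ : AnalyticAt ℝ φ 0)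
    (h0 : φ 0 = 0) (k : ℕ) :
    dY^[k] (fun p => F (p.1, φ p.1 + p.2)) =ᶠ[𝓝 0] fun p => dY^[k] F (p.1, φ p.1 + p.2) := by
  induction k with
  | zero => exact EventuallyEq.rfl
  | succ k ih =>
    simp only [Function.iterate_succ_apply']
    refine ih.dY.trans ?_
    have hc : Tendsto (fun p : ℝ × ℝ => (p.1, φ p.1 + p.2)) (𝓝 0) (𝓝 0) := by
      have : ContinuousAt (fun p : ℝ × ℝ => (p.1, φ p.1 + p.2)) 0 := by
        have : ContinuousAt φ (0 : ℝ × ℝ).1 := hφ.continuousAt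
        fun_prop
      simpa only [ContinuousAt, h0, Prod.fst_zero, Prod.snd_zero, add_zero,
          Prod.mk_zero_zero] using this
    have ha2 : ∀ᶠ p : ℝ × ℝ in 𝓝 0, AnalyticAt ℝ φ p.1 :=
      (continuous_fst.tendsto (0 : ℝ × ℝ)).eventually hφ.eventually_analyticAt
    filter_upwards [hc.eventually (hF.dY_iterate k).eventually_analyticAt, ha2] with p hp hp2
    have h1 : HasFDerivAt (fun p : ℝ × ℝ => φ p.1) _ p :=
      hp2.differentiableAt.hasDerivAt.comp_hasFDerivAt (f := Prod.fst) p
        (hasFDerivAt_fst (𝕜 := ℝ) (E := ℝ) (F := ℝ) (p := p))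
    have h2 := hp.differentiableAt.hasFDerivAt.comp p
        (hasFDerivAt_fst.prodMk (h1.add hasFDerivAt_snd))
    simp only [dY]
    have h3 : (fun p : ℝ × ℝ => dY^[k] F (p.1, φ p.1 + p.2)) = dY^[k] F ∘ fun p =>
      (p.1, ((fun p : ℝ × ℝ => φ p.1) + (Prod.snd : ℝ × ℝ → ℝ)) p) := rfl
    rw [h3, h2.fderiv]
    simp

/-- A shear that removes the subleading Taylor coefficient. -/
theorem TaylorSnd.exists_shear {F : ℝ × ℝ → ℝ} {d a U} (h : TaylorSnd F (d + 1) a U)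
    (ha : ∀ j < d + 1, a j 0 = 0) (hU : U 0 ≠ 0) :
    ∃ φ : ℝ → ℝ, AnalyticAt ℝ φ 0 ∧ φ 0 = 0 ∧ ∃ a' U',
      TaylorSnd (fun p => F (p.1, φ p.1 + p.2)) (d + 1) a' U' ∧ (∀ j < d + 1, a' j 0 = 0) ∧
        U' 0 ≠ 0 ∧
      ∀ᶠ s in 𝓝 (0 : ℝ), a' d s = 0 := by
  obtain ⟨h1, h2⟩ := h.dY_iterate
  have hF := h.analyticAt
  have hD0 : dY^[d] F 0 = 0 := by
    have := (h1 d (by omega)).self_of_nhds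
    rw [ha d (by omega), mul_zero] at this
    exact this
  have hD1 : fderiv ℝ (dY^[d] F) 0 (0, 1) ≠ 0 := by
    have := h2.self_of_nhds
    rw [Function.iterate_succ_apply'] at this
    change fderiv ℝ (dY^[d] F) 0 (0, 1) = _ * U 0 at this
    rw [this]
    exact mul_ne_zero (by exact_mod_cast (d + 1).factorial_ne_zero) hU
  obtain ⟨φ, hφ, hφ0, hφ1, -⟩ := exists_analytic_implicit (hF.dY_iterate d) hD0 hD1
  simp only [Prod.fst_zero, Prod.snd_zero] at hφ hφ0 hφ1
  have hsh : AnalyticAt ℝ (fun p : ℝ × ℝ => (p.1, φ p.1 + p.2)) 0 :=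
    analyticAt_fst.prod ((AnalyticAt.fun_comp (g := φ) (f := Prod.fst) (x := (0 : ℝ × ℝ))
      (by exact hφ) analyticAt_fst).add analyticAt_snd)
  have hF2 : AnalyticAt ℝ (fun p : ℝ × ℝ => F (p.1, φ p.1 + p.2)) 0 :=
    AnalyticAt.fun_comp (g := F) (by simpa only [hφ0, Prod.fst_zero, Prod.snd_zero, add_zero,
      Prod.mk_zero_zero] using hF) hsh
  obtain ⟨a', U', h'⟩ := hF2.exists_taylorSnd (d + 1)
  obtain ⟨h1', h2'⟩ := h'.dY_iterate
  have hk : ∀ k, ∀ᶠ s in 𝓝 (0 : ℝ), dY^[k] (fun p => F (p.1, φ p.1 + p.2)) (s, 0) =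
      dY^[k] F (s, φ s) :=
    fun k => by
      filter_upwards [eventually_fst_zero (dY_iterate_shear hF hφ hφ0 k)] with s hs
      simpa using hs
  refine ⟨φ, hφ, hφ0, a', U', h', fun j hj => ?_, fun hU' => ?_, ?_⟩
  · have e1 := (h1' j hj).self_of_nhds
    have e2 := (h1 j hj).self_of_nhds
    have e3 := (hk j).self_of_nhds
    rw [ha j hj, mul_zero] at e2
    rw [hφ0, e2] at e3
    rw [e3] at e1
    simpa [Nat.factorial_ne_zero] using e1.symm
  · have e1 := h2'.self_of_nhds
    have e2 := h2.self_of_nhds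
    have e3 := (hk (d + 1)).self_of_nhds
    rw [hφ0, e1, e2, show ((0 : ℝ), (0 : ℝ)) = 0 from rfl, hU', mul_zero] at e3
    have : ((d + 1).factorial : ℝ) ≠ 0 := by exact_mod_cast (d + 1).factorial_ne_zero
    rcases mul_eq_zero.1 e3.symm with h | h
    · exact this h
    · exact hU h
  · filter_upwards [hk d, hφ1, h1' d (by omega)] with s e1 e2 e3
    rw [e3, e2] at e1
    simpa [Nat.factorial_ne_zero] using e1

end

section

open Filter Topology

theorem coeff_eq_zero_of_eventually_eq {d : ℕ} {q : ℕ → ℝ} {u g : ℝ → ℝ} (hu : ContinuousAt u 0)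
    (hg : ContinuousAt g 0)
    (h : ∀ᶠ y in 𝓝[≠] (0 : ℝ), ∑ j ∈ Finset.range d, q j * y ^ j + y ^ d * u y = y ^ d * g y) :
    (∀ j < d, q j = 0) ∧ u 0 = g 0 := by
  induction d generalizing q with
  | zero =>
    refine ⟨fun j hj => by omega, ?_⟩
    refine tendsto_nhds_unique_of_eventuallyEq (hu.tendsto.mono_left nhdsWithin_le_nhds)
      (hg.tendsto.mono_left nhdsWithin_le_nhds) (h.mono fun y hy => by simpa using hy)
  | succ d ih =>
    have h1 : ∀ᶠ y in 𝓝[≠] (0 : ℝ),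
        q 0 + y * (∑ j ∈ Finset.range d, q (j + 1) * y ^ j + y ^ d * u y) = y * (y ^ d * g y) := by
      filter_upwards [h] with y hy
      rw [Finset.sum_range_succ'] at hy
      have : ∑ j ∈ Finset.range d, q (j + 1) * y ^ (j + 1) =
          y * ∑ j ∈ Finset.range d, q (j + 1) * y ^ j := by
        rw [Finset.mul_sum]
        exact Finset.sum_congr rfl fun j _ => by ring
      rw [this] at hy
      linear_combination hy
    have h0 : q 0 = 0 := by
      have c1 : ContinuousAt (fun y =>
          q 0 + y * (∑ j ∈ Finset.range d, q (j + 1) * y ^ j + y ^ d * u y)) 0 := by fun_prop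
      have c2 : ContinuousAt (fun y => y * (y ^ d * g y)) 0 := by fun_prop
      have := tendsto_nhds_unique_of_eventuallyEq (c1.tendsto.mono_left nhdsWithin_le_nhds)
        (c2.tendsto.mono_left nhdsWithin_le_nhds) h1
      simpa using this
    obtain ⟨h2, h3⟩ := ih (q := fun j => q (j + 1)) (by
      filter_upwards [h1, self_mem_nhdsWithin] with y hy hy0
      rw [h0, zero_add] at hy
      exact mul_left_cancel₀ hy0 hy)
    refine ⟨fun j hj => ?_, h3⟩
    cases j with
    | zero => exact h0
    | succ j => exact h2 j (by omega)

/-- `F` vanishes at the origin exactly to order `d` in the direction of the second coordinate. -/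
def HasOrdSnd (F : ℝ × ℝ → ℝ) (d : ℕ) : Prop :=
  ∃ a U, TaylorSnd F d a U ∧ (∀ j < d, a j 0 = 0) ∧ U 0 ≠ 0

theorem AnalyticAt.comp_zero_snd {U : ℝ × ℝ → ℝ} (hU : AnalyticAt ℝ U 0) :
    AnalyticAt ℝ (fun y : ℝ => U (0, y)) 0 := by
  have hA : AnalyticAt ℝ (fun s : ℝ => ((0 : ℝ), s)) 0 := analyticAt_const.prod analyticAt_id
  exact AnalyticAt.fun_comp (g := U) hU hA

theorem AnalyticAt.comp_fst {a : ℝ → ℝ} (ha : AnalyticAt ℝ a 0) :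
    AnalyticAt ℝ (fun p : ℝ × ℝ => a p.1) 0 :=
  AnalyticAt.fun_comp (g := a) (f := Prod.fst) (x := (0 : ℝ × ℝ)) (by exact ha) analyticAt_fst

theorem AnalyticAt.exists_hasOrdSnd {F : ℝ × ℝ → ℝ} (hF : AnalyticAt ℝ F 0)
    (h0 : ¬ ∀ᶠ y in 𝓝 (0 : ℝ), F (0, y) = 0) : ∃ d, HasOrdSnd F d := by
  obtain ⟨d, g, hg, hg0, hgF⟩ := (hF.comp_zero_snd.exists_eventuallyEq_pow_smul_nonzero_iff).2 h0
  obtain ⟨a, U, h⟩ := hF.exists_taylorSnd d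
  refine ⟨d, a, U, h, ?_⟩
  have := coeff_eq_zero_of_eventually_eq (d := d) (q := fun j => a j 0) (g := g)
    h.rem.comp_zero_snd.continuousAt hg.continuousAt (by
      refine Eventually.filter_mono nhdsWithin_le_nhds ?_
      filter_upwards [hgF, eventually_zero_snd h.eq] with y hy hy2
      simp only [sub_zero, smul_eq_mul] at hy
      rw [← hy, hy2])
  refine ⟨this.1, ?_⟩
  have h2 := this.2
  change U 0 = g 0 at h2
  rwa [h2]

theorem AnalyticAt.exists_hasOrdSnd_lt {F : ℝ × ℝ → ℝ} (hF : AnalyticAt ℝ F 0) {d : ℕ} {q : ℕ → ℝ}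
    {u : ℝ → ℝ} (hu : ContinuousAt u 0)
    (h : ∀ᶠ y in 𝓝 (0 : ℝ), F (0, y) = ∑ j ∈ Finset.range d, q j * y ^ j + y ^ d * u y)
    (hq : ∃ j < d, q j ≠ 0) : ∃ d' < d, HasOrdSnd F d' := by
  have key : ∀ g : ℝ → ℝ, ContinuousAt g 0 → ¬ ∀ᶠ y in 𝓝 (0 : ℝ), F (0, y) = y ^ d * g y := by
    intro g hg hFg
    obtain ⟨j, hj, hqj⟩ := hq
    refine hqj ((coeff_eq_zero_of_eventually_eq (d := d) (q := q) hu hg ?_).1 j hj)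
    refine Eventually.filter_mono nhdsWithin_le_nhds ?_
    filter_upwards [h, hFg] with y h1 h2
    rw [← h1, h2]
  obtain ⟨d', hd'⟩ := hF.exists_hasOrdSnd (fun hF0 => key (fun _ => 0) continuousAt_const
    (by simpa using hF0))
  refine ⟨d', ?_, hd'⟩
  by_contra hlt
  obtain ⟨a, U, h', ha, hU⟩ := hd'
  have := h'.rem.comp_zero_snd.continuousAt
  refine key (fun y => y ^ (d' - d) * U (0, y)) ((continuousAt_id.pow _).mul this) ?_
  filter_upwards [eventually_zero_snd h'.eq] with y h1
  rw [h1, Finset.sum_eq_zero fun j hj => by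
    rw [ha j (Finset.mem_range.1 hj), zero_mul], zero_add, ← mul_assoc, ← pow_add]
  congr 2
  omega

theorem exists_taylor_coeff_ne_zero {d : ℕ} {q : ℕ → ℝ} {c u : ℝ} (hd : 0 < d) (hq : q (d - 1) = 0)
    (hc : c ≠ 0) (hu : u ≠ 0) :
    ∃ r : ℕ → ℝ, (∀ y : ℝ, ∑ j ∈ Finset.range d, q j * (c + y) ^ j + (c + y) ^ d * u =
      ∑ j ∈ Finset.range d, r j * y ^ j + y ^ d * u) ∧ ∃ j < d, r j ≠ 0 := by
  obtain ⟨e, rfl⟩ : ∃ e, d = e + 1 := ⟨d - 1, by omega⟩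
  simp only [Nat.add_sub_cancel] at hq
  have hsum : ∀ (n : ℕ) (y : ℝ), (c + y) ^ n = ∑ m ∈ Finset.range (n + 1),
      y ^ m * c ^ (n - m) * n.choose m :=
    fun n y => by rw [add_comm, add_pow]
  set Q : Polynomial ℝ := ∑ j ∈ Finset.range (e + 1), Polynomial.monomial j (q j) +
    Polynomial.monomial (e + 1) u with hQ
  have hQe : ∀ x, Q.eval x = ∑ j ∈ Finset.range (e + 1), q j * x ^ j + x ^ (e + 1) * u := fun x => by
    simp [hQ, Polynomial.eval_finsetSum, mul_comm]
  have hcoef : ∀ n, Q.coeff n = (if n < e + 1 then q n else 0) + if n = e + 1 then u else 0 :=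
      fun n => by
    simp [hQ, Polynomial.finsetSum_coeff, Polynomial.coeff_monomial, eq_comm]
    try omega
  have hdeg : Q.natDegree ≤ e + 1 := by
    refine Polynomial.natDegree_le_iff_coeff_eq_zero.2 fun n hn => ?_
    rw [hcoef, if_neg (by omega), if_neg (by omega), add_zero]
  have hdegT : (Polynomial.taylor c Q).natDegree ≤ e + 1 := by rwa [Polynomial.natDegree_taylor]
  have hnd : Q.natDegree = e + 1 := by
    refine le_antisymm hdeg (Polynomial.le_natDegree_of_ne_zero ?_)
    rw [hcoef]; simpa using hu
  refine ⟨fun j => (Polynomial.taylor c Q).coeff j, fun y => ?_, e, by omega, ?_⟩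
  · rw [← hQe, add_comm c y, ← Polynomial.taylor_eval, Polynomial.eval_eq_sum_range' (n := e + 2)
      (by omega),
      Finset.sum_range_succ]
    congr 1
    have : (Polynomial.taylor c Q).coeff (e + 1) = u := by
      have h1 : (Polynomial.taylor c Q).coeff (Polynomial.taylor c Q).natDegree = _ :=
        Polynomial.taylor_coeff c Q _
      rw [Polynomial.natDegree_taylor, hnd] at h1
      rw [h1, Polynomial.eval_eq_sum_range' (n := 1)]
      · simp [Polynomial.hasseDeriv_coeff, hcoef]
      · exact lt_of_le_of_lt (Polynomial.natDegree_hasseDeriv_le _ _) (by omega)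
    rw [this]; ring
  · simp only
    rw [Polynomial.taylor_coeff, Polynomial.eval_eq_sum_range' (n := 2)]
    · rw [Finset.sum_range_succ, Finset.sum_range_one]
      simp only [Polynomial.hasseDeriv_coeff, hcoef]
      simp [hq, hc, hu]
      rw [add_comm 1 e, Nat.choose_succ_self_right]
      exact_mod_cast (⟨rfl, by simp⟩ : e + 1 = e + 1 ∧ ¬ False)
    · exact lt_of_le_of_lt (Polynomial.natDegree_hasseDeriv_le _ _) (by omega)

end

section

open Filter Topology

/-- The germ `F` is a polynomial in the second coordinate of degree `d`, up to a unit, without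
subleading term, and weighted homogeneous of weights `(1, k)` to leading order. -/
structure NewtonForm (k d : ℕ) (b : ℕ → ℝ → ℝ) (U F : ℝ × ℝ → ℝ) : Prop where
  coeff : ∀ j, AnalyticAt ℝ (b j) 0
  rem : AnalyticAt ℝ U 0
  rem_ne : U 0 ≠ 0
  eq : ∀ᶠ p in 𝓝 (0 : ℝ × ℝ), F p =
    ∑ j ∈ Finset.range d, p.1 ^ (k * (d - j)) * b j p.1 * p.2 ^ j + p.2 ^ d * U p
  sub : ∀ᶠ s in 𝓝 (0 : ℝ), b (d - 1) s = 0
  ne : ∃ j < d, b j 0 ≠ 0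

theorem AnalyticAt.comp_pow {a : ℝ → ℝ} (ha : AnalyticAt ℝ a 0) {N : ℕ} (hN : 0 < N) :
    AnalyticAt ℝ (fun s : ℝ => a (s ^ N)) 0 :=
  AnalyticAt.fun_comp (g := a) (f := fun s : ℝ => s ^ N) (by simpa [hN.ne'] using ha)
    (analyticAt_id.pow N)

theorem analyticAt_ramify {N : ℕ} : AnalyticAt ℝ (fun p : ℝ × ℝ => (p.1 ^ N, p.2)) 0 :=
  (analyticAt_fst.pow N).prod analyticAt_snd

theorem tendsto_ramify {N : ℕ} (hN : 0 < N) :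
    Tendsto (fun p : ℝ × ℝ => (p.1 ^ N, p.2)) (𝓝 0) (𝓝 0) := by
  have := (analyticAt_ramify (N := N)).continuousAt.tendsto
  simpa [hN.ne', Prod.mk_zero_zero] using this

theorem AnalyticAt.comp_of_tendsto {F : ℝ × ℝ → ℝ} {f : ℝ × ℝ → ℝ × ℝ} (hF : AnalyticAt ℝ F 0)
    (hf : AnalyticAt ℝ f 0) (h0 : f 0 = 0) : AnalyticAt ℝ (fun p => F (f p)) 0 :=
  AnalyticAt.fun_comp (g := F) (by rwa [h0]) hf

theorem TaylorSnd.exists_newtonForm {F : ℝ × ℝ → ℝ} {d : ℕ} {a : ℕ → ℝ → ℝ} {U : ℝ × ℝ → ℝ}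
    (h : TaylorSnd F d a U) (hU : U 0 ≠ 0) (hsub : ∀ᶠ s in 𝓝 (0 : ℝ), a (d - 1) s = 0)
    (hne : ∃ j < d, ¬ ∀ᶠ s in 𝓝 (0 : ℝ), a j s = 0) :
    ∃ N > 0, ∃ k b U', NewtonForm k d b U' (fun p => F (p.1 ^ N, p.2)) := by
  have hex : ∀ j, ∃ (e : ℕ) (g : ℝ → ℝ), AnalyticAt ℝ g 0 ∧
      (∀ᶠ s in 𝓝 (0 : ℝ), a j s = s ^ e * g s) ∧
      ((∀ᶠ s in 𝓝 (0 : ℝ), a j s = 0) → g = 0) ∧ ((¬ ∀ᶠ s in 𝓝 (0 : ℝ), a j s = 0) → g 0 ≠ 0) := by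
    intro j
    by_cases hj : ∀ᶠ s in 𝓝 (0 : ℝ), a j s = 0
    · exact ⟨0, 0, analyticAt_const, by simpa using hj, fun _ => rfl, fun h => absurd hj h⟩
    · obtain ⟨e, g, hg, hg0, heq⟩ := ((h.coeff j).exists_eventuallyEq_pow_smul_nonzero_iff).2 hj
      exact ⟨e, g, hg, by simpa using heq, fun h => absurd h hj, fun _ => hg0⟩
  choose e g hg heq hz hnz using hex
  have hN := d.factorial_pos
  set N := d.factorial with hNdef
  classical
  set J : Finset ℕ := (Finset.range d).filter fun j => ¬ ∀ᶠ s in 𝓝 (0 : ℝ), a j s = 0 with hJ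
  have hmem : ∀ j, j ∈ J ↔ j < d ∧ ¬ ∀ᶠ s in 𝓝 (0 : ℝ), a j s = 0 := fun j => by simp [hJ]
  obtain ⟨j0, hj0, hmin⟩ := Finset.exists_min_image J (fun j => N * e j / (d - j))
    (by obtain ⟨j, hj⟩ := hne; exact ⟨j, (hmem j).2 hj⟩)
  set k := N * e j0 / (d - j0) with hk
  have hk0 : k * (d - j0) = N * e j0 := by
    refine Nat.div_mul_cancel (Dvd.dvd.mul_right (Nat.dvd_factorial ?_ (by omega)) _)
    have := ((hmem j0).1 hj0).1
    omega
  have hkj : ∀ j ∈ J, k * (d - j) ≤ N * e j := fun j hj =>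
    (Nat.mul_le_mul_right _ (hmin j hj)).trans (Nat.div_mul_le_self _ _)
  refine ⟨N, hN, k, fun j s => if j ∈ J then s ^ (N * e j - k * (d - j)) * g j (s ^ N) else 0,
    fun p => U (p.1 ^ N, p.2), fun j => ?_,
    h.rem.comp_of_tendsto analyticAt_ramify (by simp [hN.ne']),
      by simpa [hN.ne', Prod.mk_zero_zero] using hU, ?_, ?_,
    j0, ((hmem j0).1 hj0).1, ?_⟩
  · by_cases hj : j ∈ J
    · simp only [hj, if_true]
      exact (analyticAt_id.pow _).mul ((hg j).comp_pow hN)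
    · simp only [hj, if_false]
      exact analyticAt_const
  · have hall : ∀ᶠ p : ℝ × ℝ in 𝓝 0, ∀ j ∈ Finset.range d, a j (p.1 ^ N) =
      (p.1 ^ N) ^ e j * g j (p.1 ^ N) := by
      rw [Filter.eventually_all_finset]
      intro j _
      have : Tendsto (fun p : ℝ × ℝ => p.1 ^ N) (𝓝 0) (𝓝 0) := by
        exact (continuous_fst.tendsto (0 : ℝ × ℝ)).comp (tendsto_ramify hN)
      exact this.eventually (heq j)
    filter_upwards [(tendsto_ramify hN).eventually h.eq, hall] with p hp hp2
    rw [hp]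
    congr 1
    refine Finset.sum_congr rfl fun j hj => ?_
    rw [hp2 j hj]
    by_cases hjJ : j ∈ J
    · rw [if_pos hjJ, ← pow_mul, ← mul_assoc (p.1 ^ (k * (d - j))), ← pow_add,
        Nat.add_sub_cancel' (hkj j hjJ)]
    · have : ∀ᶠ s in 𝓝 (0 : ℝ), a j s = 0 := by
        by_contra hcon
        exact hjJ ((hmem j).2 ⟨Finset.mem_range.1 hj, hcon⟩)
      rw [if_neg hjJ, hz j this]
      simp
  · have : d - 1 ∉ J := fun hcon => ((hmem _).1 hcon).2 hsub
    simp [this]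
  · simp only [hj0, if_true]
    rw [hk0]
    simpa [hN.ne'] using hnz j0 ((hmem j0).1 hj0).2

theorem resolution_newton {P : (ℝ × ℝ → ℝ) → Prop}
    (congr : ∀ F F', F =ᶠ[𝓝 0] F' → P F → P F')
    (base : ∀ M d U, AnalyticAt ℝ U 0 → U 0 ≠ 0 → P (fun p => p.1 ^ M * p.2 ^ d * U p))
    (blowup : ∀ (F : ℝ × ℝ → ℝ) (m n : ℕ) (G : ℝ × ℝ → ℝ), AnalyticAt ℝ F 0 → AnalyticAt ℝ G 0 →
        G 0 ≠ 0 →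
      (∀ᶠ p : ℝ × ℝ in 𝓝 0, F (p.1 * p.2, p.2) = p.1 ^ m * p.2 ^ n * G p) →
      (∀ c, P (fun p => F (p.1, p.1 * (c + p.2)))) →
      (∀ᶠ c in 𝓝[≠] 0, P (fun p => F (p.1, c + p.2))) → P F)
    {d : ℕ} (IH : ∀ d' < d, ∀ M F', HasOrdSnd F' d' → P (fun p => p.1 ^ M * F' p))
    (k M : ℕ) {b U F'} (h : NewtonForm k d b U F') : P (fun p => p.1 ^ M * F' p) := by
  have hd : 0 < d := by obtain ⟨j, hj, -⟩ := h.ne; omega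
  have hF'a : ∀ {k b U F'}, NewtonForm k d b U F' → AnalyticAt ℝ F' 0 := by
    intro k b U F' h
    refine AnalyticAt.congr ?_ (EventuallyEq.symm h.eq)
    refine AnalyticAt.fun_add (Finset.analyticAt_fun_sum _ fun j _ => ?_)
      ((analyticAt_snd.pow _).mul h.rem)
    exact ((analyticAt_fst.pow _).mul (h.coeff j).comp_fst).mul (analyticAt_snd.pow _)
  have hF's : ∀ {k b U F'}, NewtonForm k d b U F' → ∀ᶠ y in 𝓝 (0 : ℝ), F' (0, y) =
      ∑ j ∈ Finset.range d, ((0 : ℝ) ^ (k * (d - j)) * b j 0) * y ^ j + y ^ d * U (0, y) := by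
    intro k b U F' h
    exact eventually_zero_snd h.eq
  induction k generalizing M b U F' with
  | zero =>
    obtain ⟨d', hd', ho⟩ := (hF'a h).exists_hasOrdSnd_lt (q := fun j => b j 0)
      h.rem.comp_zero_snd.continuousAt (by simpa using hF's h) h.ne
    exact IH d' hd' M F' ho
  | succ k ih =>
    have hF := hF'a h
    have hFM : AnalyticAt ℝ (fun p : ℝ × ℝ => p.1 ^ M * F' p) 0 := (analyticAt_fst.pow _).mul hF
    have hBa : ∀ c, AnalyticAt ℝ (fun p : ℝ × ℝ => (p.1, p.1 * (c + p.2))) 0 := fun c =>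
      analyticAt_fst.prod (analyticAt_fst.mul (analyticAt_const.add analyticAt_snd))
    have hB : ∀ c, Tendsto (fun p : ℝ × ℝ => (p.1, p.1 * (c + p.2))) (𝓝 0) (𝓝 0) := fun c => by
      simpa [Prod.mk_zero_zero] using (hBa c).continuousAt.tendsto
    have hGeq : ∀ c, ∀ᶠ p in 𝓝 (0 : ℝ × ℝ), F' (p.1, p.1 * (c + p.2)) = p.1 ^ d *
        (∑ j ∈ Finset.range d, p.1 ^ (k * (d - j)) * b j p.1 * (c + p.2) ^ j +
          (c + p.2) ^ d * U (p.1, p.1 * (c + p.2))) := fun c => by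
      filter_upwards [(hB c).eventually h.eq] with p hp
      rw [hp, mul_add (p.1 ^ d), Finset.mul_sum]
      congr 1
      · refine Finset.sum_congr rfl fun j hj => ?_
        have hj' := Finset.mem_range.1 hj
        rw [mul_pow]
        have : p.1 ^ d = p.1 ^ (d - j) * p.1 ^ j := by rw [← pow_add]; congr 1; omega
        rw [this, Nat.succ_mul, pow_add]
        ring
      · rw [mul_pow]; ring
    have hUc : ∀ c, AnalyticAt ℝ (fun p : ℝ × ℝ => U (p.1, p.1 * (c + p.2))) 0 := fun c =>
      h.rem.comp_of_tendsto (hBa c) (by simp)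
    refine blowup _ M (M + d) (fun p => ∑ j ∈ Finset.range d, p.2 ^ (k * (d - j)) *
        p.1 ^ ((k + 1) * (d - j)) * b j (p.1 * p.2) + U (p.1 * p.2, p.2)) hFM ?_ ?_ ?_ ?_ ?_
    · have hs : AnalyticAt ℝ (fun p : ℝ × ℝ => (p.1 * p.2, p.2)) 0 :=
        (analyticAt_fst.mul analyticAt_snd).prod analyticAt_snd
      refine AnalyticAt.fun_add (Finset.analyticAt_fun_sum _ fun j _ => ?_)
        (h.rem.comp_of_tendsto hs (by simp))
      exact ((analyticAt_snd.pow _).mul (analyticAt_fst.pow _)).mul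
        ((h.coeff j).comp_fst.comp_of_tendsto hs (by simp))
    · rw [Finset.sum_eq_zero, zero_add]
      · simpa [Prod.mk_zero_zero] using h.rem_ne
      · intro j hj
        have hj' := Finset.mem_range.1 hj
        have : (k + 1) * (d - j) ≠ 0 := by
          refine Nat.mul_ne_zero (by omega) (by omega)
        simp [this]
    · have ht : Tendsto (fun p : ℝ × ℝ => (p.1 * p.2, p.2)) (𝓝 0) (𝓝 0) := by
        have : Continuous (fun p : ℝ × ℝ => (p.1 * p.2, p.2)) := by fun_prop
        simpa [Prod.mk_zero_zero] using this.tendsto 0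
      filter_upwards [ht.eventually h.eq] with p hp
      rw [hp, mul_add, mul_add, mul_pow]
      congr 1
      · rw [Finset.mul_sum, Finset.mul_sum]
        refine Finset.sum_congr rfl fun j hj => ?_
        have hj' := Finset.mem_range.1 hj
        have : p.2 ^ (M + d) = p.2 ^ M * (p.2 ^ (d - j) * p.2 ^ j) := by
          rw [← pow_add, ← pow_add]; congr 1; omega
        rw [this, Nat.succ_mul, mul_pow, pow_add, pow_add]
        ring
      · ring
    · intro c
      by_cases hc : c = 0
      · have hn : NewtonForm k d b (fun p => U (p.1, p.1 * (c + p.2)))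
            (fun p => ∑ j ∈ Finset.range d, p.1 ^ (k * (d - j)) * b j p.1 * (c + p.2) ^ j +
          (c + p.2) ^ d * U (p.1, p.1 * (c + p.2))) :=
          ⟨h.coeff, hUc c, by simpa [Prod.mk_zero_zero] using h.rem_ne, by simp [hc], h.sub, h.ne⟩
        refine congr _ _ ?_ (ih (M + d) hn)
        filter_upwards [hGeq c] with p hp
        rw [hp]
        ring
      · obtain ⟨r, hr, hr0⟩ := exists_taylor_coeff_ne_zero (c := c) (u := U 0) hd
          (q := fun j => (0 : ℝ) ^ (k * (d - j)) * b j 0)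
          (by simp [h.sub.self_of_nhds]) hc h.rem_ne
        have hG : AnalyticAt ℝ (fun p : ℝ × ℝ => ∑ j ∈ Finset.range d,
            p.1 ^ (k * (d - j)) * b j p.1 * (c + p.2) ^ j +
            (c + p.2) ^ d * U (p.1, p.1 * (c + p.2))) 0 := by
          refine AnalyticAt.fun_add (Finset.analyticAt_fun_sum _ fun j _ => ?_)
            (((analyticAt_const.add analyticAt_snd).pow _).mul (hUc c))
          exact ((analyticAt_fst.pow _).mul (h.coeff j).comp_fst).mul
            ((analyticAt_const.add analyticAt_snd).pow _)
        obtain ⟨d', hd', ho⟩ := hG.exists_hasOrdSnd_lt (d := d) (q := r) (u := fun _ => U 0)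
          continuousAt_const (by
            refine Eventually.of_forall fun y => ?_
            rw [← hr y]
            simp [Prod.mk_zero_zero]) hr0
        refine congr _ _ ?_ (IH d' hd' (M + d) _ ho)
        filter_upwards [hGeq c] with p hp
        rw [hp]
        ring
    · have hcz : ∀ᶠ c in 𝓝[≠] (0 : ℝ), F' (0, c) ≠ 0 := by
        have hs := hF's h
        filter_upwards [hs.filter_mono nhdsWithin_le_nhds, self_mem_nhdsWithin,
          (h.rem.comp_zero_snd.continuousAt.eventually_ne
            (by exact h.rem_ne)).filter_mono nhdsWithin_le_nhds] with c hc hc0 hcU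
        rw [hc, Finset.sum_eq_zero, zero_add]
        · exact mul_ne_zero (pow_ne_zero _ hc0) hcU
        · intro j hj
          have hj' := Finset.mem_range.1 hj
          have : (k + 1) * (d - j) ≠ 0 := Nat.mul_ne_zero (by omega) (by omega)
          simp [this]
      have hca : ∀ᶠ c in 𝓝 (0 : ℝ), AnalyticAt ℝ F' (0, c) :=
        eventually_zero_snd hF.eventually_analyticAt
      filter_upwards [hcz, hca.filter_mono nhdsWithin_le_nhds] with c hc hc2
      have hU : AnalyticAt ℝ (fun p : ℝ × ℝ => F' (p.1, c + p.2)) 0 :=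
        AnalyticAt.fun_comp (g := F') (f := fun p : ℝ × ℝ => (p.1, c + p.2)) (by simpa using hc2)
          (analyticAt_fst.prod (analyticAt_const.add analyticAt_snd))
      simpa using base M 0 _ hU (by simpa using hc)

/-- Induction principle for germs of analytic functions of two variables, following a resolution
of singularities by shears, ramifications and blow-ups. -/
theorem resolution_induction {P : (ℝ × ℝ → ℝ) → Prop}
    (congr : ∀ F F', F =ᶠ[𝓝 0] F' → P F → P F')
    (base : ∀ M d U, AnalyticAt ℝ U 0 → U 0 ≠ 0 → P (fun p => p.1 ^ M * p.2 ^ d * U p))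
    (shift : ∀ F φ, AnalyticAt ℝ F 0 → AnalyticAt ℝ φ 0 → φ 0 = 0 →
      P (fun p => F (p.1, φ p.1 + p.2)) → P F)
    (ramify : ∀ F N, AnalyticAt ℝ F 0 → 0 < N → P (fun p => F (p.1 ^ N, p.2)) → P F)
    (blowup : ∀ (F : ℝ × ℝ → ℝ) (m n : ℕ) (G : ℝ × ℝ → ℝ), AnalyticAt ℝ F 0 → AnalyticAt ℝ G 0 →
        G 0 ≠ 0 →
      (∀ᶠ p : ℝ × ℝ in 𝓝 0, F (p.1 * p.2, p.2) = p.1 ^ m * p.2 ^ n * G p) →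
      (∀ c, P (fun p => F (p.1, p.1 * (c + p.2)))) →
      (∀ᶠ c in 𝓝[≠] 0, P (fun p => F (p.1, c + p.2))) → P F)
    (F : ℝ × ℝ → ℝ) (hF : AnalyticAt ℝ F 0) (hF0 : ¬ ∀ᶠ p in 𝓝 (0 : ℝ × ℝ), F p = 0) : P F := by
  have main : ∀ d M F', HasOrdSnd F' d → P (fun p => p.1 ^ M * F' p) := by
    intro d
    induction d using Nat.strong_induction_on with
    | _ d IH =>
    intro M F' h
    have hbase : ∀ {F a U}, TaylorSnd F d a U → U 0 ≠ 0 → (∀ j < d, ∀ᶠ s in 𝓝 (0 : ℝ), a j s = 0) →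
        P (fun p => p.1 ^ M * F p) := by
      intro F a U h hU ha
      refine congr _ _ ?_ (base M d U h.rem hU)
      have : ∀ᶠ p : ℝ × ℝ in 𝓝 0, ∀ j ∈ Finset.range d, a j p.1 = 0 := by
        rw [Filter.eventually_all_finset]
        intro j hj
        exact (continuous_fst.tendsto (0 : ℝ × ℝ)).eventually (ha j (Finset.mem_range.1 hj))
      filter_upwards [h.eq, this] with p hp hp2
      rw [hp, Finset.sum_eq_zero fun j hj => by rw [hp2 j hj, zero_mul], zero_add, mul_assoc]
    obtain ⟨a, U, h, ha, hU⟩ := h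
    rcases Nat.eq_zero_or_pos d with rfl | hd
    · exact hbase h hU fun j hj => by omega
    obtain ⟨e, rfl⟩ : ∃ e, d = e + 1 := ⟨d - 1, by omega⟩
    obtain ⟨φ, hφ, hφ0, a', U', h', ha', hU', hsub⟩ := h.exists_shear ha hU
    refine shift _ φ ((analyticAt_fst.pow _).mul h.analyticAt) hφ hφ0 ?_
    change P (fun p => p.1 ^ M * (fun p => F' (p.1, φ p.1 + p.2)) p)
    by_cases hz : ∀ j < e + 1, ∀ᶠ s in 𝓝 (0 : ℝ), a' j s = 0
    · exact hbase h' hU' hz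
    push Not at hz
    obtain ⟨N, hN, k, b, U'', hn⟩ := h'.exists_newtonForm hU' hsub (by simpa using hz)
    refine ramify _ N ((analyticAt_fst.pow _).mul h'.analyticAt) hN ?_
    have := resolution_newton congr base blowup IH k (N * M) hn
    simpa only [pow_mul] using this
  obtain ⟨M, F₁, hF₁, heq, hF₁0⟩ := hF.exists_eq_fst_pow_mul hF0
  obtain ⟨d, hd⟩ := hF₁.exists_hasOrdSnd hF₁0
  exact congr _ _ (EventuallyEq.symm heq) (main d M F₁ hd)

end

section

open Filter Topology MeasureTheory

/-- Germs at `0⁺` of functions of the form `A (h ^ (1/q)) + B (h ^ (1/q)) * log h` with `A` and `B`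
analytic at the origin. -/
def IsLogPuiseux (f : ℝ → ℝ) : Prop :=
  ∃ q : ℕ, 0 < q ∧ ∃ A B : ℝ → ℝ, AnalyticAt ℝ A 0 ∧ AnalyticAt ℝ B 0 ∧
    ∀ᶠ h in 𝓝[>] (0 : ℝ), f h = A (h ^ (1 / (q : ℝ))) + B (h ^ (1 / (q : ℝ))) * Real.log h

namespace IsLogPuiseux

theorem congr {f g : ℝ → ℝ} (hf : IsLogPuiseux f) (h : f =ᶠ[𝓝[>] 0] g) : IsLogPuiseux g := by
  obtain ⟨q, hq, A, B, hA, hB, hfe⟩ := hf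
  refine ⟨q, hq, A, B, hA, hB, ?_⟩
  filter_upwards [hfe, h] with x h1 h2
  rw [← h2, h1]

theorem of_analytic {A : ℝ → ℝ} (hA : AnalyticAt ℝ A 0) {q : ℕ} (hq : 0 < q) :
    IsLogPuiseux fun h => A (h ^ (1 / (q : ℝ))) :=
  ⟨q, hq, A, 0, hA, analyticAt_const, by simp⟩

theorem of_analytic_log {A : ℝ → ℝ} (hA : AnalyticAt ℝ A 0) {q : ℕ} (hq : 0 < q) :
    IsLogPuiseux fun h => A (h ^ (1 / (q : ℝ))) * Real.log h :=
  ⟨q, hq, 0, A, analyticAt_const, hA, by simp⟩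

theorem zero : IsLogPuiseux fun _ => 0 :=
  of_analytic (A := fun _ => 0) analyticAt_const one_pos

theorem refine_denominator {f : ℝ → ℝ} {q : ℕ} {A B : ℝ → ℝ} (hA : AnalyticAt ℝ A 0)
    (hB : AnalyticAt ℝ B 0)
    (hf : ∀ᶠ h in 𝓝[>] (0 : ℝ), f h = A (h ^ (1 / (q : ℝ))) + B (h ^ (1 / (q : ℝ))) * Real.log h)
    {r : ℕ} (hr : 0 < r) :
    ∃ A' B' : ℝ → ℝ, AnalyticAt ℝ A' 0 ∧ AnalyticAt ℝ B' 0 ∧ ∀ᶠ h in 𝓝[>] (0 : ℝ),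
      f h = A' (h ^ (1 / ((q * r : ℕ) : ℝ))) + B' (h ^ (1 / ((q * r : ℕ) : ℝ))) * Real.log h := by
  refine ⟨_, _, hA.comp_pow hr, hB.comp_pow hr, ?_⟩
  filter_upwards [hf, self_mem_nhdsWithin] with h h1 h2
  have : (h ^ (1 / ((q * r : ℕ) : ℝ))) ^ r = h ^ (1 / (q : ℝ)) := by
    rw [← Real.rpow_natCast, ← Real.rpow_mul (le_of_lt h2)]
    congr 1
    have : (r : ℝ) ≠ 0 := by positivity
    push_cast
    field_simp
  rw [this, h1]

theorem add {f g : ℝ → ℝ} (hf : IsLogPuiseux f) (hg : IsLogPuiseux g) :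
    IsLogPuiseux fun h => f h + g h := by
  obtain ⟨q, hq, A, B, hA, hB, hf⟩ := hf
  obtain ⟨r, hr, A', B', hA', hB', hg⟩ := hg
  obtain ⟨A₁, B₁, hA₁, hB₁, h1⟩ := refine_denominator hA hB hf hr
  obtain ⟨A₂, B₂, hA₂, hB₂, h2⟩ := refine_denominator hA' hB' hg hq
  refine ⟨q * r, Nat.mul_pos hq hr, A₁ + A₂, B₁ + B₂, hA₁.add hA₂, hB₁.add hB₂, ?_⟩
  filter_upwards [h1, h2] with h h1 h2
  rw [h1, h2, mul_comm r q]
  simp only [Pi.add_apply]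
  ring

theorem const_mul {f : ℝ → ℝ} (c : ℝ) (hf : IsLogPuiseux f) : IsLogPuiseux fun h => c * f h := by
  obtain ⟨q, hq, A, B, hA, hB, hf⟩ := hf
  refine ⟨q, hq, _, _, (analyticAt_const (v := c)).mul hA, (analyticAt_const (v := c)).mul hB, ?_⟩
  filter_upwards [hf] with h h1
  rw [h1]
  simp only [Pi.mul_apply]
  ring

theorem neg {f : ℝ → ℝ} (hf : IsLogPuiseux f) : IsLogPuiseux fun h => -f h := by
  simpa using hf.const_mul (-1)

end IsLogPuiseux

/-- The function `J` cut off outside the part of `G` where `0 < |F| < h`. -/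
noncomputable def kern (F : ℝ × ℝ → ℝ) (G : Set (ℝ × ℝ)) (J : ℝ × ℝ → ℝ) (h : ℝ) : ℝ × ℝ → ℝ :=
  {p | p ∈ G ∧ F p ≠ 0 ∧ |F p| < h}.indicator J

/-- The integral of `kern F G J h` over `0 < s < ε` and `y` between `α s` and `β s`. -/
noncomputable def secInt (F : ℝ × ℝ → ℝ) (G : Set (ℝ × ℝ)) (J : ℝ × ℝ → ℝ) (α β : ℝ → ℝ)
    (ε h : ℝ) : ℝ :=
  ∫ s in (0 : ℝ)..ε, ∫ y in α s..β s, kern F G J h (s, y)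

/-- The sector integrals are log-Puiseux for all sufficiently small radii. -/
def SecLP (F : ℝ × ℝ → ℝ) (G : Set (ℝ × ℝ)) (J : ℝ × ℝ → ℝ) (α β : ℝ → ℝ) : Prop :=
  ∀ᶠ ε in 𝓝[>] (0 : ℝ), IsLogPuiseux (secInt F G J α β ε)

/-- A set which is open and closed in `{F ≠ 0}`, near the origin in the right half-plane. -/
def LocConst (F : ℝ × ℝ → ℝ) (G : Set (ℝ × ℝ)) : Prop :=
  ∀ᶠ p in 𝓝 (0 : ℝ × ℝ), 0 < p.1 → F p ≠ 0 → ∀ᶠ q in 𝓝 p, (q ∈ G ↔ p ∈ G)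

/-- Sector integrands are measurable and bounded on the box `(0, ε) × (-δ, δ)`. -/
structure NiceBox (F : ℝ × ℝ → ℝ) (G : Set (ℝ × ℝ)) (J : ℝ × ℝ → ℝ) (ε δ C : ℝ) : Prop where
  meas : ∀ h, Measurable ((Set.Ioo 0 ε ×ˢ Set.Ioo (-δ) δ).indicator (kern F G J h))
  bound : ∀ p ∈ Set.Ioo 0 ε ×ˢ Set.Ioo (-δ) δ, |J p| ≤ C

theorem abs_kern_le (F : ℝ × ℝ → ℝ) (G : Set (ℝ × ℝ)) (J : ℝ × ℝ → ℝ) (h : ℝ) (p : ℝ × ℝ) :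
    |kern F G J h p| ≤ |J p| := by
  classical
  rw [kern, Set.indicator_apply]
  split_ifs
  · exact le_rfl
  · simp

theorem exists_box_of_eventually {p : ℝ × ℝ → Prop} (h : ∀ᶠ q in 𝓝 (0 : ℝ × ℝ), p q) :
    ∃ δ > 0, ∀ x y, |x| < δ → |y| < δ → p (x, y) := by
  obtain ⟨δ, hδ, hB⟩ := Metric.eventually_nhds_iff_ball.1 h
  refine ⟨δ, hδ, fun x y hx hy => hB _ ?_⟩
  rw [mem_ball_zero_iff, Prod.norm_def, max_lt_iff]
  exact ⟨hx, hy⟩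

theorem NiceBox.of_open {F : ℝ × ℝ → ℝ} {G : Set (ℝ × ℝ)} {J : ℝ × ℝ → ℝ} {ε δ C : ℝ}
    (hF : ∀ p ∈ Set.Ioo 0 ε ×ˢ Set.Ioo (-δ) δ, ContinuousAt F p)
    (hJ : ∀ p ∈ Set.Ioo 0 ε ×ˢ Set.Ioo (-δ) δ, ContinuousAt J p)
    (hG : ∀ p ∈ Set.Ioo 0 ε ×ˢ Set.Ioo (-δ) δ, F p ≠ 0 → ∀ᶠ q in 𝓝 p, (q ∈ G ↔ p ∈ G))
    (hC : ∀ p ∈ Set.Ioo 0 ε ×ˢ Set.Ioo (-δ) δ, |J p| ≤ C) : NiceBox F G J ε δ C := by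
  classical
  refine ⟨fun h => ?_, hC⟩
  set B : Set (ℝ × ℝ) := Set.Ioo 0 ε ×ˢ Set.Ioo (-δ) δ with hB
  have hBo : IsOpen B := isOpen_Ioo.prod isOpen_Ioo
  rw [kern, Set.indicator_indicator, ← Set.piecewise_eq_indicator]
  have hW : IsOpen (B ∩ {p | p ∈ G ∧ F p ≠ 0 ∧ |F p| < h}) := by
    rw [isOpen_iff_mem_nhds]
    rintro p ⟨hpB, hpG, hpF, hph⟩
    filter_upwards [hBo.mem_nhds hpB, hG p hpB hpF, (hF p hpB).eventually_ne hpF,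
      (hF p hpB).abs.eventually_lt continuousAt_const hph] with q h1 h2 h3 h4
    exact ⟨h1, h2.2 hpG, h3, h4⟩
  exact ContinuousOn.measurable_piecewise
    (fun p hp => (hJ p hp.1).continuousWithinAt) continuousOn_const hW.measurableSet

theorem exists_niceBox {F : ℝ × ℝ → ℝ} {G : Set (ℝ × ℝ)} {J : ℝ × ℝ → ℝ}
    (hF : AnalyticAt ℝ F 0) (hJ : AnalyticAt ℝ J 0) (hG : LocConst F G) :
    ∃ δ > 0, ∃ C, ∀ ε' δ', ε' ≤ δ → δ' ≤ δ → NiceBox F G J ε' δ' C := by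
  have hb : ∀ᶠ p in 𝓝 (0 : ℝ × ℝ), |J p| < |J 0| + 1 :=
    hJ.continuousAt.abs.eventually_lt continuousAt_const (by linarith)
  obtain ⟨δ, hδ, h⟩ := exists_box_of_eventually
    ((hF.eventually_analyticAt.and hJ.eventually_analyticAt).and (hb.and hG))
  refine ⟨δ, hδ, |J 0| + 1, fun ε' δ' hε' hδ' => ?_⟩
  have key : ∀ p ∈ Set.Ioo 0 ε' ×ˢ Set.Ioo (-δ') δ', (AnalyticAt ℝ F p ∧ AnalyticAt ℝ J p) ∧
      (|J p| < |J 0| + 1 ∧ (0 < p.1 → F p ≠ 0 → ∀ᶠ q in 𝓝 p, (q ∈ G ↔ p ∈ G))) := by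
    rintro ⟨x, y⟩ ⟨⟨h1, h2⟩, h3, h4⟩
    refine h x y ?_ ?_
    · rw [abs_lt]; constructor <;> simp only at * <;> linarith
    · rw [abs_lt]; constructor <;> simp only at * <;> linarith
  exact NiceBox.of_open (fun p hp => (key p hp).1.1.continuousAt)
    (fun p hp => (key p hp).1.2.continuousAt) (fun p hp => (key p hp).2.2 hp.1.1)
    (fun p hp => (key p hp).2.1.le)

theorem measurable_intervalIntegral {f : ℝ × ℝ → ℝ} (hf : Measurable f) {α β : ℝ → ℝ}
    (hα : Measurable α) (hβ : Measurable β) : Measurable fun s => ∫ y in α s..β s, f (s, y) := by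
  have key : ∀ {α β : ℝ → ℝ}, Measurable α → Measurable β →
      Measurable fun s => ∫ y in Set.Ioc (α s) (β s), f (s, y) := by
    intro α β hα hβ
    have hm : MeasurableSet {p : ℝ × ℝ | α p.1 < p.2 ∧ p.2 ≤ β p.1} :=
      (measurableSet_lt (hα.comp measurable_fst) measurable_snd).inter
        (measurableSet_le measurable_snd (hβ.comp measurable_fst))
    have h1 := ((hf.indicator hm).stronglyMeasurable.integral_prod_right' (ν := volume)).measurable
    convert h1 using 2 with s
    rw [← integral_indicator measurableSet_Ioc]
    rfl
  exact (key hα hβ).sub (key hβ hα)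

section NiceBox

variable {F : ℝ × ℝ → ℝ} {G : Set (ℝ × ℝ)} {J : ℝ × ℝ → ℝ} {ε δ C : ℝ}

theorem NiceBox.measurable_section (hN : NiceBox F G J ε δ C) (h : ℝ) {s : ℝ}
    (hs : s ∈ Set.Ioo 0 ε) :
    Measurable ((Set.Ioo (-δ) δ).indicator fun y => kern F G J h (s, y)) := by
  have h1 := (hN.meas h).comp (measurable_prodMk_left (x := s))
  convert h1 using 1
  funext y
  simp only [Function.comp, Set.indicator_apply, Set.mem_prod]
  simp only [hs, true_and]

theorem NiceBox.intervalIntegrable (hN : NiceBox F G J ε δ C) (h : ℝ) {s : ℝ} (hs : s ∈ Set.Ioo 0 ε)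
    {a b : ℝ} (ha : a ∈ Set.Ioo (-δ) δ) (hb : b ∈ Set.Ioo (-δ) δ) :
    IntervalIntegrable (fun y => kern F G J h (s, y)) volume a b := by
  have hsub : Set.uIoc a b ⊆ Set.Ioo (-δ) δ := fun y hy =>
    (Set.ordConnected_Ioo.uIcc_subset ha hb) (Set.uIoc_subset_uIcc hy)
  have h1 : IntervalIntegrable ((Set.Ioo (-δ) δ).indicator fun y => kern F G J h (s, y)) volume a
      b := by
    refine (intervalIntegrable_const (c := |C|)).mono_fun
      (hN.measurable_section h hs).aestronglyMeasurable (ae_of_all _ fun y => ?_)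
    show ‖_‖ ≤ ‖|C|‖
    rw [Real.norm_eq_abs, Real.norm_eq_abs, abs_abs, Set.indicator_apply]
    split_ifs with hy
    · exact (abs_kern_le ..).trans ((hN.bound _ ⟨hs, hy⟩).trans (le_abs_self C))
    · simp
  refine h1.congr fun y hy => ?_
  rw [Set.indicator_of_mem (hsub hy)]

theorem NiceBox.outer_intervalIntegrable (hN : NiceBox F G J ε δ C) (h : ℝ) {α β : ℝ → ℝ}
    (hα : ContinuousOn α (Set.Ioo 0 ε)) (hβ : ContinuousOn β (Set.Ioo 0 ε))
    (hα' : ∀ s ∈ Set.Ioo 0 ε, α s ∈ Set.Ioo (-δ) δ) (hβ' : ∀ s ∈ Set.Ioo 0 ε, β s ∈ Set.Ioo (-δ) δ)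
    {a b : ℝ} (ha : 0 ≤ a) (hb : 0 ≤ b) (ha' : a < ε) (hb' : b < ε) :
    IntervalIntegrable (fun s => ∫ y in α s..β s, kern F G J h (s, y)) volume a b := by
  classical
  set α₁ : ℝ → ℝ := (Set.Ioo 0 ε).piecewise α 0
  set β₁ : ℝ → ℝ := (Set.Ioo 0 ε).piecewise β 0
  have hm1 : Measurable α₁ := hα.measurable_piecewise continuousOn_const measurableSet_Ioo
  have hm2 : Measurable β₁ := hβ.measurable_piecewise continuousOn_const measurableSet_Ioo
  have hmeas := measurable_intervalIntegral (hN.meas h) hm1 hm2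
  set g := fun s => ∫ y in α₁ s..β₁ s,
    (Set.Ioo 0 ε ×ˢ Set.Ioo (-δ) δ).indicator (kern F G J h) (s, y)
  have hsub : Set.uIoc a b ⊆ Set.Ioo 0 ε := fun s hs =>
    ⟨lt_of_le_of_lt (le_min ha hb) hs.1, lt_of_le_of_lt hs.2 (max_lt ha' hb')⟩
  have hg : ∀ s ∈ Set.Ioo 0 ε, g s = ∫ y in α s..β s, kern F G J h (s, y) := fun s hs => by
    simp only [g, α₁, β₁, Set.piecewise_eq_of_mem _ _ _ hs]
    refine intervalIntegral.integral_congr fun y hy => ?_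
    rw [Set.indicator_of_mem]
    exact ⟨hs, Set.ordConnected_Ioo.uIcc_subset (hα' s hs) (hβ' s hs) hy⟩
  have h1 : IntervalIntegrable g volume a b := by
    rw [intervalIntegrable_iff]
    refine Measure.integrableOn_of_bounded (M := |C| * (2 * δ)) (by simp)
      hmeas.aestronglyMeasurable ?_
    refine (ae_restrict_iff' measurableSet_uIoc).2 (ae_of_all _ fun s hs => ?_)
    have hs := hsub hs
    rw [hg s hs]
    refine (intervalIntegral.norm_integral_le_of_norm_le_const (C := |C|) fun y hy => ?_).trans ?_
    · exact (abs_kern_le ..).trans ((hN.bound _ ⟨hs, Set.ordConnected_Ioo.uIcc_subset (hα' s hs)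
        (hβ' s hs) (Set.uIoc_subset_uIcc hy)⟩).trans (le_abs_self C))
    · gcongr
      have := hα' s hs
      have := hβ' s hs
      simp only [Set.mem_Ioo] at *
      rw [abs_le]
      constructor <;> linarith
  exact h1.congr fun s hs => hg s (hsub hs)

end NiceBox

theorem secInt_symm (F G J α β ε h) : secInt F G J β α ε h = -secInt F G J α β ε h := by
  simp only [secInt]
  rw [← intervalIntegral.integral_neg]
  refine intervalIntegral.integral_congr fun s _ => ?_
  exact intervalIntegral.integral_symm _ _

theorem SecLP.symm {F G J α β} (h : SecLP F G J α β) : SecLP F G J β α := by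
  refine h.mono fun ε hε => ?_
  have := hε.neg
  refine this.congr (Eventually.of_forall fun h => ?_)
  exact (secInt_symm F G J α β ε h).symm

theorem SecLP.refl (F G J α) : SecLP F G J α α := by
  refine Eventually.of_forall fun ε => IsLogPuiseux.zero.congr (Eventually.of_forall fun h => ?_)
  simp [secInt]

/-- Germs of curves with values in the open interval `(-δ, δ)`. -/
def CurveIn (δ : ℝ) (α : ℝ → ℝ) : Prop := AnalyticAt ℝ α 0 ∧ |α 0| < δ

theorem CurveIn.eventually {δ : ℝ} {α : ℝ → ℝ} (h : CurveIn δ α) :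
    ∀ᶠ ε in 𝓝[>] (0 : ℝ), ContinuousOn α (Set.Ioo 0 ε) ∧ ∀ s ∈ Set.Ioo 0 ε, α s ∈ Set.Ioo (-δ) δ := by
  have h1 : ∀ᶠ s in 𝓝 (0 : ℝ), |α s| < δ :=
    h.1.continuousAt.abs.eventually_lt continuousAt_const h.2
  obtain ⟨η, hη, hB⟩ := Metric.eventually_nhds_iff_ball.1 (h1.and h.1.eventually_analyticAt)
  filter_upwards [Ioo_mem_nhdsGT hη] with ε hε
  have hm : ∀ s ∈ Set.Ioo 0 ε, s ∈ Metric.ball (0 : ℝ) η := fun s hs => by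
    rw [Metric.mem_ball, Real.dist_0_eq_abs, abs_of_pos hs.1]
    exact hs.2.trans hε.2
  exact ⟨fun s hs => (hB s (hm s hs)).2.continuousAt.continuousWithinAt,
    fun s hs => abs_lt.1 (hB s (hm s hs)).1⟩

theorem SecLP.trans_of_niceBox {F G J α β γ} {ε₁ δ C : ℝ} (nb : NiceBox F G J ε₁ δ C) (hε₁ : 0 < ε₁)
    (hα : ContinuousOn α (Set.Ioo 0 ε₁) ∧ ∀ s ∈ Set.Ioo 0 ε₁, α s ∈ Set.Ioo (-δ) δ)
    (hβ : ContinuousOn β (Set.Ioo 0 ε₁) ∧ ∀ s ∈ Set.Ioo 0 ε₁, β s ∈ Set.Ioo (-δ) δ)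
    (hγ : ContinuousOn γ (Set.Ioo 0 ε₁) ∧ ∀ s ∈ Set.Ioo 0 ε₁, γ s ∈ Set.Ioo (-δ) δ)
    (h1 : SecLP F G J α β) (h2 : SecLP F G J β γ) : SecLP F G J α γ := by
  obtain ⟨cα, mα⟩ := hα
  obtain ⟨cβ, mβ⟩ := hβ
  obtain ⟨cγ, mγ⟩ := hγ
  filter_upwards [h1, h2, Ioo_mem_nhdsGT hε₁] with ε e1 e2 hε
  refine (e1.add e2).congr (Eventually.of_forall fun h => ?_)
  simp only [secInt]
  rw [← intervalIntegral.integral_add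
    (nb.outer_intervalIntegrable h cα cβ mα mβ le_rfl hε.1.le hε₁ hε.2)
    (nb.outer_intervalIntegrable h cβ cγ mβ mγ le_rfl hε.1.le hε₁ hε.2)]
  refine intervalIntegral.integral_congr_ae ?_
  refine ae_of_all _ fun s hs => ?_
  rw [Set.uIoc_of_le hε.1.le] at hs
  have hs' : s ∈ Set.Ioo 0 ε₁ := ⟨hs.1, hs.2.trans_lt hε.2⟩
  exact intervalIntegral.integral_add_adjacent_intervals
    (nb.intervalIntegrable h hs' (mα s hs') (mβ s hs'))
        (nb.intervalIntegrable h hs' (mβ s hs') (mγ s hs'))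

theorem SecLP.exists_trans {F G J} (hF : AnalyticAt ℝ F 0) (hJ : AnalyticAt ℝ J 0)
    (hG : LocConst F G) :
    ∃ δ > 0, ∀ α β γ, CurveIn δ α → CurveIn δ β → CurveIn δ γ →
      SecLP F G J α β → SecLP F G J β γ → SecLP F G J α γ := by
  obtain ⟨δ, hδ, C, hN⟩ := exists_niceBox hF hJ hG
  refine ⟨δ, hδ, fun α β γ hα hβ hγ h1 h2 => ?_⟩
  obtain ⟨ε₁, hε₁⟩ := ((hα.eventually.and (hβ.eventually.and hγ.eventually)).and
    (Ioo_mem_nhdsGT hδ)).exists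
  exact h1.trans_of_niceBox (hN ε₁ δ hε₁.2.2.le le_rfl) hε₁.2.1 hε₁.1.1 hε₁.1.2.1 hε₁.1.2.2 h2

end

section

open Filter Topology MeasureTheory

/-- Coefficients of the primitive of a double series in the second variable, divided by it. -/
noncomputable def primCoeff (c : ℕ × ℕ → ℝ) (n : ℕ × ℕ) : ℝ := c n / (n.2 + 1)

theorem summable_abs_of_le {c c' : ℕ × ℕ → ℝ} {R C : ℝ} (hR : 0 < R)
    (h : Summable fun n : ℕ × ℕ => |c n| * R ^ (n.1 + n.2)) (hc : ∀ n, |c' n| ≤ C * |c n|) :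
    Summable fun n : ℕ × ℕ => |c' n| * R ^ (n.1 + n.2) := by
  refine Summable.of_nonneg_of_le (fun n => by positivity) (fun n => ?_) (h.mul_left C)
  rw [← mul_assoc]
  exact mul_le_mul_of_nonneg_right (hc n) (by positivity)

theorem abs_primCoeff_le (c : ℕ × ℕ → ℝ) (n : ℕ × ℕ) : |primCoeff c n| ≤ 1 * |c n| := by
  rw [primCoeff, abs_div, one_mul, abs_of_pos (a := (n.2 : ℝ) + 1) (by positivity)]
  exact div_le_self (abs_nonneg _) (by linarith [(Nat.cast_nonneg n.2 : (0 : ℝ) ≤ n.2)])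

theorem hasDoubleSeries_of_abs_le {F : ℝ × ℝ → ℝ} {c c' : ℕ × ℕ → ℝ} {R C : ℝ}
    (h : HasDoubleSeries F c R) (hc : ∀ n, |c' n| ≤ C * |c n|) :
    HasDoubleSeries (doubleSum c') c' R :=
  hasDoubleSeries_doubleSum h.pos (summable_abs_of_le h.pos h.summable hc)

theorem abs_term_le {c : ℕ × ℕ → ℝ} {R s y : ℝ} (hs : |s| ≤ R) (hy : |y| ≤ R) (n : ℕ × ℕ) :
    |c n * s ^ n.1 * y ^ n.2| ≤ |c n| * R ^ (n.1 + n.2) := by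
  have hR : 0 ≤ R := (abs_nonneg s).trans hs
  rw [abs_mul, abs_mul, abs_pow, abs_pow, mul_assoc, pow_add]
  gcongr

theorem HasDoubleSeries.integral_snd {F : ℝ × ℝ → ℝ} {c R} (h : HasDoubleSeries F c R) {s t : ℝ}
    (hs : |s| ≤ R) (ht : |t| ≤ R) :
    ∫ y in (0 : ℝ)..t, F (s, y) = t * doubleSum (primCoeff c) (s, t) := by
  have hle : ∀ y ∈ Set.uIoc 0 t, |y| ≤ R := fun y hy => by
    have := Set.uIoc_subset_uIcc hy
    rcases Set.mem_uIcc.1 this with ⟨h1, h2⟩ | ⟨h1, h2⟩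
    · rw [abs_le] at ht ⊢; constructor <;> linarith
    · rw [abs_le] at ht ⊢; constructor <;> linarith
  have h1 : HasSum (fun n : ℕ × ℕ => ∫ y in (0 : ℝ)..t, c n * s ^ n.1 * y ^ n.2)
      (∫ y in (0 : ℝ)..t, F (s, y)) := by
    refine intervalIntegral.hasSum_integral_of_dominated_convergence
      (fun n _ => |c n| * R ^ (n.1 + n.2)) (fun n => by fun_prop) (fun n => ?_)
      (ae_of_all _ fun _ _ => h.summable) (by simp)
          (ae_of_all _ fun y hy => h.hasSum s y hs (hle y hy))
    exact ae_of_all _ fun y hy => abs_term_le hs (hle y hy) n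
  have h2 := ((hasDoubleSeries_of_abs_le h (abs_primCoeff_le c)).hasSum s t hs ht).mul_left t
  refine h1.unique (h2.congr_fun' fun n => ?_)
  rw [intervalIntegral.integral_const_mul, integral_pow, primCoeff]
  field_simp
  ring

theorem AnalyticAt.exists_primitive {κ : ℝ → ℝ} (hκ : AnalyticAt ℝ κ 0) :
    ∃ E : ℝ → ℝ, AnalyticAt ℝ E 0 ∧ ∀ᶠ x in 𝓝 (0 : ℝ), ∫ s in (0 : ℝ)..x, κ s = E x := by
  have hF : AnalyticAt ℝ (fun p : ℝ × ℝ => κ p.2) 0 :=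
    AnalyticAt.fun_comp (g := κ) (f := fun p : ℝ × ℝ => p.2) (by exact hκ) analyticAt_snd
  obtain ⟨c, R, h⟩ := hF.exists_hasDoubleSeries
  have hA := (hasDoubleSeries_of_abs_le h (abs_primCoeff_le c)).analyticAt
  refine ⟨fun x => x * doubleSum (primCoeff c) (0, x), analyticAt_id.mul ?_, ?_⟩
  · exact AnalyticAt.fun_comp (g := doubleSum (primCoeff c)) (f := fun x : ℝ => ((0 : ℝ), x))
      (by exact hA) (analyticAt_const.prod analyticAt_id)
  · have : ∀ᶠ x in 𝓝 (0 : ℝ), |x| < R := continuous_abs.continuousAt.eventually_lt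
      continuousAt_const (by simpa using h.pos)
    filter_upwards [this] with x hx
    exact h.integral_snd (s := 0) (by simpa using h.pos.le) hx.le

/-- The exponent attached to a monomial when integrating along a level curve `s ^ M * t ^ d = h`. -/
noncomputable def levelExp (M d : ℕ) (n : ℕ × ℕ) : ℝ := n.1 + 1 - M * (n.2 + 1) / d

/-- Coefficients of the non-logarithmic part of a level-curve integral. -/
noncomputable def levelCoeff (M d : ℕ) (c : ℕ × ℕ → ℝ) (n : ℕ × ℕ) : ℝ :=
  primCoeff c n / levelExp M d n

/-- Coefficients of the logarithmic part of a level-curve integral. -/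
noncomputable def levelLogCoeff (M d : ℕ) (c : ℕ × ℕ → ℝ) (n : ℕ × ℕ) : ℝ :=
  if levelExp M d n = 0 then primCoeff c n else 0

theorem abs_levelCoeff_le {M d : ℕ} (hd : 0 < d) (c : ℕ × ℕ → ℝ) (n : ℕ × ℕ) :
    |levelCoeff M d c n| ≤ d * |c n| := by
  have hd' : (0 : ℝ) < d := by exact_mod_cast hd
  by_cases h : levelExp M d n = 0
  · rw [levelCoeff, h, div_zero, abs_zero]
    positivity
  have h1 : levelExp M d n = ((d * (n.1 + 1) - M * (n.2 + 1) : ℤ) : ℝ) / d := by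
    rw [levelExp]
    push_cast
    field_simp
  have h2 : (d * (n.1 + 1) - M * (n.2 + 1) : ℤ) ≠ 0 := fun h0 => h (by rw [h1, h0]; simp)
  have h3 : (1 : ℝ) ≤ |((d * (n.1 + 1) - M * (n.2 + 1) : ℤ) : ℝ)| := by
    exact_mod_cast Int.one_le_abs h2
  have h4 : (1 : ℝ) / d ≤ |levelExp M d n| := by
    rw [h1, abs_div, abs_of_pos hd']
    gcongr
  rw [levelCoeff, abs_div, div_le_iff₀ (abs_pos.2 h)]
  have := abs_primCoeff_le c n
  calc |primCoeff c n| ≤ 1 * |c n| := this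
    _ = d * |c n| * (1 / d) := by field_simp
    _ ≤ d * |c n| * |levelExp M d n| := by gcongr

theorem abs_levelLogCoeff_le (M d : ℕ) (c : ℕ × ℕ → ℝ) (n : ℕ × ℕ) :
    |levelLogCoeff M d c n| ≤ 1 * |c n| := by
  rw [levelLogCoeff]
  split_ifs
  · exact abs_primCoeff_le c n
  · simp

/-- The second coordinate of the point over `s` of the level curve `s ^ M * t ^ d = h`. -/
noncomputable def levelT (M d : ℕ) (h s : ℝ) : ℝ := (h / s ^ M) ^ (1 / (d : ℝ))

theorem levelT_eq {M d : ℕ} {h s : ℝ} (hh : 0 < h) (hs : 0 < s) :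
    levelT M d h s = h ^ (1 / (d : ℝ)) * s ^ (-(M / d : ℝ)) := by
  rw [levelT, Real.div_rpow hh.le (by positivity), ← Real.rpow_natCast, ← Real.rpow_mul hs.le,
    Real.rpow_neg hs.le, div_eq_mul_inv]
  congr 3
  ring

theorem levelT_term {M d : ℕ} {h s : ℝ} (hh : 0 < h) (hs : 0 < s) (n : ℕ × ℕ) :
    s ^ n.1 * levelT M d h s ^ (n.2 + 1) =
      (h ^ (1 / (d : ℝ))) ^ (n.2 + 1) * s ^ (levelExp M d n - 1) := by
  rw [levelT_eq hh hs, mul_pow, ← Real.rpow_natCast (s ^ _), ← Real.rpow_mul hs.le, mul_left_comm,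
    ← Real.rpow_natCast s, ← Real.rpow_add hs, levelExp]
  congr 2
  push_cast
  ring

theorem levelT_zero_fst {d : ℕ} {h s : ℝ} : levelT 0 d h s = h ^ (1 / (d : ℝ)) := by
  simp [levelT]

theorem integral_levelT_term {M d : ℕ} {h a b : ℝ} (hh : 0 < h) (hb : 0 < b)
    (hM : 0 < a ∨ M = 0) (n : ℕ × ℕ) :
    ∫ s in a..b, s ^ n.1 * levelT M d h s ^ (n.2 + 1) =
      (b * (b ^ n.1 * levelT M d h b ^ (n.2 + 1)) - a * (a ^ n.1 * levelT M d h a ^ (n.2 + 1))) /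
          levelExp M d n
      + (if levelExp M d n = 0 then a * (a ^ n.1 * levelT M d h a ^ (n.2 + 1)) else 0) *
        (Real.log b - Real.log a) := by
  rcases hM with ha' | rfl
  · have hpos : ∀ s ∈ Set.uIcc a b, 0 < s := fun s hs => lt_of_lt_of_le (lt_min ha' hb) hs.1
    rw [intervalIntegral.integral_congr (g := fun s => (h ^ (1 / (d : ℝ))) ^ (n.2 + 1) *
      s ^ (levelExp M d n - 1)) fun s hs => levelT_term hh (hpos s hs) n,
      intervalIntegral.integral_const_mul, levelT_term hh hb, levelT_term hh ha']
    by_cases h0 : levelExp M d n = 0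
    · have h1 : ∫ s in a..b, s ^ ((0 : ℝ) - 1) = ∫ s in a..b, s⁻¹ :=
        intervalIntegral.integral_congr fun s hs => by
          simp only [zero_sub]
          rw [Real.rpow_neg_one]
      rw [h0, h1, integral_inv_of_pos ha' hb, Real.log_div hb.ne' ha'.ne', zero_sub]
      simp only [Real.rpow_neg_one]
      field_simp
      simp [mul_comm]
    · rw [integral_rpow (Or.inr ⟨fun h1 => h0 (by linarith), fun h0 => lt_irrefl _ (hpos 0 h0)⟩)]
      have key : ∀ x : ℝ, 0 < x → x ^ (levelExp M d n - 1 + 1) = x * x ^ (levelExp M d n - 1) :=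
        fun x hx => by rw [Real.rpow_add hx, Real.rpow_one, mul_comm]
      rw [key b hb, key a ha', if_neg h0]
      simp only [sub_add_cancel]
      field_simp
      ring
  · have hl : levelExp 0 d n = n.1 + 1 := by simp [levelExp]
    have h0 : levelExp 0 d n ≠ 0 := by rw [hl]; positivity
    rw [if_neg h0]
    simp only [levelT_zero_fst]
    rw [intervalIntegral.integral_mul_const, integral_pow, hl]
    ring

theorem levelT_nonneg {M d : ℕ} {h s : ℝ} (hh : 0 ≤ h) (hs : 0 ≤ s) : 0 ≤ levelT M d h s := by
  rw [levelT]; positivity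

theorem HasDoubleSeries.integral_level {F : ℝ × ℝ → ℝ} {c R} (hF : HasDoubleSeries F c R) {M d : ℕ}
    (hd : 0 < d) {h a b : ℝ} (hh : 0 < h) (ha : 0 ≤ a) (hb : 0 < b) (hab : a ≤ b) (hbR : b ≤ R)
    (hM : 0 < a ∨ M = 0) (hT : ∀ s ∈ Set.Icc a b, levelT M d h s ≤ R) :
    ∫ s in a..b, ∫ t in (0 : ℝ)..levelT M d h s, F (s, t) =
      b * levelT M d h b * doubleSum (levelCoeff M d c) (b, levelT M d h b) -
      a * levelT M d h a * doubleSum (levelCoeff M d c) (a, levelT M d h a) +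
      a * levelT M d h a * doubleSum (levelLogCoeff M d c) (a, levelT M d h a) *
        (Real.log b - Real.log a) := by
  have hI : Set.uIoc a b ⊆ Set.Icc a b := by
    rw [Set.uIoc_of_le hab]; exact Set.Ioc_subset_Icc_self
  have hsR : ∀ s ∈ Set.Icc a b, |s| ≤ R := fun s hs => by
    rw [abs_of_nonneg (ha.trans hs.1)]; exact hs.2.trans hbR
  have htR : ∀ s ∈ Set.Icc a b, |levelT M d h s| ≤ R := fun s hs => by
    rw [abs_of_nonneg (levelT_nonneg hh.le (ha.trans hs.1))]; exact hT s hs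
  have hP := hasDoubleSeries_of_abs_le hF (abs_primCoeff_le c)
  have hA := hasDoubleSeries_of_abs_le hF (abs_levelCoeff_le (M := M) hd c)
  have hB := hasDoubleSeries_of_abs_le hF (abs_levelLogCoeff_le M d c)
  have h1 : HasSum (fun n : ℕ × ℕ => ∫ s in a..b,
      primCoeff c n * (s ^ n.1 * levelT M d h s ^ (n.2 + 1)))
      (∫ s in a..b, ∫ t in (0 : ℝ)..levelT M d h s, F (s, t)) := by
    refine intervalIntegral.hasSum_integral_of_dominated_convergence
      (fun n _ => |primCoeff c n| * R ^ (n.1 + n.2) * R) (fun n => ?_) (fun n => ?_)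
      (ae_of_all _ fun _ _ => hP.summable.mul_right R) (by simp) ?_
    · have : Measurable (levelT M d h) := by
        unfold levelT
        fun_prop
      fun_prop
    · refine ae_of_all _ fun s hs => ?_
      have h2 := abs_term_le (c := primCoeff c) (hsR s (hI hs)) (htR s (hI hs)) n
      rw [Real.norm_eq_abs, pow_succ, ← mul_assoc, ← mul_assoc, abs_mul]
      exact mul_le_mul h2 (htR s (hI hs)) (abs_nonneg _) ((abs_nonneg _).trans h2)
    · refine ae_of_all _ fun s hs => ?_
      rw [hF.integral_snd (hsR s (hI hs)) (htR s (hI hs)), mul_comm]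
      refine ((hP.hasSum s _ (hsR s (hI hs)) (htR s (hI hs))).mul_right _).congr_fun' fun n => ?_
      ring
  have ma : a ∈ Set.Icc a b := ⟨le_rfl, hab⟩
  have mb : b ∈ Set.Icc a b := ⟨hab, le_rfl⟩
  have h2 := (((hA.hasSum b _ (hsR b mb) (htR b mb)).mul_left (b * levelT M d h b)).sub
    ((hA.hasSum a _ (hsR a ma) (htR a ma)).mul_left (a * levelT M d h a))).add
    (((hB.hasSum a _ (hsR a ma) (htR a ma)).mul_left (a * levelT M d h a)).mul_right
      (Real.log b - Real.log a))
  refine h1.unique (h2.congr_fun' fun n => ?_)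
  rw [intervalIntegral.integral_const_mul, integral_levelT_term hh hb hM, levelCoeff, levelLogCoeff]
  split_ifs <;> ring

theorem integral_indicator_eq_of_lt {f : ℝ → ℝ} {p : ℝ → Prop} {T E : ℝ} (hT : 0 ≤ T) (hTE : T ≤ E)
    (h : ∀ t, 0 < t → t < E → t ≠ T → (p t ↔ t < T)) :
    ∫ t in (0 : ℝ)..E, {t | p t}.indicator f t = ∫ t in (0 : ℝ)..T, f t := by
  classical
  have h1 : ∫ t in (0 : ℝ)..E, {t | p t}.indicator f t =
      ∫ t in (0 : ℝ)..E, (Set.Iic T).indicator f t := by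
    refine intervalIntegral.integral_congr_ae ?_
    have : ({T, E} : Set ℝ)ᶜ ∈ ae volume := (Set.Finite.measure_zero (by simp) volume)
    filter_upwards [this] with t ht ht2
    rw [Set.uIoc_of_le (hT.trans hTE)] at ht2
    simp only [Set.mem_compl_iff, Set.mem_insert_iff, Set.mem_singleton_iff, not_or] at ht
    have := h t ht2.1 (lt_of_le_of_ne ht2.2 ht.2) ht.1
    simp only [Set.indicator_apply, Set.mem_ofPred_eq, Set.mem_Iic, this, le_iff_lt_or_eq, ht.1,
        or_false]
  rw [h1, intervalIntegral.integral_of_le (hT.trans hTE), setIntegral_indicator measurableSet_Iic,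
    intervalIntegral.integral_of_le hT, Set.Ioc_inter_Iic, min_eq_right hTE]

end

section

open Filter Topology MeasureTheory

theorem AnalyticAt.rpow_const {E : Type*} [NormedAddCommGroup E] [NormedSpace ℝ E] {f : E →
    ℝ} {x : E}
    (hf : AnalyticAt ℝ f x) (h : 0 < f x) (c : ℝ) : AnalyticAt ℝ (fun z => f z ^ c) x := by
  have h1 : AnalyticAt ℝ (fun z => Real.exp (Real.log (f z) * c)) x :=
    analyticAt_rexp.fun_comp (((analyticAt_log h).fun_comp hf).mul analyticAt_const)
  refine h1.congr ?_
  filter_upwards [hf.continuousAt.eventually (lt_mem_nhds h)] with z hz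
  rw [Real.rpow_def_of_pos hz]

theorem level_lt_iff {M d : ℕ} (hd : 0 < d) {h s t : ℝ} (hh : 0 < h) (hs : 0 < s) (ht : 0 ≤ t) :
    s ^ M * t ^ d < h ↔ t < levelT M d h s := by
  have hsM : 0 < s ^ M := by positivity
  rw [levelT, one_div, Real.lt_rpow_inv_iff_of_pos ht (by positivity) (by exact_mod_cast hd),
    Real.rpow_natCast, lt_div_iff₀ hsM, mul_comm]

/-- The solution `s = ψ x` of `s * g s ^ r = x`. -/
theorem exists_level_root {g : ℝ → ℝ} (hg : AnalyticAt ℝ g 0) (hg0 : 0 < g 0) (r : ℝ) :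
    ∃ ψ : ℝ → ℝ, AnalyticAt ℝ ψ 0 ∧ ψ 0 = 0 ∧
      (∀ᶠ x in 𝓝[>] (0 : ℝ), 0 < ψ x ∧ ψ x * g (ψ x) ^ r = x) ∧
      ∃ η > 0, StrictMonoOn (fun s => s * g s ^ r) (Set.Ioo (-η) η) := by
  set w : ℝ → ℝ := fun s => s * g s ^ r with hw
  have hwa : AnalyticAt ℝ w 0 := analyticAt_id.mul (hg.rpow_const hg0 r)
  have hd : HasDerivAt w (g 0 ^ r) 0 := by
    have h1 := (hasDerivAt_id (0 : ℝ)).mul (hg.rpow_const hg0 r).differentiableAt.hasDerivAt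
    simp only [id, zero_mul, add_zero, one_mul] at h1
    exact h1
  have hpos : 0 < g 0 ^ r := Real.rpow_pos_of_pos hg0 r
  obtain ⟨ψ, hψ, hψ0, -, hr⟩ := exists_analytic_inverse_one hwa (by rw [hd.deriv]; exact hpos.ne')
  have hw0 : w 0 = 0 := by simp [hw]
  rw [hw0] at hψ hψ0 hr
  refine ⟨ψ, hψ, hψ0, ?_, ?_⟩
  · have ht : Tendsto ψ (𝓝 0) (𝓝 0) := by simpa [hψ0] using hψ.continuousAt.tendsto
    filter_upwards [hr.filter_mono nhdsWithin_le_nhds, self_mem_nhdsWithin,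
      (ht.eventually (hg.continuousAt.eventually (lt_mem_nhds hg0))).filter_mono nhdsWithin_le_nhds]
      with x h1 h2 h3
    refine ⟨?_, h1⟩
    have h4 : 0 < g (ψ x) ^ r := Real.rpow_pos_of_pos h3 r
    have h5 : 0 < ψ x * g (ψ x) ^ r := by
      have : w (ψ x) = ψ x * g (ψ x) ^ r := rfl
      rw [← this, h1]; exact h2
    exact (pos_iff_pos_of_mul_pos h5).2 h4
  · have h1 : ∀ᶠ s in 𝓝 (0 : ℝ), AnalyticAt ℝ w s ∧ 0 < deriv w s :=
      hwa.eventually_analyticAt.and (hwa.deriv.continuousAt.eventually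
        (lt_mem_nhds (by rw [hd.deriv]; exact hpos)))
    obtain ⟨η, hη, hB⟩ := Metric.eventually_nhds_iff_ball.1 h1
    rw [Real.ball_eq_Ioo, zero_sub, zero_add] at hB
    refine ⟨η, hη, strictMonoOn_of_deriv_pos (convex_Ioo _ _)
      (fun s hs => (hB s hs).1.continuousAt.continuousWithinAt) fun s hs => ?_⟩
    rw [interior_Ioo] at hs
    exact (hB s hs).2

theorem mem_ball_of_abs {s t R : ℝ} (hs : |s| < R)
    (ht : |t| < R) : (s, t) ∈ Metric.ball (0 : ℝ × ℝ) R := by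
  rw [mem_ball_zero_iff, Prod.norm_def, max_lt_iff]
  exact ⟨hs, ht⟩

theorem tendsto_rpow_nhdsGT {r : ℝ} (hr : 0 < r) : Tendsto (fun h : ℝ => h ^ r) (𝓝[>] 0)
    (𝓝[>] 0) := by
  refine tendsto_nhdsWithin_iff.2 ⟨?_, ?_⟩
  · have := (Real.continuousAt_rpow_const 0 r (Or.inr hr.le)).tendsto
    rw [Real.zero_rpow hr.ne'] at this
    exact this.mono_left nhdsWithin_le_nhds
  · filter_upwards [self_mem_nhdsWithin] with h hh
    exact Real.rpow_pos_of_pos hh r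

theorem eventually_nhdsGT_forall_Ioc {p : ℝ → Prop} (h : ∀ᶠ s in 𝓝[>] (0 : ℝ), p s) :
    ∀ᶠ ε in 𝓝[>] (0 : ℝ), 0 < ε ∧ ∀ s ∈ Set.Ioc 0 ε, p s := by
  obtain ⟨η, hη, hB⟩ := mem_nhdsGT_iff_exists_Ioo_subset.1 h
  filter_upwards [Ioo_mem_nhdsGT hη] with ε hε
  exact ⟨hε.1, fun s hs => hB ⟨hs.1, hs.2.trans_lt hε.2⟩⟩

/-- Integrals over `{s ^ M * t ^ d < h}` below a curve with positive value at the origin, `M =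
0`. -/
theorem isLogPuiseux_of_pos {K : ℝ × ℝ → ℝ} {c R} (hK : HasDoubleSeries K c R) {d : ℕ} (hd : 0 < d)
    {e : ℝ → ℝ} (he : ContinuousAt e 0) (he0 : 0 < e 0) (heR : e 0 < R) :
    ∀ᶠ ε in 𝓝[>] (0 : ℝ), IsLogPuiseux fun h => ∫ s in (0 : ℝ)..ε, ∫ t in (0 : ℝ)..e s,
      {t | s ^ 0 * t ^ d < h}.indicator (fun t => K (s, t)) t := by
  have h1 : ∀ᶠ s in 𝓝[>] (0 : ℝ), e 0 / 2 < e s ∧ s < R :=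
    ((he.eventually (lt_mem_nhds (by linarith))).filter_mono nhdsWithin_le_nhds).and
      ((gt_mem_nhds hK.pos).filter_mono nhdsWithin_le_nhds)
  filter_upwards [eventually_nhdsGT_forall_Ioc h1] with ε hε
  obtain ⟨hε0, hε⟩ := hε
  have hεR := (hε ε ⟨hε0, le_rfl⟩).2
  have hA := hasDoubleSeries_of_abs_le hK (abs_levelCoeff_le (M := 0) hd c)
  have hA0 : AnalyticAt ℝ (fun x : ℝ => ε * x * doubleSum (levelCoeff 0 d c) (ε, x)) 0 := by
    refine (analyticAt_const.mul analyticAt_id).mul ?_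
    refine AnalyticAt.fun_comp (g := doubleSum (levelCoeff 0 d c)) (f := fun x : ℝ => (ε, x)) ?_
      (analyticAt_const.prod analyticAt_id)
    exact hA.analyticOnNhd _ (mem_ball_of_abs (by rwa [abs_of_pos hε0]) (by simpa using hK.pos))
  refine (IsLogPuiseux.of_analytic hA0 hd).congr ?_
  have hd' : (0 : ℝ) < 1 / d := by positivity
  filter_upwards [self_mem_nhdsWithin, (tendsto_rpow_nhdsGT hd').eventually
    ((gt_mem_nhds (show 0 < e 0 / 2 by linarith)).filter_mono nhdsWithin_le_nhds)] with h hh hx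
  have hh : 0 < h := hh
  have hlt : ∀ s, levelT 0 d h s = h ^ (1 / (d : ℝ)) := fun s => levelT_zero_fst
  have h2 : ∫ s in (0 : ℝ)..ε, ∫ t in (0 : ℝ)..e s,
      {t | s ^ 0 * t ^ d < h}.indicator (fun t => K (s, t)) t =
      ∫ s in (0 : ℝ)..ε, ∫ t in (0 : ℝ)..levelT 0 d h s, K (s, t) := by
    refine intervalIntegral.integral_congr_ae (ae_of_all _ fun s hs => ?_)
    rw [Set.uIoc_of_le hε0.le] at hs
    refine integral_indicator_eq_of_lt (levelT_nonneg hh.le hs.1.le) ?_ ?_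
    · rw [hlt]; exact hx.le.trans (hε s hs).1.le
    · exact fun t ht _ _ => level_lt_iff hd hh hs.1 ht.le
  rw [h2, hK.integral_level hd hh le_rfl hε0 hε0.le hεR.le (Or.inr rfl)]
  · simp [hlt]
  · intro s _
    rw [hlt]
    linarith

/-- Integrals over `{s ^ M * t ^ d < h}` below a positive curve `e s = s ^ k * g s`. -/
theorem isLogPuiseux_of_pow {K : ℝ × ℝ → ℝ} {c R} (hK : HasDoubleSeries K c R) {M d : ℕ}
    (hd : 0 < d)
    {e g : ℝ → ℝ} {k : ℕ} (he : AnalyticAt ℝ e 0) (heR : |e 0| < R) (hg : AnalyticAt ℝ g 0)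
    (hg0 : 0 < g 0) (hge : ∀ᶠ s in 𝓝 (0 : ℝ), e s = s ^ k * g s) (hP : 0 < M + k * d) :
    ∀ᶠ ε in 𝓝[>] (0 : ℝ), IsLogPuiseux fun h => ∫ s in (0 : ℝ)..ε, ∫ t in (0 : ℝ)..e s,
      {t | s ^ M * t ^ d < h}.indicator (fun t => K (s, t)) t := by
  set P := M + k * d with hPdef
  have hP' : (0 : ℝ) < P := by exact_mod_cast hP
  have hd' : (0 : ℝ) < d := by exact_mod_cast hd
  set r : ℝ := d / P with hr
  obtain ⟨ψ, hψ, hψ0, hψe, η, hη, hmono⟩ := exists_level_root hg hg0 r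
  have hPs := hasDoubleSeries_of_abs_le hK (abs_primCoeff_le c)
  have hAs := hasDoubleSeries_of_abs_le hK (abs_levelCoeff_le (M := M) hd c)
  have hBs := hasDoubleSeries_of_abs_le hK (abs_levelLogCoeff_le M d c)
  have hcomp : ∀ {D : ℝ × ℝ → ℝ} {c'}, HasDoubleSeries D c' R →
      AnalyticAt ℝ (fun s => D (s, e s)) 0 := fun {D c'} hD =>
    AnalyticAt.fun_comp (g := D) (f := fun s : ℝ => (s, e s))
      (hD.analyticOnNhd _ (mem_ball_of_abs (by simpa using hK.pos) heR)) (analyticAt_id.prod he)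
  have hκ : AnalyticAt ℝ (fun s => e s * doubleSum (primCoeff c) (s, e s)) 0 := he.mul (hcomp hPs)
  obtain ⟨E, hE, hEe⟩ := hκ.exists_primitive
  have hψc : ∀ {f : ℝ → ℝ}, AnalyticAt ℝ f 0 → AnalyticAt ℝ (fun x => f (ψ x)) 0 := fun {f} hf =>
    AnalyticAt.fun_comp (g := f) (f := ψ) (by rwa [hψ0]) hψ
  have h1 : ∀ᶠ s in 𝓝[>] (0 : ℝ), (s < η ∧ s < R ∧ 0 < g s ∧ |e s| < R) ∧ (e s = s ^ k * g s ∧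
      ContinuousAt (fun s => e s * doubleSum (primCoeff c) (s, e s)) s) :=
    Eventually.filter_mono nhdsWithin_le_nhds (((gt_mem_nhds hη).and ((gt_mem_nhds hK.pos).and
      ((hg.continuousAt.eventually (lt_mem_nhds hg0)).and
        (he.continuousAt.abs.eventually (gt_mem_nhds heR))))).and
      (hge.and (hκ.eventually_analyticAt.mono fun s hs => hs.continuousAt)))
  filter_upwards [eventually_nhdsGT_forall_Ioc h1] with ε hε
  obtain ⟨hε0, hε⟩ := hε
  have hεR := (hε ε ⟨hε0, le_rfl⟩).1.2.1
  have f1 : IsLogPuiseux fun h => E (ψ (h ^ (1 / (P : ℝ)))) := IsLogPuiseux.of_analytic (hψc hE) hP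
  have f2 : IsLogPuiseux fun h => ε * (h ^ (1 / (d : ℝ)) * ε ^ (-(M / d : ℝ))) *
      doubleSum (levelCoeff M d c) (ε, h ^ (1 / (d : ℝ)) * ε ^ (-(M / d : ℝ))) := by
    refine IsLogPuiseux.of_analytic (A := fun x => ε * (x * ε ^ (-(M / d : ℝ))) *
      doubleSum (levelCoeff M d c) (ε, x * ε ^ (-(M / d : ℝ)))) ?_ hd
    have hx : AnalyticAt ℝ (fun x : ℝ => x * ε ^ (-(M / d : ℝ))) 0 :=
        analyticAt_id.mul analyticAt_const
    refine (analyticAt_const.mul hx).mul ?_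
    refine AnalyticAt.fun_comp (g := doubleSum (levelCoeff M d c))
      (f := fun x : ℝ => (ε, x * ε ^ (-(M / d : ℝ)))) ?_ (analyticAt_const.prod hx)
    exact hAs.analyticOnNhd _ (mem_ball_of_abs (by rwa [abs_of_pos hε0]) (by simpa using hK.pos))
  set D₁ : ℝ → ℝ := fun s => s * e s * doubleSum (levelCoeff M d c) (s, e s)
  set D₂ : ℝ → ℝ := fun s => s * e s * doubleSum (levelLogCoeff M d c) (s, e s)
  have hD₁ : AnalyticAt ℝ D₁ 0 := (analyticAt_id.mul he).mul (hcomp hAs)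
  have hD₂ : AnalyticAt ℝ D₂ 0 := (analyticAt_id.mul he).mul (hcomp hBs)
  have f3 : IsLogPuiseux fun h => D₁ (ψ (h ^ (1 / (P : ℝ)))) :=
      IsLogPuiseux.of_analytic (hψc hD₁) hP
  have hlog : AnalyticAt ℝ (fun s => Real.log ε + r * Real.log (g s)) 0 :=
    analyticAt_const.add (analyticAt_const.mul ((analyticAt_log hg0).fun_comp hg))
  have f4 : IsLogPuiseux fun h => D₂ (ψ (h ^ (1 / (P : ℝ)))) *
      (Real.log ε + r * Real.log (g (ψ (h ^ (1 / (P : ℝ)))))) :=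
    IsLogPuiseux.of_analytic ((hψc hD₂).mul (hψc hlog)) hP
  have f5 : IsLogPuiseux fun h => (1 / (P : ℝ)) * (D₂ (ψ (h ^ (1 / (P : ℝ)))) * Real.log h) :=
    (IsLogPuiseux.of_analytic_log (hψc hD₂) hP).const_mul _
  refine ((f1.add (f2.add f3.neg)).add (f4.add f5.neg)).congr ?_
  have hxt := tendsto_rpow_nhdsGT (show (0 : ℝ) < 1 / P by positivity)
  have hψt : Tendsto ψ (𝓝[>] 0) (𝓝 0) := by
    have := hψ.continuousAt.tendsto
    rw [hψ0] at this
    exact this.mono_left nhdsWithin_le_nhds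
  filter_upwards [self_mem_nhdsWithin, hxt.eventually hψe,
    (hψt.comp hxt).eventually ((gt_mem_nhds hε0).and hEe)] with h hh hs hs2
  have hh : 0 < h := hh
  set x := h ^ (1 / (P : ℝ)) with hxd
  simp only [Function.comp] at hs2
  rw [← hxd] at hs2
  set a := ψ x with had
  obtain ⟨ha0, hax⟩ := hs
  obtain ⟨haε, haE⟩ := hs2
  have hx0 : 0 < x := Real.rpow_pos_of_pos hh _
  have hxP : x ^ P = h := by
    rw [hxd, ← Real.rpow_natCast, ← Real.rpow_mul hh.le]
    field_simp
    simp
  have hpow : ∀ s ∈ Set.Ioc 0 ε, s ^ M * e s ^ d = (s * g s ^ r) ^ P := fun s hs => by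
    have hgs := (hε s hs).1.2.2.1
    have : (g s ^ r) ^ P = g s ^ d := by
      rw [← Real.rpow_natCast, ← Real.rpow_mul hgs.le, hr, div_mul_cancel₀ _ hP'.ne',
          Real.rpow_natCast]
    rw [(hε s hs).2.1, mul_pow, mul_pow, this, hPdef, pow_add, pow_mul]
    ring
  have hepos : ∀ s ∈ Set.Ioc 0 ε, 0 < e s := fun s hs => by
    rw [(hε s hs).2.1]
    have := hs.1
    have := (hε s hs).1.2.2.1
    positivity
  have hmem : ∀ s ∈ Set.Ioc 0 ε, s ∈ Set.Ioo (-η) η := fun s hs =>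
    ⟨by linarith [hs.1], (hε s hs).1.1⟩
  have hwpos : ∀ s ∈ Set.Ioc 0 ε, 0 ≤ s * g s ^ r := fun s hs =>
    mul_nonneg hs.1.le (Real.rpow_nonneg (hε s hs).1.2.2.1.le _)
  have haI : a ∈ Set.Ioc 0 ε := ⟨ha0, haε.le⟩
  have hle : ∀ s ∈ Set.Ioc 0 ε, s ≤ a → s ^ M * e s ^ d ≤ h := fun s hs hsa => by
    rw [hpow s hs, ← hxP, ← hax]
    exact pow_le_pow_left₀ (hwpos s hs) (hmono.monotoneOn (hmem s hs) (hmem a haI) hsa) _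
  have hge' : ∀ s ∈ Set.Ioc 0 ε, a ≤ s → levelT M d h s ≤ e s := fun s hs hsa => by
    by_contra hcon
    push Not at hcon
    rw [← level_lt_iff hd hh hs.1 (hepos s hs).le, hpow s hs, ← hxP, ← hax] at hcon
    exact absurd hcon (not_lt.2 (pow_le_pow_left₀ (hwpos a haI)
      (hmono.monotoneOn (hmem a haI) (hmem s hs) hsa) _))
  have hTa : levelT M d h a = e a := by
    have h2 : a ^ M * e a ^ d = h := by
      rw [hpow a haI, hax, hxP]
    have haM : a ^ M ≠ 0 := by positivity
    rw [levelT, ← h2, mul_div_cancel_left₀ _ haM, ← Real.rpow_natCast,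
        ← Real.rpow_mul (hepos a haI).le,
      mul_one_div_cancel hd'.ne', Real.rpow_one]
  have hTle : ∀ s ∈ Set.Icc a ε, levelT M d h s < R := fun s hs => by
    have hs' : s ∈ Set.Ioc 0 ε := ⟨ha0.trans_le hs.1, hs.2⟩
    exact (hge' s hs' hs.1).trans_lt ((le_abs_self _).trans_lt (hε s hs').1.2.2.2)
  set I : ℝ → ℝ := fun s => ∫ t in (0 : ℝ)..e s,
    {t | s ^ M * t ^ d < h}.indicator (fun t => K (s, t)) t
  have hI1 : ∀ s ∈ Set.Ioc 0 a, I s = e s * doubleSum (primCoeff c) (s, e s) := fun s hs => by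
    have hs' : s ∈ Set.Ioc 0 ε := ⟨hs.1, hs.2.trans haε.le⟩
    have h2 : I s = ∫ t in (0 : ℝ)..e s, K (s, t) := by
      refine integral_indicator_eq_of_lt (hepos s hs').le le_rfl fun t h1 h2 _ => ?_
      refine iff_of_true ?_ h2
      refine lt_of_lt_of_le ?_ (hle s hs' hs.2)
      have := hs.1
      gcongr
    rw [h2, hK.integral_snd (by rw [abs_of_pos hs.1]; exact (hε s hs').1.2.1.le)
        (hε s hs').1.2.2.2.le]
  have hI2 : ∀ s ∈ Set.Icc a ε, I s = ∫ t in (0 : ℝ)..levelT M d h s, K (s, t) := fun s hs => by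
    have hs' : s ∈ Set.Ioc 0 ε := ⟨ha0.trans_le hs.1, hs.2⟩
    exact integral_indicator_eq_of_lt (levelT_nonneg hh.le hs'.1.le) (hge' s hs' hs.1)
      fun t ht _ _ => level_lt_iff hd hh hs'.1 ht.le
  have hi1 : IntervalIntegrable I volume 0 a := by
    have h2 : IntervalIntegrable (fun s => e s * doubleSum (primCoeff c) (s, e s)) volume 0 ε := by
      refine ContinuousOn.intervalIntegrable ?_
      rw [Set.uIcc_of_le hε0.le]
      intro s hs
      rcases hs.1.eq_or_lt with rfl | h0
      · exact hκ.continuousAt.continuousWithinAt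
      · exact (hε s ⟨h0, hs.2⟩).2.2.continuousWithinAt
    refine (h2.mono_set ?_).congr ?_
    · rw [Set.uIcc_of_le hε0.le, Set.uIcc_of_le ha0.le]
      exact Set.Icc_subset_Icc_right haε.le
    · rw [Set.uIoc_of_le ha0.le]
      exact fun s hs => (hI1 s hs).symm
  have hi2 : IntervalIntegrable I volume a ε := by
    have h2 : IntervalIntegrable (fun s => levelT M d h s * doubleSum (primCoeff c)
        (s, levelT M d h s))
        volume a ε := by
      refine ContinuousOn.intervalIntegrable ?_
      rw [Set.uIcc_of_le haε.le]
      intro s hs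
      have hs0 : 0 < s := ha0.trans_le hs.1
      have hc : ContinuousAt (levelT M d h) s := by
        unfold levelT
        refine ContinuousAt.rpow_const ?_ (Or.inr (by positivity))
        exact continuousAt_const.div (continuousAt_id.pow _) (pow_ne_zero _ hs0.ne')
      refine (hc.mul (ContinuousAt.comp (g := doubleSum (primCoeff c))
        (f := fun s => (s, levelT M d h s)) ?_ (continuousAt_id.prodMk hc))).continuousWithinAt
      refine (hPs.analyticOnNhd _ (mem_ball_of_abs ?_ ?_)).continuousAt
      · rw [abs_of_pos hs0]; exact hs.2.trans_lt hεR
      · rw [abs_of_nonneg (levelT_nonneg hh.le hs0.le)]; exact hTle s hs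
    refine h2.congr ?_
    rw [Set.uIoc_of_le haε.le]
    intro s hs
    have hs' : s ∈ Set.Icc a ε := ⟨hs.1.le, hs.2⟩
    have hs0 : 0 < s := ha0.trans_le hs'.1
    beta_reduce
    rw [hI2 s hs', hK.integral_snd (by rw [abs_of_pos hs0]; exact hs.2.trans hεR.le)
      (by rw [abs_of_nonneg (levelT_nonneg hh.le hs0.le)]; exact (hTle s hs').le)]
  have e1 : ∫ s in (0 : ℝ)..a, I s = E a := by
    rw [← haE]
    refine intervalIntegral.integral_congr_ae (ae_of_all _ fun s hs => ?_)
    rw [Set.uIoc_of_le ha0.le] at hs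
    exact hI1 s hs
  have e2 : ∫ s in a..ε, I s = ∫ s in a..ε, ∫ t in (0 : ℝ)..levelT M d h s, K (s, t) := by
    refine intervalIntegral.integral_congr fun s hs => ?_
    rw [Set.uIcc_of_le haε.le] at hs
    exact hI2 s hs
  have e3 := hK.integral_level hd hh ha0.le hε0 haε.le hεR.le (Or.inl ha0) fun s hs =>
      (hTle s hs).le
  have hloga : Real.log a + r * Real.log (g a) = 1 / P * Real.log h := by
    have hga := (hε a haI).1.2.2.1
    rw [← Real.log_rpow hga, ← Real.log_mul ha0.ne' (Real.rpow_pos_of_pos hga r).ne', hax, hxd,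
      Real.log_rpow hh]
  have e4 : ∫ s in (0 : ℝ)..ε, I s = E a + (∫ s in a..ε, I s) := by
    rw [← e1, intervalIntegral.integral_add_adjacent_intervals hi1 hi2]
  change _ = ∫ s in (0 : ℝ)..ε, I s
  rw [e4, e2, e3, hTa, levelT_eq hh hε0]
  have : Real.log a = 1 / P * Real.log h - r * Real.log (g a) := by linarith
  rw [this]
  simp only [D₁, D₂]
  ring

/-- Integrals over `{s ^ M * t ^ d < h}` below a positive analytic curve are log-Puiseux. -/
theorem isLogPuiseux_level {K : ℝ × ℝ → ℝ} (hK : AnalyticAt ℝ K 0) (M : ℕ) {d : ℕ} (hd : 0 < d) :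
    ∃ R > 0, ∀ e : ℝ → ℝ, AnalyticAt ℝ e 0 → |e 0| < R → (∀ᶠ s in 𝓝[>] (0 : ℝ), 0 < e s) →
      ∀ᶠ ε in 𝓝[>] (0 : ℝ), IsLogPuiseux fun h => ∫ s in (0 : ℝ)..ε, ∫ t in (0 : ℝ)..e s,
        {t | s ^ M * t ^ d < h}.indicator (fun t => K (s, t)) t := by
  obtain ⟨c, R, h⟩ := hK.exists_hasDoubleSeries
  refine ⟨R, h.pos, fun e he heR hpos => ?_⟩
  obtain ⟨k, g, hg, hg0, hge⟩ := he.exists_eventuallyEq_pow_smul_nonzero_iff.2 fun hz => by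
    obtain ⟨s, h1, h2⟩ := (hpos.and (hz.filter_mono nhdsWithin_le_nhds)).exists
    exact h1.ne' h2
  simp only [sub_zero, smul_eq_mul] at hge
  have hg0' : 0 < g 0 := by
    refine lt_of_le_of_ne ?_ hg0.symm
    refine ge_of_tendsto (hg.continuousAt.tendsto.mono_left (nhdsWithin_le_nhds (s := Set.Ioi 0)))
        ?_
    filter_upwards [hpos, hge.filter_mono nhdsWithin_le_nhds, self_mem_nhdsWithin] with s h1 h2 h3
    have h3 : 0 < s ^ k := pow_pos h3 k
    rw [h2] at h1
    exact ((pos_iff_pos_of_mul_pos h1).1 h3).le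
  rcases Nat.eq_zero_or_pos (M + k * d) with h0 | h0
  · obtain ⟨rfl, h1⟩ : M = 0 ∧ k * d = 0 := by omega
    obtain rfl : k = 0 := by
      rcases Nat.mul_eq_zero.1 h1 with h | h
      · exact h
      · omega
    have : e 0 = g 0 := by simpa using hge.self_of_nhds
    exact isLogPuiseux_of_pos h hd he.continuousAt (by rwa [this]) ((le_abs_self _).trans_lt heR)
  · exact isLogPuiseux_of_pow h hd he heR hg hg0' hge h0

end

section

open Filter Topology MeasureTheory

theorem AnalyticAt.fderiv_apply {F : ℝ × ℝ → ℝ} {p : ℝ × ℝ} (hF : AnalyticAt ℝ F p) (v : ℝ × ℝ) :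
    AnalyticAt ℝ (fun q => fderiv ℝ F q v) p :=
  ((ContinuousLinearMap.apply ℝ ℝ v).analyticAt _).comp hF.fderiv

theorem AnalyticAt.hasDerivAt_snd {F : ℝ × ℝ → ℝ} {s y : ℝ} (hF : AnalyticAt ℝ F (s, y)) :
    HasDerivAt (fun y => F (s, y)) (fderiv ℝ F (s, y) (0, 1)) y := by
  have h1 : HasDerivAt (fun y : ℝ => (s, y)) ((0 : ℝ), (1 : ℝ)) y :=
    (hasDerivAt_const y s).prodMk (hasDerivAt_id y)
  exact hF.differentiableAt.hasFDerivAt.comp_hasDerivAt y h1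

theorem AnalyticAt.hasDerivAt_fst {F : ℝ × ℝ → ℝ} {s y : ℝ} (hF : AnalyticAt ℝ F (s, y)) :
    HasDerivAt (fun s => F (s, y)) (fderiv ℝ F (s, y) (1, 0)) s := by
  have h1 : HasDerivAt (fun s : ℝ => (s, y)) ((1 : ℝ), (0 : ℝ)) s :=
    (hasDerivAt_id s).prodMk (hasDerivAt_const s y)
  exact hF.differentiableAt.hasFDerivAt.comp_hasDerivAt s h1

theorem intervalIntegral_substitution {f f' g : ℝ → ℝ} {b : ℝ} (hb : 0 ≤ b) (hf0 : f 0 = 0)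
    (hff' : ∀ y ∈ Set.Icc 0 b, HasDerivAt f (f' y) y) (hf' : ∀ y ∈ Set.Icc 0 b, 0 ≤ f' y) :
    ∫ y in (0 : ℝ)..b, f' y * g (f y) = ∫ t in (0 : ℝ)..f b, g t := by
  have hm : MonotoneOn f (Set.Icc 0 b) := by
    refine monotoneOn_of_deriv_nonneg (convex_Icc _ _)
      (fun y hy => (hff' y hy).continuousAt.continuousWithinAt)
      (fun y hy => (hff' y (interior_subset hy)).differentiableAt.differentiableWithinAt)
      fun y hy => ?_
    rw [(hff' y (interior_subset hy)).deriv]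
    exact hf' y (interior_subset hy)
  have h0 : 0 ≤ f b := by
    rw [← hf0]
    exact hm (Set.left_mem_Icc.2 hb) (Set.right_mem_Icc.2 hb) hb
  have := integral_Icc_deriv_smul_of_deriv_nonneg (g := g) (f := f) (f' := f') (a := 0) (b := b)
    (fun y hy => (hff' y hy).continuousAt.continuousWithinAt)
    (fun y hy => hff' y (Set.Ioo_subset_Icc_self hy))
    (fun y hy => hf' y (Set.Ioo_subset_Icc_self hy)) hb
  rw [hf0, integral_Icc_eq_integral_Ioc, integral_Icc_eq_integral_Ioc] at this
  rw [intervalIntegral.integral_of_le hb, intervalIntegral.integral_of_le h0]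
  exact this

theorem eventually_section_of_box {P : ℝ × ℝ → Prop} {δ : ℝ}
    (hP : ∀ x y, |x| < δ → |y| < δ → P (x, y)) {α : ℝ → ℝ} (hα : CurveIn δ α)
    (hpos : ∀ᶠ s in 𝓝[>] (0 : ℝ), 0 < α s) :
    ∀ᶠ s in 𝓝[>] (0 : ℝ), 0 < s ∧ 0 < α s ∧ ∀ y ∈ Set.Icc 0 (α s), P (s, y) := by
  have hδ : 0 < δ := (abs_nonneg _).trans_lt hα.2
  have h1 : ∀ᶠ s in 𝓝[>] (0 : ℝ), |α s| < δ := nhdsWithin_le_nhds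
    (hα.1.continuousAt.abs.eventually_lt continuousAt_const hα.2)
  filter_upwards [h1, hpos, Ioo_mem_nhdsGT hδ] with s h1 h2 h3
  refine ⟨h3.1, h2, fun y hy => hP s y ?_ ?_⟩
  · rw [abs_of_pos h3.1]; exact h3.2
  · rw [abs_of_nonneg hy.1]; exact (hy.2.trans (le_abs_self _)).trans_lt h1

theorem secLP_monomial_pos {U J : ℝ × ℝ → ℝ} (hU : AnalyticAt ℝ U 0) (hU0 : 0 < U 0)
    (hJ : AnalyticAt ℝ J 0) (M : ℕ) {d : ℕ} (hd : 0 < d) :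
    ∃ δ > 0, ∀ α, CurveIn δ α → (∀ᶠ s in 𝓝[>] (0 : ℝ), 0 < α s) →
      SecLP (fun p => p.1 ^ M * p.2 ^ d * U p) Set.univ J 0 α := by
  classical
  set D : ℝ × ℝ → ℝ := fun p => p.2 * U p ^ (1 / (d : ℝ)) with hD
  have hDan : AnalyticAt ℝ D 0 := analyticAt_snd.mul (hU.rpow_const hU0 _)
  have hDy : fderiv ℝ D 0 (0, 1) = U 0 ^ (1 / (d : ℝ)) := by
    have h1 := (AnalyticAt.hasDerivAt_snd (F := D) (s := 0) (y := 0) hDan).deriv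
    have h2 : HasDerivAt (fun y : ℝ => y * U (0, y) ^ (1 / (d : ℝ)))
        (1 * U (0, 0) ^ (1 / (d : ℝ)) + 0 * deriv (fun y : ℝ => U (0, y) ^ (1 / (d : ℝ))) 0) 0 := by
      refine (hasDerivAt_id (0 : ℝ)).mul (DifferentiableAt.hasDerivAt ?_)
      exact ((hU.rpow_const hU0 (1 / (d : ℝ))).hasDerivAt_snd (s := 0) (y := 0)).differentiableAt
    rw [one_mul, zero_mul, add_zero] at h2
    exact h1.symm.trans h2.deriv
  have hDy0 : 0 < fderiv ℝ D 0 (0, 1) := by rw [hDy]; positivity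
  obtain ⟨Y, hY, hY0, hDY, hYD⟩ := exists_analytic_inverse_snd hDan hDy0.ne'
  have hD0 : D 0 = 0 := by simp [D]
  rw [hD0] at hY hY0 hDY
  have hDyan := hDan.fderiv_apply (0, 1)
  have hY0' : (fun p : ℝ × ℝ => (p.1, Y p)) (0 : ℝ × ℝ) = 0 := Prod.ext rfl hY0
  have hYY : AnalyticAt ℝ (fun p : ℝ × ℝ => (p.1, Y p)) 0 := analyticAt_fst.prod hY
  set K : ℝ × ℝ → ℝ := fun p => J (p.1, Y p) / fderiv ℝ D (p.1, Y p) (0, 1) with hKdef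
  have hK : AnalyticAt ℝ K 0 := by
    refine AnalyticAt.div (AnalyticAt.comp_of_eq hJ hYY hY0')
        (AnalyticAt.comp_of_eq hDyan hYY hY0') ?_
    rw [show ((0 : ℝ × ℝ).1, Y 0) = 0 from hY0']
    exact hDy0.ne'
  obtain ⟨R, hR, hlev⟩ := isLogPuiseux_level hK M hd
  have hev : ∀ᶠ p in 𝓝 (0 : ℝ × ℝ), (0 < U p ∧ AnalyticAt ℝ D p) ∧
      (0 < fderiv ℝ D p (0, 1) ∧ Y (p.1, D p) = p.2) ∧ |D p| < R := by
    refine ((hU.continuousAt.eventually (lt_mem_nhds hU0)).and hDan.eventually_analyticAt).and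
      (((hDyan.continuousAt.eventually (lt_mem_nhds hDy0)).and hYD).and ?_)
    exact hDan.continuousAt.abs.eventually_lt continuousAt_const (by rw [hD0]; simpa using hR)
  obtain ⟨δ, hδ, hbox⟩ := exists_box_of_eventually hev
  refine ⟨δ, hδ, fun α hα hpos => ?_⟩
  have hsec := eventually_section_of_box (P := fun p => (0 < U p ∧ AnalyticAt ℝ D p) ∧
      (0 < fderiv ℝ D p (0, 1) ∧ Y (p.1, D p) = p.2) ∧ |D p| < R) hbox hα hpos
  set e : ℝ → ℝ := fun s => D (s, α s) with he
  have hDα := (hbox 0 (α 0) (by simpa using hδ) hα.2)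
  have hean : AnalyticAt ℝ e 0 :=
    AnalyticAt.comp (g := D) (f := fun s => (s, α s)) hDα.1.2 (analyticAt_id.prod hα.1)
  have hepos : ∀ᶠ s in 𝓝[>] (0 : ℝ), 0 < e s := by
    filter_upwards [hsec] with s hs
    have := (hs.2.2 (α s) ⟨hs.2.1.le, le_rfl⟩).1.1
    have := hs.2.1
    simp only [e, D]
    positivity
  filter_upwards [hlev e hean hDα.2.2 hepos, eventually_nhdsGT_forall_Ioc hsec,
    self_mem_nhdsWithin] with ε h1 h2 hε
  refine h1.congr ?_
  filter_upwards [self_mem_nhdsWithin] with h hh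
  simp only [secInt]
  refine intervalIntegral.integral_congr_ae (ae_of_all _ fun s hs => ?_)
  rw [Set.uIoc_of_le (le_of_lt hε)] at hs
  obtain ⟨hs0, hαs, hP⟩ := h2.2 s hs
  have hsub := intervalIntegral_substitution (f := fun y => D (s, y))
    (f' := fun y => fderiv ℝ D (s, y) (0, 1))
    (g := {t | s ^ M * t ^ d < h}.indicator (fun t => K (s, t))) hαs.le (by simp [D])
    (fun y hy => (hP y hy).1.2.hasDerivAt_snd) (fun y hy => (hP y hy).2.1.1.le)
  beta_reduce at hsub
  rw [← hsub]
  refine intervalIntegral.integral_congr_ae (ae_of_all _ fun y hy => ?_)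
  rw [Set.uIoc_of_le hαs.le] at hy
  obtain ⟨⟨hUp, -⟩, ⟨hDp, hYp⟩, -⟩ := hP y ⟨hy.1.le, hy.2⟩
  have hy0 : 0 < y := hy.1
  have hDd : s ^ M * D (s, y) ^ d = s ^ M * y ^ d * U (s, y) := by
    simp only [D]
    rw [mul_pow, ← Real.rpow_natCast (U (s, y) ^ (1 / (d : ℝ))), ← Real.rpow_mul hUp.le,
      one_div_mul_cancel (by positivity), Real.rpow_one, mul_assoc]
  have hFpos : 0 < s ^ M * y ^ d * U (s, y) := by positivity
  have hKJ : fderiv ℝ D (s, y) (0, 1) * K (s, D (s, y)) = J (s, y) := by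
    simp only [K]
    rw [show Y (s, D (s, y)) = y from hYp]
    field_simp
  rw [kern, Set.indicator_apply, Set.indicator_apply]
  simp only [Set.mem_ofPred_eq, hDd, Set.mem_univ, true_and, abs_of_pos hFpos, hFpos.ne', ne_eq,
    not_false_eq_true]
  split_ifs
  · exact hKJ
  · ring

end

section

open Filter Topology MeasureTheory

theorem kern_neg (F : ℝ × ℝ → ℝ) (G J h) : kern (fun p => -F p) G J h = kern F G J h := by
  simp [kern]

theorem secInt_neg (F : ℝ × ℝ → ℝ) (G J α β ε h) :
    secInt (fun p => -F p) G J α β ε h = secInt F G J α β ε h := by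
  simp only [secInt, kern_neg]

theorem kern_eq_zero_of_le {F : ℝ × ℝ → ℝ} {G J h p} (hp : h ≤ |F p|) : kern F G J h p = 0 := by
  rw [kern, Set.indicator_of_notMem]
  exact fun hm => absurd hm.2.2 (not_lt.2 hp)

theorem kern_comp_mul (F : ℝ × ℝ → ℝ) (G : Set (ℝ × ℝ)) (J : ℝ × ℝ → ℝ) (h : ℝ) (T : ℝ × ℝ → ℝ × ℝ)
    (m : ℝ × ℝ → ℝ) (p : ℝ × ℝ) :
    kern (fun p => F (T p)) (T ⁻¹' G) (fun p => m p * J (T p)) h p = m p * kern F G J h (T p) := by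
  classical
  simp only [kern, Set.indicator_apply, mul_ite, mul_zero]
  rfl

theorem secInt_scale (F : ℝ × ℝ → ℝ) (G J) (m α β : ℝ → ℝ) (ε h : ℝ) :
    secInt F G J (fun s => m s * α s) (fun s => m s * β s) ε h =
      secInt (fun p => F (p.1, m p.1 * p.2)) ((fun p => (p.1, m p.1 * p.2)) ⁻¹' G)
        (fun p => m p.1 * J (p.1, m p.1 * p.2)) α β ε h := by
  simp only [secInt]
  congr 1
  funext s
  rw [← intervalIntegral.smul_integral_comp_mul_left, smul_eq_mul,
    ← intervalIntegral.integral_const_mul]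
  congr 1
  funext y
  exact (kern_comp_mul F G J h (fun p => (p.1, m p.1 * p.2)) (fun p => m p.1) (s, y)).symm

theorem SecLP.scale {F : ℝ × ℝ → ℝ} {G J} {m α β : ℝ → ℝ}
    (h : SecLP (fun p => F (p.1, m p.1 * p.2)) ((fun p => (p.1, m p.1 * p.2)) ⁻¹' G)
        (fun p => m p.1 * J (p.1, m p.1 * p.2)) α β) :
    SecLP F G J (fun s => m s * α s) (fun s => m s * β s) := by
  filter_upwards [h] with ε hε
  exact hε.congr (Eventually.of_forall fun h => (secInt_scale F G J m α β ε h).symm)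

theorem secInt_eq_of_kern_eq_zero {F : ℝ × ℝ → ℝ} {G J} {α β : ℝ → ℝ} {ε ε₁ h : ℝ} (hε : 0 ≤ ε)
    (hle : ε ≤ ε₁) (hz : ∀ s ∈ Set.Ioc ε ε₁, ∀ y ∈ Set.uIoc (α s) (β s), kern F G J h (s, y) = 0) :
    secInt F G J α β ε₁ h = secInt F G J α β ε h := by
  simp only [secInt]
  rw [intervalIntegral.integral_of_le hε, intervalIntegral.integral_of_le (hε.trans hle)]
  refine (setIntegral_eq_of_subset_of_forall_sdiff_eq_zero measurableSet_Ioc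
    (Set.Ioc_subset_Ioc_right hle) fun s hs => ?_)
  have hs' : s ∈ Set.Ioc ε ε₁ := ⟨by
    by_contra hcon
    exact hs.2 ⟨hs.1.1, not_lt.1 hcon⟩, hs.1.2⟩
  rw [intervalIntegral.integral_congr_ae (g := fun _ => (0 : ℝ))
      (ae_of_all _ fun y hy => hz s hs' y hy)]
  simp

theorem NiceBox.integrableOn_prod {F : ℝ × ℝ → ℝ} {G J} {ε₁ δ C : ℝ} (nb : NiceBox F G J ε₁ δ C)
    (h : ℝ) :
    IntegrableOn (kern F G J h) (Set.Ioo 0 ε₁ ×ˢ Set.Ioo (-δ) δ) := by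
  have hm : MeasurableSet (Set.Ioo 0 ε₁ ×ˢ Set.Ioo (-δ) δ) :=
      measurableSet_Ioo.prod measurableSet_Ioo
  have h1 : IntegrableOn ((Set.Ioo 0 ε₁ ×ˢ Set.Ioo (-δ) δ).indicator (kern F G J h))
      (Set.Ioo 0 ε₁ ×ˢ Set.Ioo (-δ) δ) := by
    refine Measure.integrableOn_of_bounded (M := C) ?_ (nb.meas h).aestronglyMeasurable ?_
    · rw [Measure.volume_eq_prod, Measure.prod_prod]
      simp [ENNReal.mul_eq_top]
    · refine (ae_restrict_iff' hm).2 (ae_of_all _ fun p hp => ?_)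
      rw [Set.indicator_of_mem hp]
      exact (abs_kern_le ..).trans (nb.bound p hp)
  exact h1.congr_fun (fun p hp => Set.indicator_of_mem hp _) hm

theorem secInt_rect {F : ℝ × ℝ → ℝ} {G J} {ε₁ δ C : ℝ} (nb : NiceBox F G J ε₁ δ C) {ε : ℝ}
    (hε : 0 ≤ ε)
    (hε₁ : ε < ε₁) {a b : ℝ} (ha : a ∈ Set.Ioo (-δ) δ) (hb : b ∈ Set.Ioo (-δ) δ) (h : ℝ) :
    secInt F G J (fun _ => a) (fun _ => b) ε h =
      ∫ y in a..b, ∫ s in (0 : ℝ)..ε, kern F G J h (s, y) := by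
  refine intervalIntegral_intervalIntegral_swap (F := fun s y => kern F G J h (s, y))
    ((nb.integrableOn_prod h).mono_set (Set.prod_mono ?_ ?_))
  · rw [Set.uIoc_of_le hε]
    exact fun s hs => ⟨hs.1, hs.2.trans_lt hε₁⟩
  · exact fun y hy => Set.ordConnected_Ioo.uIcc_subset ha hb (Set.uIoc_subset_uIcc hy)

theorem exists_niceBox_strip {F : ℝ × ℝ → ℝ} {G : Set (ℝ × ℝ)} {J : ℝ × ℝ → ℝ} {L : ℝ}
    (hF : ∀ w ∈ Set.Icc (-L) L, AnalyticAt ℝ F (0, w))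
        (hJ : ∀ w ∈ Set.Icc (-L) L, AnalyticAt ℝ J (0, w))
    (hG : ∀ w ∈ Set.Icc (-L) L, ∀ᶠ p in 𝓝 ((0 : ℝ), w), 0 < p.1 → F p ≠ 0 → ∀ᶠ q in 𝓝 p, (q ∈ G ↔ p ∈ G)) :
    ∃ ε₁ > 0, ∃ C, ∀ ε' ≤ ε₁, NiceBox F G J ε' L C := by
  obtain ⟨C, hC⟩ := (isCompact_Icc (a := -L) (b := L)).exists_bound_of_continuousOn
    (f := fun w => J (0, w)) fun w hw => by
      have h1 : ContinuousAt (fun w : ℝ => ((0 : ℝ), w)) w := by fun_prop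
      exact (ContinuousAt.comp (f := fun w : ℝ => ((0 : ℝ), w)) (g := J) (hJ w hw).continuousAt
        h1).continuousWithinAt
  have key := (isCompact_Icc (a := -L) (b := L)).eventually_forall_of_forall_eventually
    (x₀ := (0 : ℝ)) (P := fun s w => (AnalyticAt ℝ F (s, w) ∧ AnalyticAt ℝ J (s, w)) ∧ (|J (s, w)| < C + 1 ∧
      (0 < s → F (s, w) ≠ 0 → ∀ᶠ q in 𝓝 (s, w), (q ∈ G ↔ (s, w) ∈ G)))) (fun w hw => by
        refine ((hF w hw).eventually_analyticAt.and (hJ w hw).eventually_analyticAt).and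
          (Eventually.and ?_ (hG w hw))
        exact (hJ w hw).continuousAt.abs.eventually_lt continuousAt_const
          ((hC w hw).trans_lt (lt_add_one C)))
  obtain ⟨ε₁, hε₁, hB⟩ := Metric.eventually_nhds_iff_ball.1 key
  refine ⟨ε₁, hε₁, C + 1, fun ε' hε' => ?_⟩
  have hB' : ∀ p ∈ Set.Ioo 0 ε' ×ˢ Set.Ioo (-L) L, _ := fun p hp =>
    hB p.1 (by rw [Metric.mem_ball, Real.dist_0_eq_abs, abs_of_pos hp.1.1]; exact hp.1.2.trans_le hε')
      p.2 (Set.Ioo_subset_Icc_self hp.2)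
  exact NiceBox.of_open (fun p hp => (hB' p hp).1.1.continuousAt)
    (fun p hp => (hB' p hp).1.2.continuousAt) (fun p hp => (hB' p hp).2.2 hp.1.1)
    (fun p hp => (hB' p hp).2.1.le)

theorem SecLP.const_of_local {F : ℝ × ℝ → ℝ} {G : Set (ℝ × ℝ)} {J : ℝ × ℝ → ℝ} {ε₁ L C : ℝ}
    (nb : NiceBox F G J ε₁ L C) (hε₁ : 0 < ε₁)
    (hloc : ∀ w ∈ Set.Ioo (-L) L, ∀ᶠ y in 𝓝 w, SecLP F G J (fun _ => w) (fun _ => y))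
    {a b : ℝ} (ha : a ∈ Set.Ioo (-L) L) (hb : b ∈ Set.Ioo (-L) L) :
    SecLP F G J (fun _ => a) (fun _ => b) := by
  refine (isPreconnected_Ioo (a := -L) (b := L)).induction₂'
    (fun a b => SecLP F G J (fun _ => a) (fun _ => b)) (fun w hw => ?_)
        (fun x y z hx hy hz h1 h2 => ?_) ha hb
  · exact nhdsWithin_le_nhds ((hloc w hw).mono fun y hy => ⟨hy, hy.symm⟩)
  · exact h1.trans_of_niceBox nb hε₁ ⟨continuousOn_const, fun _ _ => hx⟩
      ⟨continuousOn_const, fun _ _ => hy⟩ ⟨continuousOn_const, fun _ _ => hz⟩ h2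

end

section

open Filter Topology MeasureTheory

theorem SecLP.congr_neg {F : ℝ × ℝ → ℝ} {G J α β} (h : SecLP (fun p => -F p) G J α β) :
    SecLP F G J α β := by
  filter_upwards [h] with ε hε
  exact hε.congr (Eventually.of_forall fun h => secInt_neg F G J α β ε h)

theorem secInt_shift (F : ℝ × ℝ → ℝ) (G J) (φ α β : ℝ → ℝ) (ε h : ℝ) :
    secInt F G J (fun s => φ s + α s) (fun s => φ s + β s) ε h =
      secInt (fun p => F (p.1, φ p.1 + p.2)) ((fun p => (p.1, φ p.1 + p.2)) ⁻¹' G)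
        (fun p => J (p.1, φ p.1 + p.2)) α β ε h := by
  simp only [secInt]
  congr 1
  funext s
  rw [← intervalIntegral.integral_comp_add_left]
  rfl

theorem SecLP.shift {F : ℝ × ℝ → ℝ} {G J} {φ α β : ℝ → ℝ}
    (h : SecLP (fun p => F (p.1, φ p.1 + p.2)) ((fun p => (p.1, φ p.1 + p.2)) ⁻¹' G)
        (fun p => J (p.1, φ p.1 + p.2)) α β) :
    SecLP F G J (fun s => φ s + α s) (fun s => φ s + β s) := by
  filter_upwards [h] with ε hε
  exact hε.congr (Eventually.of_forall fun h => (secInt_shift F G J φ α β ε h).symm)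

/-- Change of sign of the second variable. -/
theorem SecLP.reflect {F : ℝ × ℝ → ℝ} {G J} {α β : ℝ → ℝ}
    (h : SecLP (fun p => F (p.1, -p.2)) ((fun p => (p.1, -p.2)) ⁻¹' G)
        (fun p => J (p.1, -p.2)) α β) :
    SecLP F G J (fun s => -α s) (fun s => -β s) := by
  filter_upwards [h] with ε hε
  refine hε.neg.congr (Eventually.of_forall fun h => ?_)
  simp only [secInt]
  rw [← intervalIntegral.integral_neg]
  congr 1
  funext s
  rw [← intervalIntegral.integral_symm]
  exact intervalIntegral.integral_comp_neg (fun y => kern F G J h (s, y))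

theorem secInt_eq_zero_of_le {F : ℝ × ℝ → ℝ} {G J} {α β : ℝ → ℝ} {ε h : ℝ} (hε : 0 ≤ ε)
    (hz : ∀ s ∈ Set.Ioc 0 ε, ∀ y ∈ Set.uIoc (α s) (β s), h ≤ |F (s, y)|) :
    secInt F G J α β ε h = 0 := by
  rw [secInt_eq_of_kern_eq_zero le_rfl hε fun s hs y hy => kern_eq_zero_of_le (hz s hs y hy)]
  simp [secInt]

theorem analyticAt_swap {p : ℝ × ℝ} : AnalyticAt ℝ (Prod.swap : ℝ × ℝ → ℝ × ℝ) p :=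
  analyticAt_snd.prod analyticAt_fst

theorem secLP_pow_const_right {V J : ℝ × ℝ → ℝ} (hV : AnalyticAt ℝ V 0) (hV0 : 0 < V 0)
    (hJ : AnalyticAt ℝ J 0) (M : ℕ) :
    ∀ᶠ c in 𝓝[>] (0 : ℝ), SecLP (fun p => p.1 ^ M * V p) Set.univ J (fun _ => 0) (fun _ => c) := by
  obtain ⟨m, hm0, hm⟩ := exists_between hV0
  obtain ⟨δ₂, hδ₂, hbox⟩ := exists_box_of_eventually (hV.continuousAt.eventually (lt_mem_nhds hm))
  have hF : AnalyticAt ℝ (fun p : ℝ × ℝ => p.1 ^ M * V p) 0 := (analyticAt_fst.pow M).mul hV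
  have hlow : ∀ {ε s y : ℝ}, 0 < ε → ε ≤ s → s < δ₂ → |y| < δ₂ → ε ^ M * m ≤ |s ^ M * V (s, y)| := by
    intro ε s y hε hs hsδ hy
    have hs0 : 0 < s := hε.trans_le hs
    have h1 := hbox s y (by rwa [abs_of_pos (hε.trans_le hs)]) hy
    rw [abs_of_pos (mul_pos (pow_pos (hε.trans_le hs) _) (hm0.trans h1))]
    gcongr
  rcases Nat.eq_zero_or_pos M with rfl | hM
  · filter_upwards [Ioo_mem_nhdsGT hδ₂] with c hc
    filter_upwards [Ioo_mem_nhdsGT hδ₂] with ε hε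
    refine IsLogPuiseux.zero.congr ?_
    filter_upwards [Ioo_mem_nhdsGT hm0] with h hh
    refine (secInt_eq_zero_of_le hε.1.le fun s hs y hy => ?_).symm
    rw [Set.uIoc_of_le hc.1.le] at hy
    have := hlow hs.1 le_rfl (hs.2.trans_lt hε.2)
      (y := y) (by rw [abs_of_pos hy.1]; exact hy.2.trans_lt hc.2)
    rw [pow_zero, one_mul] at this
    exact hh.2.le.trans this
  · obtain ⟨δ₁, hδ₁, hlp⟩ := secLP_monomial_pos (U := fun p => V p.swap) (J := fun p => J p.swap)
      (AnalyticAt.comp (g := V) hV analyticAt_swap) hV0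
          (AnalyticAt.comp (g := J) hJ analyticAt_swap)
      0 hM
    obtain ⟨δ₃, hδ₃, C, hnb⟩ := exists_niceBox (G := Set.univ) hF hJ
      (Eventually.of_forall fun p _ _ => by simp)
    obtain ⟨ε₁, hε₁, hεm⟩ := exists_between (lt_min hδ₁ (lt_min hδ₂ hδ₃))
    simp only [lt_min_iff] at hεm
    obtain ⟨he1, he2, he3⟩ := hεm
    filter_upwards [hlp (fun _ => ε₁) ⟨analyticAt_const, by rwa [abs_of_pos hε₁]⟩
      (Eventually.of_forall fun _ => hε₁), Ioo_mem_nhdsGT hε₁] with c hc hcI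
    filter_upwards [Ioo_mem_nhdsGT hε₁] with ε hε
    refine hc.congr ?_
    filter_upwards [Ioo_mem_nhdsGT (mul_pos (pow_pos hε.1 M) hm0)] with h hh
    rw [← secInt_eq_of_kern_eq_zero hε.1.le hε.2.le (fun s hs y hy => ?_),
      secInt_rect (hnb δ₃ δ₃ le_rfl le_rfl) hε₁.le he3 ⟨by linarith, by linarith⟩
        ⟨by linarith [hcI.1], by linarith [hcI.2]⟩]
    · simp only [secInt, pow_zero, one_mul]
      rfl
    · rw [Set.uIoc_of_le hcI.1.le] at hy
      exact kern_eq_zero_of_le (hh.2.le.trans (hlow hε.1 hs.1.le (hs.2.trans_lt he2)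
        (by rw [abs_of_pos hy.1]; linarith [hy.2, hcI.2])))

theorem eventually_secLP_nhds {F : ℝ × ℝ → ℝ} {G J}
    (h1 : ∀ᶠ c in 𝓝[>] (0 : ℝ), SecLP F G J (fun _ => 0) (fun _ => c))
    (h2 : ∀ᶠ c in 𝓝[>] (0 : ℝ), SecLP F G J (fun _ => 0) (fun _ => -c)) :
    ∀ᶠ c in 𝓝 (0 : ℝ), SecLP F G J (fun _ => 0) (fun _ => c) := by
  rw [eventually_nhdsWithin_iff] at h1 h2
  have h3 := (by simpa using (continuous_neg (G := ℝ)).tendsto 0 : Tendsto (fun x : ℝ => -x) (𝓝 0)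
      (𝓝 0))
  filter_upwards [h1, h3.eventually h2] with c h1 h2
  rcases lt_trichotomy c 0 with h | rfl | h
  · simpa using h2 (by simpa using h)
  · exact SecLP.refl ..
  · exact h1 h

theorem secLP_pow_const {V J : ℝ × ℝ → ℝ} {w : ℝ} (hV : AnalyticAt ℝ V (0, w)) (hV0 : V (0, w) ≠ 0)
    (hJ : AnalyticAt ℝ J (0, w)) (M : ℕ) :
    ∀ᶠ y in 𝓝 w, SecLP (fun p => p.1 ^ M * V p) Set.univ J (fun _ => w) (fun _ => y) := by
  wlog hpos : 0 < V (0, w) generalizing V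
  · have := this hV.neg (neg_ne_zero.2 hV0)
      (by simpa using lt_of_le_of_ne (not_lt.1 hpos) hV0)
    filter_upwards [this] with y hy
    exact SecLP.congr_neg (by simpa using hy)
  have hT : AnalyticAt ℝ (fun p : ℝ × ℝ => (p.1, w + p.2)) 0 :=
    analyticAt_fst.prod (analyticAt_const.add analyticAt_snd)
  have hT' : AnalyticAt ℝ (fun p : ℝ × ℝ => (p.1, w + -p.2)) 0 :=
    analyticAt_fst.prod (analyticAt_const.add analyticAt_snd.neg)
  have e : (fun p : ℝ × ℝ => (p.1, w + p.2)) 0 = (0, w) := by simp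
  have e' : (fun p : ℝ × ℝ => (p.1, w + -p.2)) 0 = (0, w) := by simp
  have key := eventually_secLP_nhds
    (secLP_pow_const_right (AnalyticAt.comp_of_eq hV hT e) (by simpa using hpos)
      (AnalyticAt.comp_of_eq hJ hT e) M) (by
    filter_upwards [secLP_pow_const_right (AnalyticAt.comp_of_eq hV hT' e') (by simpa using hpos)
      (AnalyticAt.comp_of_eq hJ hT' e') M] with c hc
    have := SecLP.reflect (F := fun p => p.1 ^ M * V (p.1, w + p.2)) (G := Set.univ)
      (J := fun p => J (p.1, w + p.2)) (α := fun _ => 0) (β := fun _ => c)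
          (by simpa [Function.comp_def] using hc)
    simpa [Function.comp_def] using this)
  have h3 : Tendsto (fun y : ℝ => y - w) (𝓝 w) (𝓝 0) := by
    have : ContinuousAt (fun y : ℝ => y - w) w := by fun_prop
    simpa [ContinuousAt] using this
  filter_upwards [h3.eventually key] with y hy
  have := SecLP.shift (F := fun p => p.1 ^ M * V p) (G := Set.univ) (J := J) (φ := fun _ => w) hy
  simpa using this

end

section

open Filter Topology MeasureTheory

theorem secLP_pow {U J : ℝ × ℝ → ℝ} (hU : AnalyticAt ℝ U 0) (hU0 : U 0 ≠ 0) (hJ : AnalyticAt ℝ J 0)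
    (M : ℕ) :
    ∃ δ > 0, ∀ α, CurveIn δ α → SecLP (fun p => p.1 ^ M * U p) Set.univ J 0 α := by
  obtain ⟨δ, hδ, hbox⟩ := exists_box_of_eventually
    ((hU.continuousAt.eventually_ne hU0).and
        (hU.eventually_analyticAt.and hJ.eventually_analyticAt))
  refine ⟨δ / 3, by positivity, fun α hα => ?_⟩
  set T : ℝ × ℝ → ℝ × ℝ := fun p => (p.1, α p.1 * p.2) with hT
  have hαf : ∀ w : ℝ, AnalyticAt ℝ (fun p : ℝ × ℝ => α p.1) (0, w) := fun w =>
    AnalyticAt.fun_comp (g := α) (f := Prod.fst) (x := ((0 : ℝ), w)) (by exact hα.1) analyticAt_fst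
  have hTan : ∀ w, AnalyticAt ℝ T (0, w) := fun w =>
    analyticAt_fst.prod ((hαf w).mul analyticAt_snd)
  have hmem : ∀ w ∈ Set.Icc (-2 : ℝ) 2, U (T (0, w)) ≠ 0 ∧ AnalyticAt ℝ U (T (0, w)) ∧
      AnalyticAt ℝ J (T (0, w)) := fun w hw => by
    refine hbox 0 (α 0 * w) (by simpa using hδ) ?_
    rw [abs_mul]
    have h1 := hα.2
    have h2 : |w| ≤ 2 := abs_le.2 hw
    nlinarith [abs_nonneg (α 0), abs_nonneg w]
  have hV : ∀ w ∈ Set.Icc (-2 : ℝ) 2, AnalyticAt ℝ (fun p => U (T p)) (0, w) := fun w hw =>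
    AnalyticAt.comp (hmem w hw).2.1 (hTan w)
  have hJ' : ∀ w ∈ Set.Icc (-2 : ℝ) 2, AnalyticAt ℝ (fun p => α p.1 * J (T p)) (0, w) := fun w hw =>
    (hαf w).mul (AnalyticAt.comp (hmem w hw).2.2 (hTan w))
  obtain ⟨ε₁, hε₁, C, nb⟩ := exists_niceBox_strip (F := fun p => p.1 ^ M * U (T p)) (G := Set.univ)
    (L := 2) (fun w hw => (analyticAt_fst.pow M).mul (hV w hw)) hJ'
    fun w _ => Eventually.of_forall fun p _ _ => by simp
  have h01 := SecLP.const_of_local (nb ε₁ le_rfl) hε₁ (fun w hw =>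
      secLP_pow_const (hV w (Set.Ioo_subset_Icc_self hw))
    (hmem w (Set.Ioo_subset_Icc_self hw)).1 (hJ' w (Set.Ioo_subset_Icc_self hw)) M)
    (a := 0) (b := 1) (by norm_num) (by norm_num)
  have := SecLP.scale (F := fun p => p.1 ^ M * U p) (G := Set.univ) (J := J) (m := α) h01
  simpa [Pi.zero_def] using this

theorem secInt_congr {F F' : ℝ × ℝ → ℝ} {G G' J J'} {α β : ℝ → ℝ} {ε h : ℝ} (hε : 0 ≤ ε)
    (H : ∀ s ∈ Set.Ioc 0 ε, ∀ y ∈ Set.uIoc (α s) (β s), kern F G J h (s, y) =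
        kern F' G' J' h (s, y)) :
    secInt F G J α β ε h = secInt F' G' J' α β ε h := by
  simp only [secInt]
  refine intervalIntegral.integral_congr_ae (ae_of_all _ fun s hs => ?_)
  rw [Set.uIoc_of_le hε] at hs
  exact intervalIntegral.integral_congr_ae (ae_of_all _ fun y hy => H s hs y hy)

theorem SecLP.congr_kern {F F' : ℝ × ℝ → ℝ} {G G' J J'} {α β : ℝ → ℝ} (hS : SecLP F G J α β)
    (H : ∀ᶠ s in 𝓝[>] (0 : ℝ), ∀ y ∈ Set.uIoc (α s) (β s), ∀ h,
      kern F G J h (s, y) = kern F' G' J' h (s, y)) : SecLP F' G' J' α β := by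
  filter_upwards [hS, eventually_nhdsGT_forall_Ioc H] with ε h1 h2
  exact h1.congr (Eventually.of_forall fun h => secInt_congr h2.1.le fun s hs y hy =>
      h2.2 s hs y hy h)

theorem SecLP.zero_integrand {F : ℝ × ℝ → ℝ} {G : Set (ℝ × ℝ)} {α β : ℝ → ℝ} :
    SecLP F G 0 α β := by
  refine Eventually.of_forall fun ε => IsLogPuiseux.zero.congr (Eventually.of_forall fun h => ?_)
  simp [secInt, kern]

theorem mem_iff_mem_of_locally {G B : Set (ℝ × ℝ)} (hB : IsPreconnected B)
    (h : ∀ p ∈ B, ∀ᶠ q in 𝓝 p, (q ∈ G ↔ p ∈ G)) {p q : ℝ × ℝ} (hp : p ∈ B) (hq : q ∈ B) :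
    p ∈ G ↔ q ∈ G :=
  hB.induction₂' (fun p q => (p ∈ G ↔ q ∈ G))
    (fun p hp => nhdsWithin_le_nhds ((h p hp).mono fun _ hq => ⟨hq.symm, hq⟩))
    (fun _ _ _ _ _ _ h1 h2 => h1.trans h2) hp hq

/-- The monomial case, on the positive side. -/
theorem secLP_monomial_of_pos {U J : ℝ × ℝ → ℝ} {G : Set (ℝ × ℝ)} (hU : AnalyticAt ℝ U 0)
    (hU0 : U 0 ≠ 0)
    (hJ : AnalyticAt ℝ J 0) (M d : ℕ)
    (hG : ∀ᶠ p in 𝓝 (0 : ℝ × ℝ), 0 < p.1 → 0 < p.2 → ∀ᶠ q in 𝓝 p, (q ∈ G ↔ p ∈ G)) :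
    ∃ δ > 0, ∀ α, CurveIn δ α → (∀ᶠ s in 𝓝[>] (0 : ℝ), 0 < α s) →
      SecLP (fun p => p.1 ^ M * p.2 ^ d * U p) G J 0 α := by
  have huniv : ∃ δ > 0, ∀ α, CurveIn δ α → (∀ᶠ s in 𝓝[>] (0 : ℝ), 0 < α s) →
      SecLP (fun p => p.1 ^ M * p.2 ^ d * U p) Set.univ J 0 α := by
    rcases Nat.eq_zero_or_pos d with rfl | hd
    · obtain ⟨δ, hδ, h⟩ := secLP_pow hU hU0 hJ M
      exact ⟨δ, hδ, fun α hα _ => by simpa using h α hα⟩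
    · rcases hU0.lt_or_gt with h | h
      · obtain ⟨δ, hδ, h⟩ := secLP_monomial_pos hU.neg (by simpa using h) hJ M hd
        exact ⟨δ, hδ, fun α hα hpos => SecLP.congr_neg (by simpa using h α hα hpos)⟩
      · exact secLP_monomial_pos hU h hJ M hd
  obtain ⟨δ₁, hδ₁, h1⟩ := huniv
  obtain ⟨δ₂, hδ₂, hbox⟩ := exists_box_of_eventually hG
  refine ⟨min δ₁ δ₂, lt_min hδ₁ hδ₂, fun α hα hpos => ?_⟩
  have hα1 : CurveIn δ₁ α := ⟨hα.1, hα.2.trans_le (min_le_left _ _)⟩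
  have hα2 : CurveIn δ₂ α := ⟨hα.1, hα.2.trans_le (min_le_right _ _)⟩
  have hB : IsPreconnected (Set.Ioo 0 δ₂ ×ˢ Set.Ioo 0 δ₂ : Set (ℝ × ℝ)) :=
    isPreconnected_Ioo.prod isPreconnected_Ioo
  have hloc : ∀ p ∈ (Set.Ioo 0 δ₂ ×ˢ Set.Ioo 0 δ₂ : Set (ℝ × ℝ)), ∀ᶠ q in 𝓝 p, (q ∈ G ↔ p ∈ G) :=
    fun p hp => hbox p.1 p.2 (by rw [abs_of_pos hp.1.1]; exact hp.1.2)
      (by rw [abs_of_pos hp.2.1]; exact hp.2.2) hp.1.1 hp.2.1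
  have hsec : ∀ᶠ s in 𝓝[>] (0 : ℝ), ∀ y ∈ Set.uIoc ((0 : ℝ → ℝ) s) (α s),
      ((s, y) : ℝ × ℝ) ∈ (Set.Ioo 0 δ₂ ×ˢ Set.Ioo 0 δ₂ : Set (ℝ × ℝ)) := by
    filter_upwards [eventually_section_of_box (P := fun p => |p.1| < δ₂ ∧ |p.2| < δ₂)
      (fun x y hx hy => ⟨hx, hy⟩) hα2 hpos] with s hs y hy
    rw [Pi.zero_apply, Set.uIoc_of_le hs.2.1.le] at hy
    have := hs.2.2 y ⟨hy.1.le, hy.2⟩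
    exact ⟨⟨hs.1, lt_of_abs_lt this.1⟩, hy.1, lt_of_abs_lt this.2⟩
  by_cases hne : ∃ p ∈ (Set.Ioo 0 δ₂ ×ˢ Set.Ioo 0 δ₂ : Set (ℝ × ℝ)), p ∈ G
  · obtain ⟨p, hp, hpG⟩ := hne
    refine (h1 α hα1 hpos).congr_kern ?_
    filter_upwards [hsec] with s hs y hy h
    have := (mem_iff_mem_of_locally hB hloc hp (hs y hy)).1 hpG
    simp only [kern, Set.indicator, Set.mem_ofPred_eq, Set.mem_univ, this, true_and]
  · push Not at hne
    refine SecLP.zero_integrand (F := 0) (G := Set.univ) |>.congr_kern ?_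
    filter_upwards [hsec] with s hs y hy h
    have := hne _ (hs y hy)
    simp [kern, this]

theorem eventually_sign_of_analyticAt {α : ℝ → ℝ} (hα : AnalyticAt ℝ α 0) :
    (∀ᶠ s in 𝓝[>] (0 : ℝ), α s = 0) ∨ (∀ᶠ s in 𝓝[>] (0 : ℝ), 0 < α s) ∨
      ∀ᶠ s in 𝓝[>] (0 : ℝ), α s < 0 := by
  rcases hα.eventually_eq_zero_or_eventually_ne_zero with h | h
  · exact Or.inl (nhdsWithin_le_nhds h)
  · right
    have h' : ∀ᶠ s in 𝓝[>] (0 : ℝ), α s ≠ 0 ∧ ContinuousAt α s := by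
      refine (h.filter_mono (nhdsWithin_mono _ fun s hs => ne_of_gt hs)).and ?_
      exact nhdsWithin_le_nhds (hα.eventually_analyticAt.mono fun s hs => hs.continuousAt)
    obtain ⟨η, hη, hη'⟩ := (eventually_nhdsGT_forall_Ioc h').exists
    have hI : Set.Ioc 0 η ∈ 𝓝[>] (0 : ℝ) := Ioc_mem_nhdsGT hη
    have hc : ContinuousOn α (Set.Ioc 0 η) := fun s hs => (hη' s hs).2.continuousWithinAt
    by_cases hp : ∃ s ∈ Set.Ioc 0 η, 0 < α s
    · obtain ⟨s, hs, hps⟩ := hp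
      left
      filter_upwards [hI] with t ht
      by_contra hcon
      obtain ⟨r, hr, hr0⟩ := isPreconnected_Ioc.intermediate_value ht hs hc ⟨not_lt.1 hcon, hps.le⟩
      exact (hη' r hr).1 hr0
    · push Not at hp
      right
      filter_upwards [hI] with t ht
      exact lt_of_le_of_ne (hp t ht) (hη' t ht).1

theorem LocConst.comp {F : ℝ × ℝ → ℝ} {G : Set (ℝ × ℝ)} (hG : LocConst F G) {T : ℝ × ℝ → ℝ × ℝ}
    {p₀ : ℝ × ℝ} (hT : AnalyticAt ℝ T p₀) (hT0 : T p₀ = 0) (hpos : ∀ p, 0 < p.1 → 0 < (T p).1) :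
    ∀ᶠ p in 𝓝 p₀, 0 < p.1 → F (T p) ≠ 0 → ∀ᶠ q in 𝓝 p, (q ∈ T ⁻¹' G ↔ p ∈ T ⁻¹' G) := by
  have h1 : Tendsto T (𝓝 p₀) (𝓝 0) := by simpa [ContinuousAt, hT0] using hT.continuousAt
  filter_upwards [h1.eventually hG, hT.eventually_analyticAt] with p hp hc hp1 hF
  exact hc.continuousAt.eventually (hp (hpos p hp1) hF)

/-- All sector integrals bounded by curves through a neighbourhood of the origin are log-Puiseux. -/
def SectorGood (F : ℝ × ℝ → ℝ) : Prop :=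
  ∀ J : ℝ × ℝ → ℝ, AnalyticAt ℝ J 0 → ∀ G, LocConst F G →
    ∃ δ > 0, ∀ α, CurveIn δ α → SecLP F G J 0 α

theorem analyticAt_neg_snd {p : ℝ × ℝ} : AnalyticAt ℝ (fun p : ℝ × ℝ => (p.1, -p.2)) p :=
  analyticAt_fst.prod analyticAt_snd.neg

/-- It suffices to integrate over the positive side, for `F` and its mirror image. -/
theorem SectorGood.of_pos {F : ℝ × ℝ → ℝ}
    (h1 : ∀ J : ℝ × ℝ → ℝ, AnalyticAt ℝ J 0 → ∀ G, LocConst F G →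
      ∃ δ > 0, ∀ α, CurveIn δ α → (∀ᶠ s in 𝓝[>] (0 : ℝ), 0 < α s) → SecLP F G J 0 α)
    (h2 : ∀ J : ℝ × ℝ → ℝ, AnalyticAt ℝ J 0 → ∀ G, LocConst (fun p => F (p.1, -p.2)) G →
      ∃ δ > 0, ∀ α, CurveIn δ α → (∀ᶠ s in 𝓝[>] (0 : ℝ), 0 < α s) →
        SecLP (fun p => F (p.1, -p.2)) G J 0 α) :
    SectorGood F := by
  intro J hJ G hG
  obtain ⟨δ₁, hδ₁, H1⟩ := h1 J hJ G hG
  obtain ⟨δ₂, hδ₂, H2⟩ := h2 (fun p => J (p.1, -p.2))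
    (AnalyticAt.comp_of_eq hJ analyticAt_neg_snd (by simp)) _
    (hG.comp analyticAt_neg_snd (by simp) fun _ h => h)
  refine ⟨min δ₁ δ₂, lt_min hδ₁ hδ₂, fun α hα => ?_⟩
  rcases eventually_sign_of_analyticAt hα.1 with h | h | h
  · refine (SecLP.zero_integrand (F := 0) (G := Set.univ)).congr_kern ?_
    filter_upwards [h] with s hs y hy
    simp [hs] at hy
  · exact H1 α ⟨hα.1, hα.2.trans_le (min_le_left _ _)⟩ h
  · have := (H2 (fun s => -α s) ⟨hα.1.neg, by simpa using hα.2.trans_le (min_le_right _ _)⟩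
      (by simpa using h)).reflect
    simpa [Pi.zero_def] using this

theorem SectorGood.monomial {U : ℝ × ℝ → ℝ} (hU : AnalyticAt ℝ U 0) (hU0 : U 0 ≠ 0) (M d : ℕ) :
    SectorGood fun p => p.1 ^ M * p.2 ^ d * U p := by
  have aux : ∀ {U : ℝ × ℝ → ℝ}, AnalyticAt ℝ U 0 → U 0 ≠ 0 → ∀ J : ℝ × ℝ → ℝ, AnalyticAt ℝ J 0 →
      ∀ G, LocConst (fun p => p.1 ^ M * p.2 ^ d * U p) G →
      ∃ δ > 0, ∀ α, CurveIn δ α → (∀ᶠ s in 𝓝[>] (0 : ℝ), 0 < α s) →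
        SecLP (fun p => p.1 ^ M * p.2 ^ d * U p) G J 0 α := by
    intro U hU hU0 J hJ G hG
    refine secLP_monomial_of_pos hU hU0 hJ M d ?_
    filter_upwards [hG, hU.continuousAt.eventually_ne hU0] with p hp hUp h1 h2
    exact hp h1 (by positivity)
  refine SectorGood.of_pos (aux hU hU0) ?_
  have := aux (U := fun p => (-1) ^ d * U (p.1, -p.2))
    (analyticAt_const.mul (AnalyticAt.comp_of_eq hU analyticAt_neg_snd (by simp)))
    (by simpa [Prod.mk_zero_zero] using hU0)
  have e : (fun p : ℝ × ℝ => p.1 ^ M * p.2 ^ d * ((-1) ^ d * U (p.1, -p.2))) =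
      fun p => p.1 ^ M * (-p.2) ^ d * U (p.1, -p.2) := by
    funext p
    rw [neg_pow p.2]
    ring
  rwa [e] at this

end

section

open Filter Topology MeasureTheory

theorem integral_triangle_swap {f : ℝ × ℝ → ℝ} {κ c : ℝ} (hκ : 0 < κ) (hc : 0 < c)
    (hf : IntegrableOn f (Set.Ioc 0 (κ * c) ×ˢ Set.Ioc 0 c)) :
    ∫ s in (0 : ℝ)..κ * c, ∫ a in s / κ..c, f (s, a) = ∫ a in (0 : ℝ)..c, ∫ s in (0 : ℝ)..κ * a,
      f (s, a) := by
  classical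
  have hA : MeasurableSet {p : ℝ × ℝ | p.1 ≤ κ * p.2} :=
    measurableSet_le measurable_fst (measurable_snd.const_mul κ)
  have hκc : 0 < κ * c := mul_pos hκ hc
  set k : ℝ × ℝ → ℝ := {p : ℝ × ℝ | p.1 ≤ κ * p.2}.indicator f with hk
  have hki : IntegrableOn k (Set.uIoc 0 (κ * c) ×ˢ Set.uIoc 0 c) := by
    rw [Set.uIoc_of_le hκc.le, Set.uIoc_of_le hc.le]
    exact hf.indicator hA
  have hsw := intervalIntegral_intervalIntegral_swap (F := fun s a => k (s, a)) hki
  have h1 : ∀ s ∈ Set.Ioc 0 (κ * c), ∫ a in s / κ..c, f (s, a) = ∫ a in (0 : ℝ)..c, k (s, a) := by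
    intro s hs
    have hs' : s / κ ≤ c := by rw [div_le_iff₀' hκ]; exact hs.2
    have hs0 : 0 < s / κ := div_pos hs.1 hκ
    rw [intervalIntegral.integral_of_le hs', intervalIntegral.integral_of_le hc.le,
      ← integral_Icc_eq_integral_Ioc]
    have e : ∀ a, k (s, a) = (Set.Ici (s / κ)).indicator (fun a => f (s, a)) a := fun a => by
      simp only [hk, Set.indicator_apply, Set.mem_ofPred_eq, Set.mem_Ici, div_le_iff₀' hκ]
    simp only [e]
    rw [setIntegral_indicator measurableSet_Ici]
    congr 2
    ext a
    simp only [Set.mem_Icc, Set.mem_inter_iff, Set.mem_Ioc, Set.mem_Ici]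
    constructor
    · rintro ⟨h1, h2⟩; exact ⟨⟨hs0.trans_le h1, h2⟩, h1⟩
    · rintro ⟨⟨_, h2⟩, h1⟩; exact ⟨h1, h2⟩
  have h2 : ∀ a ∈ Set.Ioc 0 c, ∫ s in (0 : ℝ)..κ * c, k (s, a) = ∫ s in (0 : ℝ)..κ * a, f (s, a) := by
    intro a ha
    have ha' : 0 ≤ κ * a := (mul_pos hκ ha.1).le
    rw [intervalIntegral.integral_of_le hκc.le, intervalIntegral.integral_of_le ha']
    have e : ∀ s, k (s, a) = (Set.Iic (κ * a)).indicator (fun s => f (s, a)) s := fun s => by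
      simp only [hk, Set.indicator_apply, Set.mem_ofPred_eq, Set.mem_Iic]
    simp only [e]
    rw [setIntegral_indicator measurableSet_Iic]
    congr 2
    ext s
    simp only [Set.mem_inter_iff, Set.mem_Ioc, Set.mem_Iic]
    constructor
    · rintro ⟨⟨h1, _⟩, h2⟩; exact ⟨h1, h2⟩
    · rintro ⟨h1, h2⟩
      exact ⟨⟨h1, h2.trans (mul_le_mul_of_nonneg_left ha.2 hκ.le)⟩, h2⟩
  rw [intervalIntegral.integral_congr_ae (ae_of_all _ fun s hs => h1 s (by
      rwa [Set.uIoc_of_le hκc.le] at hs)), hsw]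
  exact intervalIntegral.integral_congr_ae (ae_of_all _ fun a ha => h2 a (by
      rwa [Set.uIoc_of_le hc.le] at ha))

theorem eventually_uIcc_of_box {P : ℝ × ℝ → Prop} {δ : ℝ}
    (hP : ∀ x y, |x| < δ → |y| < δ → P (x, y)) {α β : ℝ → ℝ} (hα : CurveIn δ α) (hβ : CurveIn δ β) :
    ∀ᶠ s in 𝓝[>] (0 : ℝ), ∀ y ∈ Set.uIcc (α s) (β s), P (s, y) := by
  have hδ : 0 < δ := (abs_nonneg _).trans_lt hα.2
  have h1 : ∀ᶠ s in 𝓝[>] (0 : ℝ), |α s| < δ ∧ |β s| < δ := nhdsWithin_le_nhds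
    ((hα.1.continuousAt.abs.eventually_lt continuousAt_const hα.2).and
      (hβ.1.continuousAt.abs.eventually_lt continuousAt_const hβ.2))
  filter_upwards [h1, Ioo_mem_nhdsGT hδ] with s h1 h3 y hy
  refine hP s y (by rw [abs_of_pos h3.1]; exact h3.2) ?_
  exact abs_lt.2 (Set.ordConnected_Ioo.uIcc_subset (abs_lt.1 h1.1) (abs_lt.1 h1.2) hy)

theorem SecLP.congr_curve {F : ℝ × ℝ → ℝ} {G J} {α β α' β' : ℝ → ℝ} (h : SecLP F G J α β)
    (hα : α =ᶠ[𝓝[>] 0] α') (hβ : β =ᶠ[𝓝[>] 0] β') : SecLP F G J α' β' := by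
  filter_upwards [h, eventually_nhdsGT_forall_Ioc (hα.and hβ)] with ε h1 h2
  refine h1.congr (Eventually.of_forall fun h => ?_)
  refine intervalIntegral.integral_congr_ae (ae_of_all _ fun s hs => ?_)
  rw [Set.uIoc_of_le h2.1.le] at hs
  rw [(h2.2 s hs).1, (h2.2 s hs).2]

theorem CurveIn.zero {δ : ℝ} (hδ : 0 < δ) : CurveIn δ 0 := ⟨analyticAt_const, by simpa using hδ⟩

theorem CurveIn.const {δ c : ℝ} (hc : |c| < δ) : CurveIn δ fun _ => c := ⟨analyticAt_const, hc⟩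

theorem CurveIn.mono {δ δ' : ℝ} {α : ℝ → ℝ} (h : CurveIn δ α) (hδ : δ ≤ δ') : CurveIn δ' α :=
  ⟨h.1, h.2.trans_le hδ⟩

theorem SectorGood.congr {F F' : ℝ × ℝ → ℝ} (h : F =ᶠ[𝓝 0] F')
    (hF : SectorGood F) : SectorGood F' := by
  intro J hJ G hG
  have hG' : LocConst F G := by
    filter_upwards [hG, h] with p hp he h1 h2
    exact hp h1 (he ▸ h2)
  obtain ⟨δ₁, hδ₁, H⟩ := hF J hJ G hG'
  obtain ⟨δ₂, hδ₂, hbox⟩ := exists_box_of_eventually h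
  refine ⟨min δ₁ δ₂, lt_min hδ₁ hδ₂, fun α hα => ?_⟩
  refine (H α (hα.mono (min_le_left _ _))).congr_kern ?_
  filter_upwards [eventually_uIcc_of_box (P := fun p => F p = F' p) hbox (CurveIn.zero hδ₂)
    (hα.mono (min_le_right _ _))] with s hs y hy h
  have := hs y (Set.uIoc_subset_uIcc hy)
  classical
  simp only [kern, Set.indicator_apply, Set.mem_ofPred_eq, this]

theorem SectorGood.exists_secLP {F J : ℝ × ℝ → ℝ} {G : Set (ℝ × ℝ)} (hF : SectorGood F)
    (hFa : AnalyticAt ℝ F 0) (hJ : AnalyticAt ℝ J 0) (hG : LocConst F G) :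
    ∃ δ > 0, ∀ α β, CurveIn δ α → CurveIn δ β → SecLP F G J α β := by
  obtain ⟨δ₁, hδ₁, h1⟩ := hF J hJ G hG
  obtain ⟨δ₂, hδ₂, h2⟩ := SecLP.exists_trans hFa hJ hG
  refine ⟨min δ₁ δ₂, lt_min hδ₁ hδ₂, fun α β hα hβ => ?_⟩
  exact h2 α 0 β (hα.mono (min_le_right _ _)) (CurveIn.zero hδ₂) (hβ.mono (min_le_right _ _))
    (h1 α (hα.mono (min_le_left _ _))).symm (h1 β (hβ.mono (min_le_left _ _)))

theorem SectorGood.shift {F : ℝ × ℝ → ℝ} {φ : ℝ → ℝ} (hFa : AnalyticAt ℝ F 0)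
    (hφ : AnalyticAt ℝ φ 0)
    (hφ0 : φ 0 = 0) (hF : SectorGood fun p => F (p.1, φ p.1 + p.2)) : SectorGood F := by
  intro J hJ G hG
  have hφ1 : AnalyticAt ℝ (fun p : ℝ × ℝ => φ p.1) 0 :=
    AnalyticAt.fun_comp (g := φ) (f := Prod.fst) (x := (0 : ℝ × ℝ)) (by exact hφ) analyticAt_fst
  have hT : AnalyticAt ℝ (fun p : ℝ × ℝ => (p.1, φ p.1 + p.2)) 0 :=
    analyticAt_fst.prod (hφ1.add analyticAt_snd)
  have hT0 : (fun p : ℝ × ℝ => (p.1, φ p.1 + p.2)) (0 : ℝ × ℝ) = 0 := by simp [hφ0]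
  obtain ⟨δ, hδ, H⟩ := hF.exists_secLP (J := fun p => J (p.1, φ p.1 + p.2))
    (AnalyticAt.comp_of_eq hFa hT hT0) (AnalyticAt.comp_of_eq hJ hT hT0)
        (hG.comp hT hT0 fun _ h => h)
  refine ⟨δ, hδ, fun α hα => ?_⟩
  have := (H (fun s => -φ s) (fun s => α s - φ s) ⟨hφ.neg, by simpa [hφ0] using hδ⟩
    ⟨hα.1.sub hφ, by simpa [hφ0] using hα.2⟩).shift
  simpa [Pi.zero_def] using this

theorem SectorGood.reflect {F : ℝ × ℝ → ℝ} (hF : SectorGood F) : SectorGood fun p =>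
    F (p.1, -p.2) := by
  intro J hJ G hG
  have hG' : LocConst F ((fun p : ℝ × ℝ => (p.1, -p.2)) ⁻¹' G) := by
    have := hG.comp (p₀ := 0) analyticAt_neg_snd (by simp) fun _ h => h
    simpa [LocConst] using this
  obtain ⟨δ, hδ, H⟩ := hF (fun p => J (p.1, -p.2))
      (AnalyticAt.comp_of_eq hJ analyticAt_neg_snd (by simp))
    _ hG'
  refine ⟨δ, hδ, fun α hα => ?_⟩
  have := SecLP.reflect (F := fun p => F (p.1, -p.2)) (G := G) (J := J) (α := fun _ => 0)
    (β := fun s => -α s) (by simpa [Pi.zero_def] using H (fun s => -α s) ⟨hα.1.neg,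
        by simpa using hα.2⟩)
  simpa [Pi.zero_def] using this

theorem secInt_ramify (F : ℝ × ℝ → ℝ) (G J) (α β : ℝ → ℝ) {N : ℕ} (hN : 0 < N) {ε : ℝ} (hε : 0 ≤ ε)
    (h : ℝ) :
    secInt F G J α β (ε ^ N) h =
      secInt (fun p => F (p.1 ^ N, p.2)) ((fun p => (p.1 ^ N, p.2)) ⁻¹' G)
        (fun p => N * p.1 ^ (N - 1) * J (p.1 ^ N, p.2)) (fun s => α (s ^ N))
            (fun s => β (s ^ N)) ε h := by
  have h1 := intervalIntegral_substitution (f := fun s => s ^ N) (f' := fun s => N * s ^ (N - 1))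
    (g := fun s => ∫ y in α s..β s, kern F G J h (s, y)) hε (by simp [hN.ne'])
    (fun y _ => hasDerivAt_pow N y) (fun y hy => by have := hy.1; positivity)
  beta_reduce at h1
  simp only [secInt]
  rw [← h1]
  congr 1
  funext s
  rw [← intervalIntegral.integral_const_mul]
  congr 1
  funext y
  exact (kern_comp_mul F G J h (fun p => (p.1 ^ N, p.2)) (fun p => N * p.1 ^ (N - 1)) (s, y)).symm

theorem SectorGood.ramify {F : ℝ × ℝ → ℝ} {N : ℕ} (hN : 0 < N)
    (hF : SectorGood fun p => F (p.1 ^ N, p.2)) : SectorGood F := by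
  intro J hJ G hG
  have hT0 : (fun p : ℝ × ℝ => (p.1 ^ N, p.2)) (0 : ℝ × ℝ) = 0 := by simp [hN.ne']
  obtain ⟨δ, hδ, H⟩ := hF (fun p => N * p.1 ^ (N - 1) * J (p.1 ^ N, p.2))
    ((analyticAt_const.mul (analyticAt_fst.pow _)).mul
        (AnalyticAt.comp_of_eq hJ analyticAt_ramify hT0))
    _ (hG.comp analyticAt_ramify hT0 fun p hp => pow_pos hp N)
  refine ⟨δ, hδ, fun α hα => ?_⟩
  have h1 := H (fun s => α (s ^ N)) ⟨hα.1.comp_pow hN, by simpa [hN.ne'] using hα.2⟩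
  have ht := tendsto_rpow_nhdsGT (r := 1 / (N : ℝ)) (by positivity)
  filter_upwards [ht.eventually h1, self_mem_nhdsWithin] with ε hε hε0
  have hε0 : 0 < ε := hε0
  have e : (ε ^ (1 / (N : ℝ))) ^ N = ε := by
    rw [← Real.rpow_natCast, ← Real.rpow_mul hε0.le, one_div_mul_cancel (by positivity),
        Real.rpow_one]
  refine hε.congr (Eventually.of_forall fun h => ?_)
  have := secInt_ramify F G J 0 α hN (ε := ε ^ (1 / (N : ℝ))) (by positivity) h
  rw [e] at this
  exact this.symm

end

section

open Filter Topology MeasureTheory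

theorem AnalyticAt.exists_eq_mul {α : ℝ → ℝ} (hα : AnalyticAt ℝ α 0) (h0 : α 0 = 0) :
    ∃ β : ℝ → ℝ, AnalyticAt ℝ β 0 ∧ ∀ s, α s = s * β s := by
  obtain ⟨p, hp⟩ := hα
  refine ⟨dslope α 0, hp.has_fpower_series_dslope_fslope.analyticAt, fun s => ?_⟩
  have := sub_smul_dslope α 0 s
  rw [sub_zero, h0, sub_zero, smul_eq_mul] at this
  exact this.symm

theorem secLP_const_add_of_sectorGood {F J : ℝ × ℝ → ℝ} {G : Set (ℝ × ℝ)} {c : ℝ}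
    (hF : SectorGood fun p => F (p.1, c + p.2)) (hJ : AnalyticAt ℝ J (0, c))
    (hG : ∀ᶠ p in 𝓝 ((0 : ℝ), c), 0 < p.1 → F p ≠ 0 → ∀ᶠ q in 𝓝 p, (q ∈ G ↔ p ∈ G)) :
    ∃ δ > 0, ∀ α, CurveIn δ α → SecLP F G J (fun _ => c) (fun s => c + α s) := by
  have hT : AnalyticAt ℝ (fun p : ℝ × ℝ => (p.1, c + p.2)) 0 :=
    analyticAt_fst.prod (analyticAt_const.add analyticAt_snd)
  have hT0 : (fun p : ℝ × ℝ => (p.1, c + p.2)) (0 : ℝ × ℝ) = (0, c) := by simp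
  have hT1 : Tendsto (fun p : ℝ × ℝ => (p.1, c + p.2)) (𝓝 0) (𝓝 (0, c)) := by
    simpa [ContinuousAt] using hT.continuousAt
  obtain ⟨δ, hδ, H⟩ := hF (fun p => J (p.1, c + p.2)) (AnalyticAt.comp_of_eq hJ hT hT0)
    ((fun p => (p.1, c + p.2)) ⁻¹' G) (by
      filter_upwards [hT1.eventually hG] with p hp h1 h2
      have hc : ContinuousAt (fun p : ℝ × ℝ => (p.1, c + p.2)) p := by fun_prop
      exact hc.eventually (hp h1 h2))
  refine ⟨δ, hδ, fun α hα => ?_⟩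
  have := SecLP.shift (F := F) (φ := fun _ => c) (H α hα)
  simpa using this

/-- Sectors between two curves tangent to no vertical line,
in terms of all the charts of a blow-up. -/
theorem secLP_of_blowup {F J : ℝ × ℝ → ℝ} {G : Set (ℝ × ℝ)} (hFa : AnalyticAt ℝ F 0)
    (hJ : AnalyticAt ℝ J 0) (hG : LocConst F G)
    (hblow : ∀ c : ℝ, SectorGood fun p => F (p.1, p.1 * (c + p.2)))
    {α : ℝ → ℝ} (hα : AnalyticAt ℝ α 0) (hα0 : α 0 = 0) : SecLP F G J 0 α := by
  obtain ⟨β, hβ, hαβ⟩ := hα.exists_eq_mul hα0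
  set T : ℝ × ℝ → ℝ × ℝ := fun p => (p.1, p.1 * p.2) with hTdef
  have hT : ∀ w : ℝ, AnalyticAt ℝ T (0, w) := fun w =>
      analyticAt_fst.prod (analyticAt_fst.mul analyticAt_snd)
  have hT0 : ∀ w : ℝ, T (0, w) = 0 := fun w => by simp [T]
  have hF' : ∀ w : ℝ, AnalyticAt ℝ (fun p => F (T p)) (0, w) := fun w =>
    AnalyticAt.comp_of_eq hFa (hT w) (hT0 w)
  have hJ' : ∀ w : ℝ, AnalyticAt ℝ (fun p => p.1 * J (T p)) (0, w) := fun w =>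
    analyticAt_fst.mul (AnalyticAt.comp_of_eq hJ (hT w) (hT0 w))
  have hG' := fun w : ℝ => hG.comp (hT w) (hT0 w) fun _ h => h
  have hloc := fun c : ℝ => secLP_const_add_of_sectorGood (F := fun p => F (T p)) (hblow c) (hJ' c)
      (hG' c)
  set L : ℝ := |β 0| + 1
  have hβL : CurveIn L β := ⟨hβ, by simp [L]⟩
  obtain ⟨ε₁, hε₁, C, nb⟩ := exists_niceBox_strip (F := fun p => F (T p)) (G := T ⁻¹' G) (L := L)
    (fun w _ => hF' w) (fun w _ => hJ' w) (fun w _ => hG' w)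
  have h0 : (0 : ℝ) ∈ Set.Ioo (-L) L := by
    have := abs_nonneg (β 0)
    constructor <;> simp only [L] <;> linarith
  have hb : β 0 ∈ Set.Ioo (-L) L := abs_lt.1 hβL.2
  have h1 := SecLP.const_of_local (nb ε₁ le_rfl) hε₁ (fun w _ => by
    obtain ⟨δ, hδ, H⟩ := hloc w
    filter_upwards [Metric.ball_mem_nhds w hδ] with y hy
    have := H (fun _ => y - w) (CurveIn.const (by rwa [Metric.mem_ball, Real.dist_eq] at hy))
    simpa using this) h0 hb
  have h2 : SecLP (fun p => F (T p)) (T ⁻¹' G) (fun p => p.1 * J (T p)) (fun _ => β 0) β := by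
    obtain ⟨δ, hδ, H⟩ := hloc (β 0)
    have := H (fun s => β s - β 0) ⟨hβ.sub analyticAt_const, by simpa using hδ⟩
    simpa using this
  obtain ⟨ε₂, hε₂⟩ := (hβL.eventually.and (Ioo_mem_nhdsGT hε₁)).exists
  have h3 := h1.trans_of_niceBox (nb ε₂ hε₂.2.2.le) hε₂.2.1 ⟨continuousOn_const, fun _ _ => h0⟩
    ⟨continuousOn_const, fun _ _ => hb⟩ hε₂.1 h2
  refine (SecLP.scale (F := F) (G := G) (J := J) (m := fun s => s) h3).congr_curve ?_ ?_
  · exact Eventually.of_forall fun s => by simp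
  · exact Eventually.of_forall fun s => (hαβ s).symm

/-- The sector between a steep line and a parallel to the first axis,
by exchanging the variables. -/
theorem exists_secLP_line_const {F J g : ℝ × ℝ → ℝ} {G : Set (ℝ × ℝ)} {m n : ℕ}
    (hFa : AnalyticAt ℝ F 0)
    (hJ : AnalyticAt ℝ J 0) (hG : LocConst F G) (hg : AnalyticAt ℝ g 0) (hg0 : g 0 ≠ 0)
    (hFg : ∀ᶠ p in 𝓝 (0 : ℝ × ℝ), F (p.1 * p.2, p.2) = p.1 ^ m * p.2 ^ n * g p) :
    ∃ κ > 0, ∀ᶠ c in 𝓝[>] (0 : ℝ), SecLP F G J (fun s => s / κ) (fun _ => c) := by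
  set T : ℝ × ℝ → ℝ × ℝ := fun p => (p.2 * p.1, p.1) with hTdef
  have hT : AnalyticAt ℝ T 0 := (analyticAt_snd.mul analyticAt_fst).prod analyticAt_fst
  have hT0 : T 0 = 0 := by simp [T]
  have hTt : Tendsto T (𝓝 0) (𝓝 0) := by simpa [ContinuousAt, hT0] using hT.continuousAt
  have hsw : Tendsto (Prod.swap : ℝ × ℝ → ℝ × ℝ) (𝓝 0) (𝓝 0) := by
    have := (continuous_swap (X := ℝ) (Y := ℝ)).tendsto 0
    simpa using this
  have hFg' := hsw.eventually hFg
  have hgsw : AnalyticAt ℝ (fun p : ℝ × ℝ => g p.swap) 0 :=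
      AnalyticAt.comp (g := g) hg analyticAt_swap
  have hgne : ∀ᶠ p in 𝓝 (0 : ℝ × ℝ), g p.swap ≠ 0 := hgsw.continuousAt.eventually_ne hg0
  obtain ⟨m₀, hm₀, hm₀'⟩ := exists_between (abs_pos.2 hg0)
  have hglow : ∀ᶠ p in 𝓝 (0 : ℝ × ℝ), m₀ < |g p.swap| :=
    hgsw.continuousAt.abs.eventually (lt_mem_nhds hm₀')
  obtain ⟨δ₁, hδ₁, H⟩ := secLP_monomial_of_pos (U := fun p => g p.swap) (G := T ⁻¹' G)
    (J := fun p => p.1 * J (T p)) hgsw hg0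
    (analyticAt_fst.mul (AnalyticAt.comp_of_eq hJ hT hT0)) n m (by
      filter_upwards [hTt.eventually hG, hgne, hFg'] with p h1 h2 h3 h4 h5
      have hF : F (T p) ≠ 0 := by
        have : F (T p) = _ := h3
        rw [this]
        simp only [Prod.fst_swap, Prod.snd_swap]
        positivity
      have hc : ContinuousAt T p := by fun_prop
      exact hc.eventually (h1 (mul_pos h5 h4) hF))
  obtain ⟨δ₂, hδ₂, hbox⟩ := exists_box_of_eventually (hglow.and hFg')
  obtain ⟨δ₃, hδ₃, C, hnb⟩ := exists_niceBox hFa hJ hG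
  obtain ⟨κ, hκ, hκ'⟩ := exists_between (lt_min hδ₁ (lt_min hδ₂ one_pos))
  simp only [lt_min_iff] at hκ'
  obtain ⟨hκ1, hκ2, hκ3⟩ := hκ'
  refine ⟨κ, hκ, ?_⟩
  filter_upwards [H (fun _ => κ) (CurveIn.const (by rwa [abs_of_pos hκ]))
      (Eventually.of_forall fun _ => hκ),
    Ioo_mem_nhdsGT hδ₂, Ioo_mem_nhdsGT hδ₃] with c hc hc2 hc3
  have hc0 : 0 < c := hc2.1
  have hκc : 0 < κ * c := mul_pos hκ hc0
  have hint : ∀ h, IntegrableOn (kern F G J h) (Set.Ioc 0 (κ * c) ×ˢ Set.Ioc 0 c) := fun h => by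
    refine ((hnb δ₃ δ₃ le_rfl le_rfl).integrableOn_prod h).mono_set (Set.prod_mono ?_ ?_)
    · exact fun s hs => ⟨hs.1, by nlinarith [hs.2, hc3.2]⟩
    · exact fun y hy => ⟨by linarith [hy.1], hy.2.trans_lt hc3.2⟩
  have hlow : ∀ {s y : ℝ}, 0 < s → s ≤ κ * y → y ≤ c → (s / c) ^ m * (s / κ) ^ n * m₀ ≤
      |F (s, y)| := by
    intro s y hs hsy hy
    have hy0 : 0 < y := pos_of_mul_pos_right (hs.trans_le hsy) hκ.le
    have hz : s / y ≤ κ := by rwa [div_le_iff₀ hy0]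
    have hz0 : 0 < s / y := div_pos hs hy0
    obtain ⟨h1, h2⟩ := hbox y (s / y) (by rw [abs_of_pos hy0]; exact hy.trans_lt hc2.2)
      (by rw [abs_of_pos hz0]; exact hz.trans_lt hκ2)
    simp only [Prod.swap_prod_mk, div_mul_cancel₀ _ hy0.ne'] at h1 h2
    rw [h2, abs_mul, abs_of_pos (by positivity)]
    have h3 : s / c ≤ s / y := by gcongr
    have h4 : s / κ ≤ y := by rwa [div_le_iff₀' hκ]
    gcongr
  filter_upwards [Ioo_mem_nhdsGT hκc] with ε hε
  have hε0 : 0 < ε := hε.1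
  refine hc.congr ?_
  filter_upwards [Ioo_mem_nhdsGT (show 0 < (ε / c) ^ m * (ε / κ) ^ n * m₀ by positivity)] with h hh
  rw [← secInt_eq_of_kern_eq_zero hε.1.le hε.2.le (fun s hs y hy => ?_)]
  · simp only [secInt]
    rw [integral_triangle_swap hκ hc0 (hint h)]
    refine intervalIntegral.integral_congr_ae (ae_of_all _ fun a ha => ?_)
    rw [Set.uIoc_of_le hc0.le] at ha
    rw [mul_comm κ a]
    have := intervalIntegral.smul_integral_comp_mul_left (a := 0) (b := κ)
        (fun s => kern F G J h (s, a)) a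
    rw [mul_zero] at this
    rw [← this, smul_eq_mul, ← intervalIntegral.integral_const_mul]
    refine intervalIntegral.integral_congr_ae (ae_of_all _ fun b hb => ?_)
    rw [Pi.zero_apply, Set.uIoc_of_le hκ.le] at hb
    have e := kern_comp_mul F G J h T (fun p => p.1) (a, b)
    simp only [hTdef] at e
    rw [mul_comm a b, ← e]
    have hFe : F (T (a, b)) = a ^ n * b ^ m * g (b, a) := by
      have := (hbox a b (by rw [abs_of_pos ha.1]; exact ha.2.trans_lt hc2.2)
        (by rw [abs_of_pos hb.1]; exact hb.2.trans_lt hκ2)).2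
      simp only [Prod.swap_prod_mk] at this
      rw [mul_comm (a ^ n)]
      exact this
    classical
    simp only [kern, Set.indicator_apply, Set.mem_ofPred_eq, ← hFe, Prod.swap_prod_mk]
    rfl
  · have hsc : s / κ ≤ c := by rw [div_le_iff₀' hκ]; exact hs.2
    rw [Set.uIoc_of_le hsc] at hy
    have hs0 : 0 < s := hε0.trans hs.1
    refine kern_eq_zero_of_le (hh.2.le.trans (le_trans ?_ (hlow hs0 ?_ hy.2)))
    · have := hs.1.le
      gcongr
    · rw [← div_le_iff₀' hκ]; exact hy.1.le

end

section

open Filter Topology MeasureTheory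

theorem exists_secLP_of_blowup_of_pos {F g : ℝ × ℝ → ℝ} {m n : ℕ} (hFa : AnalyticAt ℝ F 0)
    (hg : AnalyticAt ℝ g 0) (hg0 : g 0 ≠ 0)
    (hFg : ∀ᶠ p : ℝ × ℝ in 𝓝 0, F (p.1 * p.2, p.2) = p.1 ^ m * p.2 ^ n * g p)
    (hblow : ∀ c : ℝ, SectorGood fun p => F (p.1, p.1 * (c + p.2)))
    (hline : ∀ᶠ c : ℝ in 𝓝[≠] 0, SectorGood fun p => F (p.1, c + p.2))
    (J : ℝ × ℝ → ℝ) (hJ : AnalyticAt ℝ J 0) (G : Set (ℝ × ℝ)) (hG : LocConst F G) :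
    ∃ δ > 0, ∀ α, CurveIn δ α → (∀ᶠ s in 𝓝[>] (0 : ℝ), 0 < α s) → SecLP F G J 0 α := by
  obtain ⟨δ₁, hδ₁, htrans⟩ := SecLP.exists_trans hFa hJ hG
  obtain ⟨κ, hκ, hk⟩ := exists_secLP_line_const hFa hJ hG hg hg0 hFg
  have htend : Tendsto (fun c : ℝ => ((0 : ℝ), c)) (𝓝[>] 0) (𝓝 0) := by
    have : Continuous fun c : ℝ => ((0 : ℝ), c) := by fun_prop
    exact (this.tendsto' 0 0 (by simp)).mono_left nhdsWithin_le_nhds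
  have hline' : ∀ᶠ c : ℝ in 𝓝[>] 0, SectorGood fun p => F (p.1, c + p.2) :=
    nhdsWithin_mono _ (fun x hx => ne_of_gt hx) hline
  have hev := hk.and (hline'.and (htend.eventually (hJ.eventually_analyticAt.and
    (eventually_eventually_nhds.2 hG))))
  obtain ⟨δ₂, hδ₂, hsub⟩ := mem_nhdsGT_iff_exists_Ioo_subset.1 hev
  have hzero : ∀ β : ℝ → ℝ, AnalyticAt ℝ β 0 → β 0 = 0 → SecLP F G J 0 β := fun β hβ hβ0 =>
    secLP_of_blowup hFa hJ hG hblow hβ hβ0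
  refine ⟨min δ₁ δ₂, lt_min hδ₁ hδ₂, fun α hα hpos => ?_⟩
  have hα0 : 0 ≤ α 0 := ge_of_tendsto (hα.1.continuousAt.mono_left nhdsWithin_le_nhds)
    (hpos.mono fun s hs => hs.le)
  rcases hα0.eq_or_lt with h0 | h0
  · exact hzero α hα.1 h0.symm
  have hα1 := hα.mono (min_le_left _ _)
  have hαlt : α 0 < δ₂ := (abs_lt.1 (hα.2.trans_le (min_le_right _ _))).2
  obtain ⟨k1, k2, k3, k4⟩ := hsub ⟨h0, hαlt⟩
  have hlin : AnalyticAt ℝ (fun s : ℝ => s / κ) 0 := by fun_prop (disch := exact hκ.ne')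
  have hlinC : CurveIn δ₁ fun s => s / κ := ⟨hlin, by simpa using hδ₁⟩
  have hcC : CurveIn δ₁ fun _ => α 0 := CurveIn.const hα1.2
  have h1 := htrans 0 _ _ (CurveIn.zero hδ₁) hlinC hcC (hzero _ hlin (by simp)) k1
  obtain ⟨δ₃, hδ₃, H3⟩ := secLP_const_add_of_sectorGood k2 k3 k4
  have h2 := H3 (fun s => α s - α 0) ⟨hα.1.sub analyticAt_const, by simpa using hδ₃⟩
  simp only [add_sub_cancel] at h2
  exact htrans 0 _ _ (CurveIn.zero hδ₁) hcC hα1 h1 h2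

theorem SectorGood.blowup {F g : ℝ × ℝ → ℝ} {m n : ℕ} (hFa : AnalyticAt ℝ F 0)
    (hg : AnalyticAt ℝ g 0) (hg0 : g 0 ≠ 0)
    (hFg : ∀ᶠ p : ℝ × ℝ in 𝓝 0, F (p.1 * p.2, p.2) = p.1 ^ m * p.2 ^ n * g p)
    (hblow : ∀ c : ℝ, SectorGood fun p => F (p.1, p.1 * (c + p.2)))
    (hline : ∀ᶠ c : ℝ in 𝓝[≠] 0, SectorGood fun p => F (p.1, c + p.2)) : SectorGood F := by
  refine SectorGood.of_pos (exists_secLP_of_blowup_of_pos hFa hg hg0 hFg hblow hline) ?_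
  have hneg : AnalyticAt ℝ (fun p : ℝ × ℝ => -p) 0 := analyticAt_id.neg
  refine exists_secLP_of_blowup_of_pos (m := m) (n := n)
      (g := fun p => (-1) ^ m * (-1) ^ n * g (-p))
    (AnalyticAt.comp_of_eq hFa analyticAt_neg_snd (by simp))
    (analyticAt_const.mul (AnalyticAt.comp_of_eq hg hneg (by simp))) (by simpa using hg0) ?_ ?_ ?_
  · have ht : Tendsto (fun p : ℝ × ℝ => -p) (𝓝 0) (𝓝 0) :=
      by simpa using (continuous_neg (G := ℝ × ℝ)).tendsto 0
    filter_upwards [ht.eventually hFg] with p hp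
    simp only [Prod.fst_neg, Prod.snd_neg, neg_mul_neg] at hp
    rw [hp, neg_pow p.1, neg_pow p.2]
    ring
  · intro c
    have := (hblow (-c)).reflect
    refine SectorGood.congr (Eventually.of_forall fun p => ?_) this
    simp only
    congr 2
    ring
  · have ht : Tendsto (fun c : ℝ => -c) (𝓝[≠] 0) (𝓝[≠] 0) := by
      refine tendsto_nhdsWithin_iff.2 ⟨?_, ?_⟩
      · exact ((continuous_neg (G := ℝ)).tendsto' 0 0 neg_zero).mono_left nhdsWithin_le_nhds
      · filter_upwards [self_mem_nhdsWithin] with c hc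
        simpa using hc
    filter_upwards [ht.eventually hline] with c hc
    refine SectorGood.congr (Eventually.of_forall fun p => ?_) hc.reflect
    simp only
    congr 2
    ring

/-- Sector integrals of analytic functions are log-Puiseux. -/
theorem AnalyticAt.sectorGood {F : ℝ × ℝ → ℝ} (hF : AnalyticAt ℝ F 0) : SectorGood F := by
  by_cases hF0 : ∀ᶠ p in 𝓝 (0 : ℝ × ℝ), F p = 0
  · refine SectorGood.congr (F := 0) (hF0.mono fun p hp => by simp [hp]) fun J _ G _ =>
      ⟨1, one_pos, fun α _ => Eventually.of_forall fun ε => ?_⟩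
    refine IsLogPuiseux.zero.congr (Eventually.of_forall fun h => ?_)
    simp [secInt, kern]
  · exact resolution_induction (P := SectorGood) (fun _ _ h hP => hP.congr h)
      (fun M d U hU hU0 => SectorGood.monomial hU hU0 M d)
          (fun _ _ h1 h2 h3 h4 => SectorGood.shift h1 h2 h3 h4)
      (fun _ _ _ h1 h2 => SectorGood.ramify h1 h2)
      (fun _ _ _ _ h1 h2 h3 h4 h5 h6 => SectorGood.blowup h1 h2 h3 h4 h5 h6) F hF hF0

end

section

open Filter Topology MeasureTheory

theorem SecLP.const_strip {F J : ℝ × ℝ → ℝ} {G : Set (ℝ × ℝ)} {L : ℝ}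
    (hF : ∀ w ∈ Set.Icc (-L) L, AnalyticAt ℝ F (0, w))
        (hJ : ∀ w ∈ Set.Icc (-L) L, AnalyticAt ℝ J (0, w))
    (hG : ∀ w ∈ Set.Icc (-L) L, ∀ᶠ p in 𝓝 ((0 : ℝ), w), 0 < p.1 → F p ≠ 0 → ∀ᶠ q in 𝓝 p,
        (q ∈ G ↔ p ∈ G))
    {a b : ℝ} (ha : a ∈ Set.Ioo (-L) L) (hb : b ∈ Set.Ioo (-L) L) :
    SecLP F G J (fun _ => a) (fun _ => b) := by
  obtain ⟨ε₁, hε₁, C, nb⟩ := exists_niceBox_strip hF hJ hG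
  refine SecLP.const_of_local (nb ε₁ le_rfl) hε₁ (fun w hw => ?_) ha hb
  have hw' := Set.Ioo_subset_Icc_self hw
  have hT : AnalyticAt ℝ (fun p : ℝ × ℝ => (p.1, w + p.2)) 0 :=
    analyticAt_fst.prod (analyticAt_const.add analyticAt_snd)
  have hFw : SectorGood fun p => F (p.1, w + p.2) :=
    (AnalyticAt.comp_of_eq (hF w hw') hT (by simp)).sectorGood
  obtain ⟨δ, hδ, H⟩ := secLP_const_add_of_sectorGood hFw (hJ w hw') (hG w hw')
  filter_upwards [Metric.ball_mem_nhds w hδ] with y hy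
  have := H (fun _ => y - w) (CurveIn.const (by rwa [Metric.mem_ball, Real.dist_eq] at hy))
  simpa using this

/-- Polar coordinates, on the whole plane. -/
noncomputable def polarMap (p : ℝ × ℝ) : ℝ × ℝ := (p.1 * Real.cos p.2, p.1 * Real.sin p.2)

theorem polarMap_sq (p : ℝ × ℝ) : (polarMap p).1 ^ 2 + (polarMap p).2 ^ 2 = p.1 ^ 2 := by
  simp only [polarMap]
  nlinarith [Real.sin_sq_add_cos_sq p.2]

theorem analyticAt_polarMap (p : ℝ × ℝ) : AnalyticAt ℝ polarMap p := by
  have h1 : AnalyticAt ℝ (fun p : ℝ × ℝ => Real.cos p.2) p :=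
    AnalyticAt.fun_comp (g := Real.cos) Real.analyticAt_cos analyticAt_snd
  have h2 : AnalyticAt ℝ (fun p : ℝ × ℝ => Real.sin p.2) p :=
    AnalyticAt.fun_comp (g := Real.sin) Real.analyticAt_sin analyticAt_snd
  exact (analyticAt_fst.mul h1).prod (analyticAt_fst.mul h2)

theorem continuous_polarMap : Continuous polarMap := by
  unfold polarMap
  fun_prop

/-- The area of the part of `S` where `0 < |H| < h` is log-Puiseux in `h`. -/
theorem isLogPuiseux_area {H : ℝ × ℝ → ℝ} {S : Set (ℝ × ℝ)} {ρ : ℝ} (hρ : 0 < ρ)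
    (hH : ∀ p : ℝ × ℝ, p.1 ^ 2 + p.2 ^ 2 ≤ ρ ^ 2 → AnalyticAt ℝ H p)
    (hS : ∀ p : ℝ × ℝ, p.1 ^ 2 + p.2 ^ 2 < ρ ^ 2 → H p ≠ 0 → ∀ᶠ q in 𝓝 p, (q ∈ S ↔ p ∈ S)) :
    IsLogPuiseux fun h =>
      volume.real {p : ℝ × ℝ | p.1 ^ 2 + p.2 ^ 2 < ρ ^ 2 ∧ p ∈ S ∧ H p ≠ 0 ∧ |H p| < h} := by
  classical
  set F : ℝ × ℝ → ℝ := fun p => H (polarMap p) with hFdef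
  set G : Set (ℝ × ℝ) := polarMap ⁻¹' S with hGdef
  have hF : ∀ p : ℝ × ℝ, p.1 ∈ Set.Icc 0 ρ → AnalyticAt ℝ F p := fun p hp => by
    refine AnalyticAt.fun_comp (hH _ ?_) (analyticAt_polarMap p)
    rw [polarMap_sq]
    exact pow_le_pow_left₀ hp.1 hp.2 2
  have hG : ∀ p : ℝ × ℝ, p.1 ∈ Set.Ioo 0 ρ → F p ≠ 0 → ∀ᶠ q in 𝓝 p, (q ∈ G ↔ p ∈ G) :=
      fun p hp hne => by
    have hc := continuous_polarMap.tendsto p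
    refine hc.eventually (hS _ ?_ hne)
    rw [polarMap_sq]
    exact pow_lt_pow_left₀ hp.2 hp.1.le two_ne_zero
  set K : ℝ → ℝ × ℝ → ℝ := kern F G Prod.fst with hKdef
  have hpi : Real.pi ∈ Set.Ioo (-4 : ℝ) 4 := ⟨by linarith [Real.pi_pos], Real.pi_lt_four⟩
  have hpi' : -Real.pi ∈ Set.Ioo (-4 : ℝ) 4 :=
      ⟨by linarith [Real.pi_lt_four], by linarith [Real.pi_pos]⟩
  set w : ℝ → ℝ → ℝ := fun h r => ∫ θ in (-Real.pi)..Real.pi, K h (r, θ) with hw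
  have fwd : ∀ r₀ ∈ Set.Ico 0 ρ, ∀ᶠ r in 𝓝[>] r₀, IsLogPuiseux fun h => ∫ x in r₀..r, w h x := by
    intro r₀ hr₀
    have hT : ∀ p : ℝ × ℝ, AnalyticAt ℝ (fun p : ℝ × ℝ => (r₀ + p.1, p.2)) p := fun p =>
      (analyticAt_const.add analyticAt_fst).prod analyticAt_snd
    have key : SecLP (fun p => F (r₀ + p.1, p.2)) ((fun p => (r₀ + p.1, p.2)) ⁻¹' G)
        (fun p => r₀ + p.1)
        (fun _ => -Real.pi) (fun _ => Real.pi) := by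
      refine SecLP.const_strip (L := 4) (fun y _ => ?_)
          (fun y _ => analyticAt_const.add analyticAt_fst)
        (fun y _ => ?_) hpi' hpi
      · refine AnalyticAt.fun_comp (g := F) (hF _ ?_) (hT _)
        simpa using ⟨hr₀.1, hr₀.2.le⟩
      · have : ∀ᶠ p in 𝓝 ((0 : ℝ), y), p.1 < ρ - r₀ :=
          (continuous_fst.tendsto _).eventually (gt_mem_nhds (by simpa using hr₀.2))
        filter_upwards [this] with p hp h1 h2
        exact (hT p).continuousAt.eventually (hG _ ⟨by simp only; linarith [hr₀.1],
            by simp only; linarith⟩ h2)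
    have ht : Tendsto (fun r => r - r₀) (𝓝[>] r₀) (𝓝[>] 0) := by
      refine tendsto_nhdsWithin_iff.2 ⟨?_, ?_⟩
      · exact ((continuous_sub_right r₀).tendsto' r₀ 0 (sub_self _)).mono_left nhdsWithin_le_nhds
      · filter_upwards [self_mem_nhdsWithin] with r hr
        exact sub_pos.2 (Set.mem_Ioi.1 hr)
    filter_upwards [ht.eventually key] with r hr
    refine hr.congr (Eventually.of_forall fun h => ?_)
    have := intervalIntegral.integral_comp_add_left (a := 0) (b := r - r₀) (w h) r₀
    rw [add_zero, add_sub_cancel] at this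
    exact this
  have bwd : ∀ r₀ ∈ Set.Ioc 0 ρ, ∀ᶠ r in 𝓝[<] r₀, IsLogPuiseux fun h => ∫ x in r..r₀, w h x := by
    intro r₀ hr₀
    have hT : ∀ p : ℝ × ℝ, AnalyticAt ℝ (fun p : ℝ × ℝ => (r₀ - p.1, p.2)) p := fun p =>
      (analyticAt_const.sub analyticAt_fst).prod analyticAt_snd
    have key : SecLP (fun p => F (r₀ - p.1, p.2)) ((fun p => (r₀ - p.1, p.2)) ⁻¹' G)
        (fun p => r₀ - p.1)
        (fun _ => -Real.pi) (fun _ => Real.pi) := by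
      refine SecLP.const_strip (L := 4) (fun y _ => ?_)
          (fun y _ => analyticAt_const.sub analyticAt_fst)
        (fun y _ => ?_) hpi' hpi
      · refine AnalyticAt.fun_comp (g := F) (hF _ ?_) (hT _)
        simpa using ⟨hr₀.1.le, hr₀.2⟩
      · have : ∀ᶠ p in 𝓝 ((0 : ℝ), y), p.1 < r₀ :=
          (continuous_fst.tendsto _).eventually (gt_mem_nhds (by simpa using hr₀.1))
        filter_upwards [this] with p hp h1 h2
        exact (hT p).continuousAt.eventually (hG _ ⟨by simp only; linarith [hr₀.1],
            by simp only; linarith [hr₀.2]⟩ h2)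
    have ht : Tendsto (fun r => r₀ - r) (𝓝[<] r₀) (𝓝[>] 0) := by
      refine tendsto_nhdsWithin_iff.2 ⟨?_, ?_⟩
      · exact ((continuous_sub_left r₀).tendsto' r₀ 0 (sub_self _)).mono_left nhdsWithin_le_nhds
      · filter_upwards [self_mem_nhdsWithin] with r hr
        exact sub_pos.2 (Set.mem_Iio.1 hr)
    filter_upwards [ht.eventually key] with r hr
    refine hr.congr (Eventually.of_forall fun h => ?_)
    have := intervalIntegral.integral_comp_sub_left (a := 0) (b := r₀ - r) (w h) r₀
    rw [sub_zero, sub_sub_cancel] at this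
    exact this
  set Q : Set (ℝ × ℝ) := Set.Ioo 0 ρ ×ˢ Set.Ioo (-Real.pi) Real.pi with hQ
  have hQo : IsOpen Q := isOpen_Ioo.prod isOpen_Ioo
  have hDo : ∀ h, IsOpen (Q ∩ {p | p ∈ G ∧ F p ≠ 0 ∧ |F p| < h}) := fun h => by
    rw [isOpen_iff_mem_nhds]
    rintro p ⟨hpQ, hpG, hpF, hph⟩
    have hc := (hF p ⟨hpQ.1.1.le, hpQ.1.2.le⟩).continuousAt
    filter_upwards [hQo.mem_nhds hpQ, hG p hpQ.1 hpF, hc.eventually_ne hpF,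
        hc.abs.eventually_lt continuousAt_const hph]
      with q h1 h2 h3 h4
    exact ⟨h1, h2.2 hpG, h3, h4⟩
  have hKi : ∀ h, IntegrableOn (K h) Q := fun h => by
    have hfin : volume Q ≠ ⊤ :=
      ((measure_mono (Set.prod_mono Set.Ioo_subset_Icc_self Set.Ioo_subset_Icc_self)).trans_lt
        (isCompact_Icc.prod isCompact_Icc).measure_lt_top).ne
    refine Integrable.mono' (g := fun _ => ρ) (integrableOn_const hfin) ?_ ?_
    · have h1 : AEStronglyMeasurable ((Q ∩ {p | p ∈ G ∧ F p ≠ 0 ∧ |F p| < h}).indicator Prod.fst)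
        (volume.restrict Q) := (measurable_fst.indicator (hDo h).measurableSet).aestronglyMeasurable
      refine h1.congr ?_
      filter_upwards [ae_restrict_mem hQo.measurableSet] with p hp
      simp only [hKdef, kern, Set.indicator_apply, Set.mem_inter_iff, hp, true_and]
    · filter_upwards [ae_restrict_mem hQo.measurableSet] with p hp
      refine (abs_kern_le _ _ _ _ _).trans ?_
      rw [abs_of_pos hp.1.1]
      exact hp.1.2.le
  have hwi : ∀ h, IntervalIntegrable (w h) volume 0 ρ := fun h => by
    rw [intervalIntegrable_iff_integrableOn_Ioo_of_le hρ.le]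
    have := hKi h
    rw [IntegrableOn, Measure.volume_eq_prod, ← Measure.prod_restrict] at this
    refine this.integral_prod_left.congr (ae_of_all _ fun r => ?_)
    simp only [hw]
    rw [intervalIntegral.integral_of_le (by linarith [Real.pi_pos]), integral_Ioc_eq_integral_Ioo]
  have htot : IsLogPuiseux fun h => ∫ x in (0 : ℝ)..ρ, w h x := by
    refine (isPreconnected_Icc (a := (0 : ℝ)) (b := ρ)).induction₂'
      (fun a b => IsLogPuiseux fun h => ∫ x in a..b, w h x) (fun r hr => ?_)
          (fun x y z hx hy hz h1 h2 => ?_)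
      ⟨le_rfl, hρ.le⟩ ⟨hρ.le, le_rfl⟩
    · have hsymm : ∀ a b, (IsLogPuiseux fun h => ∫ x in a..b, w h x) → IsLogPuiseux fun h =>
        ∫ x in b..a, w h x := by
        intro a b h
        refine h.neg.congr (Eventually.of_forall fun h => ?_)
        exact (intervalIntegral.integral_symm a b).symm
      have h1 : ∀ᶠ r' in 𝓝[>] r, r' ∈ Set.Icc 0 ρ → IsLogPuiseux fun h => ∫ x in r..r', w h x := by
        rcases hr.2.eq_or_lt with h | h
        · filter_upwards [self_mem_nhdsWithin] with r' hr' hr''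
          exact absurd hr''.2 (not_le.2 (h ▸ hr'))
        · exact (fwd r ⟨hr.1, h⟩).mono fun _ h _ => h
      have h2 : ∀ᶠ r' in 𝓝[<] r, r' ∈ Set.Icc 0 ρ → IsLogPuiseux fun h => ∫ x in r'..r, w h x := by
        rcases hr.1.eq_or_lt with h | h
        · filter_upwards [self_mem_nhdsWithin] with r' hr' hr''
          exact absurd hr''.1 (not_le.2 (h ▸ hr'))
        · exact (bwd r ⟨h, hr.2⟩).mono fun _ h _ => h
      have h3 : ∀ᶠ r' in 𝓝[≠] r, r' ∈ Set.Icc 0 ρ → (IsLogPuiseux fun h => ∫ x in r..r', w h x) ∧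
          IsLogPuiseux fun h => ∫ x in r'..r, w h x := by
        rw [← nhdsLT_sup_nhdsGT]
        refine eventually_sup.2 ⟨h2.mono fun r' h hr' => ⟨hsymm _ _ (h hr'), h hr'⟩,
          h1.mono fun r' h hr' => ⟨h hr', hsymm _ _ (h hr')⟩⟩
      rw [eventually_nhdsWithin_iff] at h3 ⊢
      filter_upwards [h3] with r' h hr'
      by_cases he : r' = r
      · subst he
        simp only [intervalIntegral.integral_same]
        exact ⟨IsLogPuiseux.zero, IsLogPuiseux.zero⟩
      · exact h he hr'
    · refine (h1.add h2).congr (Eventually.of_forall fun h => ?_)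
      have hsub : ∀ {a b}, a ∈ Set.Icc 0 ρ → b ∈ Set.Icc 0 ρ →
          IntervalIntegrable (w h) volume a b :=
        fun ha hb => (hwi h).mono_set (by
          rw [Set.uIcc_of_le hρ.le]; exact Set.ordConnected_Icc.uIcc_subset ha hb)
      exact intervalIntegral.integral_add_adjacent_intervals (hsub hx hy) (hsub hy hz)
  refine htot.congr (Eventually.of_forall fun h => ?_)
  set D : Set (ℝ × ℝ) := {p : ℝ × ℝ | p.1 ^ 2 + p.2 ^ 2 < ρ ^ 2 ∧ p ∈ S ∧ H p ≠ 0 ∧ |H p| <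
    h} with hD
  have hDopen : IsOpen D := by
    rw [isOpen_iff_mem_nhds]
    rintro p ⟨hp1, hp2, hp3, hp4⟩
    have hc := (hH p hp1.le).continuousAt
    have hlt : ∀ᶠ q : ℝ × ℝ in 𝓝 p, q.1 ^ 2 + q.2 ^ 2 < ρ ^ 2 := by
      have : Continuous fun q : ℝ × ℝ => q.1 ^ 2 + q.2 ^ 2 := by fun_prop
      exact (this.tendsto p).eventually (gt_mem_nhds hp1)
    filter_upwards [hlt, hS p hp1 hp3, hc.eventually_ne hp3,
        hc.abs.eventually_lt continuousAt_const hp4]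
      with q h1 h2 h3 h4
    exact ⟨h1, h2.2 hp2, h3, h4⟩
  beta_reduce
  rw [← integral_indicator_one hDopen.measurableSet, ← integral_comp_polarCoord_symm]
  have hsub : Q ⊆ polarCoord.target := Set.prod_mono Set.Ioo_subset_Ioi_self le_rfl
  rw [setIntegral_eq_of_subset_of_forall_sdiff_eq_zero polarCoord.open_target.measurableSet hsub]
  · rw [setIntegral_congr_fun (g := K h) hQo.measurableSet]
    · have := hKi h
      rw [Measure.volume_eq_prod] at this ⊢
      rw [setIntegral_prod _ this, intervalIntegral.integral_of_le hρ.le,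
          integral_Ioc_eq_integral_Ioo]
      congr 1
      ext r
      simp only [hw]
      rw [intervalIntegral.integral_of_le (by linarith [Real.pi_pos]), integral_Ioc_eq_integral_Ioo]
    · intro p hp
      have hlt : (polarMap p).1 ^ 2 + (polarMap p).2 ^ 2 < ρ ^ 2 := by
        rw [polarMap_sq]
        exact pow_lt_pow_left₀ hp.1.2 hp.1.1.le two_ne_zero
      have e : polarCoord.symm p = polarMap p := rfl
      have e2 : p ∈ G ↔ polarMap p ∈ S := Iff.rfl
      simp only [hKdef, kern, Set.indicator_apply, hD, Set.mem_ofPred_eq, e, hlt, true_and, e2,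
          hFdef,
        Pi.one_apply, smul_eq_mul, mul_ite, mul_one, mul_zero]
  · rintro p ⟨hp1, hp2⟩
    have : polarCoord.symm p ∉ D := fun hd => hp2 ⟨⟨hp1.1, ?_⟩, hp1.2⟩
    simpa using Or.inr this
    · have h1 := hd.1
      have e : polarCoord.symm p = polarMap p := rfl
      rw [e, polarMap_sq] at h1
      exact lt_of_pow_lt_pow_left₀ 2 hρ.le h1

end

section

open Filter Topology MeasureTheory

theorem AnalyticAt.exists_hasSum_pow {f : ℝ → ℝ} (hf : AnalyticAt ℝ f 0) :
    ∃ a : ℕ → ℝ, ∀ᶠ t in 𝓝 (0 : ℝ), HasSum (fun n => a n * t ^ n) (f t) := by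
  obtain ⟨p, hp⟩ := hf
  refine ⟨p.coeff, ?_⟩
  filter_upwards [hasFPowerSeriesAt_iff.1 hp] with t ht
  simpa [mul_comm] using ht

/-- The derivative of a log-Puiseux function is the sum of a convergent log-Puiseux series. -/
theorem IsLogPuiseux.hasSum_deriv {V τ : ℝ → ℝ} (hV : IsLogPuiseux V)
    (hd : ∀ᶠ h in 𝓝[>] (0 : ℝ), HasDerivAt V (τ h) h) :
    ∃ h₀ > (0 : ℝ), ∃ q : ℕ, 0 < q ∧ ∃ (k₀ : ℤ) (A B : ℤ → ℝ), ∀ h ∈ Set.Ioo (0 : ℝ) h₀,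
      HasSum (fun k : ℕ => (A (k₀ + k) + B (k₀ + k) * Real.log h) *
        h ^ (((k₀ + k : ℤ) : ℝ) / (q : ℝ))) (τ h) := by
  obtain ⟨q, hq, A, B, hA, hB, hAB⟩ := hV
  have hq' : (0 : ℝ) < q := by exact_mod_cast hq
  have hα : AnalyticAt ℝ (fun t => t * deriv A t / q + B t) 0 :=
    ((analyticAt_id.mul hA.deriv).div analyticAt_const hq'.ne').add hB
  have hβ : AnalyticAt ℝ (fun t => t * deriv B t / q) 0 :=
    (analyticAt_id.mul hB.deriv).div analyticAt_const hq'.ne'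
  obtain ⟨a, ha⟩ := hα.exists_hasSum_pow
  obtain ⟨b, hb⟩ := hβ.exists_hasSum_pow
  have ht : Tendsto (fun h : ℝ => h ^ (1 / (q : ℝ))) (𝓝[>] 0) (𝓝 0) :=
    (tendsto_rpow_nhdsGT (by positivity)).mono_right nhdsWithin_le_nhds
  have hAB' := eventually_eventually_nhdsWithin.2 hAB
  have key : ∀ᶠ h in 𝓝[>] (0 : ℝ), HasSum (fun k : ℕ => ((a k + b k * Real.log h) *
        h ^ (((-(q : ℤ) + k : ℤ) : ℝ) / (q : ℝ)))) (τ h) := by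
    filter_upwards [hd, hAB', ht.eventually ha, ht.eventually hb,
      ht.eventually hA.eventually_analyticAt, ht.eventually hB.eventually_analyticAt,
      self_mem_nhdsWithin] with h h1 h2 h3 h4 h5 h6 (h7 : 0 < h)
    rw [(isOpen_Ioi.nhdsWithin_eq h7 : 𝓝[Set.Ioi (0 : ℝ)] h = 𝓝 h)] at h2
    set t := h ^ (1 / (q : ℝ)) with htdef
    have hpow : HasDerivAt (fun h : ℝ => h ^ (1 / (q : ℝ))) (t / (q * h)) h := by
      convert Real.hasDerivAt_rpow_const (x := h) (p := 1 / (q : ℝ)) (Or.inl h7.ne') using 1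
      rw [Real.rpow_sub_one h7.ne']
      field_simp
      rfl
    have hVd : HasDerivAt (fun h => A (h ^ (1 / (q : ℝ))) + B (h ^ (1 / (q : ℝ))) * Real.log h)
        (deriv A t * (t / (q * h)) + (deriv B t * (t / (q * h)) * Real.log h + B t * h⁻¹)) h :=
      ((h5.differentiableAt.hasDerivAt).comp h hpow).add
        (((h6.differentiableAt.hasDerivAt).comp h hpow).mul (Real.hasDerivAt_log h7.ne'))
    have e := h1.unique (hVd.congr_of_eventuallyEq h2)
    have hs := ((h3.add (h4.mul_right (Real.log h))).mul_right h⁻¹)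
    have e4 : τ h = (t * deriv A t / q + B t + t * deriv B t / q * Real.log h) * h⁻¹ := by
      rw [e]
      field_simp
      ring
    rw [e4]
    have e5 : ∀ k : ℕ, (a k + b k * Real.log h) * h ^ (((-(q : ℤ) + k : ℤ) : ℝ) / (q : ℝ)) =
        (a k * t ^ k + b k * t ^ k * Real.log h) * h⁻¹ := fun k => by
      have e3 : h ^ (((-(q : ℤ) + k : ℤ) : ℝ) / (q : ℝ)) = t ^ k * h⁻¹ := by
        have : (((-(q : ℤ) + k : ℤ) : ℝ) / (q : ℝ)) = 1 / (q : ℝ) * k - 1 := by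
          push_cast
          field_simp
          ring
        rw [this, Real.rpow_sub_one h7.ne', Real.rpow_mul h7.le, Real.rpow_natCast]
        rfl
      rw [e3]
      ring
    exact (funext e5 : (fun k : ℕ => _) = _) ▸ hs
  obtain ⟨h₀, hh₀, H⟩ := mem_nhdsGT_iff_exists_Ioo_subset.1 key
  refine ⟨h₀, hh₀, q, hq, -q, fun k => a (k + q).toNat, fun k => b (k + q).toNat, fun h hh => ?_⟩
  have e : ∀ k : ℕ, ((-(q : ℤ) + k) + q).toNat = k := fun k => by omega
  simp only [e]
  exact H hh

end

section

open Filter Topology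

/-- A zero set accumulating at the origin in the right half plane is, along an ultrafilter,
a Puiseux curve. -/
theorem exists_puiseux_of_ultrafilter {F : ℝ × ℝ → ℝ} (hF : AnalyticAt ℝ F 0)
    (hF0 : ¬ ∀ᶠ p in 𝓝 (0 : ℝ × ℝ), F p = 0) :
    ∀ 𝒰 : Ultrafilter (ℝ × ℝ), (𝒰 : Filter (ℝ × ℝ)) ≤ 𝓝 0 →
      (∀ᶠ p in (𝒰 : Filter (ℝ × ℝ)), 0 < p.1 ∧ F p = 0) →
      ∃ (N : ℕ) (φ : ℝ → ℝ), 0 < N ∧ AnalyticAt ℝ φ 0 ∧ φ 0 = 0 ∧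
        ∀ᶠ p in (𝒰 : Filter (ℝ × ℝ)), p.2 = φ (p.1 ^ (1 / (N : ℝ))) := by
  refine resolution_induction (P := fun F => ∀ 𝒰 : Ultrafilter (ℝ × ℝ), (𝒰 : Filter (ℝ × ℝ)) ≤ 𝓝 0 →
      (∀ᶠ p in (𝒰 : Filter (ℝ × ℝ)), 0 < p.1 ∧ F p = 0) →
      ∃ (N : ℕ) (φ : ℝ → ℝ), 0 < N ∧ AnalyticAt ℝ φ 0 ∧ φ 0 = 0 ∧
        ∀ᶠ p in (𝒰 : Filter (ℝ × ℝ)), p.2 = φ (p.1 ^ (1 / (N : ℝ)))) ?_ ?_ ?_ ?_ ?_ F hF hF0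
  · intro F F' h IH 𝒰 h𝒰 hz
    refine IH 𝒰 h𝒰 ?_
    filter_upwards [hz, h𝒰 h] with p h1 (h2 : F p = F' p)
    exact ⟨h1.1, h2 ▸ h1.2⟩
  · intro M d U hU hU0 𝒰 h𝒰 hz
    refine ⟨1, fun _ => 0, one_pos, analyticAt_const, rfl, ?_⟩
    filter_upwards [hz, h𝒰 (hU.continuousAt.eventually_ne hU0)] with p h1 (h2 : U p ≠ 0)
    have h3 := (mul_eq_zero.1 h1.2).resolve_right h2
    exact eq_zero_of_pow_eq_zero ((mul_eq_zero.1 h3).resolve_left (pow_pos h1.1 M).ne')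
  · intro F φ hF hφ hφ0 IH 𝒰 h𝒰 hz
    have ht : Tendsto (fun p : ℝ × ℝ => (p.1, p.2 - φ p.1)) (𝒰 : Filter (ℝ × ℝ)) (𝓝 0) := by
      have h1 : AnalyticAt ℝ (fun p : ℝ × ℝ => (p.1, p.2 - φ p.1)) 0 :=
        analyticAt_fst.prod (analyticAt_snd.sub (AnalyticAt.fun_comp (g := φ) (f := Prod.fst)
          (x := (0 : ℝ × ℝ))
          (by exact hφ) analyticAt_fst))
      have h2 := h1.continuousAt.tendsto
      simp only [Prod.fst_zero, Prod.snd_zero, hφ0, sub_zero, Prod.mk_zero_zero] at h2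
      exact h2.mono_left h𝒰
    obtain ⟨N, ψ, hN, hψ, hψ0, h⟩ := IH (𝒰.map _) ht (by
      rw [Ultrafilter.coe_map, eventually_map]
      filter_upwards [hz] with p hp
      simpa using hp)
    rw [Ultrafilter.coe_map, eventually_map] at h
    refine ⟨N, fun x => φ (x ^ N) + ψ x, hN, (hφ.comp_pow hN).add hψ, by simp [hN.ne', hφ0, hψ0],
        ?_⟩
    filter_upwards [h, hz] with p hp hp2
    have : (p.1 ^ (1 / (N : ℝ))) ^ N = p.1 := by
      rw [← Real.rpow_mul_natCast hp2.1.le, one_div_mul_cancel (by exact_mod_cast hN.ne'),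
          Real.rpow_one]
    rw [this]
    linarith
  · intro F N hF hN IH 𝒰 h𝒰 hz
    have hN' : (0 : ℝ) < N := by exact_mod_cast hN
    have ht : Tendsto (fun p : ℝ × ℝ => (p.1 ^ (1 / (N : ℝ)), p.2)) (𝒰 : Filter (ℝ × ℝ)) (𝓝 0) := by
      have h1 : ContinuousAt (fun p : ℝ × ℝ => (p.1 ^ (1 / (N : ℝ)), p.2)) 0 :=
        (continuousAt_fst.rpow_const (Or.inr (by positivity))).prodMk continuousAt_snd
      have h2 := h1.tendsto
      simp only [Prod.fst_zero, Prod.snd_zero] at h2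
      rw [Real.zero_rpow (by positivity), Prod.mk_zero_zero] at h2
      exact h2.mono_left h𝒰
    have hroot : ∀ {x : ℝ}, 0 < x → (x ^ (1 / (N : ℝ))) ^ N = x := fun hx => by
      rw [← Real.rpow_mul_natCast hx.le, one_div_mul_cancel hN'.ne', Real.rpow_one]
    obtain ⟨N', ψ, hN1, hψ, hψ0, h⟩ := IH (𝒰.map _) ht (by
      rw [Ultrafilter.coe_map, eventually_map]
      filter_upwards [hz] with p hp
      simp only [hroot hp.1]
      exact ⟨Real.rpow_pos_of_pos hp.1 _, hp.2⟩)
    rw [Ultrafilter.coe_map, eventually_map] at h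
    refine ⟨N * N', ψ, Nat.mul_pos hN hN1, hψ, hψ0, ?_⟩
    filter_upwards [h, hz] with p hp hp2
    rw [hp, ← Real.rpow_mul hp2.1.le]
    congr 2
    push_cast
    field_simp
  · intro F m n G hF hG hG0 hFG hc _ 𝒰 h𝒰 hz
    by_cases hb : ∃ C : ℝ, ∀ᶠ p in (𝒰 : Filter (ℝ × ℝ)), |p.2 / p.1| ≤ C
    · obtain ⟨C, hC⟩ := hb
      obtain ⟨c, -, hcl⟩ := (isCompact_Icc (a := -C) (b := C)).ultrafilter_le_nhds
        (𝒰.map fun p => p.2 / p.1) (by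
          rw [Ultrafilter.coe_map, le_principal_iff, mem_map]
          filter_upwards [hC] with p hp
          exact abs_le.1 hp)
      have ht : Tendsto (fun p : ℝ × ℝ => (p.1, p.2 / p.1 - c)) (𝒰 : Filter (ℝ × ℝ)) (𝓝 0) := by
        rw [← Prod.mk_zero_zero, nhds_prod_eq]
        refine Tendsto.prodMk ((continuous_fst.tendsto (0 : ℝ × ℝ)).mono_left h𝒰) ?_
        have : Tendsto (fun p : ℝ × ℝ => p.2 / p.1) (𝒰 : Filter (ℝ × ℝ)) (𝓝 c) := hcl
        simpa using this.sub_const c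
      obtain ⟨N, ψ, hN, hψ, hψ0, h⟩ := hc c (𝒰.map _) ht (by
        rw [Ultrafilter.coe_map, eventually_map]
        filter_upwards [hz] with p hp
        refine ⟨hp.1, ?_⟩
        have : p.1 * (c + (p.2 / p.1 - c)) = p.2 := by
          have := hp.1.ne'
          field_simp
          ring
        simpa only [this] using hp.2)
      rw [Ultrafilter.coe_map, eventually_map] at h
      refine ⟨N, fun x => x ^ N * (c + ψ x), hN,
          (analyticAt_id.pow N).mul (analyticAt_const.add hψ),
        by simp [hN.ne'], ?_⟩
      filter_upwards [h, hz] with p hp hp2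
      have : (p.1 ^ (1 / (N : ℝ))) ^ N = p.1 := by
        rw [← Real.rpow_mul_natCast hp2.1.le, one_div_mul_cancel (by exact_mod_cast hN.ne'),
            Real.rpow_one]
      rw [this, ← hp]
      have := hp2.1.ne'
      field_simp
      ring
    · exfalso
      push Not at hb
      have ht : Tendsto (fun p : ℝ × ℝ => (p.1 / p.2, p.2)) (𝒰 : Filter (ℝ × ℝ)) (𝓝 0) := by
        rw [← Prod.mk_zero_zero, nhds_prod_eq]
        refine Tendsto.prodMk ?_ ((continuous_snd.tendsto (0 : ℝ × ℝ)).mono_left h𝒰)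
        have h1 : Tendsto (fun p : ℝ × ℝ => |p.2 / p.1|) (𝒰 : Filter (ℝ × ℝ)) atTop :=
          tendsto_atTop.2 fun C => (hb C).mono fun p hp => hp.le
        have h2 := h1.inv_tendsto_atTop
        refine (tendsto_zero_iff_abs_tendsto_zero _).2 (h2.congr fun p => ?_)
        simp [abs_div]
      obtain ⟨p, hp1, hp2, hp3, hp4⟩ := ((ht.eventually hFG).and ((ht.eventually
        (hG.continuousAt.eventually_ne hG0)).and (hz.and (hb 0)))).exists
      have hp20 : p.2 ≠ 0 := fun h => by simp [h] at hp4
      simp only [div_mul_cancel₀ _ hp20] at hp1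
      rw [hp3.2] at hp1
      have := div_ne_zero hp3.1.ne' hp20
      exact mul_ne_zero (mul_ne_zero (pow_ne_zero m this) (pow_ne_zero n hp20)) hp2 hp1.symm

theorem clm_apply_prod (L : ℝ × ℝ →L[ℝ] ℝ) (a b : ℝ) : L (a, b) = a * L (1, 0) + b * L (0, 1) := by
  have : ((a, b) : ℝ × ℝ) = a • (1, 0) + b • (0, 1) := by simp
  rw [this, map_add, map_smul, map_smul, smul_eq_mul, smul_eq_mul]

/-- Near an isolated critical point, the zero set is transversal to small circles. -/
theorem AnalyticAt.eventually_transversal {H : ℝ × ℝ → ℝ} (hH : AnalyticAt ℝ H 0)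
    (hiso : ∀ᶠ p in 𝓝 (0 : ℝ × ℝ), fderiv ℝ H p = 0 → p = 0) :
    ∀ᶠ p : ℝ × ℝ in 𝓝 0, p ≠ 0 → H p = 0 → fderiv ℝ H p (-p.2, p.1) ≠ 0 := by
  by_contra hcon
  have hfreq : ∃ᶠ p : ℝ × ℝ in 𝓝 0, p ≠ 0 ∧ H p = 0 ∧ fderiv ℝ H p (-p.2, p.1) = 0 := by
    refine (not_eventually.1 hcon).mono fun p hp => ?_
    push Not at hp
    exact hp
  set W : Set (ℝ × ℝ) := {p : ℝ × ℝ | p ≠ 0 ∧ H p = 0 ∧ fderiv ℝ H p (-p.2, p.1) = 0} with hW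
  set K : Set (ℝ × ℝ) := Set.Icc 0 1 ×ˢ Set.Icc (-Real.pi) Real.pi with hK
  have hKc : IsCompact K := isCompact_Icc.prod isCompact_Icc
  have hpolar : ∀ p : ℝ × ℝ, p ≠ 0 → ∃ r θ : ℝ, 0 < r ∧ θ ∈ Set.Icc (-Real.pi) Real.pi ∧
      polarMap (r, θ) = p := by
    intro p hp
    set z : ℂ := ⟨p.1, p.2⟩ with hz
    have hz0 : z ≠ 0 := fun h => hp (Prod.ext (congrArg Complex.re h) (congrArg Complex.im h))
    refine ⟨‖z‖, z.arg, norm_pos_iff.2 hz0, ⟨(Complex.neg_pi_lt_arg z).le, Complex.arg_le_pi z⟩, ?_⟩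
    exact Prod.ext (Complex.norm_mul_cos_arg z) (Complex.norm_mul_sin_arg z)
  have hcl : ∃ᶠ q : ℝ × ℝ in (𝓝 0).comap polarMap ⊓ 𝓟 K, 0 < q.1 ∧ polarMap q ∈ W := by
    rw [frequently_iff]
    intro U hU
    obtain ⟨V, ⟨V', hV', hVV'⟩, V2, hV2, rfl⟩ := hU
    have hnear : ∀ᶠ p : ℝ × ℝ in 𝓝 0, p.1 ^ 2 + p.2 ^ 2 < 1 := by
      have : Continuous fun q : ℝ × ℝ => q.1 ^ 2 + q.2 ^ 2 := by fun_prop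
      exact (this.tendsto 0).eventually (gt_mem_nhds (by simp))
    obtain ⟨p, h1, h2, h3⟩ := (hfreq.and_eventually (hnear.and hV')).exists
    obtain ⟨r, θ, hr, hθ, hp⟩ := hpolar p h1.1
    refine ⟨(r, θ), ⟨hVV' ?_, hV2 ⟨⟨hr.le, ?_⟩, hθ⟩⟩, hr, ?_⟩
    · rw [Set.mem_preimage, hp]
      exact h3
    · rw [← hp, polarMap_sq] at h2
      nlinarith
    · rw [hp]
      exact h1
  obtain ⟨θ₀, 𝒰, h𝒰, hU⟩ : ∃ (θ₀ : ℝ) (𝒰 : Ultrafilter (ℝ × ℝ)), (𝒰 : Filter (ℝ × ℝ)) ≤ 𝓝 0 ∧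
      ∀ᶠ q : ℝ × ℝ in (𝒰 : Filter (ℝ × ℝ)), 0 < q.1 ∧ polarMap (q.1, θ₀ + q.2) ∈ W := by
    have hne : ((𝓝 0).comap polarMap ⊓ 𝓟 K ⊓ 𝓟 {q | 0 < q.1 ∧ polarMap q ∈ W}).NeBot :=
      frequently_mem_iff_neBot.1 hcl
    set 𝒱 := Ultrafilter.of ((𝓝 0).comap polarMap ⊓ 𝓟 K ⊓ 𝓟 {q | 0 < q.1 ∧ polarMap q ∈ W}) with h𝒱
    have hle := Ultrafilter.of_le ((𝓝 0).comap polarMap ⊓ 𝓟 K ⊓ 𝓟 {q | 0 < q.1 ∧ polarMap q ∈ W})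
    rw [← h𝒱] at hle
    obtain ⟨p, -, hp⟩ := hKc.ultrafilter_le_nhds 𝒱 (hle.trans (inf_le_left.trans inf_le_right))
    have hp1 : Tendsto polarMap 𝒱 (𝓝 (polarMap p)) := (continuous_polarMap.tendsto p).mono_left hp
    have hp2 : Tendsto polarMap 𝒱 (𝓝 0) :=
        tendsto_iff_comap.2 (hle.trans (inf_le_left.trans inf_le_left))
    have hp3 := polarMap_sq p
    rw [tendsto_nhds_unique hp1 hp2] at hp3
    have hp4 : p.1 = 0 := by simpa [eq_comm] using hp3
    refine ⟨p.2, 𝒱.map fun q => (q.1, q.2 - p.2), ?_, ?_⟩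
    · have h1 : Continuous fun q : ℝ × ℝ => (q.1, q.2 - p.2) := by fun_prop
      have h2 := (h1.tendsto p).mono_left hp
      rw [hp4, sub_self, Prod.mk_zero_zero] at h2
      exact h2
    · rw [Ultrafilter.coe_map, eventually_map]
      have h2 : ∀ᶠ q in (𝒱 : Filter (ℝ × ℝ)), 0 < q.1 ∧ polarMap q ∈ W :=
        (hle.trans inf_le_right) (mem_principal_self _)
      filter_upwards [h2] with q hq
      simpa using hq
  set T : ℝ × ℝ → ℝ × ℝ := fun q => polarMap (q.1, θ₀ + q.2) with hT
  have hTa : ∀ q, AnalyticAt ℝ T q := fun q =>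
    AnalyticAt.fun_comp (analyticAt_polarMap _)
      (analyticAt_fst.prod (analyticAt_const.add analyticAt_snd))
  have hT0 : T 0 = 0 := by simp [hT, polarMap]
  have hTt : Tendsto T (𝓝 0) (𝓝 0) := by simpa [hT0] using (hTa 0).continuousAt.tendsto
  set F : ℝ × ℝ → ℝ := fun q => H (T q) with hFdef
  have hF : AnalyticAt ℝ F 0 := hH.comp_of_tendsto (hTa 0) hT0
  have hTd : ∀ q : ℝ × ℝ, HasFDerivAt T (fderiv ℝ T q) q := fun q =>
      (hTa q).differentiableAt.hasFDerivAt
  have hT1 : ∀ q : ℝ × ℝ, fderiv ℝ T q (1, 0) = (Real.cos (θ₀ + q.2), Real.sin (θ₀ + q.2)) := by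
    intro q
    have h1 : HasDerivAt (fun r : ℝ => (r, q.2)) ((1 : ℝ), (0 : ℝ)) q.1 :=
      (hasDerivAt_id _).prodMk (hasDerivAt_const _ _)
    have h2 := HasFDerivAt.comp_hasDerivAt (f := fun r : ℝ => (r, q.2)) q.1 (hTd q) h1
    refine h2.unique ?_
    simpa [Function.comp_def, hT, polarMap] using
      ((hasDerivAt_id q.1).mul_const (Real.cos (θ₀ + q.2))).prodMk
          ((hasDerivAt_id q.1).mul_const (Real.sin (θ₀ + q.2)))
  have hT2 : ∀ q : ℝ × ℝ, fderiv ℝ T q (0, 1) = (-(T q).2, (T q).1) := by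
    intro q
    have h1 : HasDerivAt (fun θ : ℝ => (q.1, θ)) ((0 : ℝ), (1 : ℝ)) q.2 :=
      (hasDerivAt_const _ _).prodMk (hasDerivAt_id _)
    have h2 := HasFDerivAt.comp_hasDerivAt (f := fun θ : ℝ => (q.1, θ)) q.2 (hTd q) h1
    refine h2.unique ?_
    have h3 : HasDerivAt (fun θ => θ₀ + θ) 1 q.2 := (hasDerivAt_id q.2).const_add θ₀
    simpa [Function.comp_def, hT, polarMap] using
      (h3.cos.const_mul q.1).prodMk (h3.sin.const_mul q.1)
  have hFd : ∀ᶠ q in 𝓝 (0 : ℝ × ℝ), fderiv ℝ F q = (fderiv ℝ H (T q)).comp (fderiv ℝ T q) := by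
    filter_upwards [hTt.eventually hH.eventually_analyticAt] with q hq
    exact (hq.differentiableAt.hasFDerivAt.comp q (hTd q)).fderiv
  have hcritF : ∀ᶠ q : ℝ × ℝ in 𝓝 0, 0 < q.1 → fderiv ℝ F q ≠ 0 := by
    filter_upwards [hFd, hTt.eventually hiso] with q h1 h2 h3 h4
    have h5 : T q = 0 := by
      refine h2 ?_
      have e1 : fderiv ℝ H (T q) (Real.cos (θ₀ + q.2), Real.sin (θ₀ + q.2)) = 0 := by
        have := congrArg (fun L => L (1, 0)) (h1.symm.trans h4)
        simpa [hT1] using this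
      have e2 : fderiv ℝ H (T q) (-(T q).2, (T q).1) = 0 := by
        have := congrArg (fun L => L (0, 1)) (h1.symm.trans h4)
        simpa [hT2] using this
      rw [clm_apply_prod] at e1 e2
      have e3 : (T q).1 = q.1 * Real.cos (θ₀ + q.2) := rfl
      have e4 : (T q).2 = q.1 * Real.sin (θ₀ + q.2) := rfl
      rw [e3, e4] at e2
      have e5 : -Real.sin (θ₀ + q.2) * fderiv ℝ H (T q) (1, 0) +
          Real.cos (θ₀ + q.2) * fderiv ℝ H (T q) (0, 1) = 0 := by
        refine (mul_eq_zero.1 (?_ : q.1 * _ = 0)).resolve_left h3.ne'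
        linarith
      have e6 := Real.sin_sq_add_cos_sq (θ₀ + q.2)
      have e7 : fderiv ℝ H (T q) (1, 0) = 0 := by
        linear_combination Real.cos (θ₀ + q.2) * e1 - Real.sin (θ₀ + q.2) * e5 - fderiv ℝ H (T q)
          (1, 0) * e6
      have e8 : fderiv ℝ H (T q) (0, 1) = 0 := by
        linear_combination Real.sin (θ₀ + q.2) * e1 + Real.cos (θ₀ + q.2) * e5 - fderiv ℝ H (T q)
          (0, 1) * e6
      ext
      · simpa using e7
      · simpa using e8
    have := polarMap_sq (q.1, θ₀ + q.2)
    have h6 : polarMap (q.1, θ₀ + q.2) = 0 := h5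
    rw [h6] at this
    simp only [Prod.fst_zero, Prod.snd_zero, ne_eq, OfNat.ofNat_ne_zero, not_false_eq_true,
        zero_pow, add_zero] at this
    exact (pow_pos h3 2).ne this
  have hF0 : ¬ ∀ᶠ p in 𝓝 (0 : ℝ × ℝ), F p = 0 := by
    intro h
    have h1 : ∀ᶠ q in 𝓝 (0 : ℝ × ℝ), fderiv ℝ F q = 0 := by
      filter_upwards [h.eventually_nhds] with q hq
      have : F =ᶠ[𝓝 q] fun _ => 0 := hq
      rw [this.fderiv_eq (𝕜 := ℝ)]
      simp
    obtain ⟨q, h2, h3, h4⟩ := ((h1.filter_mono h𝒰).and ((hcritF.filter_mono h𝒰).and hU)).exists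
    exact h3 h4.1 h2
  have hFU : ∀ᶠ q : ℝ × ℝ in (𝒰 : Filter (ℝ × ℝ)), 0 < q.1 ∧ F q = 0 ∧ fderiv ℝ F q (0, 1) = 0 := by
    filter_upwards [hU, h𝒰 hFd] with q h1 h2
    refine ⟨h1.1, h1.2.2.1, ?_⟩
    rw [h2, ContinuousLinearMap.comp_apply, hT2]
    exact h1.2.2.2
  obtain ⟨N, φ, hN, hφ, hφ0, hφU⟩ := exists_puiseux_of_ultrafilter hF hF0 𝒰 h𝒰
    (hFU.mono fun q h => ⟨h.1, h.2.1⟩)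
  set c : ℝ → ℝ × ℝ := fun x => (x ^ N, φ x) with hc
  have hca : AnalyticAt ℝ c 0 := (analyticAt_id.pow N).prod hφ
  have hc0 : c 0 = 0 := by simp [hc, hN.ne', hφ0]
  have hct : Tendsto c (𝓝 0) (𝓝 0) := by simpa [hc0] using hca.continuousAt.tendsto
  have hroot : Tendsto (fun q : ℝ × ℝ => q.1 ^ (1 / (N : ℝ))) (𝒰 : Filter (ℝ × ℝ)) (𝓝[≠] 0) := by
    have hN' : (0 : ℝ) < N := by exact_mod_cast hN
    refine tendsto_nhdsWithin_iff.2 ⟨?_, hFU.mono fun q h => (Real.rpow_pos_of_pos h.1 _).ne'⟩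
    have h1 : ContinuousAt (fun p : ℝ × ℝ => p.1 ^ (1 / (N : ℝ))) 0 :=
      continuousAt_fst.rpow_const (Or.inr (by positivity))
    have h2 := h1.tendsto
    simp only [Prod.fst_zero] at h2
    rw [Real.zero_rpow (by positivity)] at h2
    exact h2.mono_left h𝒰
  have hcU : ∀ᶠ q : ℝ × ℝ in (𝒰 : Filter (ℝ × ℝ)), c (q.1 ^ (1 / (N : ℝ))) = q := by
    filter_upwards [hφU, hFU] with q h1 h2
    refine Prod.ext ?_ h1.symm
    simp only [hc]
    rw [← Real.rpow_mul_natCast h2.1.le, one_div_mul_cancel (by exact_mod_cast hN.ne'),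
        Real.rpow_one]
  have hvan : ∀ g : ℝ × ℝ → ℝ, AnalyticAt ℝ g 0 → (∀ᶠ q in (𝒰 : Filter (ℝ × ℝ)), g q = 0) →
      ∀ᶠ x in 𝓝 (0 : ℝ), g (c x) = 0 := by
    intro g hg hgU
    refine (AnalyticAt.frequently_zero_iff_eventually_zero (AnalyticAt.comp_of_eq hg hca hc0)).1 ?_
    refine hroot.frequently (Eventually.frequently ?_)
    filter_upwards [hgU, hcU] with q h1 h2
    rw [Function.comp_apply, h2, h1]
  have hv1 := hvan F hF (hFU.mono fun q h => h.2.1)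
  have hv2 := hvan _ (hF.fderiv_apply (0, 1)) (hFU.mono fun q h => h.2.2)
  have hbad : ∀ᶠ x in 𝓝[>] (0 : ℝ), False := by
    have hw : ∀ {P : ℝ → Prop}, (∀ᶠ x in 𝓝 (0 : ℝ), P x) → ∀ᶠ x in 𝓝[>] (0 : ℝ), P x :=
      fun h => h.filter_mono nhdsWithin_le_nhds
    filter_upwards [hw hv1.eventually_nhds, hw hv2, hw hφ.eventually_analyticAt,
        hw (hct.eventually hF.eventually_analyticAt),
      hw (hct.eventually hcritF), self_mem_nhdsWithin] with x h1 h2 h3 h4 h5 (h6 : 0 < x)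
    have hx : (0 : ℝ) < (c x).1 := pow_pos h6 N
    refine h5 hx ?_
    have hcd : HasDerivAt c (N * x ^ (N - 1), deriv φ x) x :=
      (hasDerivAt_pow N x).prodMk h3.differentiableAt.hasDerivAt
    have hd := h4.differentiableAt.hasFDerivAt.comp_hasDerivAt x hcd
    have hd0 : HasDerivAt (F ∘ c) 0 x :=
      (hasDerivAt_const x (0 : ℝ)).congr_of_eventuallyEq h1
    have e := hd.unique hd0
    rw [clm_apply_prod, h2, mul_zero, add_zero] at e
    have e3 := (mul_eq_zero.1 e).resolve_left
      (mul_ne_zero (by exact_mod_cast hN.ne') (pow_ne_zero _ h6.ne'))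
    ext
    · simpa using e3
    · simpa using h2
  exact hbad.exists.elim fun _ h => h

end

section

open Filter Topology Set
open scoped NNReal

/-- `φ` is the global flow of the Lipschitz vector field `v`. -/
structure IsLipschitzFlow {E : Type*} [NormedAddCommGroup E] [NormedSpace ℝ E]
    (v : E → E) (φ : ℝ → E → E) : Prop where
  exists_lipschitz : ∃ K : ℝ≥0, LipschitzWith K v
  map_zero : ∀ x, φ 0 x = x
  hasDerivAt : ∀ x t, HasDerivAt (fun s => φ s x) (v (φ t x)) t

section Flow
variable {E : Type*} [NormedAddCommGroup E] [NormedSpace ℝ E] {v : E → E} {φ : ℝ → E → E}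

theorem exists_isLipschitzFlow [CompleteSpace E] {K L : ℝ≥0} (hv : LipschitzWith K v)
    (hL : ∀ x, ‖v x‖ ≤ L) : ∃ φ, IsLipschitzFlow v φ := by
  have key : ∀ (x : E) (n : ℕ), ∃ α : ℝ → E, α 0 = x ∧
      ∀ t ∈ Ioo (-(n + 1) : ℝ) (n + 1), HasDerivAt α (v (α t)) t := by
    intro x n
    have h0 : (0 : ℝ) ∈ Icc (-(n + 1) : ℝ) (n + 1) := by
      constructor <;> [linarith [n.cast_nonneg (α := ℝ)]; positivity]
    have hp : IsPicardLindelof (fun _ => v) (⟨0, h0⟩ : Icc (-(n + 1) : ℝ) (n + 1)) x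
        (L * (n + 1)) 0 L K :=
      { lipschitzOnWith := fun t _ => hv.lipschitzOnWith
        continuousOn := fun x _ => continuousOn_const
        norm_le := fun t _ x _ => hL x
        mul_max_le := by simp }
    obtain ⟨α, h1, h2⟩ := hp.exists_eq_forall_mem_Icc_hasDerivWithinAt₀
    exact ⟨α, h1, fun t ht => (h2 t ⟨ht.1.le, ht.2.le⟩).hasDerivAt (Icc_mem_nhds ht.1 ht.2)⟩
  choose α hα0 hα using key
  have agree : ∀ x (n m : ℕ), n ≤ m → EqOn (α x n) (α x m) (Ioo (-(n + 1) : ℝ) (n + 1)) := by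
    intro x n m hnm
    have hnm' : (n : ℝ) ≤ m := by exact_mod_cast hnm
    refine ODE_solution_unique_of_mem_Ioo (v := fun _ => v) (s := fun _ => univ) (K := K)
      (t₀ := 0) (fun t _ => hv.lipschitzOnWith) ?_ (fun t ht => ⟨hα x n t ht, mem_univ _⟩)
      (fun t ht => ⟨hα x m t ⟨by linarith [ht.1], by linarith [ht.2]⟩, mem_univ _⟩) ?_
    · constructor <;> [linarith [n.cast_nonneg (α := ℝ)]; positivity]
    · rw [hα0, hα0]
  refine ⟨fun t x => α x ⌈|t|⌉₊ t, ⟨K, hv⟩, fun x => hα0 x _, fun x t => ?_⟩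
  have hN : ∀ s : ℝ, |s| < ⌈|t|⌉₊ + 1 → α x ⌈|s|⌉₊ s = α x ⌈|t|⌉₊ s := by
    intro s hs
    have hs' : s ∈ Ioo (-(⌈|t|⌉₊ + 1) : ℝ) (⌈|t|⌉₊ + 1) := abs_lt.1 hs
    have hs'' : s ∈ Ioo (-(⌈|s|⌉₊ + 1) : ℝ) (⌈|s|⌉₊ + 1) :=
      abs_lt.1 ((Nat.le_ceil _).trans_lt (lt_add_one _))
    rcases le_total ⌈|s|⌉₊ ⌈|t|⌉₊ with h | h
    · exact agree x _ _ h hs''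
    · exact (agree x _ _ h hs').symm
  have ht : |t| < ⌈|t|⌉₊ + 1 := (Nat.le_ceil _).trans_lt (lt_add_one _)
  refine (hα x ⌈|t|⌉₊ t (abs_lt.1 ht)).congr_of_eventuallyEq ?_
  filter_upwards [(continuous_abs.isOpen_preimage _ isOpen_Iio).mem_nhds ht] with s hs
  exact hN s hs

namespace IsLipschitzFlow

theorem continuous_time (h : IsLipschitzFlow v φ) (x : E) : Continuous fun t => φ t x :=
  continuous_iff_continuousAt.2 fun t => (h.hasDerivAt x t).continuousAt

theorem neg (h : IsLipschitzFlow v φ) : IsLipschitzFlow (fun x => -v x) fun t => φ (-t) := by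
  obtain ⟨K, hK⟩ := h.exists_lipschitz
  refine ⟨⟨K, hK.neg⟩, fun x => by simp [h.map_zero], fun x t => ?_⟩
  have := (h.hasDerivAt x (-t)).scomp t (hasDerivAt_neg t)
  simpa [Function.comp_def] using this

theorem eq_of_hasDerivAt_right (h : IsLipschitzFlow v φ) {γ : ℝ → E} {b : ℝ}
    (hγ : ∀ t ∈ Icc 0 b, HasDerivAt γ (v (γ t)) t) : ∀ t ∈ Icc 0 b, γ t = φ t (γ 0) := by
  obtain ⟨K, hK⟩ := h.exists_lipschitz
  refine ODE_solution_unique (v := fun _ => v) (K := K) (fun _ => hK)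
    (fun t ht => (hγ t ht).continuousAt.continuousWithinAt)
    (fun t ht => (hγ t ⟨ht.1, ht.2.le⟩).hasDerivWithinAt)
    (h.continuous_time _).continuousOn (fun t _ => (h.hasDerivAt _ t).hasDerivWithinAt)
    (h.map_zero _).symm

theorem map_add (h : IsLipschitzFlow v φ) (s t : ℝ) (x : E) : φ (s + t) x = φ s (φ t x) := by
  obtain ⟨K, hK⟩ := h.exists_lipschitz
  have : (fun s => φ (s + t) x) = fun s => φ s (φ t x) := by
    refine ODE_solution_unique_univ (v := fun _ => v) (K := K) (s := fun _ => univ) (t₀ := 0)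
      (fun _ => hK.lipschitzOnWith) (fun s => ⟨?_, mem_univ _⟩)
      (fun s => ⟨h.hasDerivAt _ s, mem_univ _⟩) (by simp [h.map_zero])
    simpa using (h.hasDerivAt x (s + t)).comp_add_const s t
  exact congrFun this s

theorem map_neg_map (h : IsLipschitzFlow v φ) (t : ℝ) (x : E) : φ (-t) (φ t x) = x := by
  rw [← h.map_add]; simp [h.map_zero]

theorem map_map_neg (h : IsLipschitzFlow v φ) (t : ℝ) (x : E) : φ t (φ (-t) x) = x := by
  rw [← h.map_add]; simp [h.map_zero]

theorem dist_le_of_nonneg (h : IsLipschitzFlow v φ) {K : ℝ≥0} (hK : LipschitzWith K v) {t : ℝ}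
    (ht : 0 ≤ t) (x y : E) : dist (φ t x) (φ t y) ≤ dist x y * Real.exp (K * t) := by
  have := dist_le_of_trajectories_ODE (v := fun _ => v) (K := K) (fun _ => hK)
    (h.continuous_time x).continuousOn (fun t _ => (h.hasDerivAt _ t).hasDerivWithinAt)
    (h.continuous_time y).continuousOn (fun t _ => (h.hasDerivAt _ t).hasDerivWithinAt)
    (a := 0) (b := t) (δ := dist x y) (by simp [h.map_zero]) t ⟨ht, le_rfl⟩
  simpa using this

theorem dist_le (h : IsLipschitzFlow v φ) {K : ℝ≥0} (hK : LipschitzWith K v) (t : ℝ)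
    (x y : E) : dist (φ t x) (φ t y) ≤ dist x y * Real.exp (K * |t|) := by
  rcases le_total 0 t with ht | ht
  · rw [abs_of_nonneg ht]; exact h.dist_le_of_nonneg hK ht x y
  · rw [abs_of_nonpos ht]
    simpa using h.neg.dist_le_of_nonneg hK.neg (neg_nonneg.2 ht) x y

theorem continuous_uncurry (h : IsLipschitzFlow v φ) :
    Continuous fun p : ℝ × E => φ p.1 p.2 := by
  obtain ⟨K, hK⟩ := h.exists_lipschitz
  refine continuous_iff_continuousAt.2 fun ⟨t, x⟩ => ?_
  have h1 : Tendsto (fun p : ℝ × E => dist p.2 x * Real.exp (K * |p.1|) + dist (φ p.1 x) (φ t x))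
      (𝓝 (t, x)) (𝓝 0) := by
    have : Continuous fun p : ℝ × E =>
        dist p.2 x * Real.exp (K * |p.1|) + dist (φ p.1 x) (φ t x) := by
      have := h.continuous_time x
      fun_prop
    simpa using this.tendsto (t, x)
  refine tendsto_iff_dist_tendsto_zero.2 (squeeze_zero (fun _ => dist_nonneg) (fun p => ?_) h1)
  exact (dist_triangle _ (φ p.1 x) _).trans (add_le_add_left (h.dist_le hK _ _ _) _)

theorem continuous_space (h : IsLipschitzFlow v φ) (t : ℝ) : Continuous (φ t) :=
  h.continuous_uncurry.comp (continuous_const.prodMk continuous_id)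

end IsLipschitzFlow

theorem ContDiffOn.exists_isLipschitzFlow_eqOn [FiniteDimensional ℝ E] {U K : Set E}
    (hv : ContDiffOn ℝ 1 v U) (hU : IsOpen U) (hK : IsCompact K) (hKU : K ⊆ U) :
    ∃ (χ : E → ℝ) (φ : ℝ → E → E), (∀ x, 0 ≤ χ x ∧ χ x ≤ 1) ∧ (∀ x ∈ K, χ x = 1) ∧
      (∀ x, χ x ≠ 0 → x ∈ U) ∧ IsLipschitzFlow (fun x => χ x • v x) φ := by
  obtain ⟨K', hK', hKK', hK'U⟩ := exists_compact_between hK hU hKU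
  obtain ⟨χ, hχ, hr, hs, h1⟩ := exists_contMDiff_support_eq_eq_one_iff (n := 1)
    (modelWithCornersSelf ℝ E) isOpen_interior hK.isClosed hKK'
  have hχ' : ContDiff ℝ 1 χ := hχ.contDiff
  have hsub : Function.support χ ⊆ K' := hs ▸ interior_subset
  have hzero : ∀ x ∉ K', χ x = 0 := fun x hx => by
    by_contra h
    exact hx (hsub h)
  have hcd : ContDiff ℝ 1 fun x => χ x • v x := by
    refine contDiff_iff_contDiffAt.2 fun x => ?_
    by_cases hx : x ∈ U
    · exact hχ'.contDiffAt.smul (hv.contDiffAt (hU.mem_nhds hx))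
    · refine (contDiffAt_const (c := (0 : E))).congr_of_eventuallyEq ?_
      filter_upwards [hK'.isClosed.isOpen_compl.mem_nhds fun h => hx (hK'U h)] with y hy
      rw [hzero y hy, zero_smul]
  have hcs : HasCompactSupport fun x => χ x • v x :=
    HasCompactSupport.intro hK' fun x hx => by rw [hzero x hx, zero_smul]
  obtain ⟨C, hC⟩ := hcd.lipschitzWith_of_hasCompactSupport hcs one_ne_zero
  obtain ⟨L, hL⟩ := hcs.exists_bound_of_continuous hcd.continuous
  have : CompleteSpace E := FiniteDimensional.complete ℝ E
  obtain ⟨φ, hφ⟩ := exists_isLipschitzFlow (L := ⟨max L 0, le_max_right _ _⟩) hC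
    fun x => (hL x).trans (le_max_left _ _)
  exact ⟨χ, φ, fun x => hr ⟨x, rfl⟩, fun x hx => (h1 x).1 hx, fun x hx => hK'U (hsub hx), hφ⟩
end Flow

end

section

open Filter Topology Set

theorem AnalyticAt.exists_primitive_fst {g : ℝ × ℝ → ℝ} {a : ℝ × ℝ} (hg : AnalyticAt ℝ g a) :
    ∃ B : ℝ × ℝ → ℝ, AnalyticAt ℝ B a ∧ ∀ᶠ p in 𝓝 a, fderiv ℝ B p (1, 0) = g p := by
  have key : ∀ {G : ℝ × ℝ → ℝ}, AnalyticAt ℝ G 0 →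
      ∃ B : ℝ × ℝ → ℝ, AnalyticAt ℝ B 0 ∧ ∀ᶠ p in 𝓝 0, fderiv ℝ B p (1, 0) = G p := by
    intro G hG
    obtain ⟨c, R, h⟩ := hG.exists_hasDoubleSeries
    have hc : Summable fun n : ℕ × ℕ => |c n / (n.1 + 1)| * R ^ (n.1 + n.2) := by
      refine Summable.of_nonneg_of_le (fun n => by have := h.pos.le; positivity) (fun n => ?_)
        h.summable
      have := h.pos.le
      refine mul_le_mul_of_nonneg_right ?_ (by positivity)
      rw [abs_div, abs_of_nonneg (by positivity : (0 : ℝ) ≤ n.1 + 1)]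
      exact div_le_self (abs_nonneg _) (by simp)
    have hS := hasDoubleSeries_doubleSum h.pos hc
    have hB : AnalyticAt ℝ (fun p : ℝ × ℝ => p.1 * doubleSum (fun n => c n / (n.1 + 1)) p) 0 :=
      analyticAt_fst.mul hS.analyticAt
    refine ⟨_, hB, ?_⟩
    have hnear : ∀ᶠ p : ℝ × ℝ in 𝓝 0, |p.1| < R ∧ |p.2| < R := by
      have h1 : Tendsto (fun p : ℝ × ℝ => |p.1|) (𝓝 0) (𝓝 0) := by
        have : Continuous fun p : ℝ × ℝ => |p.1| := by fun_prop
        simpa using this.tendsto 0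
      have h2 : Tendsto (fun p : ℝ × ℝ => |p.2|) (𝓝 0) (𝓝 0) := by
        have : Continuous fun p : ℝ × ℝ => |p.2| := by fun_prop
        simpa using this.tendsto 0
      exact (h1.eventually_lt_const h.pos).and (h2.eventually_lt_const h.pos)
    filter_upwards [hB.eventually_analyticAt, hnear] with p hp hpR
    obtain ⟨s, y⟩ := p
    have hd := hp.hasDerivAt_fst
    have hd' : HasDerivAt (fun s => ∑' n : ℕ × ℕ, c n / (n.1 + 1) * s ^ (n.1 + 1) * y ^ n.2)
        (∑' n : ℕ × ℕ, c n * s ^ n.1 * y ^ n.2) s := by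
      refine hasDerivAt_tsum_of_isPreconnected (t := Ioo (-R) R) h.summable isOpen_Ioo
        isPreconnected_Ioo (g' := fun n s => c n * s ^ n.1 * y ^ n.2) (y₀ := 0)
        (fun n z hz => ?_) (fun n z hz => ?_) ⟨neg_lt_zero.2 h.pos, h.pos⟩ (by simp)
        (abs_lt.1 hpR.1)
      · have := ((hasDerivAt_pow (n.1 + 1) z).const_mul (c n / (n.1 + 1))).mul_const (y ^ n.2)
        refine this.congr_deriv ?_
        have : (n.1 : ℝ) + 1 ≠ 0 := by positivity
        push_cast
        field_simp
      · rw [Real.norm_eq_abs, abs_mul, abs_mul, abs_pow, abs_pow, mul_assoc, pow_add]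
        have := h.pos.le
        have := (abs_lt.2 hz).le
        have := hpR.2.le
        gcongr
    have e : (fun s => ∑' n : ℕ × ℕ, c n / (n.1 + 1) * s ^ (n.1 + 1) * y ^ n.2) =
        fun s => (s, y).1 * doubleSum (fun n => c n / (n.1 + 1)) (s, y) := by
      funext s
      rw [doubleSum, ← tsum_mul_left]
      exact tsum_congr fun n => by ring
    rw [e] at hd'
    rw [hd.unique hd']
    exact (h.hasSum s y hpR.1.le hpR.2.le).tsum_eq
  have hG : AnalyticAt ℝ (fun p : ℝ × ℝ => g (p + a)) 0 :=
    AnalyticAt.fun_comp (g := g) (f := fun p : ℝ × ℝ => p + a) (x := (0 : ℝ × ℝ))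
      (by simpa using hg) (analyticAt_id.add analyticAt_const)
  obtain ⟨B, hB, hd⟩ := key hG
  refine ⟨fun p => B (p - a), AnalyticAt.fun_comp (g := B) (f := fun p : ℝ × ℝ => p - a) (x := a)
      (by simpa using hB) (analyticAt_id.sub analyticAt_const), ?_⟩
  have ht : Tendsto (fun p : ℝ × ℝ => p - a) (𝓝 a) (𝓝 0) := by
    have : Continuous fun p : ℝ × ℝ => p - a := by fun_prop
    simpa using this.tendsto a
  filter_upwards [ht.eventually hd] with p hp
  rw [fderiv_comp_sub, hp, sub_add_cancel]

theorem hamVF_apply_self {H : ℝ × ℝ → ℝ} (p : ℝ × ℝ) : fderiv ℝ H p (hamVF H p) = 0 := by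
  rw [hamVF, clm_apply_prod]; ring

theorem exists_time_function_of_snd {H : ℝ × ℝ → ℝ} {p : ℝ × ℝ} (hH : AnalyticAt ℝ H p)
    (hy : fderiv ℝ H p (0, 1) ≠ 0) :
    ∃ A : ℝ × ℝ → ℝ, AnalyticAt ℝ A p ∧ ∀ᶠ q in 𝓝 p, fderiv ℝ A q (hamVF H q) = 1 := by
  obtain ⟨Y, hY, hYp, h1, h2⟩ := exists_analytic_inverse_snd hH hy
  have hT : AnalyticAt ℝ (fun q : ℝ × ℝ => (q.1, H q)) p := analyticAt_fst.prod hH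
  have hHy : AnalyticAt ℝ (fun q => fderiv ℝ H q (0, 1)) p := hH.fderiv_apply _
  have hg : AnalyticAt ℝ (fun z : ℝ × ℝ => (fderiv ℝ H (z.1, Y z) (0, 1))⁻¹) (p.1, H p) := by
    refine (AnalyticAt.comp_of_eq (g := fun q => fderiv ℝ H q (0, 1)) (y := p) hHy
      (analyticAt_fst.prod hY) ?_).inv ?_
    · simp [hYp]
    · simpa [hYp] using hy
  obtain ⟨B, hB, hBd⟩ := hg.exists_primitive_fst
  have hA : AnalyticAt ℝ (fun q : ℝ × ℝ => B (q.1, H q)) p :=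
    AnalyticAt.comp_of_eq (g := B) hB hT rfl
  refine ⟨_, hA, ?_⟩
  have hTt : Tendsto (fun q : ℝ × ℝ => (q.1, H q)) (𝓝 p) (𝓝 (p.1, H p)) := hT.continuousAt
  filter_upwards [h2, hTt.eventually hBd, hTt.eventually hB.eventually_analyticAt,
    hH.eventually_analyticAt, hHy.continuousAt.eventually_ne hy] with q hq hBq hBa hHq hne
  have hdT : HasFDerivAt (fun q : ℝ × ℝ => (q.1, H q))
      ((ContinuousLinearMap.fst ℝ ℝ ℝ).prod (fderiv ℝ H q)) q :=
    hasFDerivAt_fst.prodMk hHq.differentiableAt.hasFDerivAt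
  have := (hBa.differentiableAt.hasFDerivAt.comp q hdT).fderiv
  rw [Function.comp_def] at this
  rw [this, ContinuousLinearMap.comp_apply, ContinuousLinearMap.prod_apply, hamVF_apply_self,
    clm_apply_prod, hBq]
  simp only [hq, Prod.mk.eta, ContinuousLinearMap.coe_fst']
  simp only [hamVF]
  field_simp
  simp

theorem exists_time_function {H : ℝ × ℝ → ℝ} {p : ℝ × ℝ} (hH : AnalyticAt ℝ H p)
    (hd : fderiv ℝ H p ≠ 0) :
    ∃ A : ℝ × ℝ → ℝ, AnalyticAt ℝ A p ∧ ∀ᶠ q in 𝓝 p, fderiv ℝ A q (hamVF H q) = 1 := by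
  by_cases hy : fderiv ℝ H p (0, 1) = 0
  swap
  · exact exists_time_function_of_snd hH hy
  have hx : fderiv ℝ H p (1, 0) ≠ 0 := by
    intro hx
    refine hd (ContinuousLinearMap.ext fun v => ?_)
    rw [show v = (v.1, v.2) from rfl, clm_apply_prod, hx, hy]; simp
  have hsw : ∀ q : ℝ × ℝ, HasFDerivAt (Prod.swap : ℝ × ℝ → ℝ × ℝ)
      ((ContinuousLinearMap.snd ℝ ℝ ℝ).prod (ContinuousLinearMap.fst ℝ ℝ ℝ)) q := fun q =>
    hasFDerivAt_snd.prodMk hasFDerivAt_fst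
  have hswa : ∀ q : ℝ × ℝ, AnalyticAt ℝ (Prod.swap : ℝ × ℝ → ℝ × ℝ) q := fun q =>
    analyticAt_snd.prod analyticAt_fst
  have hG : AnalyticAt ℝ (H ∘ Prod.swap) p.swap :=
    AnalyticAt.comp_of_eq hH (hswa _) (Prod.swap_swap p)
  have hGd : ∀ q : ℝ × ℝ, AnalyticAt ℝ H q.swap → ∀ a b,
      fderiv ℝ (H ∘ Prod.swap) q (a, b) = fderiv ℝ H q.swap (b, a) := by
    intro q hq a b
    rw [(hq.differentiableAt.hasFDerivAt.comp q (hsw q)).fderiv]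
    simp
  obtain ⟨A, hA, hAd⟩ := exists_time_function_of_snd hG (by
    rw [hGd _ (by simpa using hH)]; simpa using hx)
  have hA' : AnalyticAt ℝ (fun q : ℝ × ℝ => -A q.swap) p :=
    (AnalyticAt.comp_of_eq (g := A) hA (hswa p) rfl).neg
  refine ⟨_, hA', ?_⟩
  have ht : Tendsto (Prod.swap : ℝ × ℝ → ℝ × ℝ) (𝓝 p) (𝓝 p.swap) := (hswa p).continuousAt
  filter_upwards [ht.eventually hAd, ht.eventually hA.eventually_analyticAt,
    hH.eventually_analyticAt] with q hq hAq hHq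
  have e := ((hAq.differentiableAt.hasFDerivAt.comp q (hsw q)).neg).fderiv
  have e' : (fun q : ℝ × ℝ => -A q.swap) = -(A ∘ Prod.swap) := rfl
  rw [e', e]
  rw [hamVF, hGd _ (by simpa using hHq), hGd _ (by simpa using hHq), Prod.swap_swap] at hq
  simp only [hamVF, neg_apply, ContinuousLinearMap.comp_apply,
    ContinuousLinearMap.prod_apply, ContinuousLinearMap.coe_fst', ContinuousLinearMap.coe_snd']
  rw [clm_apply_prod] at hq ⊢
  linarith

/-- Local straightening of a Hamiltonian flow, in area preserving coordinates. -/
theorem exists_flow_box {H : ℝ × ℝ → ℝ} {p : ℝ × ℝ} (hH : AnalyticAt ℝ H p)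
    (hd : fderiv ℝ H p ≠ 0) {v : ℝ × ℝ → ℝ × ℝ} {φ : ℝ → ℝ × ℝ → ℝ × ℝ}
    (hφ : IsLipschitzFlow v φ) (hv : ∀ᶠ q in 𝓝 p, v q = hamVF H q) :
    ∃ A : ℝ × ℝ → ℝ, ∃ N ∈ 𝓝 p, (∀ q ∈ N, AnalyticAt ℝ H q ∧ AnalyticAt ℝ A q ∧
        |(fderiv ℝ (fun q => (H q, A q)) q).det| = 1) ∧
      InjOn (fun q => (H q, A q)) N ∧
      ∀ᶠ z : ℝ × (ℝ × ℝ) in 𝓝 (0, p),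
        φ z.1 z.2 ∈ N ∧ H (φ z.1 z.2) = H z.2 ∧ A (φ z.1 z.2) = A z.2 + z.1 := by
  obtain ⟨A, hA, hAd⟩ := exists_time_function hH hd
  have hdet : ∀ᶠ q in 𝓝 p, |(fderiv ℝ (fun q => (H q, A q)) q).det| = 1 := by
    filter_upwards [hA.eventually_analyticAt, hH.eventually_analyticAt, hAd] with q hAq hHq hq
    rw [(hHq.differentiableAt.hasFDerivAt.prodMk hAq.differentiableAt.hasFDerivAt).fderiv,
      ContinuousLinearMap.det_prod_eq]
    rw [hamVF, clm_apply_prod] at hq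
    simp only [ContinuousLinearMap.prod_apply]
    rw [abs_eq zero_le_one]
    right
    linarith
  obtain ⟨g, -, -, hg, -⟩ := exists_analytic_inverse (hH.prod hA) (by
    intro h
    have := hdet.self_of_nhds
    rw [h] at this
    simp at this)
  have hN := (hA.eventually_analyticAt.and (hH.eventually_analyticAt.and (hAd.and
    (hdet.and (hg.and hv)))))
  refine ⟨A, _, hN, fun q hq => ⟨hq.2.1, hq.1, hq.2.2.2.1⟩, fun q hq q' hq' h => ?_, ?_⟩
  · have h1 := hq.2.2.2.2.1
    have h2 := hq'.2.2.2.2.1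
    rw [← h1, ← h2]
    exact congrArg g h
  have hc : Tendsto (fun z : ℝ × (ℝ × ℝ) => φ z.1 z.2) (𝓝 (0, p)) (𝓝 p) := by
    have := hφ.continuous_uncurry.tendsto ((0 : ℝ), p)
    rwa [hφ.map_zero] at this
  have hc' := hc.eventually hN
  rw [nhds_prod_eq] at hc' 
  obtain ⟨P, hP, Q, hQ, hPQ⟩ := eventually_prod_iff.1 hc'
  obtain ⟨δ, hδ, hball⟩ := Metric.eventually_nhds_iff_ball.1 hP
  rw [nhds_prod_eq]
  have hP' : ∀ᶠ s : ℝ in 𝓝 0, s ∈ Metric.ball (0 : ℝ) δ := Metric.ball_mem_nhds _ hδ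
  filter_upwards [hP'.prod_mk hQ] with z hz
  obtain ⟨s, q⟩ := z
  obtain ⟨hs, hq⟩ := hz
  have hall : ∀ u ∈ Metric.ball (0 : ℝ) δ, _ := fun u hu => hPQ (hball u hu) hq
  refine ⟨hall s hs, ?_⟩
  have hder : ∀ u ∈ Metric.ball (0 : ℝ) δ,
      HasDerivAt (fun u => (H (φ u q), A (φ u q) - u)) (0 : ℝ × ℝ) u := by
    intro u hu
    obtain ⟨h1, h2, h3, h4, h5, h6⟩ := hall u hu
    have hf := hφ.hasDerivAt q u
    rw [h6] at hf
    have e1 := h2.differentiableAt.hasFDerivAt.comp_hasDerivAt u hf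
    have e2 := (h1.differentiableAt.hasFDerivAt.comp_hasDerivAt u hf).sub (hasDerivAt_id u)
    rw [hamVF_apply_self] at e1
    rw [h3, sub_self] at e2
    exact e1.prodMk e2
  have hconst := (convex_ball (0 : ℝ) δ).is_const_of_fderivWithin_eq_zero (𝕜 := ℝ)
    (f := fun u => (H (φ u q), A (φ u q) - u))
    (fun u hu => (hder u hu).differentiableAt.differentiableWithinAt) (fun u hu => by
      rw [((hder u hu).hasFDerivAt.hasFDerivWithinAt).fderivWithin
        (Metric.isOpen_ball.uniqueDiffWithinAt hu)]
      ext <;> simp) hs (Metric.mem_ball_self hδ)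
  simp only [hφ.map_zero, Prod.mk.injEq] at hconst
  exact ⟨hconst.1, by linarith [hconst.2]⟩

end

section

open Filter Topology Set

/-- The squared Euclidean norm on `ℝ × ℝ`. -/
def nsq (p : ℝ × ℝ) : ℝ := p.1 ^ 2 + p.2 ^ 2

theorem nsq_nonneg (p : ℝ × ℝ) : 0 ≤ nsq p := by unfold nsq; positivity

theorem continuous_nsq : Continuous nsq := by unfold nsq; fun_prop

theorem nsq_pos {p : ℝ × ℝ} (hp : p ≠ 0) : 0 < nsq p := by
  refine (nsq_nonneg p).lt_of_ne fun h => hp ?_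
  unfold nsq at h
  ext <;> simp <;> nlinarith [sq_nonneg p.1, sq_nonneg p.2]

theorem ne_zero_of_nsq_pos {p : ℝ × ℝ} (hp : 0 < nsq p) : p ≠ 0 := by
  rintro rfl
  simp [nsq] at hp

theorem HasDerivAt.nsq {γ : ℝ → ℝ × ℝ} {w : ℝ × ℝ} {t : ℝ} (h : HasDerivAt γ w t) :
    HasDerivAt (fun t => nsq (γ t)) (2 * ((γ t).1 * w.1 + (γ t).2 * w.2)) t := by
  have h1 : HasDerivAt (fun t => (γ t).1) w.1 t :=
    (hasFDerivAt_fst (𝕜 := ℝ) (p := γ t)).comp_hasDerivAt t h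
  have h2 : HasDerivAt (fun t => (γ t).2) w.2 t :=
    (hasFDerivAt_snd (𝕜 := ℝ) (p := γ t)).comp_hasDerivAt t h
  refine ((h1.pow 2).add (h2.pow 2)).congr_deriv ?_
  simp; ring

theorem isCompact_annulus (a b : ℝ) : IsCompact {p : ℝ × ℝ | a ≤ nsq p ∧ nsq p ≤ b} := by
  refine Metric.isCompact_of_isClosed_isBounded
    ((isClosed_le continuous_const continuous_nsq).inter
      (isClosed_le continuous_nsq continuous_const)) ?_
  refine (Metric.isBounded_closedBall (x := (0 : ℝ × ℝ)) (r := |b| + 1)).subset fun p hp => ?_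
  have hb := hp.2
  have hb' := le_abs_self b
  unfold nsq at hb
  rw [mem_closedBall_zero_iff, Prod.norm_def, sup_le_iff, Real.norm_eq_abs, Real.norm_eq_abs]
  have : ∀ x : ℝ, x ^ 2 ≤ b → |x| ≤ |b| + 1 := fun x hx =>
    abs_le_of_sq_le_sq (by nlinarith [abs_nonneg b]) (by positivity)
  exact ⟨this _ (by nlinarith [sq_nonneg p.2]), this _ (by nlinarith [sq_nonneg p.1])⟩

/-- The angular derivative of `H`. -/
noncomputable def angDeriv (H : ℝ × ℝ → ℝ) (p : ℝ × ℝ) : ℝ := fderiv ℝ H p (-p.2, p.1)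

theorem fderiv_neg_fun (H : ℝ × ℝ → ℝ) (p : ℝ × ℝ) :
    fderiv ℝ (fun p => -H p) p = -fderiv ℝ H p := fderiv_fun_neg

theorem angDeriv_neg (H : ℝ × ℝ → ℝ) (p : ℝ × ℝ) :
    angDeriv (fun p => -H p) p = -angDeriv H p := by
  rw [angDeriv, fderiv_neg_fun]; rfl

theorem hamVF_neg (H : ℝ × ℝ → ℝ) (p : ℝ × ℝ) :
    hamVF (fun p => -H p) p = -hamVF H p := by
  rw [hamVF, fderiv_neg_fun]; rfl

/-- The disc of radius `R` around the saddle-type critical point `0` is adapted to `H`. -/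
structure IsGoodDisc (H : ℝ × ℝ → ℝ) (R : ℝ) : Prop where
  map_zero : H 0 = 0
  analyticAt : ∀ p, nsq p < R ^ 2 → AnalyticAt ℝ H p
  fderiv_ne : ∀ p, p ≠ 0 → nsq p < R ^ 2 → fderiv ℝ H p ≠ 0
  angDeriv_ne : ∀ p, p ≠ 0 → nsq p < R ^ 2 → H p = 0 → angDeriv H p ≠ 0
  not_max : ¬IsLocalMax H 0
  not_min : ¬IsLocalMin H 0

theorem IsGoodDisc.neg {H : ℝ × ℝ → ℝ} {R : ℝ} (h : IsGoodDisc H R) :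
    IsGoodDisc (fun p => -H p) R where
  map_zero := by simp [h.map_zero]
  analyticAt p hp := (h.analyticAt p hp).neg
  fderiv_ne p hp hpR := by rw [fderiv_neg_fun]; exact neg_ne_zero.2 (h.fderiv_ne p hp hpR)
  angDeriv_ne p hp hpR h0 := by
    rw [angDeriv_neg]; exact neg_ne_zero.2 (h.angDeriv_ne p hp hpR (neg_eq_zero.1 h0))
  not_max h' := h.not_min (by simpa using h'.neg)
  not_min h' := h.not_max (by simpa using h'.neg)

theorem exists_isGoodDisc {H : ℝ × ℝ → ℝ} (hH : AnalyticAt ℝ H 0) (h0 : H 0 = 0)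
    (hiso : ∀ᶠ p in 𝓝 (0 : ℝ × ℝ), fderiv ℝ H p = 0 → p = 0)
    (hmax : ¬IsLocalMax H 0) (hmin : ¬IsLocalMin H 0) : ∃ R > 0, IsGoodDisc H R := by
  obtain ⟨R, hR, hball⟩ := Metric.eventually_nhds_iff_ball.1
    (hH.eventually_analyticAt.and (hiso.and (hH.eventually_transversal hiso)))
  have hsub : ∀ p, nsq p < R ^ 2 → p ∈ Metric.ball (0 : ℝ × ℝ) R := by
    intro p hp
    unfold nsq at hp
    rw [mem_ball_zero_iff, Prod.norm_def, sup_lt_iff, Real.norm_eq_abs, Real.norm_eq_abs]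
    exact ⟨abs_lt_of_sq_lt_sq (by nlinarith [sq_nonneg p.2]) hR.le,
      abs_lt_of_sq_lt_sq (by nlinarith [sq_nonneg p.1]) hR.le⟩
  exact ⟨R, hR, h0, fun p hp => (hball p (hsub p hp)).1,
    fun p hp hpR h => hp ((hball p (hsub p hpR)).2.1 h),
    fun p hp hpR h => (hball p (hsub p hpR)).2.2 hp h, hmax, hmin⟩

/-- A vector field with unit logarithmic radial speed that preserves the zero level of `H`. -/
noncomputable def radVF (H : ℝ × ℝ → ℝ) (p : ℝ × ℝ) : ℝ × ℝ :=
  p + (-(fderiv ℝ H p p * angDeriv H p) / (angDeriv H p ^ 2 + H p ^ 2)) • (-p.2, p.1)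

theorem eq_zero_of_deriv_le {f f' : ℝ → ℝ} {a b G : ℝ}
    (hf : ∀ t ∈ uIcc a b, HasDerivAt f (f' t) t) (hG : ∀ t ∈ uIcc a b, |f' t| ≤ G * |f t|)
    (ha : f a = 0) : f b = 0 := by
  have key : ∀ {f f' : ℝ → ℝ} {a b : ℝ}, a ≤ b → (∀ t ∈ Icc a b, HasDerivAt f (f' t) t) →
      (∀ t ∈ Icc a b, |f' t| ≤ G * |f t|) → f a = 0 → f b = 0 := by
    intro f f' a b hab hf hG ha
    have := norm_le_gronwallBound_of_norm_deriv_right_le (f := f) (f' := f') (δ := 0) (K := G)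
      (ε := 0) (a := a) (b := b) (fun t ht => (hf t ht).continuousAt.continuousWithinAt)
      (fun t ht => (hf t ⟨ht.1, ht.2.le⟩).hasDerivWithinAt) (by simp [ha])
      (fun t ht => by simpa using hG t ⟨ht.1, ht.2.le⟩) b ⟨hab, le_rfl⟩
    rw [gronwallBound_ε0_δ0] at this
    simpa using this
  rcases le_total a b with hab | hab
  · rw [uIcc_of_le hab] at hf hG
    exact key hab hf hG ha
  · rw [uIcc_of_ge hab] at hf hG
    have := key (f := fun t => f (-t)) (f' := fun t => -f' (-t)) (a := -a) (b := -b)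
      (neg_le_neg hab) (fun t ht => ?_) (fun t ht => ?_) (by simpa using ha)
    · simpa using this
    · have ht' : -t ∈ Icc b a := ⟨by linarith [ht.2], by linarith [ht.1]⟩
      simpa [Function.comp_def] using (hf _ ht').scomp t (hasDerivAt_neg t)
    · have ht' : -t ∈ Icc b a := ⟨by linarith [ht.2], by linarith [ht.1]⟩
      simpa using hG _ ht'

namespace IsGoodDisc
variable {H : ℝ × ℝ → ℝ} {R : ℝ}

theorem den_ne (h : IsGoodDisc H R) {p : ℝ × ℝ} (hp : 0 < nsq p) (hpR : nsq p < R ^ 2) :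
    angDeriv H p ^ 2 + H p ^ 2 ≠ 0 := by
  intro h0
  have h1 : H p = 0 := by nlinarith [sq_nonneg (angDeriv H p), sq_nonneg (H p)]
  have h2 : angDeriv H p = 0 := by nlinarith [sq_nonneg (angDeriv H p), sq_nonneg (H p)]
  exact h.angDeriv_ne p (ne_zero_of_nsq_pos hp) hpR h1 h2

theorem isOpen_punctured (R : ℝ) : IsOpen {p : ℝ × ℝ | 0 < nsq p ∧ nsq p < R ^ 2} :=
  (isOpen_lt continuous_const continuous_nsq).inter (isOpen_lt continuous_nsq continuous_const)

theorem isOpen_disc (R : ℝ) : IsOpen {p : ℝ × ℝ | nsq p < R ^ 2} :=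
  isOpen_lt continuous_nsq continuous_const

theorem contDiffAt_fderiv (h : IsGoodDisc H R) {p : ℝ × ℝ} (hpR : nsq p < R ^ 2) :
    ContDiffAt ℝ 1 (fderiv ℝ H) p := (h.analyticAt p hpR).fderiv.contDiffAt

theorem contDiffAt_angDeriv (h : IsGoodDisc H R) {p : ℝ × ℝ} (hpR : nsq p < R ^ 2) :
    ContDiffAt ℝ 1 (angDeriv H) p := by
  have := h.contDiffAt_fderiv hpR
  unfold angDeriv
  fun_prop

theorem contDiffAt_radVF (h : IsGoodDisc H R) {p : ℝ × ℝ} (hp : 0 < nsq p)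
    (hpR : nsq p < R ^ 2) : ContDiffAt ℝ 1 (radVF H) p := by
  have h1 := h.contDiffAt_fderiv hpR
  have h2 := h.contDiffAt_angDeriv hpR
  have h3 : ContDiffAt ℝ 1 H p := (h.analyticAt p hpR).contDiffAt
  have h4 := h.den_ne hp hpR
  have h5 : ContDiffAt ℝ 1
      (fun p => -(fderiv ℝ H p p * angDeriv H p) / (angDeriv H p ^ 2 + H p ^ 2)) p := by
    refine ContDiffAt.div (f := fun p => -(fderiv ℝ H p p * angDeriv H p))
      (g := fun p => angDeriv H p ^ 2 + H p ^ 2) ?_ ?_ h4 <;> fun_prop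
  unfold radVF
  fun_prop

theorem contDiffAt_hamVF (h : IsGoodDisc H R) {p : ℝ × ℝ} (hpR : nsq p < R ^ 2) :
    ContDiffAt ℝ 1 (hamVF H) p := by
  have h1 := h.contDiffAt_fderiv hpR
  unfold hamVF
  fun_prop

theorem fderiv_radVF (h : IsGoodDisc H R) {p : ℝ × ℝ} (hp : 0 < nsq p)
    (hpR : nsq p < R ^ 2) : fderiv ℝ H p (radVF H p) =
      (fderiv ℝ H p p * H p / (angDeriv H p ^ 2 + H p ^ 2)) * H p := by
  have h4 := h.den_ne hp hpR
  rw [radVF, map_add, map_smul, smul_eq_mul]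
  rw [show fderiv ℝ H p (-p.2, p.1) = angDeriv H p from rfl]
  field_simp
  ring

theorem exists_radial_flow (h : IsGoodDisc H R) {ε ρ : ℝ} (hε : 0 < ε) (hρ : 0 < ρ)
    (hρR : ρ < R) :
    ∃ v Φ, IsLipschitzFlow v Φ ∧ (∀ p, ε ^ 2 ≤ nsq p → nsq p ≤ ρ ^ 2 → v p = radVF H p) ∧
      ∀ p t, ε ^ 2 ≤ nsq p → nsq p ≤ ρ ^ 2 → ε ^ 2 ≤ Real.exp (2 * t) * nsq p →
        Real.exp (2 * t) * nsq p ≤ ρ ^ 2 →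
        nsq (Φ t p) = Real.exp (2 * t) * nsq p ∧ (H p ≠ 0 → H (Φ t p) ≠ 0) := by
  have hρR2 : ρ ^ 2 < R ^ 2 := by nlinarith
  have hε2 : 0 < ε ^ 2 := by positivity
  have hcd : ContDiffOn ℝ 1 (radVF H) {p | 0 < nsq p ∧ nsq p < R ^ 2} := fun p hp =>
    (h.contDiffAt_radVF hp.1 hp.2).contDiffWithinAt
  have hKc := isCompact_annulus (ε ^ 2) (ρ ^ 2)
  obtain ⟨χ, Φ, hχ, hχ1, -, hΦ⟩ := hcd.exists_isLipschitzFlow_eqOn (isOpen_punctured R) hKc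
    (fun p hp => ⟨hε2.trans_le hp.1, hp.2.trans_lt hρR2⟩)
  refine ⟨_, Φ, hΦ, fun p h1 h2 => by rw [hχ1 p ⟨h1, h2⟩, one_smul], ?_⟩
  intro p T hp1 hp2 hT1 hT2
  have hs : ∀ t, HasDerivAt (fun t => nsq (Φ t p)) (2 * χ (Φ t p) * nsq (Φ t p)) t := by
    intro t
    refine (hΦ.hasDerivAt p t).nsq.congr_deriv ?_
    simp only [radVF, nsq, Prod.smul_fst, Prod.smul_snd, Prod.fst_add, Prod.snd_add, smul_eq_mul]
    ring
  have hs' : ∀ t, HasDerivAt (fun t => Real.exp (-(2 * t)) * nsq (Φ t p))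
      (2 * (χ (Φ t p) - 1) * (Real.exp (-(2 * t)) * nsq (Φ t p))) t := by
    intro t
    have := (((hasDerivAt_id t).const_mul 2).neg.exp).mul (hs t)
    refine this.congr_deriv ?_
    simp
    ring
  have hmono : Monotone fun t => nsq (Φ t p) :=
    monotone_of_hasDerivAt_nonneg hs fun t =>
      mul_nonneg (mul_nonneg zero_le_two (hχ _).1) (nsq_nonneg _)
  have hanti : Antitone fun t => Real.exp (-(2 * t)) * nsq (Φ t p) :=
    antitone_of_hasDerivAt_nonpos hs' fun t =>
      mul_nonpos_of_nonpos_of_nonneg (by linarith [(hχ (Φ t p)).2])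
        (mul_nonneg (Real.exp_pos _).le (nsq_nonneg _))
  have hK : ∀ t ∈ uIcc 0 T, ε ^ 2 ≤ nsq (Φ t p) ∧ nsq (Φ t p) ≤ ρ ^ 2 := by
    have e : ∀ t x, Real.exp (-(2 * t)) * x * Real.exp (2 * t) = x := by
      intro t x
      rw [mul_right_comm, ← Real.exp_add]; simp
    intro t ht
    rcases le_total 0 T with h0 | h0
    · rw [uIcc_of_le h0] at ht
      have m1 := hmono ht.1
      have m2 := hmono ht.2
      have m3 := hanti h0
      simp only [hΦ.map_zero, mul_zero, neg_zero, Real.exp_zero, one_mul] at m1 m2 m3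
      have := mul_le_mul_of_nonneg_right m3 (Real.exp_pos (2 * T)).le
      rw [e, mul_comm] at this
      exact ⟨by linarith, by linarith⟩
    · rw [uIcc_of_ge h0] at ht
      have m1 := hmono ht.1
      have m2 := hmono ht.2
      have m3 := hanti h0
      simp only [hΦ.map_zero, mul_zero, neg_zero, Real.exp_zero, one_mul] at m1 m2 m3
      have := mul_le_mul_of_nonneg_right m3 (Real.exp_pos (2 * T)).le
      rw [e, mul_comm] at this
      exact ⟨by linarith, by linarith⟩
  constructor
  · have hc : (fun t => Real.exp (-(2 * t)) * nsq (Φ t p) - nsq p) T = 0 := by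
      refine eq_zero_of_deriv_le (f := fun t => Real.exp (-(2 * t)) * nsq (Φ t p) - nsq p)
        (a := 0) (G := 0) (fun t _ => (hs' t).sub_const _)
        (fun t ht => ?_) (by simp [hΦ.map_zero])
      rw [hχ1 _ (hK t ht)]
      simp
    rw [sub_eq_zero] at hc
    rw [← hc, ← mul_assoc, ← Real.exp_add]
    simp
  · intro hp hT
    obtain ⟨G, hG⟩ := hKc.exists_bound_of_continuousOn
      (f := fun p => fderiv ℝ H p p * H p / (angDeriv H p ^ 2 + H p ^ 2)) (fun q hq => by
        have hq1 : 0 < nsq q := hε2.trans_le hq.1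
        have hq2 : nsq q < R ^ 2 := hq.2.trans_lt hρR2
        have h1 := (h.contDiffAt_fderiv hq2).continuousAt
        have h2 := (h.contDiffAt_angDeriv hq2).continuousAt
        have h3 := (h.analyticAt q hq2).continuousAt
        have h4 := h.den_ne hq1 hq2
        refine ContinuousAt.continuousWithinAt (ContinuousAt.div ?_ ?_ h4) <;> fun_prop)
    refine hp ?_
    have := eq_zero_of_deriv_le (f := fun t => H (Φ t p)) (a := T) (b := 0) (G := G)
      (f' := fun t => fderiv ℝ H (Φ t p) (χ (Φ t p) • radVF H (Φ t p))) (fun t ht => ?_)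
      (fun t ht => ?_) hT
    · simpa [hΦ.map_zero] using this
    · rw [uIcc_comm] at ht
      exact (h.analyticAt _ ((hK t ht).2.trans_lt
          hρR2)).differentiableAt.hasFDerivAt.comp_hasDerivAt
        t (hΦ.hasDerivAt p t)
    · rw [uIcc_comm] at ht
      have hq := hK t ht
      rw [hχ1 _ hq, one_smul, h.fderiv_radVF (hε2.trans_le hq.1) (hq.2.trans_lt hρR2), abs_mul]
      exact mul_le_mul_of_nonneg_right (hG _ hq) (abs_nonneg _)

end IsGoodDisc

end

section

open Filter Topology Set

section Sector
variable {H : ℝ × ℝ → ℝ} {ρ : ℝ} {x₀ p : ℝ × ℝ}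

theorem sector_subset : sector H ρ x₀ ⊆ {p ∈ euclBall ρ | H p ≠ 0} :=
  connectedComponentIn_subset _ _

theorem isPreconnected_sector : IsPreconnected (sector H ρ x₀) :=
  isPreconnected_connectedComponentIn

theorem mem_sector_self (hp : nsq p ≤ ρ ^ 2) (hH : H p ≠ 0) : p ∈ sector H ρ p :=
  mem_connectedComponentIn ⟨hp, hH⟩

theorem sector_eq (hp : p ∈ sector H ρ x₀) : sector H ρ p = sector H ρ x₀ :=
  (connectedComponentIn_eq hp).symm

theorem sector_neg : sector (fun p => -H p) ρ x₀ = sector H ρ x₀ := by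
  simp [sector]

theorem IsPreconnected.subset_sector {T : Set (ℝ × ℝ)} (hT : IsPreconnected T) (hp : p ∈ T)
    (hpS : p ∈ sector H ρ x₀) (hsub : ∀ q ∈ T, nsq q ≤ ρ ^ 2 ∧ H q ≠ 0) :
    T ⊆ sector H ρ x₀ := by
  rw [← sector_eq hpS]
  exact hT.subset_connectedComponentIn hp fun q hq => hsub q hq

theorem mem_sector_of_mem_closure (hp : p ∈ closure (sector H ρ x₀)) (hpρ : nsq p ≤ ρ ^ 2)
    (hH : H p ≠ 0) : p ∈ sector H ρ x₀ := by
  obtain ⟨q, hq⟩ : (sector H ρ x₀).Nonempty := by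
    by_contra h
    rw [not_nonempty_iff_eq_empty.1 h] at hp
    simp at hp
  have h1 : IsPreconnected (insert p (sector H ρ x₀)) :=
    isPreconnected_sector.subset_closure (subset_insert _ _)
      (insert_subset hp subset_closure)
  refine h1.subset_sector (mem_insert_of_mem _ hq) hq (fun z hz => ?_) (mem_insert _ _)
  rcases hz with rfl | hz
  · exact ⟨hpρ, hH⟩
  · exact sector_subset hz

theorem eventually_mem_sector_iff (hpρ : nsq p < ρ ^ 2) (hH : H p ≠ 0) (hc : ContinuousAt H p) :
    ∀ᶠ q in 𝓝 p, (q ∈ sector H ρ x₀ ↔ p ∈ sector H ρ x₀) := by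
  obtain ⟨δ, hδ, hball⟩ := Metric.eventually_nhds_iff_ball.1
    ((continuous_nsq.continuousAt.eventually_lt_const hpρ).and (hc.eventually_ne hH))
  have hpre : IsPreconnected (Metric.ball p δ) := (convex_ball p δ).isPreconnected
  filter_upwards [Metric.ball_mem_nhds p hδ] with q hq
  have hsub : ∀ q ∈ Metric.ball p δ, nsq q ≤ ρ ^ 2 ∧ H q ≠ 0 := fun q hq =>
    ⟨(hball q hq).1.le, (hball q hq).2⟩
  exact ⟨fun h => hpre.subset_sector hq h hsub (Metric.mem_ball_self hδ),
    fun h => hpre.subset_sector (Metric.mem_ball_self hδ) h hsub hq⟩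

end Sector

/-- The global Lipschitz flow `Φ` expands radially and preserves `H ≠ 0` on an annulus. -/
structure IsRadialFlow (H : ℝ × ℝ → ℝ) (ε ρ : ℝ) (v : ℝ × ℝ → ℝ × ℝ)
    (Φ : ℝ → ℝ × ℝ → ℝ × ℝ) : Prop where
  isFlow : IsLipschitzFlow v Φ
  eq_radVF : ∀ p, ε ^ 2 ≤ nsq p → nsq p ≤ ρ ^ 2 → v p = radVF H p
  nsq_eq : ∀ p t, ε ^ 2 ≤ nsq p → nsq p ≤ ρ ^ 2 → ε ^ 2 ≤ Real.exp (2 * t) * nsq p →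
    Real.exp (2 * t) * nsq p ≤ ρ ^ 2 → nsq (Φ t p) = Real.exp (2 * t) * nsq p
  ne_zero : ∀ p t, ε ^ 2 ≤ nsq p → nsq p ≤ ρ ^ 2 → ε ^ 2 ≤ Real.exp (2 * t) * nsq p →
    Real.exp (2 * t) * nsq p ≤ ρ ^ 2 → H p ≠ 0 → H (Φ t p) ≠ 0

theorem IsGoodDisc.exists_isRadialFlow {H : ℝ × ℝ → ℝ} {R : ℝ} (h : IsGoodDisc H R) {ε ρ : ℝ}
    (hε : 0 < ε) (hρ : 0 < ρ) (hρR : ρ < R) : ∃ v Φ, IsRadialFlow H ε ρ v Φ := by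
  obtain ⟨v, Φ, h1, h2, h3⟩ := h.exists_radial_flow hε hρ hρR
  exact ⟨v, Φ, h1, h2, fun p t a b c d => (h3 p t a b c d).1, fun p t a b c d => (h3 p t a b c d).2⟩

theorem IsRadialFlow.mem_sector {H : ℝ × ℝ → ℝ} {ε ρ : ℝ} {v Φ} (h : IsRadialFlow H ε ρ v Φ)
    {p x₀ : ℝ × ℝ} {t : ℝ} (hp : p ∈ sector H ρ x₀) (h1 : ε ^ 2 ≤ nsq p)
    (h2 : ε ^ 2 ≤ Real.exp (2 * t) * nsq p) (h3 : Real.exp (2 * t) * nsq p ≤ ρ ^ 2) :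
    Φ t p ∈ sector H ρ x₀ := by
  have hpF := sector_subset hp
  have hbd : ∀ s ∈ uIcc 0 t, ε ^ 2 ≤ Real.exp (2 * s) * nsq p ∧
      Real.exp (2 * s) * nsq p ≤ ρ ^ 2 := by
    intro s hs
    have hn := nsq_nonneg p
    have hpρ : nsq p ≤ ρ ^ 2 := hpF.1
    have e0 : Real.exp (2 * 0) * nsq p = nsq p := by simp
    have mono : ∀ {a b : ℝ}, a ≤ b → Real.exp (2 * a) * nsq p ≤ Real.exp (2 * b) * nsq p :=
      fun hab => by gcongr
    rcases le_total 0 t with h0 | h0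
    · rw [uIcc_of_le h0] at hs
      have := mono hs.1
      have := mono hs.2
      constructor <;> linarith
    · rw [uIcc_of_ge h0] at hs
      have := mono hs.1
      have := mono hs.2
      constructor <;> linarith
  have hpre : IsPreconnected ((fun s => Φ s p) '' uIcc 0 t) :=
    isPreconnected_uIcc.image _ (h.isFlow.continuous_time p).continuousOn
  refine hpre.subset_sector (p := p) ⟨0, left_mem_uIcc, h.isFlow.map_zero p⟩ hp ?_
    ⟨t, right_mem_uIcc, rfl⟩
  rintro _ ⟨s, hs, rfl⟩
  obtain ⟨a, b⟩ := hbd s hs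
  exact ⟨(h.nsq_eq p s h1 hpF.1 a b).trans_le b, h.ne_zero p s h1 hpF.1 a b hpF.2⟩

theorem exp_two_mul_half_log {a b : ℝ} (ha : 0 < a) (hb : 0 < b) :
    Real.exp (2 * (Real.log (b / a) / 2)) * a = b := by
  rw [mul_div_cancel₀ _ (two_ne_zero), Real.exp_log (div_pos hb ha), div_mul_cancel₀ _ ha.ne']

namespace IsGoodDisc
variable {H : ℝ × ℝ → ℝ} {R : ℝ}

theorem nsq_pos_of_ne (h : IsGoodDisc H R) {p : ℝ × ℝ} (hp : H p ≠ 0) : 0 < nsq p :=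
  nsq_pos fun h0 => hp (h0 ▸ h.map_zero)

theorem continuousAt (h : IsGoodDisc H R) {p : ℝ × ℝ} (hp : nsq p < R ^ 2) : ContinuousAt H p :=
  (h.analyticAt p hp).continuousAt

theorem continuousOn_sector (h : IsGoodDisc H R) {ρ : ℝ} (hρ : 0 < ρ) (hρR : ρ < R)
    {x₀ : ℝ × ℝ} : ContinuousOn H (sector H ρ x₀) := fun p hp =>
  (h.continuousAt (lt_of_le_of_lt (show nsq p ≤ ρ ^ 2 from (sector_subset hp).1)
    (by nlinarith))).continuousWithinAt

theorem eventually_abs_lt_of_nsq (h : IsGoodDisc H R) (hR : 0 < R) {c : ℝ} (hc : 0 < c) :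
    ∀ᶠ ε : ℝ in 𝓝[>] 0, ∀ p, nsq p ≤ ε ^ 2 → |H p| < c := by
  have h0 : ContinuousAt H 0 := h.continuousAt (by simpa [nsq] using by positivity)
  have h1 : ∀ᶠ p in 𝓝 (0 : ℝ × ℝ), |H p| < c := by
    have := h0.abs
    rw [ContinuousAt, h.map_zero, abs_zero] at this
    exact this.eventually_lt_const hc
  obtain ⟨δ, hδ, hball⟩ := Metric.eventually_nhds_iff_ball.1 h1
  filter_upwards [Ioo_mem_nhdsGT hδ] with ε hε p hp
  refine hball p ?_
  unfold nsq at hp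
  rw [mem_ball_zero_iff, Prod.norm_def, sup_lt_iff, Real.norm_eq_abs, Real.norm_eq_abs]
  have hh : ε ^ 2 < δ ^ 2 := by nlinarith [hε.1, hε.2]
  exact ⟨abs_lt_of_sq_lt_sq (by nlinarith [sq_nonneg p.2]) hδ.le,
    abs_lt_of_sq_lt_sq (by nlinarith [sq_nonneg p.1]) hδ.le⟩

theorem exists_mem_sector_abs_eq (h : IsGoodDisc H R) {ρ : ℝ} (hρ : 0 < ρ) (hρR : ρ < R)
    {x₀ : ℝ × ℝ} (hx : x₀ ∈ sector H ρ x₀) {c : ℝ} (hc : 0 < c) (hcx : c ≤ |H x₀|) :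
    ∃ q ∈ sector H ρ x₀, |H q| = c := by
  obtain ⟨ε, hε, hε0⟩ := ((h.eventually_abs_lt_of_nsq (hρ.trans hρR) hc).and
    self_mem_nhdsWithin).exists
  have hε0 : 0 < ε := hε0
  have hεx : ε ^ 2 ≤ nsq x₀ := by
    by_contra! h'
    exact (hε x₀ h'.le).not_ge hcx
  have hx0 : 0 < nsq x₀ := h.nsq_pos_of_ne (sector_subset hx).2
  obtain ⟨v, Φ, hΦ⟩ := h.exists_isRadialFlow hε0 hρ hρR
  have e := exp_two_mul_half_log hx0 (b := ε ^ 2) (by positivity)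
  have hxρ : nsq x₀ ≤ ρ ^ 2 := (sector_subset hx).1
  have hmem := hΦ.mem_sector (t := Real.log (ε ^ 2 / nsq x₀) / 2) hx hεx e.ge
    (e.le.trans (hεx.trans hxρ))
  have hn := hΦ.nsq_eq x₀ _ hεx hxρ e.ge (e.le.trans (hεx.trans hxρ))
  rw [e] at hn
  obtain ⟨q, hq, hqc⟩ := isPreconnected_sector.intermediate_value hmem hx
    (h.continuousOn_sector hρ hρR).abs ⟨(hε _ hn.le).le, hcx⟩
  exact ⟨q, hq, hqc⟩

theorem isPreconnected_sector_sphere (h : IsGoodDisc H R) {ρ : ℝ} (hρ : 0 < ρ) (hρR : ρ < R)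
    {x₀ : ℝ × ℝ} : IsPreconnected (sector H ρ x₀ ∩ {p | nsq p = ρ ^ 2}) := by
  have hρ2 : 0 < ρ ^ 2 := by positivity
  have hex : ∀ ε : ℝ, 0 < ε → ∃ vΦ : (ℝ × ℝ → ℝ × ℝ) × (ℝ → ℝ × ℝ → ℝ × ℝ),
      IsRadialFlow H ε ρ vΦ.1 vΦ.2 := fun ε hε => by
    obtain ⟨v, Φ, hh⟩ := h.exists_isRadialFlow hε hρ hρR
    exact ⟨(v, Φ), hh⟩
  choose! F hF using hex
  let T : ℝ × ℝ → ℝ := fun p => Real.log (ρ ^ 2 / nsq p) / 2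
  let π : ℝ × ℝ → ℝ × ℝ := fun p => (F (Real.sqrt (nsq p))).2 (T p) p
  have hpos : ∀ p ∈ sector H ρ x₀, 0 < nsq p := fun p hp =>
    h.nsq_pos_of_ne (sector_subset hp).2
  have hle : ∀ p ∈ sector H ρ x₀, nsq p ≤ ρ ^ 2 := fun p hp => (sector_subset hp).1
  have hT0 : ∀ p ∈ sector H ρ x₀, 0 ≤ T p := fun p hp =>
    div_nonneg (Real.log_nonneg ((one_le_div (hpos p hp)).2 (hle p hp))) zero_le_two
  have hπ : ∀ p ∈ sector H ρ x₀, ∀ ε, 0 < ε → ε ^ 2 ≤ nsq p → π p = (F ε).2 (T p) p := by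
    intro p hp ε hε hεp
    have hs := hF _ (Real.sqrt_pos.2 (hpos p hp))
    have hsq := Real.sq_sqrt (hpos p hp).le
    have hε' := hF _ hε
    have e := exp_two_mul_half_log (hpos p hp) hρ2
    refine ((hε'.isFlow.eq_of_hasDerivAt_right (γ := fun t => (F (Real.sqrt (nsq p))).2 t p)
      (b := T p) (fun t ht => ?_) (T p) ⟨hT0 p hp, le_rfl⟩).trans ?_)
    · have hd := hs.isFlow.hasDerivAt p t
      have h1 : nsq p ≤ Real.exp (2 * t) * nsq p :=
        le_mul_of_one_le_left (hpos p hp).le (Real.one_le_exp (by linarith [ht.1]))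
      have h2 : Real.exp (2 * t) * nsq p ≤ ρ ^ 2 := by
        rw [← e]
        have := ht.2
        have := (hpos p hp).le
        gcongr
      have hn := hs.nsq_eq p t hsq.le (hle p hp) (hsq.le.trans h1) h2
      rw [hs.eq_radVF _ (by rw [hn]; exact hsq.le.trans h1) (by rw [hn]; exact h2)] at hd
      rwa [hε'.eq_radVF _ (by rw [hn]; exact hεp.trans h1) (by rw [hn]; exact h2)]
    · simp only [hs.isFlow.map_zero]
  have hTc : ∀ p ∈ sector H ρ x₀, ContinuousAt T p := fun p hp => by
    have := continuous_nsq.continuousAt (x := p)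
    have h1 := (hpos p hp).ne'
    refine ContinuousAt.div_const (ContinuousAt.log ?_ ?_) _
    · exact continuousAt_const.div this h1
    · exact (div_pos hρ2 (hpos p hp)).ne'
  have hcont : ContinuousOn π (sector H ρ x₀) := by
    intro p hp
    have hε : 0 < Real.sqrt (nsq p / 2) := Real.sqrt_pos.2 (half_pos (hpos p hp))
    have hε2 : Real.sqrt (nsq p / 2) ^ 2 = nsq p / 2 := Real.sq_sqrt (half_pos (hpos p hp)).le
    have hc : ContinuousAt (fun q => (F (Real.sqrt (nsq p / 2))).2 (T q) q) p :=
      ContinuousAt.comp (g := fun z : ℝ × (ℝ × ℝ) => (F (Real.sqrt (nsq p / 2))).2 z.1 z.2)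
        (f := fun q => (T q, q)) (hF _ hε).isFlow.continuous_uncurry.continuousAt
        ((hTc p hp).prodMk continuousAt_id)
    refine hc.continuousWithinAt.congr_of_eventuallyEq ?_
      (hπ p hp _ hε (by rw [hε2]; linarith [hpos p hp]))
    have hlt : ∀ᶠ q in 𝓝 p, nsq p / 2 < nsq q :=
      continuous_nsq.continuousAt.eventually_const_lt (half_lt_self (hpos p hp))
    filter_upwards [self_mem_nhdsWithin, mem_nhdsWithin_of_mem_nhds hlt] with q hq hq'
    exact hπ q hq _ hε (hε2.le.trans hq'.le)
  have himg : π '' sector H ρ x₀ = sector H ρ x₀ ∩ {p | nsq p = ρ ^ 2} := by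
    ext z
    constructor
    · rintro ⟨p, hp, rfl⟩
      have hs := hF _ (Real.sqrt_pos.2 (hpos p hp))
      have hsq := Real.sq_sqrt (hpos p hp).le
      have e := exp_two_mul_half_log (hpos p hp) hρ2
      have h2 : Real.sqrt (nsq p) ^ 2 ≤ ρ ^ 2 := hsq.le.trans (hle p hp)
      exact ⟨hs.mem_sector hp hsq.le (h2.trans e.ge) e.le,
        (hs.nsq_eq p _ hsq.le (hle p hp) (h2.trans e.ge) e.le).trans e⟩
    · rintro ⟨hz, hzρ⟩
      have hzρ : nsq z = ρ ^ 2 := hzρ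
      refine ⟨z, hz, ?_⟩
      have : T z = 0 := by simp only [T]; rw [hzρ, div_self hρ2.ne']; simp
      simp only [π, this]
      exact (hF _ (Real.sqrt_pos.2 (hpos z hz))).isFlow.map_zero z
  rw [← himg]
  exact isPreconnected_sector.image _ hcont

end IsGoodDisc

end

section

open Filter Topology Set

/-- `φ` is the flow of a field `v` which agrees with the Hamiltonian field of `H` near the closed
ball of radius `ρ`, which lies in a disc adapted to `H`. -/
structure IsHamFlow (H : ℝ × ℝ → ℝ) (R ρ : ℝ) (v : ℝ × ℝ → ℝ × ℝ) (φ : ℝ → ℝ × ℝ → ℝ × ℝ) :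
    Prop where
  disc : IsGoodDisc H R
  pos : 0 < ρ
  lt : ρ < R
  isFlow : IsLipschitzFlow v φ
  field_eq : ∀ p, nsq p ≤ ρ ^ 2 → ∀ᶠ q in 𝓝 p, v q = hamVF H q

theorem IsGoodDisc.exists_isHamFlow {H : ℝ × ℝ → ℝ} {R ρ : ℝ} (h : IsGoodDisc H R) (hρ : 0 < ρ)
    (hρR : ρ < R) : ∃ v φ, IsHamFlow H R ρ v φ := by
  obtain ⟨r, hr, hrR⟩ := exists_between hρR
  have hr0 : 0 < r := hρ.trans hr
  have h1 : ρ ^ 2 < r ^ 2 := by nlinarith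
  have h2 : r ^ 2 < R ^ 2 := by nlinarith
  have hK : IsCompact {p : ℝ × ℝ | nsq p ≤ r ^ 2} := by
    convert isCompact_annulus 0 (r ^ 2) using 1
    ext p; simp [nsq_nonneg]
  obtain ⟨χ, φ, -, hχ, -, hφ⟩ := ContDiffOn.exists_isLipschitzFlow_eqOn (v := hamVF H)
    (fun p hp => (h.contDiffAt_hamVF hp).contDiffWithinAt) (IsGoodDisc.isOpen_disc R) hK
    (fun p hp => lt_of_le_of_lt hp h2)
  refine ⟨_, φ, h, hρ, hρR, hφ, fun p hp => ?_⟩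
  filter_upwards [(IsGoodDisc.isOpen_disc r).mem_nhds (lt_of_le_of_lt hp h1)] with q hq
  have : χ q = 1 := hχ q (le_of_lt hq)
  simp [this]

namespace IsHamFlow
variable {H : ℝ × ℝ → ℝ} {R ρ : ℝ} {v : ℝ × ℝ → ℝ × ℝ} {φ : ℝ → ℝ × ℝ → ℝ × ℝ}

theorem neg (h : IsHamFlow H R ρ v φ) :
    IsHamFlow (fun p => -H p) R ρ (fun p => -v p) (fun t => φ (-t)) where
  disc := h.disc.neg
  pos := h.pos
  lt := h.lt
  isFlow := h.isFlow.neg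
  field_eq p hp := (h.field_eq p hp).mono fun q hq => by rw [hq, hamVF_neg]

theorem sq_lt (h : IsHamFlow H R ρ v φ) : ρ ^ 2 < R ^ 2 := by
  have h1 := h.pos; have h2 := h.lt; nlinarith

theorem analyticAt (h : IsHamFlow H R ρ v φ) {p : ℝ × ℝ} (hp : nsq p ≤ ρ ^ 2) :
    AnalyticAt ℝ H p := h.disc.analyticAt p (hp.trans_lt h.sq_lt)

theorem continuousAt_angDeriv (h : IsHamFlow H R ρ v φ) {p : ℝ × ℝ} (hp : nsq p ≤ ρ ^ 2) :
    ContinuousAt (angDeriv H) p := (h.disc.contDiffAt_angDeriv (hp.trans_lt h.sq_lt)).continuousAt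

theorem continuousAt (h : IsHamFlow H R ρ v φ) {p : ℝ × ℝ} (hp : nsq p ≤ ρ ^ 2) :
    ContinuousAt H p := (h.analyticAt hp).continuousAt

theorem fderiv_ne (h : IsHamFlow H R ρ v φ) {p : ℝ × ℝ} (hp : nsq p ≤ ρ ^ 2) (h0 : H p ≠ 0) :
    fderiv ℝ H p ≠ 0 :=
  h.disc.fderiv_ne p (fun h' => h0 (by rw [h', h.disc.map_zero])) (hp.trans_lt h.sq_lt)

theorem hasDerivAt (h : IsHamFlow H R ρ v φ) {p : ℝ × ℝ} {t : ℝ} (hp : nsq (φ t p) ≤ ρ ^ 2) :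
    HasDerivAt (fun s => φ s p) (hamVF H (φ t p)) t := by
  rw [← (h.field_eq _ hp).self_of_nhds]; exact h.isFlow.hasDerivAt p t

theorem hasDerivAt_nsq (h : IsHamFlow H R ρ v φ) {p : ℝ × ℝ} {t : ℝ} (hp : nsq (φ t p) ≤ ρ ^ 2) :
    HasDerivAt (fun s => nsq (φ s p)) (2 * angDeriv H (φ t p)) t := by
  convert (h.hasDerivAt hp).nsq using 1
  rw [angDeriv, clm_apply_prod, hamVF]; ring

theorem hasDerivAt_energy (h : IsHamFlow H R ρ v φ) {p : ℝ × ℝ} {t : ℝ}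
    (hp : nsq (φ t p) ≤ ρ ^ 2) : HasDerivAt (fun s => H (φ s p)) 0 t := by
  have := (h.analyticAt hp).differentiableAt.hasFDerivAt.comp_hasDerivAt t (h.hasDerivAt hp)
  rwa [hamVF_apply_self] at this

theorem energy_eq (h : IsHamFlow H R ρ v φ) {p : ℝ × ℝ} {a b : ℝ} (hab : a ≤ b)
    (hp : ∀ t ∈ Icc a b, nsq (φ t p) ≤ ρ ^ 2) : H (φ b p) = H (φ a p) :=
  constant_of_has_deriv_right_zero
    (fun t ht => (h.hasDerivAt_energy (hp t ht)).continuousAt.continuousWithinAt)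
    (fun t ht => (h.hasDerivAt_energy (hp t ⟨ht.1, ht.2.le⟩)).hasDerivWithinAt) b ⟨hab, le_rfl⟩

theorem energy_eq_zero (h : IsHamFlow H R ρ v φ) {p : ℝ × ℝ} {b : ℝ} (hb : 0 ≤ b)
    (hp : ∀ t ∈ Icc 0 b, nsq (φ t p) ≤ ρ ^ 2) : H (φ b p) = H p := by
  rw [h.energy_eq hb hp, h.isFlow.map_zero]

/-- Nearby points on the same level lie on the same short orbit arc. -/
theorem eventually_exists_map_eq (h : IsHamFlow H R ρ v φ) {q : ℝ × ℝ} (hq : nsq q ≤ ρ ^ 2)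
    (h0 : H q ≠ 0) {δ : ℝ} (hδ : 0 < δ) :
    ∀ᶠ z : (ℝ × ℝ) × (ℝ × ℝ) in 𝓝 (q, q), H z.1 = H z.2 → ∃ s, |s| < δ ∧ φ s z.1 = z.2 := by
  obtain ⟨A, N, hN, hNA, hinj, hbox⟩ := exists_flow_box (h.analyticAt hq) (h.fderiv_ne hq h0)
    h.isFlow (h.field_eq q hq)
  have hA : ContinuousAt A q := (hNA q (mem_of_mem_nhds hN)).2.1.continuousAt
  have hA1 : ContinuousAt (fun z : (ℝ × ℝ) × (ℝ × ℝ) => A z.1) (q, q) :=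
    ContinuousAt.comp (f := Prod.fst) (x := (q, q)) hA continuousAt_fst
  have hA2 : ContinuousAt (fun z : (ℝ × ℝ) × (ℝ × ℝ) => A z.2) (q, q) :=
    ContinuousAt.comp (f := Prod.snd) (x := (q, q)) hA continuousAt_snd
  have hT : Tendsto (fun z : (ℝ × ℝ) × (ℝ × ℝ) => A z.2 - A z.1) (𝓝 (q, q)) (𝓝 0) := by
    have := (hA2.sub hA1).tendsto
    rwa [Pi.sub_apply, sub_self] at this
  have h1 : ∀ᶠ z : (ℝ × ℝ) × (ℝ × ℝ) in 𝓝 (q, q), |A z.2 - A z.1| < δ := by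
    have := hT.abs.eventually_lt_const (show |(0:ℝ)| < δ by simpa)
    exact this
  have h2 := (hT.prodMk_nhds (continuousAt_fst (p := (q, q))).tendsto).eventually hbox
  have h3 := (continuousAt_snd (p := (q, q))).tendsto.eventually hN
  filter_upwards [h1, h2, h3] with z hz1 hz2 hz3 hH
  refine ⟨_, hz1, hinj hz2.1 hz3 ?_⟩
  simp only [Prod.mk.injEq]
  exact ⟨by rw [hz2.2.1, hH], by rw [hz2.2.2]; ring⟩

/-- An orbit trapped in the ball on a nonzero level is periodic. -/
theorem exists_period (h : IsHamFlow H R ρ v φ) {p : ℝ × ℝ} (h0 : H p ≠ 0)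
    (hp : ∀ t, 0 ≤ t → nsq (φ t p) ≤ ρ ^ 2) : ∃ T > 0, φ T p = p := by
  have hK : IsCompact {p : ℝ × ℝ | nsq p ≤ ρ ^ 2} := by
    convert isCompact_annulus 0 (ρ ^ 2) using 1
    ext p; simp [nsq_nonneg]
  obtain ⟨q, hq, σ, hσ, hlim⟩ := hK.tendsto_subseq (x := fun n : ℕ => φ n p)
    (fun n => hp n n.cast_nonneg)
  have hE : ∀ t, 0 ≤ t → H (φ t p) = H p := fun t ht => h.energy_eq_zero ht fun s hs => hp s hs.1
  have hHq : H q = H p := by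
    refine tendsto_nhds_unique ((h.continuousAt hq).tendsto.comp hlim) ?_
    refine tendsto_const_nhds.congr fun n => ?_
    simp [Function.comp_def, hE _ (Nat.cast_nonneg _)]
  have hbox := h.eventually_exists_map_eq hq (hHq ▸ h0) one_pos
  obtain ⟨n, hn⟩ := ((hlim.comp (tendsto_add_atTop_nat 1)).prodMk_nhds hlim |>.eventually
    hbox).exists
  obtain ⟨s, hs, hs'⟩ := hn (by simp [hE _ (Nat.cast_nonneg _)])
  simp only [Function.comp_apply] at hs'
  have hlt : σ n < σ (n + 1) := hσ (Nat.lt_succ_self n)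
  have hlt' : (σ n : ℝ) + 1 ≤ σ (n + 1) := by exact_mod_cast hlt
  refine ⟨-(σ n : ℝ) + (s + σ (n + 1)), by linarith [(abs_lt.1 hs).1], ?_⟩
  rw [h.isFlow.map_add, h.isFlow.map_add, hs', h.isFlow.map_neg_map]

theorem trapped_of_period (h : IsHamFlow H R ρ v φ) {p : ℝ × ℝ} {T c : ℝ} (hT : 0 < T)
    (hper : φ T p = p) (hp : ∀ t ∈ Icc 0 T, nsq (φ t p) ≤ c) (t : ℝ) : nsq (φ t p) ≤ c := by
  have hP : Function.Periodic (fun t => φ t p) T := fun t => by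
    simp only [h.isFlow.map_add, hper]
  obtain ⟨s, hs, hs'⟩ := hP.exists_mem_Ico₀ hT t
  rw [show φ t p = φ s p from hs']
  exact hp s ⟨hs.1, hs.2.le⟩

theorem exists_annulus_bound (h : IsHamFlow H R ρ v φ) {r : ℝ} (hr : 0 < r) :
    ∃ c > 0, ∀ p, r ^ 2 ≤ nsq p → nsq p ≤ ρ ^ 2 → |H p| < c → angDeriv H p ≠ 0 := by
  have hK := isCompact_annulus (r ^ 2) (ρ ^ 2)
  by_contra hcon
  push Not at hcon
  choose! x hx1 hx2 hx3 hx4 using fun n : ℕ => hcon (1 / ((n : ℝ) + 1)) Nat.one_div_pos_of_nat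
  obtain ⟨q, hq, σ, hσ, hlim⟩ := hK.tendsto_subseq (x := x) fun n => ⟨hx1 n, hx2 n⟩
  have hHq : H q = 0 := by
    refine tendsto_nhds_unique ((h.continuousAt hq.2).tendsto.comp hlim) ?_
    refine squeeze_zero_norm (fun n => (hx3 (σ n)).le) ?_
    exact tendsto_one_div_add_atTop_nhds_zero_nat.comp hσ.tendsto_atTop
  have hAq : angDeriv H q = 0 := by
    refine tendsto_nhds_unique ((h.continuousAt_angDeriv hq.2).tendsto.comp hlim) ?_
    exact tendsto_const_nhds.congr fun n => (hx4 _).symm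
  exact h.disc.angDeriv_ne q (ne_zero_of_nsq_pos ((pow_pos hr 2).trans_le hq.1))
    (hq.2.trans_lt h.sq_lt) hHq hAq

theorem nsq_lt_of_period (h : IsHamFlow H R ρ v φ) {r c : ℝ}
    (hc : ∀ p, r ^ 2 ≤ nsq p → nsq p ≤ ρ ^ 2 → |H p| < c → angDeriv H p ≠ 0) {p : ℝ × ℝ}
    (hp : ∀ t, nsq (φ t p) ≤ ρ ^ 2) {T : ℝ} (hT : 0 < T) (hper : φ T p = p) (hpc : |H p| < c)
    (t : ℝ) : nsq (φ t p) < r ^ 2 := by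
  obtain ⟨s, hs, hmax⟩ := isCompact_Icc.exists_isMaxOn (nonempty_Icc.2 hT.le)
    (continuous_nsq.comp (h.isFlow.continuous_time p)).continuousOn
  have hall : ∀ t, nsq (φ t p) ≤ nsq (φ s p) := h.trapped_of_period hT hper fun t ht => hmax ht
  refine (hall t).trans_lt ?_
  by_contra hcon
  push Not at hcon
  refine hc _ hcon (hp s) ?_ ?_
  · rwa [h.energy_eq_zero hs.1 fun t _ => hp t]
  · have hm : IsLocalMax (fun s => nsq (φ s p)) s := Eventually.of_forall hall
    linarith [hm.hasDerivAt_eq_zero (h.hasDerivAt_nsq (hp s))]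

end IsHamFlow

end

section

open Filter Topology Set

theorem nsq_polarMap (p : ℝ × ℝ) : nsq (polarMap p) = p.1 ^ 2 := polarMap_sq p

theorem exists_polarMap_eq (p : ℝ × ℝ) :
    ∃ θ ∈ Ioc (-Real.pi) Real.pi, polarMap (Real.sqrt (nsq p), θ) = p := by
  have hn : ‖(⟨p.1, p.2⟩ : ℂ)‖ = Real.sqrt (nsq p) := by
    rw [Complex.norm_def, Complex.normSq_mk, nsq]; congr 1; ring
  refine ⟨Complex.arg ⟨p.1, p.2⟩, Complex.arg_mem_Ioc _, ?_⟩
  have h1 := Complex.norm_mul_cos_arg ⟨p.1, p.2⟩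
  have h2 := Complex.norm_mul_sin_arg ⟨p.1, p.2⟩
  rw [hn] at h1 h2
  exact Prod.ext h1 h2

theorem isPreconnected_punctured {r : ℝ} (hr : 0 < r) :
    IsPreconnected {p : ℝ × ℝ | 0 < nsq p ∧ nsq p < r ^ 2} := by
  have : {p : ℝ × ℝ | 0 < nsq p ∧ nsq p < r ^ 2} = polarMap '' (Ioo 0 r ×ˢ univ) := by
    ext p
    constructor
    · rintro ⟨h1, h2⟩
      obtain ⟨θ, -, hθ⟩ := exists_polarMap_eq p
      exact ⟨_, ⟨⟨Real.sqrt_pos.2 h1, (Real.sqrt_lt' hr).2 h2⟩, mem_univ _⟩, hθ⟩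
    · rintro ⟨q, ⟨⟨h1, h2⟩, -⟩, rfl⟩
      rw [Set.mem_ofPred_eq, nsq_polarMap]
      exact ⟨by positivity, by nlinarith⟩
  rw [this]
  exact (isPreconnected_Ioo.prod isPreconnected_univ).image _ continuous_polarMap.continuousOn

namespace IsHamFlow
variable {H : ℝ × ℝ → ℝ} {R ρ : ℝ} {v : ℝ × ℝ → ℝ × ℝ} {φ : ℝ → ℝ × ℝ → ℝ × ℝ}

theorem eventually_trapped (h : IsHamFlow H R ρ v φ) {p : ℝ × ℝ} (h0 : H p ≠ 0) {T : ℝ}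
    (hT : 0 < T) (hper : φ T p = p) (hp : ∀ t, nsq (φ t p) < ρ ^ 2) :
    ∀ᶠ q in 𝓝 p, ∀ t, nsq (φ t q) ≤ ρ ^ 2 := by
  have h1 : ∀ᶠ q in 𝓝 p, ∀ t ∈ Icc 0 (2 * T), nsq (φ t q) ≤ ρ ^ 2 := by
    refine isCompact_Icc.eventually_forall_of_forall_eventually fun t _ => ?_
    have hc : Continuous fun z : (ℝ × ℝ) × ℝ => nsq (φ z.2 z.1) :=
      continuous_nsq.comp (h.isFlow.continuous_uncurry.comp (continuous_snd.prodMk continuous_fst))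
    exact ((hc.tendsto (p, t)).eventually_lt_const (hp t)).mono fun _ => le_of_lt
  have hp0 : nsq p ≤ ρ ^ 2 := by simpa [h.isFlow.map_zero] using (hp 0).le
  have h2 : Tendsto (fun q => (φ T q, q)) (𝓝 p) (𝓝 (p, p)) := by
    have := ((h.isFlow.continuous_space T).tendsto p).prodMk_nhds tendsto_id
    rwa [hper] at this
  filter_upwards [h1, h2.eventually (h.eventually_exists_map_eq hp0 h0 (half_pos hT))] with q hq hs
  obtain ⟨s, hs, hs'⟩ := hs
    (h.energy_eq_zero hT.le fun t ht => hq t ⟨ht.1, by linarith [ht.2]⟩)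
  rw [← h.isFlow.map_add] at hs'
  rw [abs_lt] at hs
  exact h.trapped_of_period (by linarith) hs' fun t ht => hq t ⟨ht.1, by linarith [ht.2]⟩

/-- Orbits on small nonzero levels leave the ball. -/
theorem exists_escape (h : IsHamFlow H R ρ v φ) : ∃ c > 0, ∀ p, nsq p ≤ ρ ^ 2 → H p ≠ 0 →
    |H p| < c → ∃ t > 0, ρ ^ 2 < nsq (φ t p) := by
  have hρ := h.pos
  have hR := hρ.trans h.lt
  obtain ⟨c₁, hc₁, hann₁⟩ := h.exists_annulus_bound (half_pos hρ)
  obtain ⟨r, hrc, hr0, hrρ⟩ : ∃ r, (∀ p, nsq p ≤ r ^ 2 → |H p| < c₁) ∧ 0 < r ∧ r < ρ :=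
    ((h.disc.eventually_abs_lt_of_nsq hR hc₁).and (Ioo_mem_nhdsGT hρ)).exists
  obtain ⟨c₂, hc₂, hann₂⟩ := h.exists_annulus_bound hr0
  refine ⟨min c₁ c₂, lt_min hc₁ hc₂, fun p hp hH hpc => ?_⟩
  by_contra hcon
  push Not at hcon
  have hfwd : ∀ t, 0 ≤ t → nsq (φ t p) ≤ ρ ^ 2 := fun t ht => by
    rcases ht.eq_or_lt with rfl | ht
    · rwa [h.isFlow.map_zero]
    · exact hcon t ht
  let P : Set (ℝ × ℝ) :=
    {q | (0 < nsq q ∧ nsq q < r ^ 2) ∧ H q ≠ 0 ∧ ∀ t, nsq (φ t q) ≤ ρ ^ 2}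
  have hr2 : r ^ 2 < ρ ^ 2 := by nlinarith
  have hρ2 : (ρ / 2) ^ 2 < ρ ^ 2 := by nlinarith
  have hPper : ∀ q ∈ P, ∃ T > 0, φ T q = q := fun q hq =>
    h.exists_period hq.2.1 fun t _ => hq.2.2 t
  have hPne : (({q | 0 < nsq q ∧ nsq q < r ^ 2}) ∩ P).Nonempty := by
    obtain ⟨T, hT, hper⟩ := h.exists_period hH hfwd
    have hall := h.trapped_of_period hT hper fun t ht => hfwd t ht.1
    have := h.nsq_lt_of_period hann₂ hall hT hper (hpc.trans_le (min_le_right _ _)) 0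
    rw [h.isFlow.map_zero] at this
    have h2 := h.disc.nsq_pos_of_ne hH
    exact ⟨p, ⟨h2, this⟩, ⟨h2, this⟩, hH, hall⟩
  have hPo : IsOpen P := by
    refine isOpen_iff_mem_nhds.2 fun q hq => ?_
    obtain ⟨T, hT, hper⟩ := hPper q hq
    have hlt := h.nsq_lt_of_period hann₁ hq.2.2 hT hper (hrc q hq.1.2.le)
    have h1 := h.eventually_trapped hq.2.1 hT hper fun t => (hlt t).trans hρ2
    have h2 := (h.continuousAt (hq.1.2.le.trans hr2.le)).eventually_ne hq.2.1
    have h3 := (IsGoodDisc.isOpen_punctured r).mem_nhds hq.1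
    filter_upwards [h1, h2, h3] with z h1 h2 h3
    exact ⟨h3, h2, h1⟩
  have hPc : closure P ∩ {q | 0 < nsq q ∧ nsq q < r ^ 2} ⊆ P := by
    rintro q ⟨hqc, hq⟩
    have htr : ∀ t, nsq (φ t q) ≤ ρ ^ 2 := fun t => by
      have hcl : IsClosed {z | nsq (φ t z) ≤ ρ ^ 2} :=
        isClosed_le (continuous_nsq.comp (h.isFlow.continuous_space t)) continuous_const
      exact closure_minimal (fun z hz => hz.2.2 t) hcl hqc
    refine ⟨hq, fun hq0 => ?_, htr⟩
    set s := Real.sqrt (nsq q) with hs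
    have hs0 : 0 < s := Real.sqrt_pos.2 hq.1
    have hs2 : s ^ 2 = nsq q := Real.sq_sqrt hq.1.le
    obtain ⟨c₃, hc₃, hann₃⟩ := h.exists_annulus_bound (half_pos hs0)
    have hqρ : nsq q ≤ ρ ^ 2 := hq.2.le.trans hr2.le
    have h1 : ∀ᶠ z in 𝓝 q, |H z| < c₃ :=
      (h.continuousAt hqρ).abs.eventually_lt_const (by simpa [hq0] using hc₃)
    have h2 : ∀ᶠ z in 𝓝 q, (s / 2) ^ 2 < nsq z :=
      continuous_nsq.continuousAt.eventually_const_lt (by nlinarith)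
    obtain ⟨z, ⟨hz1, hz2⟩, hzP⟩ := mem_closure_iff_nhds.1 hqc _ (h1.and h2)
    obtain ⟨T, hT, hper⟩ := hPper z hzP
    have := h.nsq_lt_of_period hann₃ hzP.2.2 hT hper hz1 0
    rw [h.isFlow.map_zero] at this
    exact lt_asymm this hz2
  have hsub := (isPreconnected_punctured hr0).subset_of_closure_inter_subset hPo hPne hPc
  have hcont : ContinuousOn H {q | 0 < nsq q ∧ nsq q < r ^ 2} := fun q hq =>
    (h.continuousAt (hq.2.le.trans hr2.le)).continuousWithinAt
  have hnhds : ∀ᶠ q in 𝓝 (0 : ℝ × ℝ), nsq q < r ^ 2 :=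
    (IsGoodDisc.isOpen_disc r).mem_nhds (by simp [nsq, hr0])
  have himg := (isPreconnected_punctured hr0).image _ hcont
  have hsign : (∀ q, 0 < nsq q ∧ nsq q < r ^ 2 → 0 < H q) ∨
      (∀ q, 0 < nsq q ∧ nsq q < r ^ 2 → H q < 0) := by
    by_contra hno
    push Not at hno
    obtain ⟨⟨x, hx, hx'⟩, ⟨y, hy, hy'⟩⟩ := hno
    obtain ⟨z, hz, hz0⟩ := himg.ordConnected.out (mem_image_of_mem H hx) (mem_image_of_mem H hy)
      ⟨hx', hy'⟩
    exact (hsub hz).2.1 hz0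
  rcases hsign with hs | hs
  · refine h.disc.not_min (hnhds.mono fun q hq => ?_)
    rcases eq_or_ne q 0 with rfl | hq0
    · exact le_rfl
    · rw [h.disc.map_zero]; exact (hs q ⟨nsq_pos hq0, hq⟩).le
  · refine h.disc.not_max (hnhds.mono fun q hq => ?_)
    rcases eq_or_ne q 0 with rfl | hq0
    · exact le_rfl
    · rw [h.disc.map_zero]; exact (hs q ⟨nsq_pos hq0, hq⟩).le

end IsHamFlow

end

section

open Filter Topology Set

theorem HasDerivAt.eventually_lt_right {f : ℝ → ℝ} {d a : ℝ} (hf : HasDerivAt f d a) (hd : 0 < d) :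
    ∀ᶠ x in 𝓝[>] a, f a < f x := by
  have h1 := (hasDerivAt_iff_tendsto_slope.1 hf).eventually_const_lt hd
  filter_upwards [h1.filter_mono (nhdsWithin_mono a fun x hx => ne_of_gt hx),
    self_mem_nhdsWithin] with x hx hxa
  have hxa' : a < x := hxa
  rw [slope_def_field, lt_div_iff₀ (sub_pos.2 hxa')] at hx
  linarith

theorem HasDerivAt.eventually_gt_right {f : ℝ → ℝ} {d a : ℝ} (hf : HasDerivAt f d a) (hd : d < 0) :
    ∀ᶠ x in 𝓝[>] a, f x < f a := by
  simpa using hf.neg.eventually_lt_right (neg_pos.2 hd)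

theorem polarMap_add_two_pi (r θ : ℝ) (n : ℤ) :
    polarMap (r, θ + n * (2 * Real.pi)) = polarMap (r, θ) := by
  simp [polarMap, Real.cos_add_int_mul_two_pi, Real.sin_add_int_mul_two_pi]

theorem exists_polarMap_of_nsq {p : ℝ × ℝ} {ρ : ℝ} (hρ : 0 < ρ) (hp : nsq p = ρ ^ 2) :
    ∃ θ ∈ Ioc (-Real.pi) Real.pi, polarMap (ρ, θ) = p := by
  obtain ⟨θ, hθ, h⟩ := exists_polarMap_eq p
  rw [hp, Real.sqrt_sq hρ.le] at h
  exact ⟨θ, hθ, h⟩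

/-- A preconnected subset of a circle containing two points contains one of the two arcs between
them. -/
theorem IsPreconnected.arc_subset {C : Set (ℝ × ℝ)} {ρ α β : ℝ} (hC : IsPreconnected C)
    (hρ : 0 < ρ) (hCρ : ∀ p ∈ C, nsq p = ρ ^ 2) (hα : polarMap (ρ, α) ∈ C)
    (hβ : polarMap (ρ, β) ∈ C) :
    (∀ θ ∈ Icc α β, polarMap (ρ, θ) ∈ C) ∨
      (∀ θ ∈ Icc β (α + 2 * Real.pi), polarMap (ρ, θ) ∈ C) := by
  by_contra hcon
  push Not at hcon
  obtain ⟨⟨a, ⟨ha1, ha2⟩, haC⟩, ⟨b, ⟨hb1, hb2⟩, hbC⟩⟩ := hcon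
  replace ha1 : α < a := lt_of_le_of_ne ha1 fun h => haC (h ▸ hα)
  replace ha2 : a < β := lt_of_le_of_ne ha2 fun h => haC (h ▸ hβ)
  replace hb1 : β < b := lt_of_le_of_ne hb1 fun h => hbC (h ▸ hβ)
  replace hb2 : b < α + 2 * Real.pi := lt_of_le_of_ne hb2 fun h => hbC <| by
    have := polarMap_add_two_pi ρ α 1
    rw [Int.cast_one, one_mul] at this
    rwa [h, this]
  set m := (a + b) / 2 with hm
  let l : ℝ × ℝ → ℝ := fun x => x.1 * Real.cos m + x.2 * Real.sin m - ρ * Real.cos ((b - a) / 2)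
  have hl : ∀ θ, l (polarMap (ρ, θ)) =
      -2 * ρ * (Real.sin ((θ - a) / 2) * Real.sin ((θ - b) / 2)) := fun θ => by
    have h1 := Real.cos_sub_cos (θ - m) ((b - a) / 2)
    rw [show (θ - m + (b - a) / 2) / 2 = (θ - a) / 2 by rw [hm]; ring,
      show (θ - m - (b - a) / 2) / 2 = (θ - b) / 2 by rw [hm]; ring, Real.cos_sub] at h1
    simp only [l, polarMap]
    linear_combination ρ * h1
  have hlc : Continuous l := by fun_prop
  have h1 : l (polarMap (ρ, α)) < 0 := by
    rw [hl]
    have h1 : Real.sin ((α - a) / 2) < 0 :=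
      Real.sin_neg_of_neg_of_neg_pi_lt (by linarith) (by linarith)
    have h2 : Real.sin ((α - b) / 2) < 0 :=
      Real.sin_neg_of_neg_of_neg_pi_lt (by linarith) (by linarith)
    have := mul_pos hρ (mul_pos_of_neg_of_neg h1 h2)
    linarith
  have h2 : 0 < l (polarMap (ρ, β)) := by
    rw [hl]
    have h1 : 0 < Real.sin ((β - a) / 2) :=
      Real.sin_pos_of_pos_of_lt_pi (by linarith) (by linarith)
    have h2 : Real.sin ((β - b) / 2) < 0 :=
      Real.sin_neg_of_neg_of_neg_pi_lt (by linarith) (by linarith)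
    have := mul_neg_of_pos_of_neg hρ (mul_neg_of_pos_of_neg h1 h2)
    linarith
  obtain ⟨x, hx, hx0⟩ := (hC.image l hlc.continuousOn).ordConnected.out (mem_image_of_mem l hα)
    (mem_image_of_mem l hβ) ⟨h1.le, h2.le⟩
  obtain ⟨θ, -, rfl⟩ := exists_polarMap_of_nsq hρ (hCρ x hx)
  rw [hl] at hx0
  have key : ∀ d, polarMap (ρ, d) ∉ C → Real.sin ((θ - d) / 2) ≠ 0 := fun d hd h0 => by
    obtain ⟨n, hn⟩ := Real.sin_eq_zero_iff.1 h0
    have : θ = d + n * (2 * Real.pi) := by linarith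
    rw [this, polarMap_add_two_pi] at hx
    exact hd hx
  have h3 := mul_ne_zero (key a haC) (key b hbC)
  exact mul_ne_zero (mul_ne_zero (by norm_num) hρ.ne') h3 hx0

theorem sector_pos {H : ℝ × ℝ → ℝ} {ρ : ℝ} {x₀ p q : ℝ × ℝ} (hc : ContinuousOn H (sector H ρ x₀))
    (hp : p ∈ sector H ρ x₀) (hq : q ∈ sector H ρ x₀) (hpos : 0 < H p) : 0 < H q := by
  by_contra hcon
  obtain ⟨z, hz, hz0⟩ := (isPreconnected_sector.image H hc).ordConnected.out
    (mem_image_of_mem H hq) (mem_image_of_mem H hp) ⟨not_lt.1 hcon, hpos.le⟩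
  exact (sector_subset hz).2 hz0

theorem hasDerivAt_polarMap_angle {H : ℝ × ℝ → ℝ} {ρ θ : ℝ}
    (hH : DifferentiableAt ℝ H (polarMap (ρ, θ))) :
    HasDerivAt (fun θ => H (polarMap (ρ, θ))) (angDeriv H (polarMap (ρ, θ))) θ := by
  have h1 : HasDerivAt (fun θ => polarMap (ρ, θ))
      (-(polarMap (ρ, θ)).2, (polarMap (ρ, θ)).1) θ := by
    refine HasDerivAt.prodMk ?_ ?_
    · have := (Real.hasDerivAt_cos θ).const_mul ρ
      rwa [mul_neg] at this
    · exact (Real.hasDerivAt_sin θ).const_mul ρ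
  exact hH.hasFDerivAt.comp_hasDerivAt θ h1

namespace IsHamFlow
variable {H : ℝ × ℝ → ℝ} {R ρ : ℝ} {v : ℝ × ℝ → ℝ × ℝ} {φ : ℝ → ℝ × ℝ → ℝ × ℝ}

theorem arc_false (h : IsHamFlow H R ρ v φ) {c a b : ℝ}
    (hc : ∀ p, nsq p = ρ ^ 2 → |H p| < c → angDeriv H p ≠ 0) (hab : a < b)
    (hpos : ∀ θ ∈ Icc a b, 0 < H (polarMap (ρ, θ)))
    (heq : H (polarMap (ρ, b)) = H (polarMap (ρ, a))) (hlt : H (polarMap (ρ, a)) < c)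
    (hd : angDeriv H (polarMap (ρ, a)) < 0) : False := by
  have hρ : ∀ θ, nsq (polarMap (ρ, θ)) = ρ ^ 2 := fun θ => nsq_polarMap _
  have hder : ∀ θ, HasDerivAt (fun θ => H (polarMap (ρ, θ))) (angDeriv H (polarMap (ρ, θ))) θ :=
    fun θ => hasDerivAt_polarMap_angle (h.analyticAt (hρ θ).le).differentiableAt
  obtain ⟨s, hs, hmin⟩ := isCompact_Icc.exists_isMinOn (nonempty_Icc.2 hab.le)
    (fun θ _ => (hder θ).continuousAt.continuousWithinAt)
  obtain ⟨θ, hθ1, hθ2⟩ := (((hder a).eventually_gt_right hd).and (Ioo_mem_nhdsGT hab)).exists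
  have hsa : H (polarMap (ρ, s)) < H (polarMap (ρ, a)) :=
    lt_of_le_of_lt (hmin (Ioo_subset_Icc_self hθ2)) hθ1
  have hs1 : a < s := lt_of_le_of_ne hs.1 fun h' => by rw [h'] at hsa; exact lt_irrefl _ hsa
  have hs2 : s < b := lt_of_le_of_ne hs.2 fun h' => by rw [h', heq] at hsa; exact lt_irrefl _ hsa
  have hloc := hmin.isLocalMin (Icc_mem_nhds hs1 hs2)
  exact hc _ (hρ s) (by rw [abs_of_pos (hpos s hs)]; linarith) (hloc.hasDerivAt_eq_zero (hder s))

/-- On each small level, a sector is entered through at most one boundary point. -/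
theorem entry_unique (h : IsHamFlow H R ρ v φ) {c : ℝ}
    (hc : ∀ p, nsq p = ρ ^ 2 → |H p| < c → angDeriv H p ≠ 0) {x₀ u w : ℝ × ℝ}
    (hu : u ∈ sector H ρ x₀) (hw : w ∈ sector H ρ x₀) (huρ : nsq u = ρ ^ 2) (hwρ : nsq w = ρ ^ 2)
    (hu0 : 0 < H u) (huc : H u < c) (huw : H u = H w) (hdu : angDeriv H u < 0)
    (hdw : angDeriv H w < 0) : u = w := by
  have hcont := h.disc.continuousOn_sector h.pos h.lt (x₀ := x₀)
  have key : ∀ α β : ℝ, α ∈ Ioc (-Real.pi) Real.pi → β ∈ Ioc (-Real.pi) Real.pi →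
      polarMap (ρ, α) ∈ sector H ρ x₀ → polarMap (ρ, β) ∈ sector H ρ x₀ →
      H (polarMap (ρ, α)) = H u → H (polarMap (ρ, β)) = H u →
      angDeriv H (polarMap (ρ, α)) < 0 → angDeriv H (polarMap (ρ, β)) < 0 → ¬ α < β := by
    intro α β hα hβ hαS hβS hαu hβu hαd hβd hlt
    have h2 := polarMap_add_two_pi ρ α 1
    rw [Int.cast_one, one_mul] at h2
    rcases (h.disc.isPreconnected_sector_sphere h.pos h.lt (x₀ := x₀)).arc_subset h.pos
      (fun p hp => hp.2) ⟨hαS, nsq_polarMap _⟩ ⟨hβS, nsq_polarMap _⟩ with hA | hA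
    · exact h.arc_false hc hlt (fun θ hθ => sector_pos hcont hu (hA θ hθ).1 hu0)
        (by rw [hαu, hβu]) (by rw [hαu]; exact huc) hαd
    · exact h.arc_false hc (b := α + 2 * Real.pi) (by linarith [hα.1, hβ.2])
        (fun θ hθ => sector_pos hcont hu (hA θ hθ).1 hu0)
        (by rw [h2, hαu, hβu]) (by rw [hβu]; exact huc) hβd
  obtain ⟨α, hα, rfl⟩ := exists_polarMap_of_nsq h.pos huρ
  obtain ⟨β, hβ, rfl⟩ := exists_polarMap_of_nsq h.pos hwρ
  rcases lt_trichotomy α β with hlt | rfl | hlt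
  · exact (key α β hα hβ hu hw rfl huw.symm hdu hdw hlt).elim
  · rfl
  · exact (key β α hβ hα hw hu huw.symm rfl hdw hdu hlt).elim

end IsHamFlow

end

section

open Filter Topology Set

namespace IsHamFlow
variable {H : ℝ × ℝ → ℝ} {R ρ : ℝ} {v : ℝ × ℝ → ℝ × ℝ} {φ : ℝ → ℝ × ℝ → ℝ × ℝ}

theorem continuous_nsq_orbit (h : IsHamFlow H R ρ v φ) (p : ℝ × ℝ) :
    Continuous fun t => nsq (φ t p) := continuous_nsq.comp (h.isFlow.continuous_time p)

theorem exists_exit_time (h : IsHamFlow H R ρ v φ) {c : ℝ}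
    (hc : ∀ p, nsq p = ρ ^ 2 → |H p| < c → angDeriv H p ≠ 0) {p : ℝ × ℝ} (hp : nsq p ≤ ρ ^ 2)
    (hpc : |H p| < c) (hesc : ∃ t > 0, ρ ^ 2 < nsq (φ t p)) :
    ∃ T, 0 ≤ T ∧ (∀ s ∈ Icc 0 T, nsq (φ s p) ≤ ρ ^ 2) ∧ nsq (φ T p) = ρ ^ 2 ∧
      0 < angDeriv H (φ T p) ∧ ∀ s ∈ Ioo 0 T, nsq (φ s p) < ρ ^ 2 := by
  have hcn := h.continuous_nsq_orbit p
  set E : Set ℝ := {t | 0 < t ∧ ρ ^ 2 < nsq (φ t p)} with hE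
  have hEne : E.Nonempty := hesc
  have hEb : BddBelow E := ⟨0, fun t ht => ht.1.le⟩
  set T := sInf E with hT
  have hT0 : 0 ≤ T := le_csInf hEne fun t ht => ht.1.le
  have hlt : ∀ s, 0 ≤ s → s < T → nsq (φ s p) ≤ ρ ^ 2 := fun s hs hsT => by
    rcases hs.eq_or_lt with rfl | hs
    · rwa [h.isFlow.map_zero]
    · by_contra hcon
      exact notMem_of_lt_csInf hsT hEb ⟨hs, not_le.1 hcon⟩
  have hge : ρ ^ 2 ≤ nsq (φ T p) := by
    have h1 : T ∈ closure E := csInf_mem_closure hEne hEb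
    exact closure_minimal (fun t ht => ht.2.le) (isClosed_le continuous_const hcn) h1
  have hle : nsq (φ T p) ≤ ρ ^ 2 := by
    rcases hT0.eq_or_lt with h0 | h0
    · rwa [← h0, h.isFlow.map_zero]
    · have h1 : T ∈ closure (Ioo 0 T) := by
        rw [closure_Ioo h0.ne]; exact ⟨hT0, le_rfl⟩
      exact closure_minimal (fun t ht => hlt t ht.1.le ht.2) (isClosed_le hcn continuous_const) h1
  have hin : ∀ s ∈ Icc 0 T, nsq (φ s p) ≤ ρ ^ 2 := fun s hs => by
    rcases hs.2.eq_or_lt with rfl | hs'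
    · exact hle
    · exact hlt s hs.1 hs'
  have hen : ∀ s ∈ Icc 0 T, H (φ s p) = H p := fun s hs =>
    h.energy_eq_zero hs.1 fun t ht => hin t ⟨ht.1, ht.2.trans hs.2⟩
  refine ⟨T, hT0, hin, le_antisymm hle hge, ?_, fun s hs => ?_⟩
  · have hne := hc _ (le_antisymm hle hge) (by rwa [hen T ⟨hT0, le_rfl⟩])
    refine lt_of_le_of_ne (not_lt.1 fun hneg => ?_) hne.symm
    have h1 := (h.hasDerivAt_nsq hle).eventually_gt_right (by linarith)
    obtain ⟨u, hu, hsub⟩ := mem_nhdsGT_iff_exists_Ioo_subset.1 h1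
    obtain ⟨t, ht, htu⟩ := exists_lt_of_csInf_lt hEne (show sInf E < u from hu)
    have hTt : T ≤ t := csInf_le hEb ht
    rcases hTt.eq_or_lt with h0 | h0
    · have := ht.2; rw [← h0] at this; exact absurd this hle.not_gt
    · have h2 : nsq (φ t p) < nsq (φ T p) := hsub ⟨h0, htu⟩
      linarith [ht.2]
  · have hs' := Ioo_subset_Icc_self hs
    refine lt_of_le_of_ne (hin s hs') fun heq => ?_
    have hloc : IsLocalMax (fun t => nsq (φ t p)) s := by
      filter_upwards [Icc_mem_nhds hs.1 hs.2] with t ht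
      rw [heq]; exact hin t ht
    refine hc _ heq (by rwa [hen s hs']) ?_
    linarith [hloc.hasDerivAt_eq_zero (h.hasDerivAt_nsq (hin s hs'))]

theorem map_mem_sector (h : IsHamFlow H R ρ v φ) {p x₀ : ℝ × ℝ} (hp : p ∈ sector H ρ x₀) {T : ℝ}
    (hT : 0 ≤ T) (hin : ∀ s ∈ Icc 0 T, nsq (φ s p) ≤ ρ ^ 2) : φ T p ∈ sector H ρ x₀ := by
  have hpre : IsPreconnected ((fun t => φ t p) '' Icc 0 T) :=
    isPreconnected_Icc.image _ (h.isFlow.continuous_time p).continuousOn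
  refine hpre.subset_sector (p := p) ⟨0, ⟨le_rfl, hT⟩, h.isFlow.map_zero p⟩ hp ?_
    ⟨T, ⟨hT, le_rfl⟩, rfl⟩
  rintro _ ⟨s, hs, rfl⟩
  refine ⟨hin s hs, ?_⟩
  have := h.energy_eq_zero hs.1 fun t ht => hin t ⟨ht.1, ht.2.trans hs.2⟩
  simp only [this]
  exact (sector_subset hp).2

end IsHamFlow

/-- The Hamiltonian flow `φ` crosses the sector of `x₀` along each level `0 < y < c`, from the
entry point `e y` and in time `τ y`. -/
structure IsPassage (H : ℝ × ℝ → ℝ) (R ρ : ℝ) (v : ℝ × ℝ → ℝ × ℝ) (φ : ℝ → ℝ × ℝ → ℝ × ℝ)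
    (x₀ : ℝ × ℝ) (c : ℝ) (e : ℝ → ℝ × ℝ) (τ : ℝ → ℝ) : Prop extends IsHamFlow H R ρ v φ where
  sphere : ∀ p, nsq p = ρ ^ 2 → |H p| < c → angDeriv H p ≠ 0
  mem : ∀ y ∈ Ioo 0 c, e y ∈ sector H ρ x₀
  nsq_entry : ∀ y ∈ Ioo 0 c, nsq (e y) = ρ ^ 2
  energy_entry : ∀ y ∈ Ioo 0 c, H (e y) = y
  ang_entry : ∀ y ∈ Ioo 0 c, angDeriv H (e y) < 0
  unique : ∀ p ∈ sector H ρ x₀, nsq p = ρ ^ 2 → H p ∈ Ioo 0 c → angDeriv H p < 0 → p = e (H p)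
  nonneg : ∀ y ∈ Ioo 0 c, 0 ≤ τ y
  inside : ∀ y ∈ Ioo 0 c, ∀ s ∈ Icc 0 (τ y), nsq (φ s (e y)) ≤ ρ ^ 2
  nsq_exit : ∀ y ∈ Ioo 0 c, nsq (φ (τ y) (e y)) = ρ ^ 2
  ang_exit : ∀ y ∈ Ioo 0 c, 0 < angDeriv H (φ (τ y) (e y))
  interior : ∀ y ∈ Ioo 0 c, ∀ s ∈ Ioo 0 (τ y), nsq (φ s (e y)) < ρ ^ 2
  back : ∀ p ∈ sector H ρ x₀, H p ∈ Ioo 0 c → ∃ t ≥ 0, φ t (e (H p)) = p ∧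
    ∀ s ∈ Icc 0 t, nsq (φ s (e (H p))) ≤ ρ ^ 2

theorem IsGoodDisc.exists_isPassage {H : ℝ × ℝ → ℝ} {R ρ : ℝ} (h : IsGoodDisc H R) (hρ : 0 < ρ)
    (hρR : ρ < R) {x₀ : ℝ × ℝ} (hx₀ : x₀ ∈ sector H ρ x₀) (hpos : 0 < H x₀) :
    ∃ v φ c e τ, 0 < c ∧ IsPassage H R ρ v φ x₀ c e τ := by
  obtain ⟨v, φ, hf⟩ := h.exists_isHamFlow hρ hρR
  obtain ⟨c₁, hc₁, hsph₁⟩ := hf.exists_annulus_bound hρ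
  obtain ⟨c₂, hc₂, hesc⟩ := hf.exists_escape
  obtain ⟨c₃, hc₃, hback⟩ := hf.neg.exists_escape
  have hcont := h.continuousOn_sector hρ hρR (x₀ := x₀)
  obtain ⟨c, hc0, hcc⟩ : ∃ c, 0 < c ∧ (c ≤ c₁ ∧ c ≤ c₂ ∧ c ≤ c₃ ∧ c ≤ H x₀) :=
    ⟨min (min c₁ c₂) (min c₃ (H x₀)), by positivity, by simp⟩
  obtain ⟨h1, h2, h3, h4⟩ := hcc
  have hsph : ∀ p, nsq p = ρ ^ 2 → |H p| < c → angDeriv H p ≠ 0 := fun p hp hpc =>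
    hsph₁ p hp.ge hp.le (hpc.trans_le h1)
  have hB : ∀ p ∈ sector H ρ x₀, H p ∈ Ioo 0 c → ∃ u ∈ sector H ρ x₀, nsq u = ρ ^ 2 ∧ H u = H p ∧
      angDeriv H u < 0 ∧ ∃ t ≥ 0, φ t u = p ∧ ∀ s ∈ Icc 0 t, nsq (φ s u) ≤ ρ ^ 2 := by
    intro p hp hpc
    have hpρ : nsq p ≤ ρ ^ 2 := (sector_subset hp).1
    have habs : |(-H p)| < c := by rw [abs_neg, abs_of_pos hpc.1]; exact hpc.2
    obtain ⟨T, hT0, hin, hTn, hTa, -⟩ := hf.neg.exists_exit_time (c := c)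
      (fun q hq hqc => by
        rw [angDeriv_neg]; exact neg_ne_zero.2 (hsph q hq (by simpa using hqc))) hpρ habs
      (hback p hpρ (neg_ne_zero.2 hpc.1.ne') (habs.trans_le h3))
    rw [angDeriv_neg] at hTa
    have hmem := hf.neg.map_mem_sector (x₀ := x₀) (by rwa [sector_neg]) hT0 hin
    rw [sector_neg] at hmem
    refine ⟨_, hmem, hTn, neg_injective (hf.neg.energy_eq_zero hT0 hin), by linarith, T, hT0,
      hf.isFlow.map_map_neg T p, fun s hs => ?_⟩
    rw [← hf.isFlow.map_add]
    have := hin (T - s) ⟨by linarith [hs.2], by linarith [hs.1]⟩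
    rwa [show -(T - s) = s + -T by ring] at this
  have hE : ∀ y ∈ Ioo 0 c, ∃ u ∈ sector H ρ x₀, nsq u = ρ ^ 2 ∧ H u = y ∧ angDeriv H u < 0 := by
    intro y hy
    obtain ⟨q, hq, hqy⟩ := h.exists_mem_sector_abs_eq hρ hρR hx₀ hy.1
      (show y ≤ |H x₀| by rw [abs_of_pos hpos]; linarith [hy.2])
    rw [abs_of_pos (sector_pos hcont hx₀ hq hpos)] at hqy
    obtain ⟨u, hu, hun, huH, hua, -⟩ := hB q hq (by rwa [hqy])
    exact ⟨u, hu, hun, by rw [huH, hqy], hua⟩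
  choose! e he hen heH hea using hE
  have huniq : ∀ p ∈ sector H ρ x₀, nsq p = ρ ^ 2 → H p ∈ Ioo 0 c → angDeriv H p < 0 →
      p = e (H p) := fun p hp hpn hpc hpa =>
    hf.entry_unique hsph hp (he _ hpc) hpn (hen _ hpc) hpc.1 hpc.2 (heH _ hpc).symm hpa
      (hea _ hpc)
  have hX : ∀ y ∈ Ioo 0 c, _ := fun y hy => hf.exists_exit_time hsph (hen y hy).le
    (by rw [heH y hy, abs_of_pos hy.1]; exact hy.2) (hesc (e y) (hen y hy).le
    (by rw [heH y hy]; exact hy.1.ne') (by rw [heH y hy, abs_of_pos hy.1]; linarith [hy.2]))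
  choose! τ hτ0 hτi hτn hτa hτs using hX
  refine ⟨v, φ, c, e, τ, hc0, hf, hsph, he, hen, heH, hea, huniq, hτ0, hτi, hτn, hτa, hτs, ?_⟩
  intro p hp hpc
  obtain ⟨u, hu, hun, huH, hua, hut⟩ := hB p hp hpc
  rwa [huniq u hu hun (by rwa [huH]) hua, huH] at hut

namespace IsPassage
variable {H : ℝ × ℝ → ℝ} {R ρ : ℝ} {v : ℝ × ℝ → ℝ × ℝ} {φ : ℝ → ℝ × ℝ → ℝ × ℝ} {x₀ : ℝ × ℝ}
  {c : ℝ} {e : ℝ → ℝ × ℝ} {τ : ℝ → ℝ}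

theorem tau_pos (h : IsPassage H R ρ v φ x₀ c e τ) {y : ℝ} (hy : y ∈ Ioo 0 c) : 0 < τ y := by
  refine lt_of_le_of_ne (h.nonneg y hy) fun h0 => ?_
  have := h.ang_exit y hy
  rw [← h0, h.isFlow.map_zero] at this
  exact lt_asymm this (h.ang_entry y hy)

theorem energy (h : IsPassage H R ρ v φ x₀ c e τ) {y : ℝ} (hy : y ∈ Ioo 0 c) {t : ℝ}
    (ht : t ∈ Icc 0 (τ y)) : H (φ t (e y)) = y := by
  rw [h.energy_eq_zero ht.1 fun s hs => h.inside y hy s ⟨hs.1, hs.2.trans ht.2⟩,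
    h.energy_entry y hy]

theorem map_mem (h : IsPassage H R ρ v φ x₀ c e τ) {y : ℝ} (hy : y ∈ Ioo 0 c) {t : ℝ}
    (ht : t ∈ Icc 0 (τ y)) : φ t (e y) ∈ sector H ρ x₀ :=
  h.map_mem_sector (h.mem y hy) ht.1 fun s hs => h.inside y hy s ⟨hs.1, hs.2.trans ht.2⟩

theorem le_tau (h : IsPassage H R ρ v φ x₀ c e τ) {y : ℝ} (hy : y ∈ Ioo 0 c) {t : ℝ}
    (ht : ∀ s ∈ Icc 0 t, nsq (φ s (e y)) ≤ ρ ^ 2) : t ≤ τ y := by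
  by_contra! hlt
  have h1 := (h.hasDerivAt_nsq (h.nsq_exit y hy).le).eventually_lt_right
    (by linarith [h.ang_exit y hy])
  obtain ⟨s, hs1, hs2⟩ := (h1.and (Ioo_mem_nhdsGT hlt)).exists
  rw [h.nsq_exit y hy] at hs1
  exact (ht s ⟨(h.nonneg y hy).trans hs2.1.le, hs2.2.le⟩).not_gt hs1

theorem injOn (h : IsPassage H R ρ v φ x₀ c e τ) {y : ℝ} (hy : y ∈ Ioo 0 c) :
    InjOn (fun t => φ t (e y)) (Icc 0 (τ y)) := by
  have key : ∀ s ∈ Icc 0 (τ y), ∀ t ∈ Icc 0 (τ y), s < t → φ s (e y) ≠ φ t (e y) := by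
    intro s hs t ht hst heq
    have hper : φ (t - s) (e y) = e y := by
      rw [sub_eq_neg_add, h.isFlow.map_add, ← heq, h.isFlow.map_neg_map]
    rcases (show t - s ≤ τ y by linarith [hs.1, ht.2]).eq_or_lt with h1 | h1
    · rw [h1] at hper
      have h2 := h.ang_exit y hy
      rw [hper] at h2
      exact lt_asymm h2 (h.ang_entry y hy)
    · have h2 := h.interior y hy _ ⟨sub_pos.2 hst, h1⟩
      rw [hper, h.nsq_entry y hy] at h2
      exact lt_irrefl _ h2
  intro s hs t ht heq
  rcases lt_trichotomy s t with hlt | rfl | hlt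
  · exact (key s hs t ht hlt heq).elim
  · rfl
  · exact (key t ht s hs hlt heq.symm).elim

theorem image_eq (h : IsPassage H R ρ v φ x₀ c e τ) {y : ℝ} (hy : y ∈ Ioo 0 c) :
    (fun t => φ t (e y)) '' Icc 0 (τ y) = {p ∈ sector H ρ x₀ | H p = y} := by
  ext p
  constructor
  · rintro ⟨t, ht, rfl⟩
    exact ⟨h.map_mem hy ht, h.energy hy ht⟩
  · rintro ⟨hp, rfl⟩
    obtain ⟨t, ht, hte, hin⟩ := h.back p hp hy
    exact ⟨t, ⟨ht, h.le_tau hy hin⟩, hte⟩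

theorem isCompact_sphere : IsCompact {p : ℝ × ℝ | nsq p = ρ ^ 2} := by
  convert isCompact_annulus (ρ ^ 2) (ρ ^ 2) using 1
  ext p; exact ⟨fun hp => ⟨hp.ge, hp.le⟩, fun hp => le_antisymm hp.2 hp.1⟩

theorem continuousAt_entry (h : IsPassage H R ρ v φ x₀ c e τ) {y : ℝ} (hy : y ∈ Ioo 0 c) :
    ContinuousAt e y := by
  have hev : ∀ᶠ z in 𝓝 y, z ∈ Ioo 0 c := Ioo_mem_nhds hy.1 hy.2
  refine isCompact_sphere.tendsto_nhds_of_unique_mapClusterPt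
    (hev.mono fun z hz => h.nsq_entry z hz) fun p hp hcl => ?_
  obtain ⟨U, hU, hlim⟩ := mapClusterPt_iff_ultrafilter.1 hcl
  have hUe : ∀ᶠ z in U, z ∈ Ioo 0 c := hU hev
  have hHp : H p = y := by
    refine tendsto_nhds_unique ((h.continuousAt (le_of_eq hp)).tendsto.comp hlim)
      (tendsto_id.mono_right hU |>.congr' ?_)
    exact hUe.mono fun z hz => (h.energy_entry z hz).symm
  have hpS : p ∈ sector H ρ x₀ := mem_sector_of_mem_closure
    (mem_closure_of_tendsto hlim (hUe.mono h.mem)) (le_of_eq hp) (by rw [hHp]; exact hy.1.ne')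
  have ha : angDeriv H p ≤ 0 :=
    le_of_tendsto ((h.continuousAt_angDeriv (le_of_eq hp)).tendsto.comp hlim)
      (hUe.mono fun z hz => (h.ang_entry z hz).le)
  have hne := h.sphere p hp (by rw [hHp, abs_of_pos hy.1]; exact hy.2)
  rw [h.unique p hpS hp (by rwa [hHp]) (lt_of_le_of_ne ha hne), hHp]

theorem continuousAt_tau (h : IsPassage H R ρ v φ x₀ c e τ) {y : ℝ} (hy : y ∈ Ioo 0 c) :
    ContinuousAt τ y := by
  have hev : ∀ᶠ z in 𝓝 y, z ∈ Ioo 0 c := Ioo_mem_nhds hy.1 hy.2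
  have he := h.continuousAt_entry hy
  obtain ⟨b, hb, hbn⟩ : ∃ b ≥ 0, ρ ^ 2 < nsq (φ b (e y)) := by
    by_contra hcon
    push Not at hcon
    exact absurd (h.le_tau hy (t := τ y + 1) fun s hs => hcon s hs.1) (by simp)
  have hbd : ∀ᶠ z in 𝓝 y, τ z ∈ Icc 0 b := by
    have hc1 : ContinuousAt (fun z => nsq (φ b (e z))) y :=
      (continuous_nsq.comp (h.isFlow.continuous_space b)).continuousAt.comp he
    filter_upwards [hev, hc1.eventually_const_lt hbn] with z hz hzb
    refine ⟨h.nonneg z hz, ?_⟩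
    by_contra! hlt
    exact (h.inside z hz b ⟨hb, hlt.le⟩).not_gt hzb
  refine isCompact_Icc.tendsto_nhds_of_unique_mapClusterPt hbd fun t ht hcl => ?_
  obtain ⟨U, hU, hlim⟩ := mapClusterPt_iff_ultrafilter.1 hcl
  have hUe : ∀ᶠ z in U, z ∈ Ioo 0 c := hU hev
  have heU : Tendsto e U (𝓝 (e y)) := he.tendsto.mono_left hU
  have hexit : Tendsto (fun z => φ (τ z) (e z)) U (𝓝 (φ t (e y))) :=
    (h.isFlow.continuous_uncurry.tendsto (t, e y)).comp (hlim.prodMk_nhds heU)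
  have hn : nsq (φ t (e y)) = ρ ^ 2 := by
    refine tendsto_nhds_unique ((continuous_nsq.tendsto _).comp hexit) ?_
    exact tendsto_const_nhds.congr' (hUe.mono fun z hz => (h.nsq_exit z hz).symm)
  have ha : 0 ≤ angDeriv H (φ t (e y)) :=
    ge_of_tendsto ((h.continuousAt_angDeriv hn.le).tendsto.comp hexit)
      (hUe.mono fun z hz => (h.ang_exit z hz).le)
  have htτ : t ≤ τ y := h.le_tau hy fun s hs => by
    rcases hs.2.eq_or_lt with rfl | hst
    · exact hn.le
    · refine le_of_tendsto (((continuous_nsq.comp (h.isFlow.continuous_space s)).tendsto _).comp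
        heU) ?_
      filter_upwards [hUe, hlim.eventually_const_lt hst] with z hz hsz
      exact h.inside z hz s ⟨hs.1, hsz.le⟩
  rcases htτ.eq_or_lt with h1 | h1
  · exact h1
  · rcases ht.1.eq_or_lt with h0 | h0
    · rw [← h0, h.isFlow.map_zero] at ha
      exact absurd (h.ang_entry y hy) ha.not_gt
    · exact absurd hn (h.interior y hy t ⟨h0, h1⟩).ne

end IsPassage

end

section

open Filter Topology Set MeasureTheory

theorem volume_image_shear {a : ℝ → ℝ} (ha : Measurable a) {E : Set (ℝ × ℝ)}
    (hE : MeasurableSet E) : volume ((fun z : ℝ × ℝ => (z.1, z.2 + a z.1)) '' E) = volume E := by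
  have hmp : MeasurePreserving (fun z : ℝ × ℝ => (z.1, z.2 - a z.1)) := by
    refine MeasurePreserving.skew_product (g := fun x y => y - a x) (MeasurePreserving.id volume)
      (by fun_prop) (Eventually.of_forall fun x => ?_)
    exact (measurePreserving_sub_right volume (a x)).map_eq
  rw [← hmp.measure_preimage hE.nullMeasurableSet]
  congr 1
  ext z
  constructor
  · rintro ⟨x, hx, rfl⟩
    simpa using hx
  · intro hz
    exact ⟨_, hz, by simp⟩

/-- A continuous injection of the plane which locally preserves area preserves area. -/
theorem volume_image_of_locally {Ψ : ℝ × ℝ → ℝ × ℝ} {O : Set (ℝ × ℝ)} (hO : IsOpen O)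
    (hc : ContinuousOn Ψ O) (hinj : InjOn Ψ O)
    (hloc : ∀ z ∈ O, ∃ W ∈ 𝓝 z, ∀ E ⊆ W ∩ O, MeasurableSet E → volume (Ψ '' E) = volume E)
    {E : Set (ℝ × ℝ)} (hEO : E ⊆ O) (hE : MeasurableSet E) : volume (Ψ '' E) = volume E := by
  choose! W hW hWE using hloc
  obtain ⟨t, htO, htc, hcov⟩ := TopologicalSpace.countable_cover_nhdsWithin (s := O)
    (f := fun z => interior (W z))
    (fun z hz => mem_nhdsWithin_of_mem_nhds (interior_mem_nhds.2 (hW z hz)))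
  rcases O.eq_empty_or_nonempty with rfl | ⟨z₀, hz₀⟩
  · rw [subset_empty_iff.1 hEO]; simp
  have htne : t.Nonempty := by
    by_contra h
    rw [not_nonempty_iff_eq_empty.1 h] at hcov
    simpa using hcov hz₀
  obtain ⟨f, rfl⟩ := htc.exists_eq_range htne
  let D : ℕ → Set (ℝ × ℝ) := disjointed fun n => interior (W (f n))
  have hDm : ∀ n, MeasurableSet (E ∩ D n) := fun n =>
    hE.inter (MeasurableSet.disjointed (fun n => isOpen_interior.measurableSet) n)
  have hDd : Pairwise (Function.onFun Disjoint fun n => E ∩ D n) := fun i j hij =>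
    (disjoint_disjointed _ hij).mono inter_subset_right inter_subset_right
  have hEU : E = ⋃ n, E ∩ D n := by
    rw [← inter_iUnion, iUnion_disjointed, eq_comm, inter_eq_left]
    refine hEO.trans (hcov.trans ?_)
    simp
  have hsub : ∀ n, E ∩ D n ⊆ O := fun n => inter_subset_left.trans hEO
  have hn : ∀ n, volume (Ψ '' (E ∩ D n)) = volume (E ∩ D n) := fun n => by
    refine hWE (f n) (htO (mem_range_self n)) _ (fun z hz => ⟨?_, hEO hz.1⟩) (hDm n)
    exact interior_subset (disjointed_subset (fun n => interior (W (f n))) n hz.2)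
  have hPd : Pairwise (Function.onFun Disjoint fun n => Ψ '' (E ∩ D n)) := fun i j hij =>
    (hDd hij).image hinj (hsub i) (hsub j)
  rw [hEU, image_iUnion, measure_iUnion hPd fun n => (hDm n).image_of_continuousOn_injOn
    (hc.mono (hsub n)) (hinj.mono (hsub n)), measure_iUnion hDd hDm]
  exact tsum_congr hn

namespace IsPassage
variable {H : ℝ × ℝ → ℝ} {R ρ : ℝ} {v : ℝ × ℝ → ℝ × ℝ} {φ : ℝ → ℝ × ℝ → ℝ × ℝ} {x₀ : ℝ × ℝ}
  {c : ℝ} {e : ℝ → ℝ × ℝ} {τ : ℝ → ℝ}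

theorem continuousOn_tau (h : IsPassage H R ρ v φ x₀ c e τ) : ContinuousOn τ (Ioo 0 c) :=
  fun _ hy => (h.continuousAt_tau hy).continuousWithinAt

theorem isOpen_region (h : IsPassage H R ρ v φ x₀ c e τ) :
    IsOpen {z : ℝ × ℝ | z.1 ∈ Ioo 0 c ∧ z.2 ∈ Ioo 0 (τ z.1)} := by
  refine isOpen_iff_mem_nhds.2 fun z hz => ?_
  have h1 : ContinuousAt (fun z : ℝ × ℝ => τ z.1) z :=
    ContinuousAt.comp (f := Prod.fst) (h.continuousAt_tau hz.1) continuousAt_fst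
  filter_upwards [(isOpen_Ioo.preimage continuous_fst).mem_nhds hz.1,
    continuousAt_snd.eventually_const_lt hz.2.1,
    (continuousAt_snd (p := z)).eventually_lt h1 hz.2.2] with q h1 h2 h3
  exact ⟨h1, h2, h3⟩

theorem continuousAt_param (h : IsPassage H R ρ v φ x₀ c e τ) {z : ℝ × ℝ} (hz : z.1 ∈ Ioo 0 c) :
    ContinuousAt (fun z : ℝ × ℝ => φ z.2 (e z.1)) z :=
  ContinuousAt.comp (f := fun z : ℝ × ℝ => (z.2, e z.1)) (g := fun p : ℝ × (ℝ × ℝ) => φ p.1 p.2)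
    h.isFlow.continuous_uncurry.continuousAt
    (continuousAt_snd.prodMk (ContinuousAt.comp (f := Prod.fst) (h.continuousAt_entry hz)
      continuousAt_fst))

theorem injOn_param (h : IsPassage H R ρ v φ x₀ c e τ) :
    InjOn (fun z : ℝ × ℝ => φ z.2 (e z.1)) {z : ℝ × ℝ | z.1 ∈ Ioo 0 c ∧ z.2 ∈ Ioo 0 (τ z.1)} := by
  rintro ⟨y, t⟩ ⟨hy, ht⟩ ⟨y', t'⟩ ⟨hy', ht'⟩ heq
  have h1 := h.energy hy (Ioo_subset_Icc_self ht)
  have h2 := h.energy hy' (Ioo_subset_Icc_self ht')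
  simp only at heq h1 h2 hy hy' ht ht'
  rw [heq, h2] at h1
  subst h1
  rw [h.injOn hy (Ioo_subset_Icc_self ht) (Ioo_subset_Icc_self ht') heq]

theorem volume_image_param (h : IsPassage H R ρ v φ x₀ c e τ) {E : Set (ℝ × ℝ)}
    (hEO : E ⊆ {z : ℝ × ℝ | z.1 ∈ Ioo 0 c ∧ z.2 ∈ Ioo 0 (τ z.1)}) (hE : MeasurableSet E) :
    volume ((fun z : ℝ × ℝ => φ z.2 (e z.1)) '' E) = volume E := by
  refine volume_image_of_locally h.isOpen_region
    (fun z hz => (h.continuousAt_param hz.1).continuousWithinAt) h.injOn_param ?_ hEO hE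
  classical
  rintro ⟨y₀, t₀⟩ ⟨hy₀, ht₀⟩
  simp only at hy₀ ht₀
  have hin := h.inside y₀ hy₀ t₀ (Ioo_subset_Icc_self ht₀)
  have hen := h.energy hy₀ (Ioo_subset_Icc_self ht₀)
  obtain ⟨A, N, hN, hNA, hNinj, hbox⟩ := exists_flow_box (h.analyticAt hin)
    (h.fderiv_ne hin (by rw [hen]; exact hy₀.1.ne')) h.isFlow (h.field_eq _ hin)
  have hst : ∀ {y}, y ∈ Ioo 0 c → ContinuousAt (fun y => φ t₀ (e y)) y := fun hy =>
    (h.isFlow.continuous_space t₀).continuousAt.comp (h.continuousAt_entry hy)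
  obtain ⟨δ, hδ, hball⟩ := Metric.eventually_nhds_iff_ball.1
    (((hst hy₀).eventually hN).and (Ioo_mem_nhds hy₀.1 hy₀.2))
  let a : ℝ → ℝ := (Metric.ball y₀ δ).piecewise (fun y => A (φ t₀ (e y)) - t₀) fun _ => 0
  have ha : Measurable a := by
    refine ContinuousOn.measurable_piecewise (fun y hy => ?_) continuousOn_const
      Metric.isOpen_ball.measurableSet
    have h1 : ContinuousAt A (φ t₀ (e y)) := (hNA _ (hball y hy).1).2.1.continuousAt
    exact ((ContinuousAt.comp (f := fun y => φ t₀ (e y)) h1 (hst (hball y hy).2)).sub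
      continuousAt_const).continuousWithinAt
  have hz : Tendsto (fun z : ℝ × ℝ => (z.2 - t₀, φ t₀ (e z.1))) (𝓝 (y₀, t₀))
      (𝓝 (0, φ t₀ (e y₀))) := by
    have h1 : Tendsto (fun z : ℝ × ℝ => z.2 - t₀) (𝓝 (y₀, t₀)) (𝓝 0) := by
      have : Continuous fun z : ℝ × ℝ => z.2 - t₀ := by fun_prop
      simpa using this.tendsto (y₀, t₀)
    exact h1.prodMk_nhds ((hst hy₀).tendsto.comp (continuousAt_fst (p := (y₀, t₀))))
  refine ⟨_, inter_mem (hz.eventually hbox)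
    ((Metric.isOpen_ball.preimage continuous_fst).mem_nhds (Metric.mem_ball_self hδ)), ?_⟩
  intro E hE hEm
  have hN' : (fun z : ℝ × ℝ => φ z.2 (e z.1)) '' E ⊆ N := by
    rintro _ ⟨z, hz, rfl⟩
    have := (hE hz).1.1.1
    rwa [← h.isFlow.map_add, sub_add_cancel] at this
  have hPm : MeasurableSet ((fun z : ℝ × ℝ => φ z.2 (e z.1)) '' E) :=
    hEm.image_of_continuousOn_injOn
      (fun z hz => (h.continuousAt_param (hE hz).2.1).continuousWithinAt)
      (h.injOn_param.mono fun z hz => (hE hz).2)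
  have hL := lintegral_abs_det_fderiv_eq_addHaar_image volume hPm
    (f := fun q => (H q, A q)) (f' := fderiv ℝ fun q => (H q, A q))
    (fun q hq => ((hNA q (hN' hq)).1.differentiableAt.prodMk
      (hNA q (hN' hq)).2.1.differentiableAt).hasFDerivAt.hasFDerivWithinAt) (hNinj.mono hN')
  rw [setLIntegral_congr_fun (g := fun _ => 1) hPm fun q hq => by
    simp [(hNA q (hN' hq)).2.2], setLIntegral_one] at hL
  rw [hL, ← volume_image_shear ha hEm, image_image]
  congr 1
  refine image_congr fun z hz => ?_
  have h1 := h.energy (hE hz).2.1 (Ioo_subset_Icc_self (hE hz).2.2)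
  have h2 := (hE hz).1.1.2.2
  simp only [← h.isFlow.map_add, sub_add_cancel] at h2
  rw [h1, h2, show a z.1 = A (φ t₀ (e z.1)) - t₀ from piecewise_eq_of_mem _ _ _ (hE hz).1.2]
  congr 1; ring

theorem image_region (h : IsPassage H R ρ v φ x₀ c e τ) {I : Set ℝ} (hI : I ⊆ Ioo 0 c) :
    (fun z : ℝ × ℝ => φ z.2 (e z.1)) '' regionBetween (fun _ => 0) τ I =
      {p ∈ sector H ρ x₀ | nsq p < ρ ^ 2 ∧ H p ∈ I} := by
  ext p
  constructor
  · rintro ⟨z, ⟨hz, ht⟩, rfl⟩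
    have ht : z.2 ∈ Ioo 0 (τ z.1) := ht
    refine ⟨h.map_mem (hI hz) (Ioo_subset_Icc_self ht), h.interior _ (hI hz) _ ht, ?_⟩
    simp only [h.energy (hI hz) (Ioo_subset_Icc_self ht)]
    exact hz
  · rintro ⟨hpS, hpn, hpI⟩
    have hy := hI hpI
    have : p ∈ (fun t => φ t (e (H p))) '' Icc 0 (τ (H p)) := by
      rw [h.image_eq hy]; exact ⟨hpS, rfl⟩
    obtain ⟨t, ht, htp⟩ := this
    simp only at htp
    refine ⟨(H p, t), ⟨hpI, ?_, ?_⟩, htp⟩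
    · refine lt_of_le_of_ne ht.1 fun h0 => ?_
      have h0 : 0 = t := h0
      rw [← h0, h.isFlow.map_zero] at htp
      rw [← htp, h.nsq_entry _ hy] at hpn
      exact lt_irrefl _ hpn
    · refine lt_of_le_of_ne ht.2 fun h0 => ?_
      have h0 : t = τ (H p) := h0
      rw [← htp, h0, h.nsq_exit _ hy] at hpn
      exact lt_irrefl _ hpn

theorem volume_between (h : IsPassage H R ρ v φ x₀ c e τ) {u w : ℝ} (hu : 0 < u) (huw : u ≤ w)
    (hw : w < c) : MeasurableSet {p ∈ sector H ρ x₀ | nsq p < ρ ^ 2 ∧ H p ∈ Ico u w} ∧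
    volume.real {p ∈ sector H ρ x₀ | nsq p < ρ ^ 2 ∧ H p ∈ Ico u w} = ∫ y in u..w, τ y := by
  have hI : Ico u w ⊆ Ioo 0 c := fun y hy => ⟨hu.trans_le hy.1, hy.2.trans hw⟩
  have hII : Icc u w ⊆ Ioo 0 c := fun y hy => ⟨hu.trans_le hy.1, hy.2.trans_lt hw⟩
  have hint : IntegrableOn τ (Ico u w) :=
    (h.continuousOn_tau.mono hII).integrableOn_Icc.mono_set Ico_subset_Icc_self
  have hreg : MeasurableSet (regionBetween (fun _ => 0) τ (Ico u w)) := by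
    have h1 : regionBetween (fun _ => 0) τ (Ico u w) =
        {z : ℝ × ℝ | z.1 ∈ Ioo 0 c ∧ z.2 ∈ Ioo 0 (τ z.1)} ∩
        Prod.fst ⁻¹' Ico u w := by
      ext z
      exact ⟨fun hz => ⟨⟨hI hz.1, hz.2⟩, hz.1⟩, fun hz => ⟨hz.2, hz.1.2⟩⟩
    rw [h1]
    exact h.isOpen_region.measurableSet.inter (measurable_fst measurableSet_Ico)
  have hsub : regionBetween (fun _ => 0) τ (Ico u w) ⊆ {z : ℝ × ℝ | z.1 ∈ Ioo 0 c ∧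
      z.2 ∈ Ioo 0 (τ z.1)} :=
    fun z hz => ⟨hI hz.1, hz.2⟩
  rw [← h.image_region hI]
  refine ⟨hreg.image_of_continuousOn_injOn
    (fun z hz => (h.continuousAt_param (hsub hz).1).continuousWithinAt)
    (h.injOn_param.mono hsub), ?_⟩
  rw [Measure.real, h.volume_image_param hsub hreg, Measure.volume_eq_prod,
    volume_regionBetween_eq_integral (integrableOn_zero) hint measurableSet_Ico
      fun y hy => h.nonneg y (hI hy), ENNReal.toReal_ofReal]
  · rw [intervalIntegral.integral_of_le huw, integral_Ico_eq_integral_Ioo,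
      integral_Ioc_eq_integral_Ioo]
    simp
  · refine setIntegral_nonneg measurableSet_Ico fun y hy => ?_
    simpa using h.nonneg y (hI hy)

theorem hasDerivAt_area (h : IsPassage H R ρ v φ x₀ c e τ) (hx₀ : x₀ ∈ sector H ρ x₀)
    (hpos : 0 < H x₀) {y : ℝ} (hy : y ∈ Ioo 0 c) :
    HasDerivAt (fun y => volume.real {p : ℝ × ℝ | p.1 ^ 2 + p.2 ^ 2 < ρ ^ 2 ∧
      p ∈ sector H ρ x₀ ∧ H p ≠ 0 ∧ |H p| < y}) (τ y) y := by
  have hHp : ∀ p ∈ sector H ρ x₀, 0 < H p := fun p hp =>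
    sector_pos (h.disc.continuousOn_sector h.pos h.lt) hx₀ hp hpos
  have hset : ∀ y, {p : ℝ × ℝ | p.1 ^ 2 + p.2 ^ 2 < ρ ^ 2 ∧ p ∈ sector H ρ x₀ ∧ H p ≠ 0 ∧
      |H p| < y} = {p ∈ sector H ρ x₀ | nsq p < ρ ^ 2 ∧ H p < y} := fun y => by
    ext p
    constructor
    · rintro ⟨h1, h2, h3, h4⟩
      exact ⟨h2, h1, by rwa [abs_of_pos (hHp p h2)] at h4⟩
    · rintro ⟨h2, h1, h4⟩
      exact ⟨h1, h2, (hHp p h2).ne', by rwa [abs_of_pos (hHp p h2)]⟩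
  have hfin : ∀ y, volume {p ∈ sector H ρ x₀ | nsq p < ρ ^ 2 ∧ H p < y} ≠ ⊤ := fun y => by
    have hK : volume {p : ℝ × ℝ | 0 ≤ nsq p ∧ nsq p ≤ ρ ^ 2} ≠ ⊤ :=
      (isCompact_annulus _ _).measure_lt_top.ne
    have hsub : {p ∈ sector H ρ x₀ | nsq p < ρ ^ 2 ∧ H p < y} ⊆
        {p : ℝ × ℝ | 0 ≤ nsq p ∧ nsq p ≤ ρ ^ 2} := fun p hp => ⟨nsq_nonneg p, hp.2.1.le⟩
    exact measure_ne_top_of_subset hsub hK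
  simp only [hset]
  have hy2 : 0 < y / 2 := half_pos hy.1
  have hV : ∀ w ∈ Ioo (y / 2) c, volume.real {p ∈ sector H ρ x₀ | nsq p < ρ ^ 2 ∧ H p < w} =
      volume.real {p ∈ sector H ρ x₀ | nsq p < ρ ^ 2 ∧ H p < y / 2} + ∫ s in (y / 2)..w, τ s := by
    intro w hw
    obtain ⟨hm, hv⟩ := h.volume_between hy2 hw.1.le hw.2
    have hsub : {p ∈ sector H ρ x₀ | nsq p < ρ ^ 2 ∧ H p ∈ Ico (y / 2) w} ⊆
        {p ∈ sector H ρ x₀ | nsq p < ρ ^ 2 ∧ H p < w} := fun p hp => ⟨hp.1, hp.2.1, hp.2.2.2⟩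
    have hfin' := measure_ne_top_of_subset hsub (hfin w)
    rw [← hv, ← measureReal_union ?_ hm (hfin _) hfin']
    · congr 1
      ext p
      constructor
      · rintro ⟨h1, h2, h3⟩
        rcases lt_or_ge (H p) (y / 2) with h4 | h4
        · exact Or.inl ⟨h1, h2, h4⟩
        · exact Or.inr ⟨h1, h2, h4, h3⟩
      · rintro (⟨h1, h2, h3⟩ | ⟨h1, h2, h3⟩)
        · exact ⟨h1, h2, h3.trans hw.1⟩
        · exact ⟨h1, h2, h3.2⟩
    · rw [Set.disjoint_left]
      rintro p ⟨-, -, h1⟩ ⟨-, -, h2, -⟩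
      exact h1.not_ge h2
  have hd : HasDerivAt (fun w => ∫ s in (y / 2)..w, τ s) (τ y) y := by
    refine intervalIntegral.integral_hasDerivAt_right ?_ ?_ (h.continuousAt_tau hy)
    · refine (h.continuousOn_tau.mono ?_).intervalIntegrable
      rw [uIcc_of_le (by linarith [hy.1])]
      exact fun s hs => ⟨hy2.trans_le hs.1, hs.2.trans_lt hy.2⟩
    · exact h.continuousOn_tau.stronglyMeasurableAtFilter isOpen_Ioo y hy
  refine (hd.const_add (volume.real {p ∈ sector H ρ x₀ | nsq p < ρ ^ 2 ∧
    H p < y / 2})).congr_of_eventuallyEq ?_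
  filter_upwards [Ioo_mem_nhds (half_lt_self hy.1) hy.2] with w hw
  exact hV w hw

end IsPassage

end

section

open Filter Topology Set MeasureTheory

/-- `γ` is an injective integral curve of the Hamiltonian field traversing the part of the sector
at level `h` from circle to circle in time `τ`. -/
def IsCrossing (H : ℝ × ℝ → ℝ) (ρ : ℝ) (x₀ : ℝ × ℝ) (h τ : ℝ) (γ : ℝ → ℝ × ℝ) : Prop :=
  (∀ t ∈ Icc 0 τ, HasDerivAt γ (hamVF H (γ t)) t) ∧ InjOn γ (Icc 0 τ) ∧
    γ '' Icc 0 τ = {p ∈ sector H ρ x₀ | |H p| = h} ∧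
    nsq (γ 0) = ρ ^ 2 ∧ nsq (γ τ) = ρ ^ 2 ∧ ∀ t ∈ Ioo 0 τ, nsq (γ t) < ρ ^ 2

theorem IsCrossing.of_neg {H : ℝ × ℝ → ℝ} {ρ : ℝ} {x₀ : ℝ × ℝ} {h τ : ℝ} {γ : ℝ → ℝ × ℝ}
    (hγ : IsCrossing (fun p => -H p) ρ x₀ h τ γ) :
    IsCrossing H ρ x₀ h τ fun t => γ (τ - t) := by
  obtain ⟨h1, h2, h3, h4, h5, h6⟩ := hγ
  have hmem : ∀ t ∈ Icc 0 τ, τ - t ∈ Icc 0 τ := fun t ht => ⟨by linarith [ht.2], by linarith [ht.1]⟩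
  refine ⟨fun t ht => ?_, fun s hs t ht hst => ?_, ?_, by simpa using h5, by simpa using h4,
    fun t ht => h6 _ ⟨by linarith [ht.2], by linarith [ht.1]⟩⟩
  · have hd := (h1 _ (hmem t ht)).scomp t ((hasDerivAt_id t).const_sub τ)
    rw [hamVF_neg] at hd
    simpa [Function.comp_def] using hd
  · have := h2 (hmem s hs) (hmem t ht) hst
    linarith
  · rw [sector_neg] at h3
    simp only [abs_neg] at h3
    rw [← h3]
    ext p
    constructor
    · rintro ⟨t, ht, rfl⟩
      exact ⟨_, hmem t ht, rfl⟩
    · rintro ⟨t, ht, rfl⟩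
      exact ⟨_, hmem t ht, by simp⟩

theorem IsPassage.isCrossing {H : ℝ × ℝ → ℝ} {R ρ : ℝ} {v : ℝ × ℝ → ℝ × ℝ}
    {φ : ℝ → ℝ × ℝ → ℝ × ℝ} {x₀ : ℝ × ℝ} {c : ℝ} {e : ℝ → ℝ × ℝ} {τ : ℝ → ℝ}
    (h : IsPassage H R ρ v φ x₀ c e τ) (hx₀ : x₀ ∈ sector H ρ x₀) (hpos : 0 < H x₀) {y : ℝ}
    (hy : y ∈ Ioo 0 c) : IsCrossing H ρ x₀ y (τ y) fun t => φ t (e y) := by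
  refine ⟨fun t ht => h.hasDerivAt (h.inside y hy t ht), h.injOn hy, ?_, ?_, h.nsq_exit y hy,
    h.interior y hy⟩
  · rw [h.image_eq hy]
    ext p
    refine and_congr_right fun hp => ?_
    rw [abs_of_pos (sector_pos (h.disc.continuousOn_sector h.pos h.lt) hx₀ hp hpos)]
  · simp only [h.isFlow.map_zero]
    exact h.nsq_entry y hy

theorem IsGoodDisc.exists_crossing_of_pos {H : ℝ × ℝ → ℝ} {R ρ : ℝ} (h : IsGoodDisc H R)
    (hρ : 0 < ρ) (hρR : ρ < R) {x₀ : ℝ × ℝ} (hx₀ : x₀ ∈ sector H ρ x₀) (hpos : 0 < H x₀) :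
    ∃ h₀ > 0, ∃ q : ℕ, 0 < q ∧ ∃ (k₀ : ℤ) (A B : ℤ → ℝ), ∀ y ∈ Ioo (0 : ℝ) h₀, ∃ τ γ, 0 < τ ∧
      IsCrossing H ρ x₀ y τ γ ∧ HasSum (fun k : ℕ =>
        (A (k₀ + k) + B (k₀ + k) * Real.log y) * y ^ (((k₀ + k : ℤ) : ℝ) / (q : ℝ))) τ := by
  obtain ⟨v, φ, c, e, τ, hc, hP⟩ := h.exists_isPassage hρ hρR hx₀ hpos
  have hlt : ρ ^ 2 < R ^ 2 := by gcongr
  have hV := isLogPuiseux_area (H := H) (S := sector H ρ x₀) hρ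
    (fun p hp => h.analyticAt p (lt_of_le_of_lt hp hlt))
    fun p hp hp0 => eventually_mem_sector_iff hp hp0 (h.continuousAt (lt_trans hp hlt))
  obtain ⟨h₁, hh₁, q, hq, k₀, A, B, hsum⟩ := hV.hasSum_deriv (τ := τ) (by
    filter_upwards [Ioo_mem_nhdsGT hc] with y hy
    exact hP.hasDerivAt_area hx₀ hpos hy)
  refine ⟨min h₁ c, lt_min hh₁ hc, q, hq, k₀, A, B, fun y hy => ?_⟩
  have hyc : y ∈ Ioo 0 c := ⟨hy.1, hy.2.trans_le (min_le_right _ _)⟩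
  exact ⟨τ y, _, hP.tau_pos hyc, hP.isCrossing hx₀ hpos hyc,
    hsum y ⟨hy.1, hy.2.trans_le (min_le_left _ _)⟩⟩

theorem IsGoodDisc.exists_crossing {H : ℝ × ℝ → ℝ} {R ρ : ℝ} (h : IsGoodDisc H R)
    (hρ : 0 < ρ) (hρR : ρ < R) {x₀ : ℝ × ℝ} (hx₀ : nsq x₀ ≤ ρ ^ 2) (hne : H x₀ ≠ 0) :
    ∃ h₀ > 0, ∃ q : ℕ, 0 < q ∧ ∃ (k₀ : ℤ) (A B : ℤ → ℝ), ∀ y ∈ Ioo (0 : ℝ) h₀, ∃ τ γ, 0 < τ ∧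
      IsCrossing H ρ x₀ y τ γ ∧ HasSum (fun k : ℕ =>
        (A (k₀ + k) + B (k₀ + k) * Real.log y) * y ^ (((k₀ + k : ℤ) : ℝ) / (q : ℝ))) τ := by
  have hmem : x₀ ∈ sector H ρ x₀ := mem_sector_self hx₀ hne
  rcases hne.lt_or_gt with hneg | hpos
  · obtain ⟨h₀, hh₀, q, hq, k₀, A, B, hall⟩ := h.neg.exists_crossing_of_pos hρ hρR (x₀ := x₀)
      (by rwa [sector_neg]) (neg_pos.2 hneg)
    refine ⟨h₀, hh₀, q, hq, k₀, A, B, fun y hy => ?_⟩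
    obtain ⟨τ, γ, hτ, hγ, hs⟩ := hall y hy
    exact ⟨τ, _, hτ, hγ.of_neg, hs⟩
  · exact h.exists_crossing_of_pos hρ hρR hmem hpos

end

/-- Passage times through a separatrix sector are log-Puiseux: for all sufficiently
small `ρ > 0` and every separatrix sector `S_ρ` of `B_ρ ∖ {H = 0}`, there are
`h₀ > 0`, a positive integer `q`, an integer `k₀`, and coefficients `A k, B k` such
that for every `h ∈ (0, h₀)`: the set `{p ∈ S_ρ : |H p| = h}` is the image of an
injective solution `γ : [0, τ] → ℝ²` of `γ' = X(γ)` with endpoints on `∂B_ρ` and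
interior of the curve inside the open ball, and the passage time `τ` equals the
convergent log-Puiseux series `∑_{k ≥ k₀} (A k + B k · ln h) · h^{k/q}`. -/
theorem passage_time_is_log_puiseux (H : ℝ × ℝ → ℝ)
    (hH : AnalyticAt ℝ H 0) (h0 : H 0 = 0) (hcrit : fderiv ℝ H 0 = 0)
    (hiso : ∀ᶠ p in nhds (0 : ℝ × ℝ), fderiv ℝ H p = 0 → p = 0)
    (hmax : ¬ IsLocalMax H 0) (hmin : ¬ IsLocalMin H 0) :
    ∃ ρ₀ > (0 : ℝ), ∀ ρ : ℝ, 0 < ρ → ρ < ρ₀ →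
      ∀ x₀ ∈ {p ∈ euclBall ρ | H p ≠ 0},
        ∃ h₀ > (0 : ℝ), ∃ q : ℕ, 0 < q ∧ ∃ (k₀ : ℤ) (A B : ℤ → ℝ),
          ∀ h ∈ Set.Ioo (0 : ℝ) h₀,
            ∃ (τ : ℝ) (γ : ℝ → ℝ × ℝ), 0 < τ ∧
              (∀ t ∈ Set.Icc 0 τ, HasDerivAt γ (hamVF H (γ t)) t) ∧
              Set.InjOn γ (Set.Icc 0 τ) ∧
              γ '' Set.Icc 0 τ = {p ∈ sector H ρ x₀ | |H p| = h} ∧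
              (γ 0).1 ^ 2 + (γ 0).2 ^ 2 = ρ ^ 2 ∧
              (γ τ).1 ^ 2 + (γ τ).2 ^ 2 = ρ ^ 2 ∧
              (∀ t ∈ Set.Ioo 0 τ, (γ t).1 ^ 2 + (γ t).2 ^ 2 < ρ ^ 2) ∧
              HasSum
                (fun k : ℕ =>
                  (A (k₀ + k) + B (k₀ + k) * Real.log h) *
                    h ^ (((k₀ + k : ℤ) : ℝ) / (q : ℝ)))
                τ := by
  obtain ⟨R, hR, hgood⟩ := exists_isGoodDisc hH h0 hiso hmax hmin
  refine ⟨R, hR, fun ρ hρ hρR x₀ hx₀ => ?_⟩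
  obtain ⟨h₀, hh₀, q, hq, k₀, A, B, hall⟩ := hgood.exists_crossing hρ hρR hx₀.1 hx₀.2
  refine ⟨h₀, hh₀, q, hq, k₀, A, B, fun h hh => ?_⟩
  obtain ⟨τ, γ, hτ, ⟨h1, h2, h3, h4, h5, h6⟩, hs⟩ := hall h hh
  exact ⟨τ, γ, hτ, h1, h2, h3, h4, h5, h6, hs⟩
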